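/- For every ε > 0 there exists a constant C = C(k, ε) such that for all real X ≥ 2: if 1 ≤ k ≤ 4 is real then the sum of h_3(d)^k over squarefree integers d with 1 < d < X is at most C · X^{(5k+13)/18 + ε}, and if k ≥ 4 is real then this sum is at most C · X^{(2k+3)/6 + ε}. -/

import Mathlib

/-- The real quadratic field `ℚ(√d)`, realized as the subfield of `ℝ`
generated over `ℚ` by `√d`. -/
noncomputable def Kpos (d : ℕ) : IntermediateField ℚ ℝ :=
  IntermediateField.adjoin ℚ {Real.sqrt d}

/-- `hpos g d` is the `g`-part of the class number of `ℚ(√d)`: the number of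
ideal classes `c` of the ring of integers of `ℚ(√d)` with `c ^ g = 1`. -/
noncomputable def hpos (g d : ℕ) : ℕ :=
  Nat.card {c : ClassGroup (NumberField.RingOfIntegers (Kpos d)) // c ^ g = 1}

section CubicSymbol

open QuadraticAlgebra

/-- The Eisenstein integers `ℤ[ω]`, `ω ^ 2 = -1 - ω`. -/
abbrev Eis : Type := QuadraticAlgebra ℤ (-1) (-1)

namespace Eis

lemma norm_eq (z : Eis) : norm z = z.re ^ 2 - z.re * z.im + z.im ^ 2 := by
  rw [norm_def]; ring

lemma norm_eq_zero {z : Eis} : norm z = 0 ↔ z = 0 := by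
  refine ⟨fun h => ?_, fun h => by simp [h]⟩
  rw [norm_eq] at h
  have h1 : z.im = 0 := by nlinarith [sq_nonneg (2 * z.re - z.im), sq_nonneg z.im]
  have h2 : z.re = 0 := by simpa [h1] using h
  ext <;> simp [h1, h2]

lemma norm_nonneg (z : Eis) : 0 ≤ norm z := by
  rw [norm_eq]; nlinarith [sq_nonneg (2 * z.re - z.im), sq_nonneg z.im]

instance : NoZeroDivisors Eis where
  eq_zero_or_eq_zero_of_mul_eq_zero {a b} h := by
    have : norm a * norm b = 0 := by rw [← map_mul, h]; simp
    simpa [norm_eq_zero] using this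

instance : IsDomain Eis := NoZeroDivisors.to_isDomain _

/-- The primitive cube root of unity. -/
def w : Eis := ⟨0, 1⟩

/-- The element `√-3 = 1 + 2 ω`. -/
def th : Eis := ⟨1, 2⟩

lemma w_sq : w ^ 2 = -1 - w := by ext <;> simp [w, pow_two]
lemma w_cube : w ^ 3 = 1 := by
  linear_combination (w - 1) * w_sq
lemma th_eq : th = 1 + 2 * w := by
  ext <;> simp [w, th]
lemma th_sq : th ^ 2 = -3 := by rw [th_eq]; linear_combination 4 * w_sq
lemma star_w : star w = w ^ 2 := by rw [w_sq]; ext <;> simp [w]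
lemma star_th : star th = -th := by ext <;> simp [th]
lemma star_int (n : ℤ) : star (n : Eis) = n := by ext <;> simp
lemma mul_star_eq (z : Eis) : z * star z = (norm z : ℤ) := by
  rw [← algebraMap_norm_eq_mul_star]; simp

lemma norm_star' (z : Eis) : norm (star z) = norm z := norm_star z

lemma eq_add (z : Eis) : z = z.re + z.im * w := by
  ext <;> simp [w]

/-- cube roots of unity in `Eis` -/
lemma cube_one {x : Eis} (h : x ^ 3 = 1) : x = 1 ∨ x = w ∨ x = w ^ 2 := by
  have h1 : (x - 1) * ((x - w) * (x - w ^ 2)) = 0 := by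
    linear_combination h + (x - 1) * (-x) * w_sq + (x - 1) * w_cube
  rcases mul_eq_zero.1 h1 with h | h
  · exact Or.inl (sub_eq_zero.1 h)
  rcases mul_eq_zero.1 h with h | h
  · exact Or.inr (Or.inl (sub_eq_zero.1 h))
  · exact Or.inr (Or.inr (sub_eq_zero.1 h))

lemma star_of_cube {x : Eis} (h : x ^ 3 = 1) : star x = x ^ 2 := by
  rcases cube_one h with rfl | rfl | rfl
  · simp
  · exact star_w
  · rw [star_pow, star_w]

end Eis

/-- An algebraic closure of the field with `q` elements. -/
abbrev Fbar (q : ℕ) [Fact q.Prime] : Type := AlgebraicClosure (ZMod q)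

section residue
variable (q : ℕ) [Fact q.Prime]

lemma exists_omega_bar : ∃ u : Fbar q, u * u = (-1 : ℤ) • 1 + (-1 : ℤ) • u := by
  have hd : (Polynomial.X ^ 2 + Polynomial.X + 1 : Polynomial (Fbar q)).degree ≠ 0 := by
    have : (Polynomial.X ^ 2 + Polynomial.X + 1 : Polynomial (Fbar q)).degree = 2 := by
      compute_degree!
    rw [this]; norm_num
  obtain ⟨u, hu⟩ := IsAlgClosed.exists_root _ hd
  refine ⟨u, ?_⟩
  simp [Polynomial.IsRoot] at hu
  simp
  linear_combination hu

/-- A reduction homomorphism from the Eisenstein integers to characteristic `q`. -/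
noncomputable def eisRed : Eis →+* Fbar q :=
  (QuadraticAlgebra.lift (R := ℤ) ⟨(exists_omega_bar q).choose,
    (exists_omega_bar q).choose_spec⟩ : Eis →ₐ[ℤ] Fbar q).toRingHom

variable {q}

lemma red_w_sq : eisRed q Eis.w ^ 2 = -1 - eisRed q Eis.w := by
  rw [← map_pow, Eis.w_sq]; simp

lemma red_w_cube : eisRed q Eis.w ^ 3 = 1 := by
  rw [← map_pow, Eis.w_cube]; simp

lemma int_eq_zero_iff (n : ℤ) : ((n : ℤ) : Fbar q) = 0 ↔ (q : ℤ) ∣ n := by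
  have : CharP (Fbar q) q := charP_of_injective_algebraMap (algebraMap (ZMod q) (Fbar q)).injective q
  exact CharP.intCast_eq_zero_iff _ q n

lemma three_ne (h3 : q ≠ 3) : (3 : Fbar q) ≠ 0 := by
  have := (int_eq_zero_iff (q := q) 3).not
  intro h
  apply this.2 _ (by exact_mod_cast h)
  intro h
  have : q ∣ 3 := by exact_mod_cast h
  exact h3 ((Nat.prime_dvd_prime_iff_eq (Fact.out) Nat.prime_three).1 this)

lemma red_w_ne_one (h3 : q ≠ 3) : eisRed q Eis.w ≠ 1 := by
  intro h
  have := red_w_sq (q := q)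
  rw [h] at this
  apply three_ne h3
  linear_combination this

lemma red_norm (z : Eis) : eisRed q z * eisRed q (star z) = ((norm z : ℤ) : Fbar q) := by
  rw [← map_mul, Eis.mul_star_eq]; simp

lemma red_ne {z : Eis} (h : ¬ (q : ℤ) ∣ norm z) : eisRed q z ≠ 0 := by
  intro h0
  apply h
  rw [← int_eq_zero_iff, ← red_norm, h0, zero_mul]

lemma red_star_ne {z : Eis} (h : ¬ (q : ℤ) ∣ norm z) : eisRed q (star z) ≠ 0 :=
  red_ne (by rwa [Eis.norm_star'])

lemma red_inj {x y : Eis} (h3 : q ≠ 3) (hx : x ^ 3 = 1) (hy : y ^ 3 = 1)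
    (h : eisRed q x = eisRed q y) : x = y := by
  have key : ∀ z : Eis, z ^ 3 = 1 → eisRed q z = 1 → z = 1 := by
    intro z hz h1
    have hw := red_w_ne_one h3
    rcases Eis.cube_one hz with rfl | rfl | rfl
    · rfl
    · exact absurd h1 hw
    · rw [map_pow] at h1
      exfalso; apply hw
      have := red_w_cube (q := q)
      rw [pow_succ, h1, one_mul] at this
      exact this
  have h1 := key (x * y ^ 2) (by
    rw [mul_pow, hx, ← pow_mul, mul_comm 2 3, pow_mul, hy]; simp) (by
    rw [map_mul, h, map_pow, ← pow_succ', ← map_pow, hy, map_one])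
  calc x = x * y ^ 3 := by rw [hy, mul_one]
    _ = (x * y ^ 2) * y := by ring
    _ = y := by rw [h1, one_mul]

lemma exists_red {t : Fbar q} (ht : t ^ 3 = 1) : ∃ x : Eis, x ^ 3 = 1 ∧ eisRed q x = t := by
  have hw := red_w_sq (q := q)
  have h3 := red_w_cube (q := q)
  set u := eisRed q Eis.w with hu
  have h1 : (t - 1) * ((t - u) * (t - u ^ 2)) = 0 := by
    linear_combination ht + (t - 1) * (-t) * hw + (t - 1) * h3
  rcases mul_eq_zero.1 h1 with h | h
  · exact ⟨1, by simp, by rw [sub_eq_zero.1 h]; simp⟩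
  rcases mul_eq_zero.1 h with h | h
  · exact ⟨Eis.w, Eis.w_cube, by rw [sub_eq_zero.1 h]⟩
  · refine ⟨Eis.w ^ 2, ?_, by rw [sub_eq_zero.1 h]; simp [hu]⟩
    rw [← pow_mul, mul_comm 2 3, pow_mul, Eis.w_cube]; simp

lemma exp_dvd (h3 : q ≠ 3) : 3 ∣ q ^ 2 - 1 := by
  have hq : q.Prime := Fact.out
  have h : ¬ 3 ∣ q := fun h => h3 ((Nat.prime_dvd_prime_iff_eq Nat.prime_three hq).1 h).symm
  have : q % 3 = 1 ∨ q % 3 = 2 := by omega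
  rw [← Nat.modEq_iff_dvd' (Nat.one_le_pow _ _ hq.pos)]
  unfold Nat.ModEq
  rcases this with h | h <;> simp [Nat.pow_mod, h]

lemma red_pow (h3 : q ≠ 3) (z : Eis) : eisRed q z ^ q ^ 2 = eisRed q z := by
  have : CharP (Fbar q) q := charP_of_injective_algebraMap (algebraMap (ZMod q) (Fbar q)).injective q
  have : ExpChar (Fbar q) q := ExpChar.prime Fact.out
  have hq : q.Prime := Fact.out
  have hcast : ∀ n : ℤ, ((n : ℤ) : Fbar q) ^ q ^ 2 = n := by
    intro n
    have := map_intCast (iterateFrobenius (Fbar q) q 2) n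
    rwa [iterateFrobenius_def] at this
  have hw : eisRed q Eis.w ^ q ^ 2 = eisRed q Eis.w := by
    obtain ⟨k, hk⟩ := exp_dvd h3
    have : q ^ 2 = 3 * k + 1 := by have := Nat.one_le_pow 2 q hq.pos; omega
    rw [this, pow_succ, pow_mul, red_w_cube]; simp
  have hz : eisRed q z = z.re + z.im * eisRed q Eis.w := by
    conv_lhs => rw [Eis.eq_add z]
    simp
  rw [hz, add_pow_expChar_pow, mul_pow, hcast, hcast, hw]

lemma red_pow_sub_one (h3 : q ≠ 3) {z : Eis} (hz : eisRed q z ≠ 0) :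
    eisRed q z ^ (q ^ 2 - 1) = 1 := by
  have hq : q.Prime := Fact.out
  have h1 := red_pow h3 z
  have : q ^ 2 = (q ^ 2 - 1) + 1 := by have := Nat.one_le_pow 2 q hq.pos; omega
  rw [this, pow_succ] at h1
  exact mul_right_cancel₀ hz (by simpa using h1)

variable (q)

/-- The residue in characteristic `q` of the cubic symbol. -/
noncomputable def symT (A : Eis) : Fbar q := eisRed q (A ^ 2 * star A) ^ ((q ^ 2 - 1) / 3)

/-- The cubic residue symbol of `A` at the rational prime `q`. -/
noncomputable def symP (A : Eis) : Eis :=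
  open Classical in
  if h : ∃ x : Eis, x ^ 3 = 1 ∧ eisRed q x = symT q A then h.choose else 1

variable {q}

lemma symP_cube (A : Eis) : symP q A ^ 3 = 1 := by
  unfold symP
  split_ifs with h
  · exact h.choose_spec.1
  · simp

lemma symT_cube (h3 : q ≠ 3) {A : Eis} (hA : ¬ (q : ℤ) ∣ norm A) : symT q A ^ 3 = 1 := by
  unfold symT
  rw [← pow_mul, Nat.div_mul_cancel (exp_dvd h3)]
  apply red_pow_sub_one h3
  rw [map_mul, map_pow]
  exact mul_ne_zero (pow_ne_zero _ (red_ne hA)) (red_star_ne hA)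

lemma red_symP (h3 : q ≠ 3) {A : Eis} (hA : ¬ (q : ℤ) ∣ norm A) :
    eisRed q (symP q A) = symT q A := by
  unfold symP
  have h := exists_red (symT_cube h3 hA)
  rw [dif_pos h]
  exact h.choose_spec.2

lemma symP_eq (h3 : q ≠ 3) {A : Eis} (hA : ¬ (q : ℤ) ∣ norm A) {x : Eis} (hx : x ^ 3 = 1)
    (h : eisRed q x = symT q A) : symP q A = x :=
  red_inj h3 (symP_cube A) hx (by rw [red_symP h3 hA, h])

lemma symT_mul (A B : Eis) : symT q (A * B) = symT q A * symT q B := by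
  unfold symT
  rw [← mul_pow, ← map_mul, star_mul]
  congr 2; ring

lemma q_not_dvd_mul {A B : Eis} (hA : ¬ (q : ℤ) ∣ norm A) (hB : ¬ (q : ℤ) ∣ norm B) :
    ¬ (q : ℤ) ∣ norm (A * B) := by
  rw [map_mul]
  intro h
  have hq : Prime (q : ℤ) := Nat.prime_iff_prime_int.1 Fact.out
  rcases hq.dvd_or_dvd h with h | h
  · exact hA h
  · exact hB h

lemma symP_mul (h3 : q ≠ 3) {A B : Eis} (hA : ¬ (q : ℤ) ∣ norm A) (hB : ¬ (q : ℤ) ∣ norm B) :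
    symP q (A * B) = symP q A * symP q B := by
  apply symP_eq h3 (q_not_dvd_mul hA hB)
  · rw [mul_pow, symP_cube, symP_cube, one_mul]
  · rw [map_mul, red_symP h3 hA, red_symP h3 hB, symT_mul]

lemma symP_star (h3 : q ≠ 3) {A : Eis} (hA : ¬ (q : ℤ) ∣ norm A) :
    symP q (star A) = star (symP q A) := by
  have hA' : ¬ (q : ℤ) ∣ norm (star A) := by rwa [Eis.norm_star']
  apply symP_eq h3 hA'
  · rw [← star_pow, symP_cube, star_one]
  · rw [Eis.star_of_cube (symP_cube A), map_pow, red_symP h3 hA]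
    unfold symT
    rw [← pow_mul, mul_comm _ 2, pow_mul, ← map_pow, star_star]
    have h0 : eisRed q A ≠ 0 := red_ne hA
    have h1 := red_star_ne hA
    have : eisRed q ((A ^ 2 * star A) ^ 2) = eisRed q (star A ^ 2 * A) * (eisRed q A) ^ 3 := by
      simp only [map_mul, map_pow]; ring
    rw [this, mul_pow, ← pow_mul (eisRed q A), Nat.mul_div_cancel' (exp_dvd h3), red_pow_sub_one h3 h0, mul_one]

lemma symP_congr {A B : Eis} (C : Eis) (h : A = B + q * C) :
    symP q A = symP q B := by
  have : symT q A = symT q B := by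
    unfold symT
    congr 1
    subst h
    simp
  unfold symP
  rw [this]

lemma not_dvd_norm_int {n : ℤ} (hn : ¬ (q : ℤ) ∣ n) : ¬ (q : ℤ) ∣ norm (n : Eis) := by
  rw [norm_intCast]
  intro h
  exact hn ((Nat.prime_iff_prime_int.1 Fact.out).dvd_of_dvd_pow h)

lemma symP_int (h3 : q ≠ 3) {n : ℤ} (hn : ¬ (q : ℤ) ∣ n) : symP q (n : Eis) = 1 := by
  have h := not_dvd_norm_int hn
  apply symP_eq h3 h (by simp)
  unfold symT
  have : ((n : Eis) ^ 2 * star (n : Eis)) = (n : Eis) ^ 3 := by rw [Eis.star_int]; ring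
  rw [this, map_pow, ← pow_mul, Nat.mul_div_cancel' (exp_dvd h3), red_pow_sub_one h3 (red_ne h), map_one]

lemma not_dvd_norm_th (h3 : q ≠ 3) : ¬ (q : ℤ) ∣ norm Eis.th := by
  have : norm Eis.th = 3 := by rw [Eis.norm_eq]; simp [Eis.th]
  rw [this]
  intro h
  have : q ∣ 3 := by exact_mod_cast h
  exact h3 ((Nat.prime_dvd_prime_iff_eq Fact.out Nat.prime_three).1 this)

lemma symP_th (h3 : q ≠ 3) : symP q Eis.th = 1 := by
  have h := not_dvd_norm_th h3
  apply symP_eq h3 h (by simp)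
  unfold symT
  have : (Eis.th ^ 2 * star Eis.th) = (-1) * Eis.th ^ 3 := by rw [Eis.star_th]; ring
  rw [this, map_mul, mul_pow, map_pow, ← pow_mul (eisRed q Eis.th), Nat.mul_div_cancel' (exp_dvd h3),
    red_pow_sub_one h3 (red_ne h), map_one]
  rcases Nat.Prime.eq_two_or_odd' (Fact.out : q.Prime) with rfl | ho
  · have : (2 : Fbar 2) = 0 := by
      have := (int_eq_zero_iff (q := 2) 2).2 dvd_rfl
      exact_mod_cast this
    simp
    linear_combination this
  · have hev : Even ((q ^ 2 - 1) / 3) := by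
      have h1 : Even (q ^ 2 - 1) := by
        have : Odd (q ^ 2) := ho.pow
        exact Nat.Odd.sub_odd this odd_one
      have h2 := Nat.div_mul_cancel (exp_dvd h3)
      rw [← h2, Nat.even_mul] at h1
      rcases h1 with h | h
      · exact h
      · exact absurd h (by decide)
    rw [map_neg, map_one, hev.neg_one_pow, one_mul]

lemma symP_w (h3 : q ≠ 3) : symP q Eis.w = Eis.w ^ ((q ^ 2 - 1) / 3) := by
  have hw : norm Eis.w = 1 := by rw [Eis.norm_eq]; simp [Eis.w]
  have h : ¬ (q : ℤ) ∣ norm Eis.w := by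
    rw [hw]; exact (Nat.prime_iff_prime_int.1 Fact.out).not_dvd_one
  apply symP_eq h3 h
  · rw [← pow_mul, mul_comm, pow_mul, Eis.w_cube, one_pow]
  · unfold symT
    have : Eis.w ^ 2 * star Eis.w = Eis.w := by
      rw [Eis.star_w]; linear_combination Eis.w * Eis.w_cube
    rw [this, map_pow]

end residue

end CubicSymbol

section CubicReciprocity

open QuadraticAlgebra

lemma Eis.w_primitive : IsPrimitiveRoot Eis.w 3 := by
  have : Fact (Nat.Prime 3) := ⟨Nat.prime_three⟩
  rw [IsPrimitiveRoot.iff_orderOf]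
  refine orderOf_eq_prime Eis.w_cube fun h => ?_
  have := congrArg QuadraticAlgebra.im h
  simp [Eis.w] at this

variable {p : ℕ} [Fact p.Prime]

lemma exists_cubic_char (h1 : p % 3 = 1) : ∃ χ : MulChar (ZMod p) Eis, orderOf χ = 3 := by
  apply MulChar.exists_mulChar_orderOf _ _ Eis.w_primitive
  rw [ZMod.card]
  exact (Nat.modEq_iff_dvd' (Fact.out : p.Prime).one_le).1 (by simp [Nat.ModEq, h1])

lemma chi_cube {χ : MulChar (ZMod p) Eis} (hχ : orderOf χ = 3) {a : ZMod p} (ha : a ≠ 0) :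
    χ a ^ 3 = 1 := by
  rw [← MulChar.pow_apply' χ (by norm_num), ← hχ, pow_orderOf_eq_one, MulChar.one_apply ha.isUnit]

lemma chi_neg_one {χ : MulChar (ZMod p) Eis} (hχ : orderOf χ = 3) : χ (-1) = 1 := by
  have h1 := chi_cube hχ (a := -1) (by simp)
  rw [← map_pow] at h1
  rwa [show (-1 : ZMod p) ^ 3 = -1 by ring] at h1

/-- The embedding of the Eisenstein integers in `ℂ`-like algebraically closed fields of
characteristic zero is injective. -/
lemma exists_eis_complex : ∃ f : Eis →+* ℂ, Function.Injective f := by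
  have hu : ∃ u : ℂ, u * u = (-1 : ℤ) • 1 + (-1 : ℤ) • u := by
    have h := Complex.isPrimitiveRoot_exp 3 (by norm_num)
    have h1 := h.geom_sum_eq_zero (by norm_num)
    refine ⟨Complex.exp (2 * Real.pi * Complex.I / (3 : ℕ)), ?_⟩
    simp only [Finset.sum_range_succ, Finset.sum_range_zero] at h1
    simp only [neg_smul, one_smul]
    linear_combination h1
  let f : Eis →+* ℂ := (QuadraticAlgebra.lift (R := ℤ) ⟨hu.choose, hu.choose_spec⟩ :
    Eis →ₐ[ℤ] ℂ).toRingHom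
  refine ⟨f, (injective_iff_map_eq_zero f).2 fun z hz => ?_⟩
  have : f (z * star z) = 0 := by rw [map_mul, hz, zero_mul]
  rw [Eis.mul_star_eq, map_intCast] at this
  exact Eis.norm_eq_zero.1 (by exact_mod_cast this)

lemma comp_ne_one {R : Type*} [CommRing R] (f : Eis →+* R)
    (hf : ∀ x : Eis, x ^ 3 = 1 → f x = 1 → x = 1)
    {χ : MulChar (ZMod p) Eis} (hχ : orderOf χ = 3) : χ.ringHomComp f ≠ 1 := by
  intro h
  have hne : χ ≠ 1 := by rintro rfl; simp at hχ
  apply hne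
  refine MulChar.ext fun a => ?_
  rw [MulChar.one_apply_coe]
  apply hf _ (chi_cube hχ a.ne_zero)
  have := congrArg (fun c : MulChar (ZMod p) R => c a) h
  simpa using this

lemma comp_orderOf {R : Type*} [CommRing R] (f : Eis →+* R)
    (hf : ∀ x : Eis, x ^ 3 = 1 → f x = 1 → x = 1)
    {χ : MulChar (ZMod p) Eis} (hχ : orderOf χ = 3) : orderOf (χ.ringHomComp f) = 3 := by
  have : Fact (Nat.Prime 3) := ⟨Nat.prime_three⟩
  apply orderOf_eq_prime _ (comp_ne_one f hf hχ)
  ext a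
  rw [MulChar.pow_apply_coe, MulChar.one_apply_coe, MulChar.ringHomComp_apply, ← map_pow,
    chi_cube hχ a.ne_zero, map_one]

lemma norm_jacobi {χ : MulChar (ZMod p) Eis} (hχ : orderOf χ = 3) :
    norm (jacobiSum χ χ) = (p : ℤ) := by
  obtain ⟨f, hf⟩ := exists_eis_complex
  have hf1 : ∀ x : Eis, x ^ 3 = 1 → f x = 1 → x = 1 := fun x _ h => hf (by rw [h, map_one])
  have hne := comp_ne_one f hf1 hχ
  have ho := comp_orderOf f hf1 hχ
  have h2 : (χ.ringHomComp f) * (χ.ringHomComp f) ≠ 1 := by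
    intro h
    rw [← pow_two] at h
    have := orderOf_dvd_of_pow_eq_one h
    rw [ho] at this
    norm_num at this
  have key := jacobiSum_mul_jacobiSum_inv (F := ZMod p) (F' := ℂ) (by
    rw [ZMod.ringChar_zmod_n, ringChar.eq ℂ 0]
    exact (Fact.out : p.Prime).ne_zero.symm) hne hne h2
  have hinv : (χ.ringHomComp f)⁻¹ = (χ⁻¹).ringHomComp f := by
    ext a
    rw [MulChar.inv_apply_eq_inv, MulChar.ringHomComp_apply, MulChar.ringHomComp_apply,
      MulChar.inv_apply_eq_inv, Ring.inverse_eq_inv']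
    have h1 : χ a * Ring.inverse (χ a) = 1 := Ring.mul_inverse_cancel _ (a.isUnit.map χ)
    apply inv_eq_of_mul_eq_one_right
    rw [← map_mul, h1, map_one]
  rw [hinv, jacobiSum_ringHomComp, jacobiSum_ringHomComp, ← map_mul] at key
  have hstar : jacobiSum χ⁻¹ χ⁻¹ = star (jacobiSum χ χ) := by
    have : ∀ a, χ⁻¹ a = star (χ a) := by
      intro a
      by_cases ha : a = 0
      · subst ha
        rw [MulChar.map_zero, MulChar.map_zero, star_zero]
      · rw [MulChar.inv_apply_eq_inv, Eis.star_of_cube (chi_cube hχ ha)]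
        have h1 : χ a * Ring.inverse (χ a) = 1 :=
          Ring.mul_inverse_cancel _ ((isUnit_iff_ne_zero.2 ha).map χ)
        calc Ring.inverse (χ a) = χ a ^ 3 * Ring.inverse (χ a) := by rw [chi_cube hχ ha, one_mul]
          _ = χ a ^ 2 * (χ a * Ring.inverse (χ a)) := by ring
          _ = _ := by rw [h1, mul_one]
    unfold jacobiSum
    rw [star_sum]
    refine Finset.sum_congr rfl fun a _ => ?_
    rw [star_mul, this, this, mul_comm]
  rw [hstar, Eis.mul_star_eq, map_intCast, ZMod.card] at key
  exact_mod_cast key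

lemma symP_jacobi {χ : MulChar (ZMod p) Eis} (hχ : orderOf χ = 3) {q : ℕ} [Fact q.Prime]
    (h3 : q ≠ 3) (hpq : q ≠ p) : symP q (jacobiSum χ χ) = χ q := by
  have hp : p.Prime := Fact.out
  have hq : q.Prime := Fact.out
  have hN : ¬ (q : ℤ) ∣ norm (jacobiSum χ χ) := by
    rw [norm_jacobi hχ]
    intro h
    exact hpq ((Nat.prime_dvd_prime_iff_eq hq hp).1 (by exact_mod_cast h))
  have hq0 : (q : ZMod p) ≠ 0 := by
    intro h
    exact hpq ((Nat.prime_dvd_prime_iff_eq hp hq).1 ((ZMod.natCast_eq_zero_iff _ _).1 h)).symm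
  apply symP_eq h3 hN (chi_cube hχ hq0)
  have : CharP (Fbar q) q := charP_of_injective_algebraMap (algebraMap (ZMod q) (Fbar q)).injective q
  have hpne : (p : Fbar q) ≠ 0 := by
    intro h
    have h' : ((p : ℤ) : Fbar q) = 0 := by exact_mod_cast h
    rw [int_eq_zero_iff] at h'
    exact hpq ((Nat.prime_dvd_prime_iff_eq hq hp).1 (by exact_mod_cast h'))
  have : NeZero (p : Fbar q) := ⟨hpne⟩
  have : NeZero p := ⟨hp.ne_zero⟩
  obtain ⟨ζ, hζ⟩ := HasEnoughRootsOfUnity.exists_primitiveRoot (Fbar q) p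
  set ψ := AddChar.zmodChar p hζ.pow_eq_one with hψ
  have hprim : ψ.IsPrimitive := AddChar.zmodChar_primitive_of_primitive_root p hζ
  set χ' := χ.ringHomComp (eisRed q) with hχ'
  have hinj : ∀ x : Eis, x ^ 3 = 1 → eisRed q x = 1 → x = 1 := fun x hx h =>
    red_inj h3 hx (by simp) (by rw [h, map_one])
  have ho : orderOf χ' = 3 := comp_orderOf _ hinj hχ
  have hg3 := gaussSum_pow_eq_prod_jacobiSum (χ := χ') (ψ := ψ) (by rw [ho]; norm_num) hprim
  have hneg : χ' (-1) = 1 := by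
    rw [hχ', MulChar.ringHomComp_apply, chi_neg_one hχ, map_one]
  rw [ho, hneg, ZMod.card] at hg3
  simp only [Nat.reduceSub, Nat.Ico_succ_singleton, Finset.prod_singleton, pow_one, one_mul] at hg3
  rw [hχ', jacobiSum_ringHomComp, ← hχ'] at hg3
  have hJ := red_ne hN
  set g := gaussSum χ' ψ with hg
  have hg0 : g ≠ 0 := by
    intro h
    rw [h] at hg3
    have := mul_ne_zero hpne hJ
    exact this (by rw [← hg3]; norm_num)
  have hfrob : g ^ (q ^ 2) = eisRed q (χ q) * g := by
    have h1 : g ^ (q ^ 2) = gaussSum ((χ' ^ q) ^ q) ((ψ ^ q) ^ q) := by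
      rw [pow_two, pow_mul, hg, gaussSum_frob, gaussSum_frob]
    have hc : (χ' ^ q) ^ q = χ' := by
      rw [← pow_mul, ← pow_two]
      obtain ⟨k, hk⟩ := exp_dvd h3
      have : q ^ 2 = 3 * k + 1 := by have := Nat.one_le_pow 2 q hq.pos; omega
      rw [this, pow_succ, pow_mul, ← ho, pow_orderOf_eq_one]; simp
    have hs : (ψ ^ q) ^ q = ψ.mulShift ((q ^ 2 : ℕ) : ZMod p) := by
      rw [← pow_mul, ← pow_two, AddChar.pow_mulShift]
    rw [hc, hs] at h1
    have hu : IsUnit ((q ^ 2 : ℕ) : ZMod p) := by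
      rw [isUnit_iff_ne_zero]; push_cast; exact pow_ne_zero _ hq0
    have h2 := gaussSum_mulShift χ' ψ hu.unit
    rw [IsUnit.unit_spec, ← h1, ← hg] at h2
    have h4 : χ' ((q ^ 2 : ℕ) : ZMod p) = eisRed q (χ q) ^ 2 := by
      rw [hχ', MulChar.ringHomComp_apply]; push_cast; rw [map_pow, map_pow]
    rw [h4] at h2
    have h5 : eisRed q (χ q) ^ 3 = 1 := by rw [← map_pow, chi_cube hχ hq0, map_one]
    calc g ^ q ^ 2 = eisRed q (χ q) ^ 3 * g ^ q ^ 2 := by rw [h5, one_mul]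
      _ = eisRed q (χ q) * (eisRed q (χ q) ^ 2 * g ^ q ^ 2) := by ring
      _ = _ := by rw [h2]
  unfold symT
  have hrw : eisRed q (jacobiSum χ χ ^ 2 * star (jacobiSum χ χ)) = g ^ 3 := by
    rw [hg3, pow_two, mul_assoc, Eis.mul_star_eq, norm_jacobi hχ, map_mul, mul_comm]; simp
  rw [hrw, ← pow_mul, Nat.mul_div_cancel' (exp_dvd h3)]
  have : q ^ 2 = (q ^ 2 - 1) + 1 := by have := Nat.one_le_pow 2 q hq.pos; omega
  rw [this, pow_succ] at hfrob
  exact (mul_right_cancel₀ hg0 hfrob).symm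

end CubicReciprocity

section CubicSymbolComposite

open QuadraticAlgebra

/-- The cubic symbol at a natural number, trivial unless it is prime. -/
noncomputable def symQ (q : ℕ) (A : Eis) : Eis :=
  open Classical in if h : q.Prime then @symP q ⟨h⟩ A else 1

/-- The cubic residue symbol of `A` modulo the rational integer `m`. -/
noncomputable def symM (m : ℤ) (A : Eis) : Eis :=
  (m.natAbs.primeFactorsList.map fun q => symQ q A).prod

lemma symQ_cube (q : ℕ) (A : Eis) : symQ q A ^ 3 = 1 := by
  unfold symQ
  split_ifs with h
  · have : Fact q.Prime := ⟨h⟩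
    exact symP_cube A
  · simp

lemma symM_cube (m : ℤ) (A : Eis) : symM m A ^ 3 = 1 := by
  unfold symM
  generalize m.natAbs.primeFactorsList = l
  induction l with
  | nil => simp
  | cons a l ih => simp [mul_pow, ih, symQ_cube]

lemma symM_mul_left {m n : ℤ} (hm : m ≠ 0) (hn : n ≠ 0) (A : Eis) :
    symM (m * n) A = symM m A * symM n A := by
  unfold symM
  rw [Int.natAbs_mul, ((Nat.perm_primeFactorsList_mul (by simpa) (by simpa)).map _).prod_eq,
    List.map_append, List.prod_append]

lemma symM_pow_left {m : ℤ} (hm : m ≠ 0) (A : Eis) (k : ℕ) :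
    symM (m ^ k) A = symM m A ^ k := by
  induction k with
  | zero => simp [symM]
  | succ k ih => rw [pow_succ, symM_mul_left (pow_ne_zero _ hm) hm, ih, pow_succ]

lemma symM_one_left (A : Eis) : symM 1 A = 1 := by simp [symM]

lemma mem_factors {m : ℤ} {q : ℕ} (hq : q ∈ m.natAbs.primeFactorsList) :
    q.Prime ∧ (q : ℤ) ∣ m :=
  ⟨Nat.prime_of_mem_primeFactorsList hq,
    Int.natCast_dvd.2 (Nat.dvd_of_mem_primeFactorsList hq)⟩

lemma not_dvd_of_coprime {m n : ℤ} (h : IsCoprime m n) {q : ℕ} (hq : q.Prime) (hm : (q : ℤ) ∣ m) :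
    ¬ (q : ℤ) ∣ n := by
  intro hn
  exact (Nat.prime_iff_prime_int.1 hq).not_isUnit (h.isUnit_of_dvd' hm hn)

lemma ne_three_of_coprime {m : ℤ} (h : IsCoprime m 3) {q : ℕ} (hq : q.Prime) (hm : (q : ℤ) ∣ m) :
    q ≠ 3 := by
  rintro rfl
  exact not_dvd_of_coprime h hq hm (by simp)

lemma ne_zero_of_coprime_three {m : ℤ} (h : IsCoprime m 3) : m ≠ 0 := by
  rintro rfl
  rw [isCoprime_zero_left, Int.isUnit_iff] at h
  omega

lemma symM_mul {m : ℤ} (h3 : IsCoprime m 3) {A B : Eis} (hA : IsCoprime m (norm A))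
    (hB : IsCoprime m (norm B)) : symM m (A * B) = symM m A * symM m B := by
  unfold symM
  rw [← List.prod_map_mul]
  congr 1
  refine List.map_congr_left fun q hq => ?_
  obtain ⟨hp, hd⟩ := mem_factors hq
  have : Fact q.Prime := ⟨hp⟩
  simp only [symQ, hp, dif_pos]
  exact symP_mul (ne_three_of_coprime h3 hp hd) (not_dvd_of_coprime hA hp hd)
    (not_dvd_of_coprime hB hp hd)

lemma symM_eq_one_of {m : ℤ} {A : Eis}
    (h : ∀ q : ℕ, ∀ hq : q.Prime, (q : ℤ) ∣ m → @symP q ⟨hq⟩ A = 1) : symM m A = 1 := by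
  unfold symM
  apply List.prod_eq_one
  intro x hx
  obtain ⟨q, hq, rfl⟩ := List.mem_map.1 hx
  obtain ⟨hp, hd⟩ := mem_factors hq
  simp only [symQ, hp, dif_pos]
  exact h q hp hd

lemma symM_int {m : ℤ} (h3 : IsCoprime m 3) {n : ℤ} (hn : IsCoprime m n) :
    symM m (n : Eis) = 1 := by
  refine symM_eq_one_of fun q hq hd => ?_
  have : Fact q.Prime := ⟨hq⟩
  exact symP_int (ne_three_of_coprime h3 hq hd) (not_dvd_of_coprime hn hq hd)

lemma symM_th {m : ℤ} (h3 : IsCoprime m 3) : symM m Eis.th = 1 := by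
  refine symM_eq_one_of fun q hq hd => ?_
  have : Fact q.Prime := ⟨hq⟩
  exact symP_th (ne_three_of_coprime h3 hq hd)

lemma symM_congr {m : ℤ} {A B : Eis} (C : Eis) (h : A = B + m * C) : symM m A = symM m B := by
  unfold symM
  congr 1
  refine List.map_congr_left fun q hq => ?_
  obtain ⟨hp, k, hk⟩ := mem_factors hq
  have : Fact q.Prime := ⟨hp⟩
  simp only [symQ, hp, dif_pos]
  refine symP_congr (k * C) ?_
  rw [h, hk]; push_cast; ring

lemma prod_induct {P : ℤ → Prop} (hone : ∀ m : ℤ, m.natAbs = 1 → P m)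
    (hmul : ∀ (m : ℤ) (q : ℕ), m ≠ 0 → q.Prime → P m → P (m * q)) (m : ℤ) (hm : m ≠ 0) : P m := by
  have : ∀ n : ℕ, ∀ m : ℤ, m ≠ 0 → m.natAbs = n → P m := by
    intro n
    induction n using Nat.strong_induction_on with
    | _ n ih =>
      intro m hm hn
      by_cases h1 : n = 1
      · exact hone m (hn.trans h1)
      · obtain ⟨q, hq, hd⟩ := Nat.exists_prime_and_dvd h1
        obtain ⟨k, hk⟩ := Int.natCast_dvd.2 (hn ▸ hd : q ∣ m.natAbs)
        have hk0 : k ≠ 0 := by rintro rfl; simp [hm] at hk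
        rw [hk, mul_comm]
        refine hmul k q hk0 hq (ih k.natAbs ?_ k hk0 rfl)
        rw [← hn, hk, Int.natAbs_mul, Int.natAbs_natCast]
        have := Int.natAbs_pos.2 hk0
        have := hq.two_le
        nlinarith
  exact this _ m hm rfl

lemma symM_star {m : ℤ} (h3 : IsCoprime m 3) {A : Eis} (hA : IsCoprime m (norm A)) :
    symM m (star A) = star (symM m A) := by
  unfold symM
  have h : ∀ l : List ℕ, (∀ q ∈ l, symQ q (star A) = star (symQ q A)) →
      (l.map fun q => symQ q (star A)).prod = star ((l.map fun q => symQ q A).prod) := by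
    intro l
    induction l with
    | nil => simp
    | cons a l ih =>
      intro hl
      simp only [List.map_cons, List.prod_cons, star_mul]
      rw [ih fun q hq => hl q (List.mem_cons_of_mem _ hq), hl a (by simp), mul_comm]
  refine h _ fun q hq => ?_
  obtain ⟨hp, hd⟩ := mem_factors hq
  have : Fact q.Prime := ⟨hp⟩
  simp only [symQ, hp, dif_pos]
  exact symP_star (ne_three_of_coprime h3 hp hd) (not_dvd_of_coprime hA hp hd)

lemma sq_mod_three {m : ℤ} (h3 : IsCoprime m 3) : (3 : ℤ) ∣ m ^ 2 - 1 := by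
  have h := not_dvd_of_coprime h3.symm Nat.prime_three (by simp)
  have h' : m % 3 = 1 ∨ m % 3 = 2 := by push_cast at h; omega
  apply Int.dvd_of_emod_eq_zero
  rcases h' with h | h <;> simp [pow_two, Int.sub_emod, Int.mul_emod, h]

lemma w_pow_mod (a b : ℕ) (h : a % 3 = b % 3) : Eis.w ^ a = Eis.w ^ b := by
  rw [← Nat.div_add_mod a 3, ← Nat.div_add_mod b 3, pow_add, pow_add, pow_mul, pow_mul,
    Eis.w_cube, h]; simp

lemma symM_w (m : ℤ) (h3 : IsCoprime m 3) :
    symM m Eis.w = Eis.w ^ ((m ^ 2 - 1) / 3).toNat := by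
  have hm0 : m ≠ 0 := ne_zero_of_coprime_three h3
  revert h3
  refine prod_induct (P := fun m => IsCoprime m 3 → symM m Eis.w =
    Eis.w ^ ((m ^ 2 - 1) / 3).toNat) ?_ ?_ m hm0
  · intro m hm _
    rcases Int.natAbs_eq m with h | h <;> rw [h, hm] <;> norm_num [symM]
  · intro m q hm hq ih h
    have hm3 : IsCoprime m 3 := h.of_mul_left_left
    have hq3 : IsCoprime (q : ℤ) 3 := h.of_mul_left_right
    have h3 := ne_three_of_coprime hq3 hq dvd_rfl
    have : Fact q.Prime := ⟨hq⟩
    have hqq : symM (q : ℤ) Eis.w = Eis.w ^ ((q ^ 2 - 1) / 3) := by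
      rw [← symP_w h3]
      simp [symM, Nat.primeFactorsList_prime hq, symQ, hq]
    rw [symM_mul_left hm (by exact_mod_cast hq.ne_zero), ih hm3, hqq, ← pow_add]
    apply w_pow_mod
    obtain ⟨k, hk⟩ := sq_mod_three hm3
    obtain ⟨l, hl⟩ := exp_dvd h3
    have hq1 : 1 ≤ q ^ 2 := Nat.one_le_pow _ _ hq.pos
    have hl' : ((q : ℤ)) ^ 2 = 3 * l + 1 := by
      have : q ^ 2 = 3 * l + 1 := by omega
      exact_mod_cast this
    have hk0 : 0 ≤ k := by
      have : 0 < m ^ 2 := by positivity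
      omega
    have e1 : (m ^ 2 - 1) / 3 = k := by rw [hk]; simp
    have e2 : (q ^ 2 - 1) / 3 = l := by rw [hl]; simp
    have e3 : ((m * q) ^ 2 - 1) / 3 = k + l + 3 * (k * l) := by
      have : (m * q) ^ 2 - 1 = 3 * (k + l + 3 * (k * l)) := by
        rw [mul_pow, hl']; linear_combination (3 * (l : ℤ) + 1) * hk
      rw [this]; simp
    rw [e1, e2, e3]
    lift k to ℕ using hk0
    have : ((k : ℤ) + l + 3 * (k * l)).toNat = k + l + 3 * (k * l) := by
      rw [← Int.toNat_natCast (k + l + 3 * (k * l))]; push_cast; rfl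
    rw [this]
    simp

lemma symM_jacobi {p : ℕ} [Fact p.Prime] {χ : MulChar (ZMod p) Eis} (hχ : orderOf χ = 3) (m : ℤ)
    (h3 : IsCoprime m 3) (hp : IsCoprime m p) : symM m (jacobiSum χ χ) = χ m := by
  have hm0 : m ≠ 0 := ne_zero_of_coprime_three h3
  revert h3 hp
  refine prod_induct (P := fun m => IsCoprime m 3 → IsCoprime m p → symM m (jacobiSum χ χ) =
    χ m) ?_ ?_ m hm0
  · intro m hm _ _
    rcases Int.natAbs_eq m with h | h <;> rw [h, hm] <;> norm_num [symM, chi_neg_one hχ]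
  · intro m q hm hq ih h hp
    have h3 := ne_three_of_coprime h.of_mul_left_right hq dvd_rfl
    have hqp : q ≠ p := by
      rintro rfl
      exact not_dvd_of_coprime hp.of_mul_left_right hq dvd_rfl dvd_rfl
    have : Fact q.Prime := ⟨hq⟩
    rw [symM_mul_left hm (by exact_mod_cast hq.ne_zero),
      ih h.of_mul_left_left hp.of_mul_left_left]
    push_cast
    rw [map_mul, ← symP_jacobi hχ h3 hqp]
    congr 1
    simp [symM, Nat.primeFactorsList_prime hq, symQ, hq]

end CubicSymbolComposite

section CubicPeriodic

open QuadraticAlgebra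

lemma Eis.unit_cases {B : Eis} (h : norm B = 1) :
    ∃ (s : ℤ) (k : ℕ), (s = 1 ∨ s = -1) ∧ B = s * Eis.w ^ k := by
  rw [Eis.norm_eq] at h
  obtain ⟨x, y⟩ := B
  simp only at h
  have hy : y ^ 2 ≤ 1 := by nlinarith [sq_nonneg (2 * x - y)]
  have hy1 : -1 ≤ y := by nlinarith
  have hy2 : y ≤ 1 := by nlinarith
  obtain rfl | rfl | rfl : y = -1 ∨ y = 0 ∨ y = 1 := by omega
  · have : x * (x + 1) = 0 := by linear_combination h
    rcases mul_eq_zero.1 this with h | h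
    · exact ⟨-1, 1, Or.inr rfl, by subst h; ext <;> simp [Eis.w]⟩
    · refine ⟨1, 2, Or.inl rfl, ?_⟩
      obtain rfl : x = -1 := by omega
      rw [Eis.w_sq]; ext <;> simp [Eis.w]
  · have : (x - 1) * (x + 1) = 0 := by linear_combination h
    rcases mul_eq_zero.1 this with h | h
    · obtain rfl : x = 1 := by omega
      exact ⟨1, 0, Or.inl rfl, by ext <;> simp⟩
    · obtain rfl : x = -1 := by omega
      exact ⟨-1, 0, Or.inr rfl, by ext <;> simp⟩
  · have : x * (x - 1) = 0 := by linear_combination h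
    rcases mul_eq_zero.1 this with h | h
    · exact ⟨1, 1, Or.inl rfl, by subst h; ext <;> simp [Eis.w]⟩
    · refine ⟨-1, 2, Or.inr rfl, ?_⟩
      obtain rfl : x = 1 := by omega
      rw [Eis.w_sq]; ext <;> simp [Eis.w]

lemma Eis.norm_w : norm Eis.w = 1 := by rw [Eis.norm_eq]; simp [Eis.w]
lemma Eis.norm_th : norm Eis.th = 3 := by rw [Eis.norm_eq]; simp [Eis.th]

lemma symM_unit_periodic {B : Eis} (h : norm B = 1) {m m' : ℤ} (h3 : IsCoprime m 3)
    (h3' : IsCoprime m' 3) (h9 : (9 : ℤ) ∣ m - m') : symM m B = symM m' B := by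
  obtain ⟨s, k, hs, rfl⟩ := Eis.unit_cases h
  have hsu : ∀ n : ℤ, IsCoprime n s := fun n => by
    rcases hs with rfl | rfl
    · exact isCoprime_one_right
    · exact (isCoprime_one_right (x := n)).neg_right
  have hval : ∀ n : ℤ, IsCoprime n 3 → symM n ((s : Eis) * Eis.w ^ k) = symM n Eis.w ^ k := by
    intro n hn
    have hN : ∀ k : ℕ, IsCoprime n (norm (Eis.w ^ k)) := fun k => by
      rw [map_pow, Eis.norm_w, one_pow]; exact isCoprime_one_right
    rw [symM_mul hn (by rw [norm_intCast]; exact (hsu n).pow_right) (hN k), symM_int hn (hsu n), one_mul]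
    clear h
    induction k with
    | zero => simpa using symM_int hn (n := 1) isCoprime_one_right
    | succ k ih =>
      rw [pow_succ, symM_mul hn (hN k) (by simpa using hN 1), ih, pow_succ]
  rw [hval m h3, hval m' h3', symM_w m h3, symM_w m' h3']
  congr 1
  apply w_pow_mod
  obtain ⟨a, ha⟩ := sq_mod_three h3
  obtain ⟨b, hb⟩ := sq_mod_three h3'
  have : (9 : ℤ) ∣ m ^ 2 - m' ^ 2 := by
    have : m ^ 2 - m' ^ 2 = (m - m') * (m + m') := by ring
    rw [this]; exact h9.mul_right _
  have h1 : 0 < m ^ 2 := by have := ne_zero_of_coprime_three h3; positivity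
  have h2 : 0 < m' ^ 2 := by have := ne_zero_of_coprime_three h3'; positivity
  omega

lemma prime_two_mod {q : ℕ} (hq : q.Prime) (h2 : q % 3 = 2) {B : Eis} (h : (q : ℤ) ∣ norm B) :
    ∃ C : Eis, B = (q : ℤ) * C := by
  have : Fact q.Prime := ⟨hq⟩
  have h3 : q ≠ 3 := by rintro rfl; simp at h2
  have : CharP (Fbar q) q := charP_of_injective_algebraMap (algebraMap (ZMod q) (Fbar q)).injective q
  have : ExpChar (Fbar q) q := ExpChar.prime hq
  have hred : ∀ z : Eis, eisRed q z = z.re + z.im * eisRed q Eis.w := by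
    intro z
    conv_lhs => rw [Eis.eq_add z]
    simp
  have hcast : ∀ n : ℤ, ((n : ℤ) : Fbar q) ^ q = n := by
    intro n
    have := map_intCast (frobenius (Fbar q) q) n
    rwa [frobenius_def] at this
  have hfrob : ∀ z : Eis, eisRed q z ^ q = eisRed q (star z) := by
    intro z
    have hw : eisRed q Eis.w ^ q = eisRed q (star Eis.w) := by
      rw [Eis.star_w, ← map_pow, w_pow_mod q 2 (by omega)]
    have e : star z = (z.re : Eis) + z.im * star Eis.w := by
      conv_lhs => rw [Eis.eq_add z]
      rw [star_add, star_mul, Eis.star_int, Eis.star_int]; ring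
    rw [hred z, add_pow_expChar, mul_pow, hcast, hcast, hw, e]; simp
  have h0 : eisRed q B = 0 := by
    have h1 := red_norm (q := q) B
    rw [(int_eq_zero_iff _).2 h, ← hfrob, ← pow_succ'] at h1
    exact pow_eq_zero_iff (by omega) |>.1 h1
  have h0' : eisRed q (star B) = 0 := by rw [← hfrob, h0, zero_pow hq.ne_zero]
  have hsub : ((B.im : ℤ) : Fbar q) * eisRed q Eis.th = 0 := by
    have : (B.im : Eis) * Eis.th = B - star B := by ext <;> simp [Eis.th]; ring
    rw [← map_intCast (eisRed q), ← map_mul, this, map_sub, h0, h0', sub_zero]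
  have him : ((B.im : ℤ) : Fbar q) = 0 :=
    (mul_eq_zero.1 hsub).resolve_right (red_ne (not_dvd_norm_th h3))
  have hre : ((B.re : ℤ) : Fbar q) = 0 := by
    have := hred B
    rw [h0, him, zero_mul, add_zero] at this
    exact this.symm
  obtain ⟨x, hx⟩ := (int_eq_zero_iff _).1 hre
  obtain ⟨y, hy⟩ := (int_eq_zero_iff _).1 him
  exact ⟨⟨x, y⟩, by ext <;> simp [hx, hy]⟩

lemma three_dvd_norm {B : Eis} (h : (3 : ℤ) ∣ norm B) : ∃ C : Eis, B = Eis.th * C := by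
  rw [Eis.norm_eq] at h
  obtain ⟨x, y⟩ := B
  simp only at h
  have h1 : (3 : ℤ) ∣ (x + y) ^ 2 := by
    have : (x + y) ^ 2 = (x ^ 2 - x * y + y ^ 2) + 3 * (x * y) := by ring
    rw [this]; exact dvd_add h ⟨_, rfl⟩
  obtain ⟨k, hk⟩ := Int.prime_three.dvd_of_dvd_pow h1
  obtain rfl : x = 3 * k - y := by omega
  refine ⟨⟨y - k, y - 2 * k⟩, ?_⟩
  ext <;> simp [Eis.th] <;> ring

lemma dvd_of_norm_dvd {p : ℕ} (hp : p.Prime) {J B : Eis} (hJ : norm J = (p : ℤ))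
    (h : (p : ℤ) ∣ norm B) : (∃ C, B = J * C) ∨ ∃ C, B = star J * C := by
  have hpp : Prime (p : ℤ) := Nat.prime_iff_prime_int.1 hp
  have main : ∀ z : Eis, (p : ℤ) ∣ z.im → (p : ℤ) ^ 2 ∣ norm z → ∃ C : Eis, z = (p : ℤ) * C := by
    rintro ⟨x, y⟩ ⟨k, hk⟩ h2
    simp only at hk
    subst hk
    have h3 : (p : ℤ) ∣ x ^ 2 := by
      rw [Eis.norm_eq] at h2
      have h4 := dvd_trans (dvd_pow_self _ two_ne_zero) h2
      have : x ^ 2 = (x ^ 2 - x * (p * k) + (p * k) ^ 2) + p * (x * k - p * k ^ 2) := by ring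
      rw [this]; exact dvd_add h4 ⟨_, rfl⟩
    obtain ⟨l, rfl⟩ := hpp.dvd_of_dvd_pow h3
    exact ⟨⟨l, k⟩, by ext <;> simp⟩
  have hJn : J * star J = ((p : ℤ) : Eis) := by rw [Eis.mul_star_eq, hJ]
  have hp0 : ((p : ℤ) : Eis) ≠ 0 := by
    intro h
    have := congrArg QuadraticAlgebra.re h
    simp at this
    exact hp.ne_zero this
  have hJ0 : J ≠ 0 := by rintro rfl; exact hp0 (by rw [← hJn, zero_mul])
  have hJs0 : star J ≠ 0 := fun h => hp0 (by rw [← hJn, h, mul_zero])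
  have hd : (p : ℤ) ∣ (B * star J).im * (B * J).im := by
    have e : (B * star J).im * (B * J).im = B.im ^ 2 * norm J - J.im ^ 2 * norm B := by
      rw [Eis.norm_eq, Eis.norm_eq]; simp; ring
    rw [e, hJ]
    exact dvd_sub (Dvd.intro_left _ rfl) (h.mul_left _)
  rcases hpp.dvd_or_dvd hd with h1 | h1
  · left
    obtain ⟨C, hC⟩ := main _ h1 (by
      rw [map_mul, Eis.norm_star', hJ, pow_two]; exact mul_dvd_mul_right h _)
    refine ⟨C, mul_right_cancel₀ hJs0 ?_⟩
    rw [hC, ← hJn]; ring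
  · right
    obtain ⟨C, hC⟩ := main _ h1 (by
      rw [map_mul, hJ, pow_two]; exact mul_dvd_mul_right h _)
    refine ⟨C, mul_right_cancel₀ hJ0 ?_⟩
    rw [hC, ← hJn]; ring

/-- Eisenstein reciprocity, in the form of periodicity of the cubic symbol. -/
theorem symM_periodic {B : Eis} (hB : B ≠ 0) {m m' : ℤ} (h3 : IsCoprime m 3)
    (h3' : IsCoprime m' 3) (hm : IsCoprime m (norm B)) (hm' : IsCoprime m' (norm B))
    (h9 : (9 : ℤ) ∣ m - m') (hN : norm B ∣ m - m') : symM m B = symM m' B := by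
  obtain ⟨n, hn⟩ : ∃ n : ℕ, (norm B).natAbs = n := ⟨_, rfl⟩
  induction n using Nat.strong_induction_on generalizing B with
  | _ n ih =>
  by_cases h1 : n = 1
  · refine symM_unit_periodic ?_ h3 h3' h9
    have := Eis.norm_nonneg B
    omega
  have hN0 : norm B ≠ 0 := fun h => hB (Eis.norm_eq_zero.1 h)
  -- peel off a factor
  have peel : ∀ A C : Eis, B = A * C → 1 < (norm A).natAbs →
      symM m A = symM m' A → symM m B = symM m' B := by
    rintro A C rfl hA hs
    rw [map_mul] at hm hm' hN hN0 hn
    have hmA := hm.of_mul_right_left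
    have hmC := hm.of_mul_right_right
    have hmA' := hm'.of_mul_right_left
    have hmC' := hm'.of_mul_right_right
    have hC : C ≠ 0 := by rintro rfl; simp at hB
    have hCpos : 0 < (norm C).natAbs := Int.natAbs_pos.2 fun h => hC (Eis.norm_eq_zero.1 h)
    rw [symM_mul h3 hmA hmC, symM_mul h3' hmA' hmC', hs]
    congr 1
    refine ih (norm C).natAbs ?_ hC hmC hmC' ((Dvd.intro_left _ rfl).trans hN) rfl
    rw [← hn, Int.natAbs_mul]
    nlinarith
  obtain ⟨p, hp, hd⟩ := Nat.exists_prime_and_dvd h1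
  have hd' : (p : ℤ) ∣ norm B := Int.natCast_dvd.2 (hn ▸ hd)
  have hmp : IsCoprime m p := hm.of_isCoprime_of_dvd_right hd'
  have hmp' : IsCoprime m' p := hm'.of_isCoprime_of_dvd_right hd'
  have hmod : p % 3 = 0 ∨ p % 3 = 1 ∨ p % 3 = 2 := by omega
  rcases hmod with h0 | h0 | h0
  · obtain rfl : p = 3 :=
      ((Nat.prime_dvd_prime_iff_eq Nat.prime_three hp).1 (Nat.dvd_of_mod_eq_zero h0)).symm
    obtain ⟨C, hC⟩ := three_dvd_norm hd'
    refine peel _ C hC (by rw [Eis.norm_th]; decide) ?_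
    rw [symM_th h3, symM_th h3']
  · have : Fact p.Prime := ⟨hp⟩
    obtain ⟨χ, hχ⟩ := exists_cubic_char h0
    have hJ := norm_jacobi hχ
    have hpd : (p : ℤ) ∣ m - m' := hd'.trans hN
    have hχe : χ ((m : ℤ) : ZMod p) = χ ((m' : ℤ) : ZMod p) := by
      have : ((m : ℤ) : ZMod p) = ((m' : ℤ) : ZMod p) := by
        rw [← sub_eq_zero, ← Int.cast_sub]
        exact (ZMod.intCast_zmod_eq_zero_iff_dvd _ _).2 hpd
      rw [this]
    have hsJ : symM m (jacobiSum χ χ) = symM m' (jacobiSum χ χ) := by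
      rw [symM_jacobi hχ m h3 hmp, symM_jacobi hχ m' h3' hmp', hχe]
    rcases dvd_of_norm_dvd hp hJ hd' with ⟨C, hC⟩ | ⟨C, hC⟩
    · exact peel _ C hC (by rw [hJ]; simpa using hp.one_lt) hsJ
    · refine peel _ C hC (by rw [Eis.norm_star', hJ]; simpa using hp.one_lt) ?_
      rw [symM_star h3 (by rwa [hJ]), symM_star h3' (by rwa [hJ]), hsJ]
  · obtain ⟨C, hC⟩ := prime_two_mod hp h0 hd'
    refine peel _ C hC ?_ ?_
    · rw [norm_intCast, Int.natAbs_pow]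
      exact Nat.one_lt_pow two_ne_zero (by simpa using hp.one_lt)
    · rw [symM_int h3 hmp, symM_int h3' hmp']

end CubicPeriodic

section CubicKey

open QuadraticAlgebra

lemma isCoprime_of_prime {a b : ℤ} (ha : a ≠ 0)
    (h : ∀ q : ℤ, Prime q → q ∣ a → ¬ q ∣ b) : IsCoprime a b :=
  isCoprime_of_prime_dvd (fun h0 => ha h0.1) fun q hq h1 h2 => h q hq h1 h2

lemma Eis.norm_lin (u v : ℤ) : norm ((u : Eis) * Eis.th + (v : Eis)) = 3 * u ^ 2 + v ^ 2 := by
  rw [Eis.norm_eq]; simp [Eis.th]; ring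

/-- The cubic symbol of an element attached to a solution of `s ^ 2 - d t ^ 2 = n ^ 3` vanishes
on integers represented by the form `X ^ 2 + 3 d z ^ 2`. -/
theorem symM_eq_one_of_represented {d s t n X z m : ℤ} (hst : s ^ 2 - d * t ^ 2 = n ^ 3)
    (hc : IsCoprime s t) (ht3 : (3 : ℤ) ∣ t) (hXz : IsCoprime X z) (hz9 : (9 : ℤ) ∣ z)
    (hm : m = X ^ 2 + 3 * d * z ^ 2) (hmn : IsCoprime m n) (hm3 : IsCoprime m 3) :
    symM m ((s * z : ℤ) * Eis.th + (t * X : ℤ)) = 1 := by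
  by_cases hz0 : z = 0
  · subst hz0
    have hX : IsUnit X := isCoprime_zero_right.1 hXz
    have : m = 1 := by
      rcases Int.isUnit_iff.1 hX with h | h <;> rw [hm, h] <;> norm_num
    rw [this, symM_one_left]
  have h3p : Prime (3 : ℤ) := Int.prime_three
  have hs3 : ¬ (3 : ℤ) ∣ s := fun h => h3p.not_isUnit (hc.isUnit_of_dvd' h ht3)
  have hs0 : s ≠ 0 := by rintro rfl; simp at hs3
  have hz3 : (3 : ℤ) ∣ z := dvd_trans (by norm_num) hz9
  have hX3 : ¬ (3 : ℤ) ∣ X := fun h => h3p.not_isUnit (hXz.isUnit_of_dvd' h hz3)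
  have hX0 : X ≠ 0 := by rintro rfl; simp at hX3
  have hm0 : m ≠ 0 := ne_zero_of_coprime_three hm3
  have hn3 : ¬ (3 : ℤ) ∣ n := by
    intro h
    apply hs3
    apply h3p.dvd_of_dvd_pow (n := 2)
    have : s ^ 2 = n ^ 3 + d * t ^ 2 := by linear_combination hst
    rw [this]
    exact dvd_add (dvd_pow h (by norm_num)) ((dvd_pow ht3 two_ne_zero).mul_left _)
  have hn0 : n ≠ 0 := by rintro rfl; simp at hn3
  obtain ⟨h, hh⟩ : ∃ h : ℤ, h = Int.gcd s X := ⟨_, rfl⟩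
  have hg1 : h ≠ 0 := by rw [hh]; exact_mod_cast (Int.gcd_pos_of_ne_zero_left X hs0).ne'
  obtain ⟨s1, hs1⟩ : h ∣ s := hh ▸ Int.gcd_dvd_left _ _
  obtain ⟨X1, hX1⟩ : h ∣ X := hh ▸ Int.gcd_dvd_right _ _
  have hc1 : IsCoprime s1 X1 := by
    have hab := Int.gcd_eq_gcd_ab s X
    rw [← hh] at hab
    refine ⟨Int.gcdA s X, Int.gcdB s X, mul_left_cancel₀ hg1 ?_⟩
    linear_combination -hab - Int.gcdA s X * hs1 - Int.gcdB s X * hX1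
  obtain ⟨k, hk⟩ : ∃ k : ℤ, k = Int.gcd t z := ⟨_, rfl⟩
  have hg2 : k ≠ 0 := by rw [hk]; exact_mod_cast (Int.gcd_pos_of_ne_zero_right t hz0).ne'
  obtain ⟨t1, ht1⟩ : k ∣ t := hk ▸ Int.gcd_dvd_left _ _
  obtain ⟨z1, hz1⟩ : k ∣ z := hk ▸ Int.gcd_dvd_right _ _
  have hk3 : (3 : ℤ) ∣ k := hk ▸ Int.dvd_coe_gcd ht3 hz3
  have hc2 : IsCoprime t1 z1 := by
    have hab := Int.gcd_eq_gcd_ab t z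
    rw [← hk] at hab
    refine ⟨Int.gcdA t z, Int.gcdB t z, mul_left_cancel₀ hg2 ?_⟩
    linear_combination -hab - Int.gcdA t z * ht1 - Int.gcdB t z * hz1
  have hs10 : s1 ≠ 0 := by rintro rfl; simp at hs1; exact hs0 hs1
  have hX10 : X1 ≠ 0 := by rintro rfl; simp at hX1; exact hX0 hX1
  have hz10 : z1 ≠ 0 := by rintro rfl; simp at hz1; exact hz0 hz1
  set B : Eis := ((s1 * z1 : ℤ) : Eis) * Eis.th + (t1 * X1 : ℤ) with hB
  have hNB : norm B = 3 * (s1 * z1) ^ 2 + (t1 * X1) ^ 2 := Eis.norm_lin _ _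
  have hB0 : B ≠ 0 := by
    intro h0
    have : norm B = 0 := by rw [h0]; simp
    rw [hNB] at this
    have : (s1 * z1) ^ 2 > 0 := by positivity
    nlinarith [sq_nonneg (t1 * X1)]
  have hA : (((s * z : ℤ) : Eis) * Eis.th + (t * X : ℤ)) = ((h * k : ℤ) : Eis) * B := by
    rw [hB, hs1, hX1, ht1, hz1]; push_cast; ring
  have rel : m * s1 ^ 2 - X1 ^ 2 * n ^ 3 = d * k ^ 2 * norm B := by
    apply mul_left_cancel₀ (pow_ne_zero 2 hg1)
    rw [hNB, hm, ← hst, hs1, hX1, ht1, hz1]; ring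
  -- coprimality facts
  have cop_s1 : IsCoprime s1 (norm B) := isCoprime_of_prime hs10 fun q hq h1 h2 => by
    rw [hNB] at h2
    have h3 : q ∣ (t1 * X1) ^ 2 := by
      have := dvd_sub h2 ((dvd_pow (h1.mul_right z1) two_ne_zero).mul_left 3)
      simpa using this
    rcases hq.dvd_or_dvd (hq.dvd_of_dvd_pow h3) with h4 | h4
    · exact hq.not_isUnit (hc.isUnit_of_dvd' (hs1 ▸ h1.mul_left _) (ht1 ▸ h4.mul_left _))
    · exact hq.not_isUnit (hc1.isUnit_of_dvd' h1 h4)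
  have hX1_3 : ¬ (3 : ℤ) ∣ X1 := fun h => hX3 (hX1 ▸ h.mul_left _)
  have cop_X1 : IsCoprime X1 (norm B) := isCoprime_of_prime hX10 fun q hq h1 h2 => by
    rw [hNB] at h2
    have h3 : q ∣ 3 * (s1 * z1) ^ 2 := by
      have := dvd_sub h2 (dvd_pow (h1.mul_left t1) two_ne_zero)
      simpa using this
    rcases hq.dvd_or_dvd h3 with h4 | h4
    · exact hX1_3 ((hq.associated_of_dvd h3p h4).symm.dvd.trans h1)
    rcases hq.dvd_or_dvd (hq.dvd_of_dvd_pow h4) with h4 | h4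
    · exact hq.not_isUnit (hc1.isUnit_of_dvd' h4 h1)
    · exact hq.not_isUnit (hXz.isUnit_of_dvd' (hX1 ▸ h1.mul_left _) (hz1 ▸ h4.mul_left _))
  have cop_m : IsCoprime m (norm B) := isCoprime_of_prime hm0 fun q hq h1 h2 => by
    have h3 : q ∣ X1 ^ 2 * n ^ 3 := by
      have e : X1 ^ 2 * n ^ 3 = m * s1 ^ 2 - d * k ^ 2 * norm B := by linear_combination -rel
      rw [e]; exact dvd_sub (h1.mul_right _) (h2.mul_left _)
    rcases hq.dvd_or_dvd h3 with h4 | h4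
    · exact hq.not_isUnit (cop_X1.isUnit_of_dvd' (hq.dvd_of_dvd_pow h4) h2)
    · exact hq.not_isUnit (hmn.isUnit_of_dvd' h1 (hq.dvd_of_dvd_pow h4))
  have cop_n : IsCoprime n (norm B) := isCoprime_of_prime hn0 fun q hq h1 h2 => by
    have h3 : q ∣ m * s1 ^ 2 := by
      have e : m * s1 ^ 2 = X1 ^ 2 * n ^ 3 + d * k ^ 2 * norm B := by linear_combination rel
      rw [e]; exact dvd_add ((dvd_pow h1 (by norm_num)).mul_left _) (h2.mul_left _)
    rcases hq.dvd_or_dvd h3 with h4 | h4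
    · exact hq.not_isUnit (hmn.isUnit_of_dvd' h4 h1)
    · exact hq.not_isUnit (cop_s1.isUnit_of_dvd' (hq.dvd_of_dvd_pow h4) h2)
  have c3 : ∀ a : ℤ, ¬ (3 : ℤ) ∣ a → IsCoprime a 3 := fun a ha =>
    ((Prime.coprime_iff_not_dvd h3p).2 ha).symm
  have s1_3 : IsCoprime s1 3 := c3 _ fun h => hs3 (hs1 ▸ h.mul_left _)
  have X1_3 := c3 _ hX1_3
  have n_3 := c3 _ hn3
  have key := symM_periodic hB0 (m := m * s1 ^ 2) (m' := X1 ^ 2 * n ^ 3)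
    (hm3.mul_left (s1_3.pow_left)) ((X1_3.pow_left).mul_left n_3.pow_left)
    (cop_m.mul_left cop_s1.pow_left) (cop_X1.pow_left.mul_left cop_n.pow_left)
    (by
      rw [rel]
      obtain ⟨l, rfl⟩ := hk3
      exact ⟨d * l ^ 2 * norm B, by ring⟩)
    (by rw [rel]; exact Dvd.intro_left _ rfl)
  rw [symM_mul_left hm0 (pow_ne_zero _ hs10), symM_mul_left (pow_ne_zero _ hX10)
    (pow_ne_zero _ hn0), symM_pow_left hs10, symM_pow_left hX10, symM_pow_left hn0,
    symM_cube, mul_one] at key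
  have e1 : symM s1 B = 1 := by
    rw [symM_congr (B := ((t1 * X1 : ℤ) : Eis)) (z1 * Eis.th) (by rw [hB]; push_cast; ring)]
    refine symM_int s1_3 (IsCoprime.mul_right ?_ hc1)
    exact hc.of_isCoprime_of_dvd_left (Dvd.intro_left _ hs1.symm)
      |>.of_isCoprime_of_dvd_right (Dvd.intro_left _ ht1.symm)
  have e2 : symM X1 B = 1 := by
    rw [symM_congr (B := ((s1 * z1 : ℤ) : Eis) * Eis.th) (t1 : Eis) (by rw [hB]; push_cast; ring)]
    have hcs : IsCoprime X1 (s1 * z1) := by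
      refine IsCoprime.mul_right hc1.symm ?_
      exact hXz.of_isCoprime_of_dvd_left (Dvd.intro_left _ hX1.symm)
        |>.of_isCoprime_of_dvd_right (Dvd.intro_left _ hz1.symm)
    rw [symM_mul X1_3 (by rw [norm_intCast]; exact hcs.pow_right) (by rwa [Eis.norm_th]),
      symM_int X1_3 hcs, symM_th X1_3, one_mul]
  rw [e1, e2, one_pow, mul_one] at key
  have cop_hk : IsCoprime m (h * k) := by
    refine isCoprime_of_prime hm0 fun q hq h1 h2 => ?_
    rcases hq.dvd_or_dvd h2 with h4 | h4
    · have hqX : q ∣ X := hX1 ▸ h4.mul_right _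
      have hqs : q ∣ s := hs1 ▸ h4.mul_right _
      have h5 : q ∣ 3 * d * z ^ 2 := by
        have := dvd_sub h1 (dvd_pow hqX two_ne_zero)
        rw [hm] at this; simpa using this
      rcases hq.dvd_or_dvd h5 with h6 | h6
      · rcases hq.dvd_or_dvd h6 with h7 | h7
        · exact hq.not_isUnit (hm3.isUnit_of_dvd' h1 h7)
        · have : q ∣ n ^ 3 := by
            rw [← hst]
            exact dvd_sub (dvd_pow hqs two_ne_zero) (h7.mul_right _)
          exact hq.not_isUnit (hmn.isUnit_of_dvd' h1 (hq.dvd_of_dvd_pow this))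
      · exact hq.not_isUnit (hXz.isUnit_of_dvd' hqX (hq.dvd_of_dvd_pow h6))
    · have hqz : q ∣ z := hz1 ▸ h4.mul_right _
      have h5 : q ∣ X ^ 2 := by
        have := dvd_sub h1 ((dvd_pow hqz two_ne_zero).mul_left (3 * d))
        rw [hm] at this; simpa using this
      exact hq.not_isUnit (hXz.isUnit_of_dvd' (hq.dvd_of_dvd_pow h5) hqz)
  rw [hA, symM_mul hm3 (by rw [norm_intCast]; exact cop_hk.pow_right) cop_m,
    symM_int hm3 cop_hk, key, one_mul]

end CubicKey

section GaussReduction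

lemma exists_min_form {A B C : ℝ} (hA : 0 < A) (hΔ : 0 < 4 * A * C - B ^ 2) :
    ∃ p q r s : ℤ, p * s - q * r = 1 ∧ ∀ p' q' r' s' : ℤ, p' * s' - q' * r' = 1 →
      (A * p ^ 2 + B * p * q + C * q ^ 2) + (A * r ^ 2 + B * r * s + C * s ^ 2) ≤
      (A * p' ^ 2 + B * p' * q' + C * q' ^ 2) + (A * r' ^ 2 + B * r' * s' + C * s' ^ 2) := by
  have hC : 0 < C := by
    by_contra h
    push Not at h
    nlinarith [sq_nonneg B]
  let Q : ℤ → ℤ → ℝ := fun p q => A * p ^ 2 + B * p * q + C * q ^ 2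
  have hQ1 : ∀ p q : ℤ, (4 * A * C - B ^ 2) * p ^ 2 ≤ 4 * C * Q p q := fun p q => by
    simp only [Q]; nlinarith [sq_nonneg (2 * C * q + B * p)]
  have hQ2 : ∀ p q : ℤ, (4 * A * C - B ^ 2) * q ^ 2 ≤ 4 * A * Q p q := fun p q => by
    simp only [Q]; nlinarith [sq_nonneg (2 * A * p + B * q)]
  have hQ0 : ∀ p q : ℤ, 0 ≤ Q p q := fun p q => by
    have := hQ1 p q
    have h2 : 0 ≤ (4 * A * C - B ^ 2) * (p : ℝ) ^ 2 := by positivity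
    by_contra hcon
    push Not at hcon
    nlinarith
  let S : Set (ℤ × ℤ × ℤ × ℤ) := {v | v.1 * v.2.2.2 - v.2.1 * v.2.2.1 = 1 ∧
    Q v.1 v.2.1 + Q v.2.2.1 v.2.2.2 ≤ A + C}
  have hbd : ∃ N : ℕ, ∀ p q : ℤ, Q p q ≤ A + C → |p| ≤ N ∧ |q| ≤ N := by
    obtain ⟨N, hN⟩ := exists_nat_gt (4 * (A + C) * (A + C) / (4 * A * C - B ^ 2) + 1)
    have hN' : 4 * (A + C) * (A + C) < (4 * A * C - B ^ 2) * N := by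
      have h1 : 4 * (A + C) * (A + C) / (4 * A * C - B ^ 2) < N := by linarith
      rw [div_lt_iff₀ hΔ] at h1
      linarith
    have hN1 : (1 : ℝ) ≤ N := by
      have : 0 ≤ 4 * (A + C) * (A + C) / (4 * A * C - B ^ 2) := by positivity
      linarith
    have aux : ∀ x : ℤ, (4 * A * C - B ^ 2) * (x : ℝ) ^ 2 ≤ 4 * (A + C) * (A + C) → |x| ≤ N := by
      intro x hx
      have h1 : (x : ℝ) ^ 2 < N := by
        by_contra h
        push Not at h
        nlinarith
      have h2 : (x : ℝ) ^ 2 ≤ (N : ℝ) ^ 2 := by nlinarith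
      have h3 := abs_le_of_sq_le_sq h2 (by positivity)
      exact_mod_cast h3
    refine ⟨N, fun p q h => ⟨aux p ?_, aux q ?_⟩⟩
    · have := hQ1 p q
      have h0 := hQ0 p q
      nlinarith
    · have := hQ2 p q
      have h0 := hQ0 p q
      nlinarith
  obtain ⟨N, hN⟩ := hbd
  have hfin : S.Finite := by
    have hI := Set.finite_Icc (-(N : ℤ)) N
    refine (hI.prod (hI.prod (hI.prod hI))).subset ?_
    rintro ⟨p, q, r, s⟩ ⟨_, hv⟩
    have h1 := hN p q (by have := hQ0 r s; simp only at hv; linarith)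
    have h2 := hN r s (by have := hQ0 p q; simp only at hv; linarith)
    simp only [abs_le] at h1 h2
    simp [h1.1.1, h1.1.2, h1.2.1, h1.2.2, h2.1.1, h2.1.2, h2.2.1, h2.2.2]
  have hne : S.Nonempty := ⟨(1, 0, 0, 1), by simp [S, Q]⟩
  obtain ⟨⟨p, q, r, s⟩, ⟨hdet, hle⟩, hmin⟩ :=
    hfin.exists_minimalFor (fun v => Q v.1 v.2.1 + Q v.2.2.1 v.2.2.2) S hne
  refine ⟨p, q, r, s, hdet, fun p' q' r' s' hdet' => ?_⟩
  by_contra hcon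
  push Not at hcon
  have hm : (p', q', r', s') ∈ S := ⟨hdet', by simp only [Q] at hle ⊢; linarith⟩
  have := hmin hm (by simp only [Q]; linarith)
  simp only [Q] at this
  linarith

/-- Reduction of positive definite binary quadratic forms. -/
lemma exists_reduced_form {A B C : ℝ} (hA : 0 < A) (hΔ : 0 < 4 * A * C - B ^ 2) :
    ∃ p q r s : ℤ, p * s - q * r = 1 ∧
      |2 * A * p * r + B * (p * s + q * r) + 2 * C * q * s| ≤
        A * p ^ 2 + B * p * q + C * q ^ 2 ∧
      |2 * A * p * r + B * (p * s + q * r) + 2 * C * q * s| ≤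
        A * r ^ 2 + B * r * s + C * s ^ 2 ∧
      (A * p ^ 2 + B * p * q + C * q ^ 2) * (A * r ^ 2 + B * r * s + C * s ^ 2) ≤
        (4 * A * C - B ^ 2) / 3 := by
  obtain ⟨p, q, r, s, hdet, hmin⟩ := exists_min_form hA hΔ
  have h1 := hmin p q (r + p) (s + q) (by linarith)
  have h2 := hmin p q (r - p) (s - q) (by linarith)
  have h3 := hmin (p + r) (q + s) r s (by linarith)
  have h4 := hmin (p - r) (q - s) r s (by linarith)
  push_cast at h1 h2 h3 h4
  have e1 : |2 * A * p * r + B * (p * s + q * r) + 2 * C * q * s| ≤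
        A * p ^ 2 + B * p * q + C * q ^ 2 := abs_le.2 ⟨by nlinarith, by nlinarith⟩
  have e2 : |2 * A * p * r + B * (p * s + q * r) + 2 * C * q * s| ≤
        A * r ^ 2 + B * r * s + C * s ^ 2 := abs_le.2 ⟨by nlinarith, by nlinarith⟩
  refine ⟨p, q, r, s, hdet, e1, e2, ?_⟩
  have hdet' : (p : ℝ) * s - q * r = 1 := by exact_mod_cast hdet
  set A' := A * p ^ 2 + B * p * q + C * (q : ℝ) ^ 2 with hA'
  set C' := A * r ^ 2 + B * r * s + C * (s : ℝ) ^ 2 with hC'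
  set B' := 2 * A * p * r + B * (p * s + q * r) + 2 * C * (q : ℝ) * s with hB'
  have hinv : 4 * A' * C' - B' ^ 2 = 4 * A * C - B ^ 2 := by
    have : 4 * A' * C' - B' ^ 2 = (4 * A * C - B ^ 2) * ((p : ℝ) * s - q * r) ^ 2 := by
      rw [hA', hB', hC']; ring
    rw [this, hdet']; ring
  have h5 : B' ^ 2 ≤ A' * C' := by
    rw [← sq_abs]
    have := abs_nonneg B'
    nlinarith
  linarith

end GaussReduction

section QuadFieldDef

open NumberField

/-- A presentation of a number field as the real quadratic field `ℚ(√d)`. -/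
structure QuadField (d : ℕ) (K : Type) [Field K] [NumberField K] where
  θ : K
  sq : θ ^ 2 = d
  σ : K →ₐ[ℚ] K
  σθ : σ θ = -θ
  φ : K →+* ℝ
  φθ : φ θ = Real.sqrt d
  span : ∀ x : K, ∃ a b : ℚ, x = algebraMap ℚ K a + algebraMap ℚ K b * θ
  sqf : Squarefree d
  one_lt : 1 < d

lemma not_rat_sq {d : ℕ} (hd : Squarefree d) (h1 : 1 < d) (a b : ℚ) (h : a ^ 2 = d * b ^ 2) :
    a = 0 ∧ b = 0 := by
  by_cases hb : b = 0
  · subst hb; simpa using h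
  exfalso
  have h2 : IsSquare ((d : ℕ) : ℚ) := ⟨a / b, by field_simp; linarith⟩
  rw [Rat.isSquare_natCast_iff] at h2
  obtain ⟨r, rfl⟩ := h2
  have := hd r (dvd_refl _)
  rw [Nat.isUnit_iff] at this
  subst this
  omega

end QuadFieldDef

namespace QuadField

open NumberField

variable {d : ℕ} {K : Type} [Field K] [NumberField K] (Q : QuadField d K)

include Q in
lemma rat_pair_zero {a b : ℚ} (h : algebraMap ℚ K a + algebraMap ℚ K b * Q.θ = 0) :
    a = 0 ∧ b = 0 := by
  refine not_rat_sq Q.sqf Q.one_lt a b ?_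
  have h1 : algebraMap ℚ K a = - (algebraMap ℚ K b * Q.θ) := by linear_combination h
  have h2 : algebraMap ℚ K (a ^ 2) = algebraMap ℚ K (d * b ^ 2) := by
    simp only [map_pow, map_mul, map_natCast]
    rw [h1, ← Q.sq]; ring
  exact (algebraMap ℚ K).injective h2

lemma θ_ne : Q.θ ≠ 0 := by
  intro h
  have := Q.sq
  rw [h] at this
  have h1 := Q.one_lt
  have : (d : K) = 0 := by rw [← this]; ring
  rw [Nat.cast_eq_zero] at this
  omega

@[simp] lemma σσ (x : K) : Q.σ (Q.σ x) = x := by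
  obtain ⟨a, b, rfl⟩ := Q.span x
  simp [Q.σθ]

lemma σ_ne {x : K} (hx : x ≠ 0) : Q.σ x ≠ 0 := by
  simpa using hx

lemma eq_rat_of_fixed {x : K} (h : Q.σ x = x) : ∃ r : ℚ, x = algebraMap ℚ K r := by
  obtain ⟨a, b, rfl⟩ := Q.span x
  refine ⟨a, ?_⟩
  simp only [map_add, map_mul, AlgHom.commutes, Q.σθ] at h
  have : algebraMap ℚ K 0 + algebraMap ℚ K (2 * b) * Q.θ = 0 := by
    simp only [map_mul, map_zero, map_ofNat]; linear_combination -h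
  have := (Q.rat_pair_zero this).2
  have hb : b = 0 := by linarith
  simp [hb]

lemma trace_rat (x : K) : ∃ r : ℚ, x + Q.σ x = algebraMap ℚ K r :=
  Q.eq_rat_of_fixed (by simp [add_comm])

lemma norm_rat (x : K) : ∃ r : ℚ, x * Q.σ x = algebraMap ℚ K r :=
  Q.eq_rat_of_fixed (by simp [mul_comm])

/-- The conjugation on the ring of integers. -/
def conj (x : 𝓞 K) : 𝓞 K := ⟨Q.σ x, x.isIntegral_coe.map (Q.σ.restrictScalars ℤ)⟩

@[simp] lemma coe_conj (x : 𝓞 K) : ((Q.conj x : 𝓞 K) : K) = Q.σ x := rfl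

lemma int_of_rat_integral {r : ℚ} (h : IsIntegral ℤ (algebraMap ℚ K r)) : ∃ n : ℤ, r = n := by
  have h1 : IsIntegral ℤ r := (isIntegral_algebraMap_iff (algebraMap ℚ K).injective).1 h
  obtain ⟨n, hn⟩ := IsIntegrallyClosed.isIntegral_iff.1 h1
  exact ⟨n, by simpa using hn.symm⟩

lemma trace_int (x : 𝓞 K) : ∃ n : ℤ, (x : K) + Q.σ x = n := by
  obtain ⟨r, hr⟩ := Q.trace_rat x
  obtain ⟨n, hn⟩ := int_of_rat_integral (K := K) (r := r)
    (by rw [← hr]; exact (x + Q.conj x).isIntegral_coe)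
  exact ⟨n, by rw [hr, hn]; simp⟩

lemma norm_int (x : 𝓞 K) : ∃ n : ℤ, (x : K) * Q.σ x = n := by
  obtain ⟨r, hr⟩ := Q.norm_rat x
  obtain ⟨n, hn⟩ := int_of_rat_integral (K := K) (r := r)
    (by rw [← hr]; exact (x * Q.conj x).isIntegral_coe)
  exact ⟨n, by rw [hr, hn]; simp⟩

/-- The norm of an integer as an integer. -/
noncomputable def nrm (x : 𝓞 K) : ℤ := (Q.norm_int x).choose

lemma nrm_spec (x : 𝓞 K) : (x : K) * Q.σ x = (Q.nrm x : K) := (Q.norm_int x).choose_spec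

lemma nrm_eq {x : 𝓞 K} {n : ℤ} (h : (x : K) * Q.σ x = n) : Q.nrm x = n := by
  have := (Q.nrm_spec x).symm.trans h
  exact_mod_cast this

lemma nrm_mul (x y : 𝓞 K) : Q.nrm (x * y) = Q.nrm x * Q.nrm y := by
  apply Q.nrm_eq
  push_cast
  rw [← Q.nrm_spec, ← Q.nrm_spec, map_mul]; ring

lemma nrm_pow (x : 𝓞 K) (k : ℕ) : Q.nrm (x ^ k) = Q.nrm x ^ k := by
  apply Q.nrm_eq
  push_cast
  rw [← Q.nrm_spec, map_pow]; ring

lemma nrm_ne_zero {x : 𝓞 K} (hx : x ≠ 0) : Q.nrm x ≠ 0 := by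
  intro h
  have := Q.nrm_spec x
  rw [h] at this
  have hx' : (x : K) ≠ 0 := by simpa using hx
  have := mul_ne_zero hx' (Q.σ_ne hx')
  simp_all

/-- `2 x = u + v θ` with `u, v` integers for `x` integral. -/
lemma exists_uv (x : 𝓞 K) : ∃ u v : ℤ, 2 * (x : K) = u + v * Q.θ ∧
    u ^ 2 - d * v ^ 2 = 4 * Q.nrm x := by
  obtain ⟨a, b, hab⟩ := Q.span x
  obtain ⟨t, ht⟩ := Q.trace_int x
  have hn := Q.nrm_spec x
  set n := Q.nrm x
  have hta : (t : ℚ) = 2 * a := by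
    apply (algebraMap ℚ K).injective
    rw [hab] at ht
    simp only [map_add, map_mul, AlgHom.commutes, Q.σθ] at ht
    simp only [map_intCast, map_mul, map_ofNat]
    rw [← ht]; ring
  have hnab : (n : ℚ) = a ^ 2 - d * b ^ 2 := by
    apply (algebraMap ℚ K).injective
    rw [hab] at hn
    simp only [map_add, map_mul, AlgHom.commutes, Q.σθ] at hn
    simp only [map_intCast, map_mul, map_sub, map_pow, map_natCast]
    rw [← hn, ← Q.sq]; ring
  have hb : (d : ℚ) * (2 * b) ^ 2 = ((t ^ 2 - 4 * n : ℤ) : ℚ) := by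
    push_cast; rw [hta, hnab]; ring
  have hbint : ∃ v : ℤ, 2 * b = v := by
    set c := 2 * b
    have hden : ((c.den : ℤ)) ^ 2 ∣ d := by
      have h1 : (d : ℤ) * c.num ^ 2 = (t ^ 2 - 4 * n) * (c.den : ℤ) ^ 2 := by
        have h2 : (c.den : ℚ) ≠ 0 := by exact_mod_cast c.den_nz
        have h3 : c * c.den = c.num := Rat.mul_den_eq_num c
        have : (d : ℚ) * c.num ^ 2 = (t ^ 2 - 4 * n) * (c.den : ℚ) ^ 2 := by
          rw [← h3]; push_cast at hb; rw [← hb]; ring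
        exact_mod_cast this
      have h4 : ((c.den : ℤ)) ^ 2 ∣ (d : ℤ) * c.num ^ 2 := ⟨t ^ 2 - 4 * n, by rw [h1]; ring⟩
      have h5 : IsCoprime ((c.den : ℤ) ^ 2) (c.num ^ 2) := by
        apply IsCoprime.pow
        exact (Int.isCoprime_iff_gcd_eq_one.2 (by
          rw [Int.gcd_comm]; exact c.reduced))
      exact h5.dvd_of_dvd_mul_right h4
    have h6 : c.den * c.den ∣ d := by
      have : ((c.den * c.den : ℕ) : ℤ) ∣ (d : ℤ) := by push_cast; rw [← pow_two]; exact hden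
      exact_mod_cast this
    have h7 := Q.sqf _ h6
    rw [Nat.isUnit_iff] at h7
    exact ⟨c.num, (Rat.den_eq_one_iff c).1 h7 |>.symm⟩
  obtain ⟨v, hv⟩ := hbint
  refine ⟨t, v, ?_, ?_⟩
  · have e1 : (t : K) = algebraMap ℚ K (2 * a) := by rw [← hta]; simp
    have e2 : (v : K) = algebraMap ℚ K (2 * b) := by rw [hv]; simp
    rw [e1, e2, hab]; simp only [map_mul, map_ofNat]; ring
  · have : ((t ^ 2 - d * v ^ 2 : ℤ) : ℚ) = ((4 * n : ℤ) : ℚ) := by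
      push_cast; rw [← hv, hta, hnab]; ring
    exact_mod_cast this

/-- The element `u + v θ` of the ring of integers. -/
noncomputable def el (u v : ℤ) : 𝓞 K :=
  ⟨u + v * Q.θ, by
    have h1 : IsIntegral ℤ Q.θ := by
      refine IsIntegral.of_pow (n := 2) (by norm_num) ?_
      rw [Q.sq]; exact isIntegral_natCast _
    exact (isIntegral_intCast _).add ((isIntegral_intCast _).mul h1)⟩

lemma coe_el (u v : ℤ) : ((Q.el u v : 𝓞 K) : K) = u + v * Q.θ := rfl

lemma nrm_el (u v : ℤ) : Q.nrm (Q.el u v) = u ^ 2 - d * v ^ 2 := by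
  apply Q.nrm_eq
  rw [coe_el]
  simp only [map_add, map_mul, map_intCast, Q.σθ]
  push_cast
  rw [← Q.sq]; ring

include Q in
lemma finrank_eq : Module.finrank ℚ K = 2 := by
  have hli : LinearIndependent ℚ ![(1 : K), Q.θ] := by
    rw [LinearIndependent.pair_iff]
    intro s t h
    apply Q.rat_pair_zero
    simpa [Algebra.smul_def] using h
  have hsp : ⊤ ≤ Submodule.span ℚ (Set.range ![(1 : K), Q.θ]) := by
    intro x _
    obtain ⟨a, b, rfl⟩ := Q.span x
    refine Submodule.add_mem _ ?_ ?_
    · rw [Algebra.algebraMap_eq_smul_one]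
      exact Submodule.smul_mem _ _ (Submodule.subset_span ⟨0, rfl⟩)
    · rw [← Algebra.smul_def]
      exact Submodule.smul_mem _ _ (Submodule.subset_span ⟨1, rfl⟩)
  rw [Module.finrank_eq_card_basis (Module.Basis.mk hli hsp)]
  simp

/-- The alternating form `u σ(v) - σ(u) v`. -/
def alt (u v : K) : K := u * Q.σ v - Q.σ u * v


lemma alt_mul (κ u v : K) : Q.alt (κ * u) (κ * v) = κ * Q.σ κ * Q.alt u v := by
  simp only [alt, map_mul]; ring

lemma alt_comb (u v : K) (p q r s : ℤ) :
    Q.alt (p * u + q * v) (r * u + s * v) = ((p * s - q * r : ℤ) : K) * Q.alt u v := by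
  simp only [alt, map_mul, map_add, map_intCast]; push_cast; ring

lemma alt_basis (b : Module.Basis (Fin 2) ℤ (𝓞 K)) (I : Ideal (𝓞 K))
    (bI : Module.Basis (Fin 2) ℤ I) :
    Q.alt (bI 0 : 𝓞 K) (bI 1 : 𝓞 K) = (Ideal.absNorm I : K) * Q.alt (b 0 : 𝓞 K) (b 1 : 𝓞 K) ∨
    Q.alt (bI 0 : 𝓞 K) (bI 1 : 𝓞 K) =
      - ((Ideal.absNorm I : K) * Q.alt (b 0 : 𝓞 K) (b 1 : 𝓞 K)) := by
  have h := Ideal.natAbs_det_basis_change b I bI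
  have hs : ∀ x : 𝓞 K, (x : K) = (b.repr x 0 : K) * (b 0 : 𝓞 K) + (b.repr x 1 : K) * (b 1 : 𝓞 K) := by
    intro x
    conv_lhs => rw [← b.sum_repr x]
    simp [Fin.sum_univ_two]
  rw [Module.Basis.det_apply, Matrix.det_fin_two] at h
  simp only [Module.Basis.toMatrix_apply, Function.comp] at h
  rw [hs (bI 0), hs (bI 1), alt_comb, ← h]
  rw [mul_comm (b.repr (bI 1 : 𝓞 K) 0)] at h
  rcases Int.natAbs_eq ((b.repr (bI 0 : 𝓞 K)) 0 * (b.repr (bI 1 : 𝓞 K)) 1 -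
    (b.repr (bI 1 : 𝓞 K)) 0 * (b.repr (bI 0 : 𝓞 K)) 1) with h1 | h1
  · left
    congr 1
    have := congrArg (fun z : ℤ => (z : K)) h1
    simp only [Int.cast_natCast] at this
    rw [← this]; congr 1; ring
  · right
    rw [← neg_mul]
    congr 1
    have := congrArg (fun z : ℤ => (z : K)) h1
    simp only [Int.cast_neg, Int.cast_natCast] at this
    rw [← this]; congr 1; ring

include Q in
lemma exists_basis : ∃ _ : Module.Basis (Fin 2) ℤ (𝓞 K), True := by
  have h : Module.finrank ℤ (𝓞 K) = 2 := by rw [RingOfIntegers.rank, Q.finrank_eq]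
  exact ⟨(Module.finBasisOfFinrankEq ℤ (𝓞 K) h), trivial⟩

lemma alt_one_θ : Q.alt 1 Q.θ = -2 * Q.θ := by
  simp [alt, Q.σθ]; ring

lemma alt_int_basis_ne (b : Module.Basis (Fin 2) ℤ (𝓞 K)) :
    ∃ n : ℤ, Q.alt 1 Q.θ = n * Q.alt (b 0 : 𝓞 K) (b 1 : 𝓞 K) := by
  have hs : ∀ x : 𝓞 K, (x : K) = (b.repr x 0 : K) * (b 0 : 𝓞 K) + (b.repr x 1 : K) * (b 1 : 𝓞 K) := by
    intro x
    conv_lhs => rw [← b.sum_repr x]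
    simp [Fin.sum_univ_two]
  have h1 := hs (Q.el 1 0)
  have h2 := hs (Q.el 0 1)
  simp only [coe_el, Int.cast_one, Int.cast_zero, zero_mul, add_zero, one_mul, zero_add] at h1 h2
  rw [h1, h2, alt_comb]
  exact ⟨_, rfl⟩

lemma absNorm_span (x : 𝓞 K) (hx : x ≠ 0) : Ideal.absNorm (Ideal.span {x}) = (Q.nrm x).natAbs := by
  obtain ⟨b, -⟩ := Q.exists_basis
  have h := Q.alt_basis b _ (Ideal.basisSpanSingleton b hx)
  simp only [Ideal.basisSpanSingleton_apply, map_mul] at h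
  rw [alt_mul, nrm_spec] at h
  obtain ⟨n, hn⟩ := Q.alt_int_basis_ne b
  have hne : Q.alt (b 0 : 𝓞 K) (b 1 : 𝓞 K) ≠ 0 := by
    intro h0
    rw [h0, mul_zero, alt_one_θ] at hn
    have := Q.θ_ne
    simp_all
  rw [← neg_mul] at h
  rcases h with h | h
  · have := mul_right_cancel₀ hne h
    have : Q.nrm x = (Ideal.absNorm (Ideal.span {x}) : ℤ) := by exact_mod_cast this
    omega
  · have := mul_right_cancel₀ hne h
    have : Q.nrm x = -(Ideal.absNorm (Ideal.span {x}) : ℤ) := by exact_mod_cast this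
    omega

lemma exists_alt_basis (I : Ideal (𝓞 K)) (hI : I ≠ ⊥) : ∃ f₁ f₂ : 𝓞 K, f₁ ∈ I ∧ f₂ ∈ I ∧
    (∀ x ∈ I, ∃ a b : ℤ, x = a * f₁ + b * f₂) ∧ Q.alt f₁ f₂ ≠ 0 ∧
    (Q.φ (Q.alt f₁ f₂)) ^ 2 ≤ 4 * d * (Ideal.absNorm I : ℝ) ^ 2 := by
  obtain ⟨b, -⟩ := Q.exists_basis
  let bI := I.selfBasis b hI
  obtain ⟨n, hn⟩ := Q.alt_int_basis_ne b
  set e := Q.alt (b 0 : 𝓞 K) (b 1 : 𝓞 K) with he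
  have hn0 : n ≠ 0 := by
    rintro rfl
    have := Q.θ_ne
    rw [alt_one_θ] at hn
    simp_all
  have hne : e ≠ 0 := by
    intro h0
    rw [h0, mul_zero, alt_one_θ] at hn
    have := Q.θ_ne
    simp_all
  have hN : (Ideal.absNorm I : K) ≠ 0 := by
    rw [Nat.cast_ne_zero]
    exact fun h => hI (Ideal.absNorm_eq_zero_iff.1 h)
  have hsq : (Q.alt (bI 0 : 𝓞 K) (bI 1 : 𝓞 K)) ^ 2 = ((Ideal.absNorm I : K) * e) ^ 2 := by
    rcases Q.alt_basis b I bI with h | h <;> rw [h]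
    ring
  refine ⟨bI 0, bI 1, (bI 0).2, (bI 1).2, fun x hx => ?_, ?_, ?_⟩
  · refine ⟨bI.repr ⟨x, hx⟩ 0, bI.repr ⟨x, hx⟩ 1, ?_⟩
    have := congrArg (fun y : I => (y : 𝓞 K)) (bI.sum_repr ⟨x, hx⟩)
    simp only [Fin.sum_univ_two] at this
    refine this.symm.trans ?_
    simp
  · intro h0
    rw [h0] at hsq
    have : ((Ideal.absNorm I : K) * e) ^ 2 ≠ 0 := pow_ne_zero _ (mul_ne_zero hN hne)
    exact this (by rw [← hsq]; ring)
  · rw [← map_pow, hsq, map_pow, map_mul, map_natCast]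
    have h1 : (Q.φ e) ^ 2 * n ^ 2 = 4 * d := by
      have := congrArg (fun z => (Q.φ z) ^ 2) hn
      simp only [alt_one_θ, map_mul, map_intCast, map_neg, map_ofNat, Q.φθ] at this
      rw [mul_pow, Real.sq_sqrt (by positivity)] at this
      rw [mul_comm, ← mul_pow, ← this]; norm_num
    have h2 : (1 : ℝ) ≤ n ^ 2 := by
      have : 1 ≤ n ^ 2 := by have := sq_nonneg n; have := pow_ne_zero 2 hn0; omega
      exact_mod_cast this
    have h3 : (Q.φ e) ^ 2 ≤ 4 * d := by nlinarith [sq_nonneg (Q.φ e)]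
    rw [mul_pow, mul_comm]
    gcongr

/-- The weighted quadratic form attached to the two real embeddings. -/
noncomputable def qf (w₁ w₂ : ℝ) (x : K) : ℝ := w₁ * Q.φ x ^ 2 + w₂ * Q.φ (Q.σ x) ^ 2

lemma qf_comb (w₁ w₂ : ℝ) (x y : K) (p q : ℤ) : Q.qf w₁ w₂ (p * x + q * y) =
    Q.qf w₁ w₂ x * p ^ 2 + 2 * (w₁ * Q.φ x * Q.φ y + w₂ * Q.φ (Q.σ x) * Q.φ (Q.σ y)) * p * q +
    Q.qf w₁ w₂ y * q ^ 2 := by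
  simp only [qf, map_add, map_mul, map_intCast]; ring

/-- Reduced oriented bases of ideals. -/
theorem exists_reduced_basis (I : Ideal (𝓞 K)) (hI : I ≠ ⊥) {w₁ w₂ : ℝ} (hw₁ : 0 < w₁)
    (hw₂ : 0 < w₂) : ∃ f₁ f₂ : 𝓞 K, f₁ ∈ I ∧ f₂ ∈ I ∧
    (∀ x ∈ I, ∃ a b : ℤ, x = a * f₁ + b * f₂) ∧ 0 < Q.φ (Q.alt f₁ f₂) ∧
    (Q.φ (Q.alt f₁ f₂)) ^ 2 ≤ 4 * d * (Ideal.absNorm I : ℝ) ^ 2 ∧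
    Q.qf w₁ w₂ f₁ ≤ Q.qf w₁ w₂ f₂ ∧
    Q.qf w₁ w₂ f₁ * Q.qf w₁ w₂ f₂ ≤ 16 / 3 * w₁ * w₂ * d * (Ideal.absNorm I : ℝ) ^ 2 := by
  obtain ⟨g₁, g₂, hg₁, hg₂, hspan, halt, hsq⟩ := Q.exists_alt_basis I hI
  have halt' : Q.φ (Q.alt g₁ g₂) ≠ 0 := by simpa using halt
  have hdisc : 4 * Q.qf w₁ w₂ g₁ * Q.qf w₁ w₂ g₂ -
      (2 * (w₁ * Q.φ g₁ * Q.φ g₂ + w₂ * Q.φ (Q.σ g₁) * Q.φ (Q.σ g₂))) ^ 2 =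
      4 * w₁ * w₂ * (Q.φ (Q.alt g₁ g₂)) ^ 2 := by
    simp only [qf, alt, map_sub, map_mul]; ring
  have hg0 : (g₁ : K) ≠ 0 := by
    intro h; apply halt; simp [alt, h]
  have hA : 0 < Q.qf w₁ w₂ g₁ := by
    have : Q.φ g₁ ≠ 0 := by simpa using hg0
    have : 0 < Q.φ g₁ ^ 2 := by positivity
    simp only [qf]; positivity
  obtain ⟨p, q, r, s, hdet, -, -, hprod⟩ := exists_reduced_form hA
    (by rw [hdisc]; positivity)
  rw [← qf_comb, ← qf_comb, hdisc] at hprod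
  have hprod' : Q.qf w₁ w₂ (p * g₁ + q * g₂) * Q.qf w₁ w₂ (r * g₁ + s * g₂) ≤
      16 / 3 * w₁ * w₂ * d * (Ideal.absNorm I : ℝ) ^ 2 := by
    refine hprod.trans ?_
    have : w₁ * w₂ * (Q.φ (Q.alt g₁ g₂)) ^ 2 ≤ w₁ * w₂ * (4 * d * (Ideal.absNorm I : ℝ) ^ 2) := by
      gcongr
    linarith
  have key : ∀ h₁ h₂ : 𝓞 K, h₁ ∈ I → h₂ ∈ I → (∀ x ∈ I, ∃ a b : ℤ, x = a * h₁ + b * h₂) →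
      (Q.φ (Q.alt h₁ h₂)) ^ 2 = (Q.φ (Q.alt g₁ g₂)) ^ 2 → Q.qf w₁ w₂ h₁ ≤ Q.qf w₁ w₂ h₂ →
      Q.qf w₁ w₂ h₁ * Q.qf w₁ w₂ h₂ ≤ 16 / 3 * w₁ * w₂ * d * (Ideal.absNorm I : ℝ) ^ 2 →
      ∃ f₁ f₂ : 𝓞 K, f₁ ∈ I ∧ f₂ ∈ I ∧
    (∀ x ∈ I, ∃ a b : ℤ, x = a * f₁ + b * f₂) ∧ 0 < Q.φ (Q.alt f₁ f₂) ∧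
    (Q.φ (Q.alt f₁ f₂)) ^ 2 ≤ 4 * d * (Ideal.absNorm I : ℝ) ^ 2 ∧
    Q.qf w₁ w₂ f₁ ≤ Q.qf w₁ w₂ f₂ ∧
    Q.qf w₁ w₂ f₁ * Q.qf w₁ w₂ f₂ ≤ 16 / 3 * w₁ * w₂ * d * (Ideal.absNorm I : ℝ) ^ 2 := by
    intro h₁ h₂ m₁ m₂ hsp hal hle hpr
    rcases lt_trichotomy (Q.φ (Q.alt h₁ h₂)) 0 with h | h | h
    · have hneg : Q.alt h₁ ((-h₂ : 𝓞 K) : K) = - Q.alt h₁ h₂ := by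
        simp only [alt, map_neg]; ring
      have hqn : Q.qf w₁ w₂ ((-h₂ : 𝓞 K) : K) = Q.qf w₁ w₂ h₂ := by
        simp only [qf, map_neg]; ring
      refine ⟨h₁, -h₂, m₁, I.neg_mem m₂, fun x hx => ?_, ?_, ?_, ?_, ?_⟩
      · obtain ⟨a, b, rfl⟩ := hsp x hx
        exact ⟨a, -b, by push_cast; ring⟩
      · rw [hneg, map_neg]; linarith
      · rw [hneg, map_neg, neg_sq, hal]; exact hsq
      · rw [hqn]; exact hle
      · rw [hqn]; exact hpr
    · rw [h] at hal
      have := pow_ne_zero 2 halt'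
      exact absurd hal.symm (by simpa using this)
    · exact ⟨h₁, h₂, m₁, m₂, hsp, h, hal ▸ hsq, hle, hpr⟩
  have hm₁ : (p * g₁ + q * g₂ : 𝓞 K) ∈ I := I.add_mem (I.mul_mem_left _ hg₁) (I.mul_mem_left _ hg₂)
  have hm₂ : (r * g₁ + s * g₂ : 𝓞 K) ∈ I := I.add_mem (I.mul_mem_left _ hg₁) (I.mul_mem_left _ hg₂)
  have hdetK : (p : 𝓞 K) * s - q * r = 1 := by exact_mod_cast congrArg (Int.cast : ℤ → 𝓞 K) hdet
  have hsp : ∀ x ∈ I, ∃ a b : ℤ, x = a * (p * g₁ + q * g₂ : 𝓞 K) + b * (r * g₁ + s * g₂ : 𝓞 K) := by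
    intro x hx
    obtain ⟨a, b, rfl⟩ := hspan x hx
    refine ⟨a * s - b * r, b * p - a * q, ?_⟩
    push_cast
    linear_combination (-a * g₁ - b * g₂) * hdetK
  have c₁ : ((p * g₁ + q * g₂ : 𝓞 K) : K) = p * (g₁ : K) + q * g₂ := by
    simp only [map_add, map_mul, map_intCast]
  have c₂ : ((r * g₁ + s * g₂ : 𝓞 K) : K) = r * (g₁ : K) + s * g₂ := by
    simp only [map_add, map_mul, map_intCast]
  have hal : (Q.φ (Q.alt ((p * g₁ + q * g₂ : 𝓞 K) : K) ((r * g₁ + s * g₂ : 𝓞 K) : K))) ^ 2 =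
      (Q.φ (Q.alt g₁ g₂)) ^ 2 := by
    rw [c₁, c₂, alt_comb, hdet]; simp
  rw [← c₁, ← c₂] at hprod'
  rcases le_total (Q.qf w₁ w₂ ((p * g₁ + q * g₂ : 𝓞 K) : K))
    (Q.qf w₁ w₂ ((r * g₁ + s * g₂ : 𝓞 K) : K)) with h | h
  · exact key _ _ hm₁ hm₂ hsp hal h hprod'
  · refine key _ _ hm₂ hm₁ (fun x hx => ?_) ?_ h (by rw [mul_comm]; exact hprod')
    · obtain ⟨a, b, h⟩ := hsp x hx
      exact ⟨b, a, by rw [h]; ring⟩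
    · rw [← hal]
      simp only [alt, map_sub, map_mul]; ring

end QuadField

section KposField

lemma sqrt_integral (d : ℕ) : IsIntegral ℚ (Real.sqrt d) := by
  refine IsIntegral.of_pow (n := 2) (by norm_num) ?_
  rw [Real.sq_sqrt (by positivity)]
  exact isIntegral_natCast _

instance (d : ℕ) : FiniteDimensional ℚ (Kpos d) :=
  IntermediateField.adjoin.finiteDimensional (sqrt_integral d)

instance (d : ℕ) : NumberField (Kpos d) where

lemma mem_Kpos {d : ℕ} {x : ℝ} (hx : x ∈ Kpos d) : ∃ a b : ℚ, x = a + b * Real.sqrt d := by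
  have h1 : x ∈ Algebra.adjoin ℚ {Real.sqrt d} := by
    rw [← IntermediateField.adjoin_simple_toSubalgebra_of_isAlgebraic (sqrt_integral d).isAlgebraic]
    exact hx
  clear hx
  induction h1 using Algebra.adjoin_induction with
  | mem x h => exact ⟨0, 1, by simpa using h⟩
  | algebraMap r => exact ⟨r, 0, by simp⟩
  | add x y _ _ h1 h2 =>
    obtain ⟨a, b, h⟩ := h1
    obtain ⟨a', b', h'⟩ := h2
    exact ⟨a + a', b + b', by rw [h, h']; push_cast; ring⟩
  | mul x y _ _ h1 h2 =>
    obtain ⟨a, b, h⟩ := h1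
    obtain ⟨a', b', h'⟩ := h2
    have hs := Real.sq_sqrt (Nat.cast_nonneg (α := ℝ) d)
    exact ⟨a * a' + d * b * b', a * b' + a' * b, by rw [h, h']; push_cast; linear_combination b * b' * hs⟩

/-- The square root generator of `Kpos d`. -/
noncomputable def Kpos.rt (d : ℕ) : Kpos d :=
  ⟨Real.sqrt d, IntermediateField.mem_adjoin_simple_self ℚ _⟩

lemma Kpos.rt_sq (d : ℕ) : Kpos.rt d ^ 2 = (d : Kpos d) := by
  apply Subtype.ext
  simp [Kpos.rt]

lemma Kpos.span {d : ℕ} (x : Kpos d) : ∃ a b : ℚ,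
    x = algebraMap ℚ (Kpos d) a + algebraMap ℚ (Kpos d) b * Kpos.rt d := by
  obtain ⟨a, b, h⟩ := mem_Kpos x.2
  exact ⟨a, b, Subtype.ext (by rw [h]; simp [Kpos.rt])⟩

/-- The map from the formal quadratic algebra sending the generator to `c`. -/
noncomputable def Kpos.ofQuad (d : ℕ) (c : Kpos d) (hc : c ^ 2 = d) :
    QuadraticAlgebra ℚ (d : ℚ) 0 →ₐ[ℚ] Kpos d :=
  QuadraticAlgebra.lift ⟨c, by
    rw [← pow_two, hc, zero_smul, add_zero, Algebra.smul_def, mul_one, map_natCast]⟩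

lemma Kpos.ofQuad_apply (d : ℕ) (c : Kpos d) (hc : c ^ 2 = d) (a b : ℚ) :
    Kpos.ofQuad d c hc ⟨a, b⟩ = algebraMap ℚ (Kpos d) a + algebraMap ℚ (Kpos d) b * c := by
  simp [Kpos.ofQuad, QuadraticAlgebra.lift, Algebra.smul_def]

lemma Kpos.bijective {d : ℕ} (hd : Squarefree d) (h1 : 1 < d) :
    Function.Bijective (Kpos.ofQuad d (Kpos.rt d) (Kpos.rt_sq d)) := by
  constructor
  · rw [injective_iff_map_eq_zero]
    rintro ⟨a, b⟩ h
    rw [Kpos.ofQuad_apply] at h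
    have h2 : algebraMap ℚ (Kpos d) (a ^ 2) = algebraMap ℚ (Kpos d) (d * b ^ 2) := by
      have h3 : algebraMap ℚ (Kpos d) a = - (algebraMap ℚ (Kpos d) b * Kpos.rt d) := by
        linear_combination h
      rw [map_pow, h3, map_mul, map_pow, map_natCast, ← Kpos.rt_sq]; ring
    obtain ⟨rfl, rfl⟩ := not_rat_sq hd h1 a b ((algebraMap ℚ (Kpos d)).injective h2)
    rfl
  · intro x
    obtain ⟨a, b, rfl⟩ := Kpos.span x
    exact ⟨⟨a, b⟩, Kpos.ofQuad_apply _ _ _ _ _⟩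

/-- `Kpos d` is a presentation of `ℚ(√d)`. -/
noncomputable def Kpos.quadField {d : ℕ} (hd : Squarefree d) (h1 : 1 < d) :
    QuadField d (Kpos d) where
  θ := Kpos.rt d
  sq := Kpos.rt_sq d
  σ := (Kpos.ofQuad d (-Kpos.rt d) (by rw [neg_sq, Kpos.rt_sq])).comp
    (AlgEquiv.ofBijective _ (Kpos.bijective hd h1)).symm.toAlgHom
  σθ := by
    have : (AlgEquiv.ofBijective _ (Kpos.bijective hd h1)).symm (Kpos.rt d) = ⟨0, 1⟩ := by
      rw [AlgEquiv.symm_apply_eq]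
      simp [Kpos.ofQuad_apply]
    simp [this, Kpos.ofQuad_apply]
  φ := algebraMap (Kpos d) ℝ
  φθ := rfl
  span := Kpos.span
  sqf := hd
  one_lt := h1

end KposField

namespace QuadField

open NumberField
open scoped nonZeroDivisors

variable {d : ℕ} {K : Type} [Field K] [NumberField K] (Q : QuadField d K)

lemma exists_generator_cube {I : (Ideal (𝓞 K))⁰} (hc : ClassGroup.mk0 I ^ 3 = 1) :
    ∃ δ : 𝓞 K, δ ≠ 0 ∧ (I : Ideal (𝓞 K)) ^ 3 = Ideal.span {δ} := by
  have h0 : (I : Ideal (𝓞 K)) ^ 3 ≠ 0 := pow_ne_zero 3 (nonZeroDivisors.coe_ne_zero I)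
  have hm : (I : Ideal (𝓞 K)) ^ 3 ∈ (Ideal (𝓞 K))⁰ := mem_nonZeroDivisors_of_ne_zero h0
  have hI : I ^ 3 = ⟨(I : Ideal (𝓞 K)) ^ 3, hm⟩ := Subtype.ext (SubmonoidClass.coe_pow I 3)
  have h1 : ClassGroup.mk0 (⟨(I : Ideal (𝓞 K)) ^ 3, hm⟩ : (Ideal (𝓞 K))⁰) = 1 := by
    rw [← hI, ← hc]
    exact map_pow ClassGroup.mk0 I 3
  have h := (ClassGroup.mk0_eq_one_iff hm).1 h1
  obtain ⟨δ, hδ⟩ := h.principal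
  have hδ' : (I : Ideal (𝓞 K)) ^ 3 = Ideal.span {δ} := by
    rw [Ideal.submodule_span_eq] at hδ
    exact hδ
  refine ⟨δ, ?_, hδ'⟩
  rintro rfl
  rw [hδ'] at h0
  simp at h0

lemma exists_torsion_ideal (c : ClassGroup (𝓞 K)) (hc : c ^ 3 = 1) :
    ∃ (I : (Ideal (𝓞 K))⁰) (δ : 𝓞 K), δ ≠ 0 ∧ ClassGroup.mk0 I = c ∧
      (I : Ideal (𝓞 K)) ^ 3 = Ideal.span {δ} := by
  obtain ⟨I, rfl⟩ := ClassGroup.mk0_surjective c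
  obtain ⟨δ, hδ, h⟩ := exists_generator_cube hc
  exact ⟨I, δ, hδ, rfl, h⟩

lemma natAbs_nrm_cube {I : Ideal (𝓞 K)} {δ : 𝓞 K} (hδ : δ ≠ 0) (h : I ^ 3 = Ideal.span {δ}) :
    (Q.nrm δ).natAbs = Ideal.absNorm I ^ 3 := by
  rw [← Q.absNorm_span δ hδ, ← h, map_pow]

lemma mk0_eq_one_of_cube {I : (Ideal (𝓞 K))⁰} {η : 𝓞 K}
    (h : (I : Ideal (𝓞 K)) ^ 3 = Ideal.span {η ^ 3}) : ClassGroup.mk0 I = 1 := by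
  rw [← Ideal.span_singleton_pow] at h
  have h1 : (I : Ideal (𝓞 K)) = Ideal.span {η} := by
    apply dvd_antisymm' 
    · exact (UniqueFactorizationMonoid.pow_dvd_pow_iff_dvd (by norm_num : (3 : ℕ) ≠ 0)).1 h.symm.dvd
    · exact (UniqueFactorizationMonoid.pow_dvd_pow_iff_dvd (by norm_num : (3 : ℕ) ≠ 0)).1 h.dvd
  refine (ClassGroup.mk0_eq_one_iff I.2).2 ⟨η, h1⟩

omit [NumberField K] in
lemma span_mul_eq_of_ratio {I J : (Ideal (𝓞 K))⁰} {f₁ f₂ g₁ g₂ : 𝓞 K}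
    (hI : ∀ x ∈ (I : Ideal (𝓞 K)), ∃ a b : ℤ, x = a * f₁ + b * f₂)
    (hJ : ∀ x ∈ (J : Ideal (𝓞 K)), ∃ a b : ℤ, x = a * g₁ + b * g₂)
    (h1 : f₁ ∈ (I : Ideal (𝓞 K))) (h2 : f₂ ∈ (I : Ideal (𝓞 K)))
    (h1' : g₁ ∈ (J : Ideal (𝓞 K))) (h2' : g₂ ∈ (J : Ideal (𝓞 K)))
    (h : f₁ * g₂ = g₁ * f₂) : Ideal.span {g₁} * (I : Ideal (𝓞 K)) =
      Ideal.span {f₁} * (J : Ideal (𝓞 K)) := by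
  ext x
  simp only [Ideal.mem_span_singleton_mul]
  constructor
  · rintro ⟨z, hz, rfl⟩
    obtain ⟨a, b, rfl⟩ := hI z hz
    refine ⟨a * g₁ + b * g₂, Ideal.add_mem _ (Ideal.mul_mem_left _ _ h1')
      (Ideal.mul_mem_left _ _ h2'), by linear_combination b * h⟩
  · rintro ⟨z, hz, rfl⟩
    obtain ⟨a, b, rfl⟩ := hJ z hz
    refine ⟨a * f₁ + b * f₂, Ideal.add_mem _ (Ideal.mul_mem_left _ _ h1)
      (Ideal.mul_mem_left _ _ h2), by linear_combination -b * h⟩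

/-- Reduced bases of ideals with oriented ratio. -/
theorem exists_reduced_basis' (I : Ideal (𝓞 K)) (hI : I ≠ ⊥) {w₁ w₂ : ℝ} (hw₁ : 0 < w₁)
    (hw₂ : 0 < w₂) : ∃ f₁ f₂ : 𝓞 K, f₁ ≠ 0 ∧ f₁ ∈ I ∧ f₂ ∈ I ∧
    (∀ x ∈ I, ∃ a b : ℤ, x = a * f₁ + b * f₂) ∧ Q.φ (Q.σ (f₂ / f₁)) < Q.φ (f₂ / f₁) ∧
    (Q.φ (Q.alt f₁ f₂)) ^ 2 ≤ 4 * d * (Ideal.absNorm I : ℝ) ^ 2 ∧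
    Q.qf w₁ w₂ f₁ ≤ Q.qf w₁ w₂ f₂ ∧
    Q.qf w₁ w₂ f₁ * Q.qf w₁ w₂ f₂ ≤ 16 / 3 * w₁ * w₂ * d * (Ideal.absNorm I : ℝ) ^ 2 := by
  obtain ⟨f₁, f₂, m₁, m₂, hsp, halt, hal, hle, hpr⟩ := Q.exists_reduced_basis I hI hw₁ hw₂
  have hf : (f₁ : K) ≠ 0 := by
    intro h
    simp [alt, h] at halt
  have hf' : f₁ ≠ 0 := by rintro rfl; simp at hf
  have hne : Q.φ (Q.σ (f₂ / f₁)) ≠ Q.φ (f₂ / f₁) := by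
    intro h
    have h1 := Q.φ.injective h
    rw [map_div₀, div_eq_div_iff (Q.σ_ne hf) hf] at h1
    have : Q.alt f₁ f₂ = 0 := by simp only [alt]; linear_combination h1
    rw [this] at halt; simp at halt
  rcases lt_or_gt_of_ne hne with h | h
  · exact ⟨f₁, f₂, hf', m₁, m₂, hsp, h, hal, hle, hpr⟩
  · have hneg : Q.alt f₁ ((-f₂ : 𝓞 K) : K) = - Q.alt f₁ f₂ := by
      simp only [alt, map_neg]; ring
    have hqn : Q.qf w₁ w₂ ((-f₂ : 𝓞 K) : K) = Q.qf w₁ w₂ f₂ := by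
      simp only [qf, map_neg]; ring
    refine ⟨f₁, -f₂, hf', m₁, I.neg_mem m₂, fun x hx => ?_, ?_, ?_, ?_, ?_⟩
    · obtain ⟨a, b, rfl⟩ := hsp x hx
      exact ⟨a, -b, by push_cast; ring⟩
    · simp only [map_neg, neg_div]; linarith
    · rw [hneg, map_neg, neg_sq]; exact hal
    · rw [hqn]; exact hle
    · rw [hqn]; exact hpr

lemma exists_vco (x : 𝓞 K) : ∃ v : ℤ, (x : K) - Q.σ x = v * Q.θ := by
  obtain ⟨u, v, h, -⟩ := Q.exists_uv x
  refine ⟨v, ?_⟩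
  have h' := congrArg Q.σ h
  simp only [map_mul, map_add, map_ofNat, map_intCast, Q.σθ] at h'
  have : (2 : K) * (x - Q.σ x) = 2 * (v * Q.θ) := by linear_combination h - h'
  exact mul_left_cancel₀ two_ne_zero this

/-- The coefficient of `θ / 2`. -/
noncomputable def vco (x : 𝓞 K) : ℤ := (Q.exists_vco x).choose

lemma vco_spec (x : 𝓞 K) : (x : K) - Q.σ x = Q.vco x * Q.θ := (Q.exists_vco x).choose_spec

lemma vco_real (x : 𝓞 K) : Q.φ x - Q.φ (Q.σ x) = Q.vco x * Real.sqrt d := by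
  rw [← map_sub, vco_spec, map_mul, Q.φθ, map_intCast]

lemma absNorm_real (x : 𝓞 K) (hx : x ≠ 0) :
    (Ideal.absNorm (Ideal.span {x}) : ℝ) = |Q.φ x| * |Q.φ (Q.σ x)| := by
  rw [← abs_mul, ← map_mul, nrm_spec, map_intCast, absNorm_span _ _ hx, Nat.cast_natAbs, Int.cast_abs]

end QuadField

section Chebyshev

open Finset Real Chebyshev
open ArithmeticFunction hiding log

/-- The nontrivial character modulo `3`. -/
def chi3 (n : ℕ) : ℤ := if n % 3 = 1 then 1 else if n % 3 = 2 then -1 else 0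

lemma chi3_mul (m n : ℕ) : chi3 (m * n) = chi3 m * chi3 n := by
  have hm : m % 3 < 3 := Nat.mod_lt _ (by norm_num)
  have hn : n % 3 < 3 := Nat.mod_lt _ (by norm_num)
  unfold chi3
  rw [Nat.mul_mod]
  generalize m % 3 = a at *
  generalize n % 3 = b at *
  interval_cases a <;> interval_cases b <;> rfl

lemma sum_chi3 (n : ℕ) : ∑ i ∈ Icc 1 n, chi3 i = if n % 3 = 1 then 1 else 0 := by
  induction n with
  | zero => rfl
  | succ n ih =>
    rw [Finset.sum_Icc_succ_top (by omega), ih]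
    have : n % 3 = 0 ∨ n % 3 = 1 ∨ n % 3 = 2 := by omega
    unfold chi3
    rcases this with h | h | h <;> simp [Nat.add_mod, h]

lemma sum_chi3_mul_log_aux (j : ℕ) :
    ∑ i ∈ Icc 1 (3 * j + 1), (chi3 i : ℝ) * log i ≤ log (3 * j + 1 : ℕ) := by
  induction j with
  | zero => simp
  | succ j ih =>
    have e : 3 * (j + 1) + 1 = 3 * j + 1 + 1 + 1 + 1 := by ring
    rw [e, Finset.sum_Icc_succ_top (by omega), Finset.sum_Icc_succ_top (by omega),
      Finset.sum_Icc_succ_top (by omega)]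
    have h1 : chi3 (3 * j + 1 + 1) = -1 := by unfold chi3; simp [show (3 * j + 1 + 1) % 3 = 2 by omega]
    have h2 : chi3 (3 * j + 1 + 1 + 1) = 0 := by
      unfold chi3; simp [show (3 * j + 1 + 1 + 1) % 3 = 0 by omega]
    have h3 : chi3 (3 * j + 1 + 1 + 1 + 1) = 1 := by
      unfold chi3; simp [show (3 * j + 1 + 1 + 1 + 1) % 3 = 1 by omega]
    rw [h1, h2, h3]
    have h4 : log (3 * j + 1 : ℕ) ≤ log (3 * j + 1 + 1 : ℕ) :=
      log_le_log (by positivity) (by push_cast; linarith)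
    simp only [Int.cast_neg, Int.cast_one, Int.cast_zero]
    linarith

lemma sum_chi3_mul_log (n : ℕ) (hn : 1 ≤ n) :
    ∑ i ∈ Icc 1 n, (chi3 i : ℝ) * log i ≤ log n := by
  obtain ⟨j, hj⟩ : ∃ j, n = 3 * j + 1 ∨ n = 3 * j + 1 + 1 ∨ n = 3 * j + 1 + 1 + 1 :=
    ⟨(n - 1) / 3, by omega⟩
  have h0 := sum_chi3_mul_log_aux j
  have h1 : chi3 (3 * j + 1 + 1) = -1 := by unfold chi3; simp [show (3 * j + 1 + 1) % 3 = 2 by omega]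
  have h2 : chi3 (3 * j + 1 + 1 + 1) = 0 := by
    unfold chi3; simp [show (3 * j + 1 + 1 + 1) % 3 = 0 by omega]
  have h4 : log (3 * j + 1 : ℕ) ≤ log (3 * j + 1 + 1 : ℕ) :=
      log_le_log (by positivity) (by push_cast; linarith)
  have h5 : 0 ≤ log (3 * j + 1 + 1 : ℕ) := log_natCast_nonneg _
  have h6 : 0 ≤ log (3 * j + 1 + 1 + 1 : ℕ) := log_natCast_nonneg _
  rcases hj with rfl | rfl | rfl
  · exact h0
  · rw [Finset.sum_Icc_succ_top (by omega), h1]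
    push_cast at *
    linarith
  · rw [Finset.sum_Icc_succ_top (by omega), Finset.sum_Icc_succ_top (by omega), h1, h2]
    push_cast at *
    linarith

lemma sum_chi3_mul_log_eq (N : ℕ) : ∑ i ∈ Icc 1 N, (chi3 i : ℝ) * log i =
    ∑ m ∈ Icc 1 N, (chi3 m : ℝ) * Λ m * (if N / m % 3 = 1 then 1 else 0) := by
  have h1 : ∀ i ∈ Icc 1 N, (chi3 i : ℝ) * log i =
      ∑ m ∈ Icc 1 N, if m ∣ i then (chi3 i : ℝ) * Λ m else 0 := by
    intro i hi
    rw [mem_Icc] at hi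
    rw [← vonMangoldt_sum, Finset.mul_sum, ← Finset.sum_filter]
    apply Finset.sum_congr _ fun _ _ => rfl
    ext m
    rw [Nat.mem_divisors, mem_filter, mem_Icc]
    constructor
    · rintro ⟨h, h'⟩
      exact ⟨⟨Nat.pos_of_dvd_of_pos h (by omega), (Nat.le_of_dvd (by omega) h).trans hi.2⟩, h⟩
    · rintro ⟨-, h⟩
      exact ⟨h, by omega⟩
  rw [Finset.sum_congr rfl h1, Finset.sum_comm]
  apply Finset.sum_congr rfl
  intro m hm
  rw [mem_Icc] at hm
  rw [← Finset.sum_filter]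
  have h2 : (Icc 1 N).filter (fun i => m ∣ i) = (Icc 1 (N / m)).image (fun j => m * j) := by
    ext i
    rw [mem_filter, mem_Icc, mem_image]
    constructor
    · rintro ⟨⟨h1, h2⟩, j, rfl⟩
      refine ⟨j, mem_Icc.2 ⟨Nat.pos_of_ne_zero ?_, ?_⟩, rfl⟩
      · rintro rfl; simp at h1
      · rw [Nat.le_div_iff_mul_le hm.1, mul_comm]; exact h2
    · rintro ⟨j, hj, rfl⟩
      rw [mem_Icc, Nat.le_div_iff_mul_le hm.1, mul_comm j] at hj
      exact ⟨⟨Nat.mul_pos hm.1 hj.1, hj.2⟩, dvd_mul_right _ _⟩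
  rw [h2, Finset.sum_image (fun a _ b _ h => Nat.eq_of_mul_eq_mul_left hm.1 h)]
  simp only [chi3_mul]
  push_cast
  rw [← Finset.sum_mul, ← Finset.mul_sum]
  have h3 := sum_chi3 (N / m)
  have h4 : (∑ j ∈ Icc 1 (N / m), (chi3 j : ℝ)) = if N / m % 3 = 1 then 1 else 0 := by
    exact_mod_cast congrArg (Int.cast : ℤ → ℝ) h3
  rw [h4]
  ring

/-- The Chebyshev function of the residue class `2` modulo `3`. -/
noncomputable def psi32 (N : ℕ) : ℝ := ∑ m ∈ (Icc 1 N).filter (fun m => m % 3 = 2), Λ m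

lemma psi32_mono {M N : ℕ} (h : M ≤ N) : psi32 M ≤ psi32 N := by
  apply Finset.sum_le_sum_of_subset_of_nonneg
  · exact Finset.filter_subset_filter _ (Finset.Icc_subset_Icc_right h)
  · exact fun _ _ _ => vonMangoldt_nonneg

lemma psi_natCast (N : ℕ) : psi N = ∑ m ∈ Icc 1 N, Λ m := by
  rw [psi, Nat.floor_natCast]; rfl

lemma sum_vonMangoldt_three_dvd (N : ℕ) :
    ∑ m ∈ (Icc 1 N).filter (fun m => m % 3 = 0), Λ m ≤ log N := by
  rcases Nat.eq_zero_or_pos N with rfl | hN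
  · simp
  have h1 : ∀ m ∈ (Icc 1 N).filter (fun m => m % 3 = 0), Λ m ≠ 0 →
      m ∈ (Icc 1 (Nat.log 3 N)).image (fun k => 3 ^ k) := by
    intro m hm hm0
    rw [mem_filter, mem_Icc] at hm
    rw [vonMangoldt_ne_zero_iff, isPrimePow_nat_iff] at hm0
    obtain ⟨p, k, hp, hk, rfl⟩ := hm0
    have h3 : 3 ∣ p := Nat.prime_three.dvd_of_dvd_pow (Nat.dvd_of_mod_eq_zero hm.2)
    have : 3 = p := (Nat.prime_dvd_prime_iff_eq Nat.prime_three hp).1 h3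
    subst this
    refine mem_image.2 ⟨k, mem_Icc.2 ⟨hk, ?_⟩, rfl⟩
    exact (Nat.le_log_iff_pow_le (by norm_num) (by omega)).2 hm.1.2
  calc ∑ m ∈ (Icc 1 N).filter (fun m => m % 3 = 0), Λ m
      = ∑ m ∈ ((Icc 1 N).filter (fun m => m % 3 = 0)).filter (fun m => Λ m ≠ 0), Λ m :=
        (Finset.sum_filter_ne_zero _).symm
    _ ≤ ∑ m ∈ (Icc 1 (Nat.log 3 N)).image (fun k => 3 ^ k), Λ m := by
        apply Finset.sum_le_sum_of_subset_of_nonneg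
        · intro m hm
          rw [mem_filter] at hm
          exact h1 m hm.1 hm.2
        · exact fun _ _ _ => vonMangoldt_nonneg
    _ = ∑ k ∈ Icc 1 (Nat.log 3 N), log 3 := by
        rw [Finset.sum_image (fun a _ b _ h => Nat.pow_right_injective (le_refl _) (by simpa using h))]
        apply Finset.sum_congr rfl
        intro k hk
        rw [mem_Icc] at hk
        rw [vonMangoldt_apply_pow (by omega), vonMangoldt_apply_prime Nat.prime_three]
        norm_num
    _ = log ((3 ^ Nat.log 3 N : ℕ)) := by simp
    _ ≤ log N := by
        apply log_le_log (by positivity)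
        exact_mod_cast Nat.pow_log_le_self 3 (by omega)

lemma psi_le_psi_half_add (N : ℕ) (hN : 1 ≤ N) :
    psi N ≤ psi (N / 2 : ℕ) + 2 * (psi32 N + log N) := by
  set c : ℕ → ℝ := fun m => if N / m % 3 = 1 then 1 else 0 with hc
  have hc0 : ∀ m, 0 ≤ c m := fun m => by simp only [hc]; split_ifs <;> norm_num
  have hc1 : ∀ m, c m ≤ 1 := fun m => by simp only [hc]; split_ifs <;> norm_num
  have h1 := sum_chi3_mul_log N hN
  rw [sum_chi3_mul_log_eq] at h1
  have h2 := sum_vonMangoldt_three_dvd N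
  have h3 : ∀ m ∈ Icc 1 N, Λ m * c m ≤ (chi3 m : ℝ) * Λ m * c m +
      2 * (if m % 3 = 2 then Λ m else 0) + (if m % 3 = 0 then Λ m else 0) := by
    intro m _
    have hL : 0 ≤ Λ m := vonMangoldt_nonneg
    have h5 : Λ m * c m ≤ Λ m := mul_le_of_le_one_right hL (hc1 m)
    have : m % 3 = 0 ∨ m % 3 = 1 ∨ m % 3 = 2 := by omega
    unfold chi3
    rcases this with h | h | h <;> simp [h] <;> linarith
  have h4 := Finset.sum_le_sum h3
  rw [Finset.sum_add_distrib, Finset.sum_add_distrib, ← Finset.mul_sum, ← Finset.sum_filter,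
    ← Finset.sum_filter] at h4
  have h5 : psi N ≤ psi (N / 2 : ℕ) + ∑ m ∈ Icc 1 N, Λ m * c m := by
    rw [psi_natCast, psi_natCast]
    have e : Icc 1 N = Icc 1 (N / 2) ∪ Ioc (N / 2) N := by
      ext m; simp only [mem_union, mem_Icc, mem_Ioc]; omega
    have hd : Disjoint (Icc 1 (N / 2)) (Ioc (N / 2) N) := by
      rw [Finset.disjoint_left]; intro m; simp only [mem_Icc, mem_Ioc]; omega
    have h6 : ∑ m ∈ Ioc (N / 2) N, Λ m ≤ ∑ m ∈ Icc 1 N, Λ m * c m := by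
      rw [e, Finset.sum_union hd]
      have : ∑ m ∈ Ioc (N / 2) N, Λ m = ∑ m ∈ Ioc (N / 2) N, Λ m * c m := by
        apply Finset.sum_congr rfl
        intro m hm
        rw [mem_Ioc] at hm
        have : N / m = 1 := by
          rw [Nat.div_eq_iff (by omega)]; omega
        simp [hc, this]
      rw [this]
      exact le_add_of_nonneg_left
        (Finset.sum_nonneg fun m _ => mul_nonneg vonMangoldt_nonneg (hc0 m))
    calc ∑ m ∈ Icc 1 N, Λ m = ∑ m ∈ Icc 1 (N / 2), Λ m + ∑ m ∈ Ioc (N / 2) N, Λ m := by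
          rw [e, Finset.sum_union hd]
      _ ≤ _ := by gcongr
  unfold psi32
  linarith

lemma psi_le_psi32 (N : ℕ) (hN : 1 ≤ N) :
    psi N ≤ 2 * (Nat.log 2 N + 1) * (psi32 N + log N) := by
  induction N using Nat.strong_induction_on with
  | _ N ih =>
    have h1 := psi_le_psi_half_add N hN
    have hp : 0 ≤ psi32 N := Finset.sum_nonneg fun _ _ => vonMangoldt_nonneg
    have hl : 0 ≤ log N := log_natCast_nonneg _
    rcases Nat.lt_or_ge N 2 with h | h
    · have : N = 1 := by omega
      subst this
      simp at h1 hp ⊢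
      linarith
    · have h2 := ih (N / 2) (by omega) (by omega)
      have h3 : Nat.log 2 (N / 2) + 1 = Nat.log 2 N := by
        have := Nat.log_of_one_lt_of_le (b := 2) (by norm_num) h
        omega
      have h3' : (Nat.log 2 (N / 2) : ℝ) + 1 = Nat.log 2 N := by exact_mod_cast h3
      rw [h3'] at h2
      have h4 : psi32 (N / 2) ≤ psi32 N := psi32_mono (Nat.div_le_self _ _)
      have h5 : log (N / 2 : ℕ) ≤ log N :=
        log_le_log (by exact_mod_cast (by omega : 0 < N / 2))
          (by exact_mod_cast Nat.div_le_self _ _)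
      have h6 : 2 * (Nat.log 2 N : ℝ) * (psi32 (N / 2) + log (N / 2 : ℕ)) ≤
        2 * (Nat.log 2 N : ℝ) * (psi32 N + log N) := by gcongr
      linarith

/-- The primes `p ≡ 2 mod 3` up to `N`. -/
def primes32 (N : ℕ) : Finset ℕ := (Icc 1 N).filter (fun p => p.Prime ∧ p % 3 = 2)

lemma psi32_le (N : ℕ) (hN : 1 ≤ N) :
    psi32 N ≤ (primes32 N).card * log N + 2 * √N * log N := by
  have h1 := psi_sub_theta_le (x := N) (by exact_mod_cast hN)
  have h2 : psi N - theta N = ∑ m ∈ (Icc 1 N).filter (fun m => ¬ m.Prime), Λ m := by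
    rw [psi_natCast, theta, Nat.floor_natCast, ← Finset.sum_filter_add_sum_filter_not _ Nat.Prime]
    have : ∑ m ∈ (Icc 1 N).filter Nat.Prime, Λ m = ∑ p ∈ (Ioc 0 N).filter Nat.Prime, log p := by
      apply Finset.sum_congr rfl
      intro p hp
      exact vonMangoldt_apply_prime (mem_filter.1 hp).2
    rw [this]; ring
  have h3 : psi32 N ≤ ∑ p ∈ primes32 N, Λ p + ∑ m ∈ (Icc 1 N).filter (fun m => ¬ m.Prime), Λ m := by
    unfold psi32 primes32
    rw [← Finset.sum_filter_add_sum_filter_not _ Nat.Prime, Finset.filter_filter,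
      Finset.filter_filter]
    apply add_le_add
    · apply le_of_eq
      apply Finset.sum_congr _ fun _ _ => rfl
      ext; simp only [mem_filter]; tauto
    · apply Finset.sum_le_sum_of_subset_of_nonneg
      · intro x; simp only [mem_filter]; tauto
      · exact fun _ _ _ => vonMangoldt_nonneg
  have h4 : ∑ p ∈ primes32 N, Λ p ≤ (primes32 N).card * log N := by
    rw [← nsmul_eq_mul]
    apply Finset.sum_le_card_nsmul
    intro p hp
    rw [primes32, mem_filter, mem_Icc] at hp
    rw [vonMangoldt_apply_prime hp.2.1]
    exact log_le_log (by exact_mod_cast hp.1.1) (by exact_mod_cast hp.1.2)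
  linarith

end Chebyshev

section PrimeCount

open Real

lemma two_mem_primes32 {N : ℕ} (hN : 2 ≤ N) : 2 ∈ primes32 N := by
  rw [primes32, Finset.mem_filter, Finset.mem_Icc]
  exact ⟨⟨by norm_num, hN⟩, Nat.prime_two, rfl⟩

lemma le_log_sq_mul_card_primes32 (N : ℕ) (hN : 2 ≤ N) :
    (N : ℝ) ≤ 32 * log N ^ 2 * ((primes32 N).card + 4 * √N) := by
  have hN1 : 1 ≤ N := by omega
  have hN' : (2 : ℝ) ≤ N := by exact_mod_cast hN
  set l := log N with hl
  set P : ℝ := ((primes32 N).card : ℝ)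
  have hP : 0 ≤ P := Nat.cast_nonneg _
  have h1 := psi_le_psi32 N hN1
  have h2 := psi32_le N hN1
  have h3 := Chebyshev.psi_ge' (x := N) (by linarith)
  have hl2 : 0.6931 < log 2 := by have := log_two_gt_d9; linarith
  have hl2' : log 2 < 0.6932 := by have := log_two_lt_d9; linarith
  have hll : log 2 ≤ l := log_le_log (by norm_num) hN'
  have hs : 1 ≤ √(N : ℝ) := by rw [one_le_sqrt]; linarith
  have h4 : log (N + 2) ≤ (N + 2) / 4 - 1 + 2 * log 2 := by
    have h5 := log_le_sub_one_of_pos (x := (N + 2 : ℝ) / 4) (by linarith)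
    rw [log_div (by linarith) (by norm_num), show (4 : ℝ) = 2 ^ 2 by norm_num, log_pow] at h5
    push_cast at h5
    linarith
  have hJ : (Nat.log 2 N : ℝ) * log 2 ≤ l := by
    have : log ((2 ^ Nat.log 2 N : ℕ)) ≤ l :=
      log_le_log (by positivity) (by exact_mod_cast Nat.pow_log_le_self 2 (by omega))
    simpa using this
  have hJ2 : (Nat.log 2 N : ℝ) + 1 ≤ 4 * l := by nlinarith
  have h6 : psi32 N + l ≤ l * (P + 3 * √N) := by nlinarith
  have h7 : Chebyshev.psi N ≤ 2 * (4 * l) * (l * (P + 3 * √N)) := by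
    refine h1.trans ?_
    have : 0 ≤ psi32 N := Finset.sum_nonneg fun _ _ => ArithmeticFunction.vonMangoldt_nonneg
    have : 0 ≤ l := by linarith
    gcongr
  have h8 : (N : ℝ) / 4 - 2 ≤ Chebyshev.psi N := by nlinarith
  have h9 : 2 ≤ 8 * l ^ 2 * √N := by nlinarith
  nlinarith

/-- There are at least `N ^ (1 - ε) / C` primes `p ≡ 2 mod 3` up to `N`. -/
lemma card_primes32_ge {ε : ℝ} (hε : 0 < ε) :
    ∃ C : ℝ, 0 < C ∧ ∀ N : ℕ, 2 ≤ N → (N : ℝ) ^ (1 - ε) ≤ C * (primes32 N).card := by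
  set η := min ε (1 / 4) / 2 with hη
  have hη0 : 0 < η := by positivity
  have hηε : 2 * η ≤ ε := by have := min_le_left ε (1 / 4); linarith
  have hη4 : 2 * η ≤ 1 / 4 := by have := min_le_right ε (1 / 4); linarith
  set C := 128 / η ^ 2 with hC
  have hC1 : 1 ≤ C := by
    rw [hC, le_div_iff₀ (by positivity)]
    nlinarith
  refine ⟨(2 * C) ^ 4, by positivity, fun N hN => ?_⟩
  have hN1 : (1 : ℝ) ≤ N := by exact_mod_cast (by omega : 1 ≤ N)
  have hN0 : (0 : ℝ) < N := by linarith
  set P : ℝ := ((primes32 N).card : ℝ) with hPdef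
  have hP : 1 ≤ P := by
    rw [hPdef]
    exact_mod_cast Finset.card_pos.2 ⟨2, two_mem_primes32 hN⟩
  have h1 := le_log_sq_mul_card_primes32 N hN
  have h2 : log N ≤ (N : ℝ) ^ η / η := log_le_rpow_div hN0.le hη0
  have h3 : log N ^ 2 ≤ (N : ℝ) ^ (2 * η) / η ^ 2 := by
    have := pow_le_pow_left₀ (log_natCast_nonneg N) h2 2
    rwa [div_pow, ← rpow_natCast ((N : ℝ) ^ η), ← rpow_mul hN0.le, mul_comm η] at this
  have h4 : (N : ℝ) ≤ C * (N : ℝ) ^ (2 * η) * (P + √N) := by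
    calc (N : ℝ) ≤ 32 * log N ^ 2 * (P + 4 * √N) := h1
      _ ≤ 32 * ((N : ℝ) ^ (2 * η) / η ^ 2) * (4 * (P + √N)) := by
          gcongr
          linarith
      _ = _ := by rw [hC]; ring
  have h5 : (N : ℝ) ^ (1 - 2 * η) ≤ C * (P + √N) := by
    rw [rpow_sub hN0, rpow_one, div_le_iff₀ (by positivity)]
    linarith
  have h6 : (N : ℝ) ^ (1 - ε) ≤ (N : ℝ) ^ (1 - 2 * η) :=
    rpow_le_rpow_of_exponent_le hN1 (by linarith)
  have hC4 : 2 * C ≤ (2 * C) ^ 4 := le_self_pow₀ (by linarith) (by norm_num)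
  rcases le_total (√(N : ℝ)) P with h | h
  · calc (N : ℝ) ^ (1 - ε) ≤ C * (P + √N) := h6.trans h5
      _ ≤ 2 * C * P := by nlinarith
      _ ≤ _ := by gcongr
  · have h7 : (N : ℝ) ^ (1 / 4 : ℝ) * √N ≤ 2 * C * √N := by
      calc (N : ℝ) ^ (1 / 4 : ℝ) * √N = (N : ℝ) ^ (3 / 4 : ℝ) := by
            rw [sqrt_eq_rpow, ← rpow_add hN0]; norm_num
        _ ≤ (N : ℝ) ^ (1 - 2 * η) := rpow_le_rpow_of_exponent_le hN1 (by linarith)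
        _ ≤ C * (P + √N) := h5
        _ ≤ 2 * C * √N := by nlinarith
    have h8 : (N : ℝ) ^ (1 / 4 : ℝ) ≤ 2 * C := le_of_mul_le_mul_right h7 (by positivity)
    have h9 : (N : ℝ) ≤ (2 * C) ^ 4 := by
      have := pow_le_pow_left₀ (by positivity) h8 4
      rwa [← rpow_natCast, ← rpow_mul hN0.le, show (1 / 4 : ℝ) * (4 : ℕ) = 1 by norm_num,
        rpow_one] at this
    calc (N : ℝ) ^ (1 - ε) ≤ (N : ℝ) ^ (1 : ℝ) :=
          rpow_le_rpow_of_exponent_le hN1 (by linarith)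
      _ ≤ (2 * C) ^ 4 := by rw [rpow_one]; exact h9
      _ ≤ _ := le_mul_of_one_le_right (by positivity) hP

end PrimeCount

section DivisorBound

open Real

/-- The divisor bound. -/
lemma card_divisors_le_rpow {ε : ℝ} (hε : 0 < ε) :
    ∃ C : ℝ, 0 < C ∧ ∀ n : ℕ, n ≠ 0 → (n.divisors.card : ℝ) ≤ C * (n : ℝ) ^ ε := by
  set A : ℝ := max 1 (1 / (ε * log 2)) with hA
  have hA1 : 1 ≤ A := le_max_left _ _
  have hl : 0 < log 2 := log_pos (by norm_num)
  have hA2 : 1 ≤ A * (ε * log 2) := by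
    rw [← div_le_iff₀ (by positivity)]; exact le_max_right _ _
  set P : ℕ := ⌈(2 : ℝ) ^ (1 / ε)⌉₊ with hP
  refine ⟨A ^ P, by positivity, fun n hn => ?_⟩
  have hprod : (n : ℝ) ^ ε = ∏ p ∈ n.primeFactors, ((p : ℝ) ^ ε) ^ n.factorization p := by
    conv_lhs => rw [← Nat.prod_factorization_pow_eq_self hn]
    rw [Finsupp.prod, Nat.support_factorization]
    push_cast
    rw [← finsetProd_rpow _ _ (fun _ _ => by positivity)]
    apply Finset.prod_congr rfl
    intro p _
    rw [← rpow_natCast, ← rpow_natCast, ← rpow_mul (Nat.cast_nonneg _),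
      ← rpow_mul (Nat.cast_nonneg _), mul_comm]
  rw [Nat.card_divisors hn, hprod]
  push_cast
  have hterm : ∀ p ∈ n.primeFactors, ((n.factorization p : ℝ) + 1) ≤
      (if p < P then A else 1) * ((p : ℝ) ^ ε) ^ n.factorization p := by
    intro p hp
    have hp2 : (2 : ℝ) ≤ p := by exact_mod_cast (Nat.prime_of_mem_primeFactors hp).two_le
    set k := n.factorization p
    split_ifs with h
    · have h1 : (2 : ℝ) ^ ε ≤ (p : ℝ) ^ ε := rpow_le_rpow (by norm_num) hp2 hε.le
      have h2 : (1 : ℝ) + k * (ε * log 2) ≤ ((2 : ℝ) ^ ε) ^ k := by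
        rw [rpow_def_of_pos (by norm_num), ← exp_nat_mul]
        have := add_one_le_exp (k * (log 2 * ε))
        linarith
      calc (k : ℝ) + 1 ≤ A * (1 + k * (ε * log 2)) := by
            have : (k : ℝ) * 1 ≤ k * (A * (ε * log 2)) := by gcongr
            linarith
        _ ≤ A * ((2 : ℝ) ^ ε) ^ k := by gcongr
        _ ≤ _ := by gcongr
    · have h1 : (2 : ℝ) ≤ (p : ℝ) ^ ε := by
        have h2 : (2 : ℝ) ^ (1 / ε) ≤ p := by
          refine (Nat.le_ceil _).trans ?_
          exact_mod_cast (by omega : P ≤ p)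
        calc (2 : ℝ) = ((2 : ℝ) ^ (1 / ε)) ^ ε := by
              rw [← rpow_mul (by norm_num), one_div_mul_cancel hε.ne', rpow_one]
          _ ≤ _ := rpow_le_rpow (by positivity) h2 hε.le
      rw [one_mul]
      calc (k : ℝ) + 1 ≤ 2 ^ k := by exact_mod_cast Nat.lt_two_pow_self
        _ ≤ _ := by gcongr
  refine (Finset.prod_le_prod (fun _ _ => by positivity) hterm).trans ?_
  rw [Finset.prod_mul_distrib]
  gcongr
  rw [Finset.prod_ite, Finset.prod_const_one, mul_one, Finset.prod_const]
  apply pow_le_pow_right₀ hA1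
  calc (n.primeFactors.filter (fun p => p < P)).card ≤ (Finset.range P).card := by
        apply Finset.card_le_card
        intro p hp
        rw [Finset.mem_filter] at hp
        exact Finset.mem_range.2 hp.2
    _ = P := Finset.card_range P

end DivisorBound

section CubicFormBounds

lemma cauchy_two (x₁ x₂ y₁ y₂ z₁ z₂ : ℝ) :
    (x₁ * y₁ * z₁ + x₂ * y₂ * z₂) ^ 2 ≤ (x₁ ^ 2 + x₂ ^ 2) * (y₁ ^ 2 + y₂ ^ 2) * (z₁ ^ 2 + z₂ ^ 2) := by
  have h1 : (x₁ * y₁ * z₁ + x₂ * y₂ * z₂) ^ 2 ≤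
      ((x₁ * y₁) ^ 2 + (x₂ * y₂) ^ 2) * (z₁ ^ 2 + z₂ ^ 2) := by
    nlinarith [sq_nonneg (x₁ * y₁ * z₂ - x₂ * y₂ * z₁)]
  have h2 : (x₁ * y₁) ^ 2 + (x₂ * y₂) ^ 2 ≤ (x₁ ^ 2 + x₂ ^ 2) * (y₁ ^ 2 + y₂ ^ 2) := by
    nlinarith [sq_nonneg (x₁ * y₂), sq_nonneg (x₂ * y₁)]
  exact h1.trans (by gcongr)

/-- Bounds for the coefficients of the cubic forms. -/
structure CubicBounds (D : ℕ) (a b c e : ℤ) : Prop where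
  ha : a ≠ 0
  h1 : a ^ 4 ≤ D
  h2 : b ^ 4 ≤ D
  h3 : (a * e) ^ 2 ≤ D
  h4 : (b * c) ^ 2 ≤ D
  h5 : |a| * |c| ^ 3 ≤ D

lemma CubicBounds.of_real {d : ℕ} (hd : 0 < d) {a b c e : ℤ} (ha0 : a ≠ 0) {P R : ℝ}
    (hP : 0 ≤ P) (hPR : P ≤ R) (hle : P * R ≤ 16 / 3 * d)
    (ha : (a : ℝ) ^ 2 * d ≤ P * P * P) (hb : (b : ℝ) ^ 2 * d ≤ P * P * R)
    (hc : (c : ℝ) ^ 2 * d ≤ P * R * R) (he : (e : ℝ) ^ 2 * d ≤ R * R * R) :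
    CubicBounds (152 * d) a b c e := by
  have hR : 0 ≤ R := hP.trans hPR
  have hd' : (0 : ℝ) < d := by exact_mod_cast hd
  have h3 : (P * R) ^ 3 ≤ 152 * (d : ℝ) ^ 3 := by
    calc (P * R) ^ 3 ≤ (16 / 3 * (d : ℝ)) ^ 3 := by gcongr
      _ ≤ 152 * (d : ℝ) ^ 3 := by rw [mul_pow]; gcongr; norm_num
  have key : ∀ x : ℝ, x * (d : ℝ) ^ 2 ≤ (P * R) ^ 3 → x ≤ 152 * d := by
    intro x hx
    have : x * (d : ℝ) ^ 2 ≤ (152 * d) * (d : ℝ) ^ 2 := by nlinarith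
    exact le_of_mul_le_mul_right this (by positivity)
  refine ⟨ha0, ?_, ?_, ?_, ?_, ?_⟩
  · have := key ((a : ℝ) ^ 4) (by
      calc (a : ℝ) ^ 4 * d ^ 2 = (a ^ 2 * d) * (a ^ 2 * d) := by ring
        _ ≤ (P * P * P) * (P * P * P) := by gcongr
        _ = P ^ 3 * P ^ 3 := by ring
        _ ≤ P ^ 3 * R ^ 3 := by gcongr
        _ = _ := by ring)
    exact_mod_cast this
  · have := key ((b : ℝ) ^ 4) (by
      calc (b : ℝ) ^ 4 * d ^ 2 = (b ^ 2 * d) * (b ^ 2 * d) := by ring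
        _ ≤ (P * P * R) * (P * P * R) := by gcongr
        _ = P ^ 3 * R ^ 2 * P := by ring
        _ ≤ P ^ 3 * R ^ 2 * R := by gcongr
        _ = _ := by ring)
    exact_mod_cast this
  · have := key (((a : ℝ) * e) ^ 2) (by
      calc ((a : ℝ) * e) ^ 2 * d ^ 2 = (a ^ 2 * d) * (e ^ 2 * d) := by ring
        _ ≤ (P * P * P) * (R * R * R) := by gcongr
        _ = _ := by ring)
    exact_mod_cast this
  · have := key (((b : ℝ) * c) ^ 2) (by
      calc ((b : ℝ) * c) ^ 2 * d ^ 2 = (b ^ 2 * d) * (c ^ 2 * d) := by ring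
        _ ≤ (P * P * R) * (P * R * R) := by gcongr
        _ = _ := by ring)
    exact_mod_cast this
  · have := key (|(a : ℝ)| * |(c : ℝ)| ^ 3) (by
      refine (sq_le_sq₀ (by positivity) (by positivity)).1 ?_
      calc (|(a : ℝ)| * |(c : ℝ)| ^ 3 * d ^ 2) ^ 2
          = (|(a : ℝ)| ^ 2 * d) * ((|(c : ℝ)| ^ 2 * d) * (|(c : ℝ)| ^ 2 * d) * (|(c : ℝ)| ^ 2 * d)) := by
            ring
        _ = ((a : ℝ) ^ 2 * d) * (((c : ℝ) ^ 2 * d) * ((c : ℝ) ^ 2 * d) * ((c : ℝ) ^ 2 * d)) := by rw [sq_abs, sq_abs]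
        _ ≤ (P * P * P) * ((P * R * R) * (P * R * R) * (P * R * R)) := by gcongr
        _ = _ := by ring)
    exact_mod_cast this

end CubicFormBounds

namespace QuadField

open NumberField
open scoped nonZeroDivisors

/-- The coefficients of the binary cubic form attached to a class. -/
structure CubicData {d : ℕ} {K : Type} [Field K] [NumberField K] (Q : QuadField d K)
    (cl : ClassGroup (𝓞 K)) (a b c e : ℤ) : Prop where
  data : ∃ (I : (Ideal (𝓞 K))⁰) (f₁ f₂ : 𝓞 K) (α : K), ClassGroup.mk0 I = cl ∧ f₁ ≠ 0 ∧ α ≠ 0 ∧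
    f₁ ∈ (I : Ideal (𝓞 K)) ∧ f₂ ∈ (I : Ideal (𝓞 K)) ∧
    (∀ x ∈ (I : Ideal (𝓞 K)), ∃ a b : ℤ, x = a * f₁ + b * f₂) ∧
    Q.φ (Q.σ (f₂ / f₁)) < Q.φ (f₂ / f₁) ∧
    (a : K) = α + Q.σ α ∧ (b : K) = α * (f₂ / f₁) + Q.σ (α * (f₂ / f₁)) ∧
    (c : K) = α * (f₂ / f₁) ^ 2 + Q.σ (α * (f₂ / f₁) ^ 2) ∧
    (e : K) = α * (f₂ / f₁) ^ 3 + Q.σ (α * (f₂ / f₁) ^ 3)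

section

variable {d : ℕ} {K : Type} [Field K] [NumberField K] (Q : QuadField d K)

lemma exists_coeff {δ : 𝓞 K} (hδ : δ ≠ 0) {I : Ideal (𝓞 K)} (hI : I ^ 3 = Ideal.span {δ})
    {g₁ g₂ g₃ : 𝓞 K} (h1 : g₁ ∈ I) (h2 : g₂ ∈ I) (h3 : g₃ ∈ I) :
    ∃ v : ℤ, (v : K) = (δ * Q.θ : K)⁻¹ * (g₁ * g₂ * g₃) + Q.σ ((δ * Q.θ : K)⁻¹ * (g₁ * g₂ * g₃)) ∧
      |(v : ℝ)| * Real.sqrt d ≤ |Q.φ g₁| * |Q.φ g₂| * |Q.φ g₃| / |Q.φ δ| +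
        |Q.φ (Q.σ g₁)| * |Q.φ (Q.σ g₂)| * |Q.φ (Q.σ g₃)| / |Q.φ (Q.σ δ)| := by
  have hm : g₁ * g₂ * g₃ ∈ I ^ 3 := by
    rw [pow_succ, pow_two]
    exact Ideal.mul_mem_mul (Ideal.mul_mem_mul h1 h2) h3
  rw [hI, Ideal.mem_span_singleton'] at hm
  obtain ⟨y, hy⟩ := hm
  have hδK : (δ : K) ≠ 0 := by simpa using hδ
  have hyK : (y : K) = (g₁ * g₂ * g₃ : K) / δ := by
    rw [eq_div_iff hδK]; exact_mod_cast congrArg (fun z : 𝓞 K => (z : K)) hy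
  have hv := Q.vco_spec y
  refine ⟨Q.vco y, ?_, ?_⟩
  · have hθ := Q.θ_ne
    have hσδ := Q.σ_ne hδK
    rw [hyK] at hv
    have : (Q.vco y : K) = ((g₁ * g₂ * g₃ : K) / δ - Q.σ ((g₁ * g₂ * g₃ : K) / δ)) / Q.θ := by
      rw [hv]; field_simp
    rw [this]
    simp only [map_mul, map_inv₀, map_div₀, Q.σθ]
    field_simp
    ring
  · have hr := Q.vco_real y
    have : |(Q.vco y : ℝ)| * Real.sqrt d = |Q.φ y - Q.φ (Q.σ y)| := by
      rw [hr, abs_mul, abs_of_nonneg (Real.sqrt_nonneg _)]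
    rw [this]
    refine (abs_sub _ _).trans (le_of_eq ?_)
    rw [hyK]; simp only [map_mul, map_div₀, abs_mul, abs_div]

/-- A class with a vanishing leading coefficient is trivial. -/
lemma mk0_eq_one_of_fixed {δ : 𝓞 K} (hδ : δ ≠ 0) {I : (Ideal (𝓞 K))⁰}
    (hI : (I : Ideal (𝓞 K)) ^ 3 = Ideal.span {δ}) {g : 𝓞 K} (hg : g ≠ 0)
    (h : Q.σ ((g : K) ^ 3 / δ) = (g : K) ^ 3 / δ) : ClassGroup.mk0 I = 1 := by
  obtain ⟨r, hr⟩ := Q.eq_rat_of_fixed h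
  have hδK : (δ : K) ≠ 0 := by simpa using hδ
  have hgK : (g : K) ≠ 0 := by simpa using hg
  have hr0 : r ≠ 0 := by
    rintro rfl
    rw [map_zero, div_eq_zero_iff] at hr
    rcases hr with hr | hr
    · exact hgK (by simpa using hr)
    · exact hδK hr
  rw [div_eq_iff hδK] at hr
  have hN := Q.natAbs_nrm_cube hδ hI
  set N := Ideal.absNorm (I : Ideal (𝓞 K)) with hNdef
  have hN0 : N ≠ 0 := by
    rw [hNdef, Ne, Ideal.absNorm_eq_zero_iff]
    exact nonZeroDivisors.coe_ne_zero I
  have hnr : (Q.nrm g : ℚ) ^ 3 = r ^ 2 * (Q.nrm δ : ℚ) := by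
    apply (algebraMap ℚ K).injective
    have h2 := congrArg Q.σ hr
    simp only [map_mul, map_pow, map_intCast, AlgHom.commutes] at h2 ⊢
    rw [← Q.nrm_spec, ← Q.nrm_spec, mul_pow, h2, hr]; ring
  have hm : ∃ m : ℚ, m ≠ 0 ∧ r ^ 2 = m ^ 3 := by
    rcases Int.natAbs_eq (Q.nrm δ) with h1 | h1
    · rw [hN] at h1
      refine ⟨Q.nrm g / N, div_ne_zero (by exact_mod_cast Q.nrm_ne_zero hg) (by exact_mod_cast hN0), ?_⟩
      rw [h1] at hnr; push_cast at hnr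
      rw [div_pow, eq_div_iff (by positivity), ← hnr]
    · rw [hN] at h1
      refine ⟨-Q.nrm g / N, div_ne_zero (neg_ne_zero.2 (by exact_mod_cast Q.nrm_ne_zero hg)) (by exact_mod_cast hN0), ?_⟩
      rw [h1] at hnr; push_cast at hnr
      rw [div_pow, eq_div_iff (by positivity)]
      linear_combination hnr
  obtain ⟨m, hm0, hm⟩ := hm
  have hrm : r = (r / m) ^ 3 := by
    rw [div_pow, ← hm]; field_simp
  set t : K := algebraMap ℚ K (r / m) with ht
  have ht0 : t ≠ 0 := by rw [ht]; simp [hr0, hm0]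
  have hη : ((g : K) / t) ^ 3 = δ := by
    have ht3 : t ^ 3 = algebraMap ℚ K r := by rw [ht, ← map_pow, ← hrm]
    rw [div_pow, ht3, hr]
    have : algebraMap ℚ K r ≠ 0 := by simpa using hr0
    field_simp
  let η : 𝓞 K := ⟨(g : K) / t, IsIntegral.of_pow (n := 3) (by norm_num) (by
    rw [hη]; exact δ.isIntegral_coe)⟩
  have hη' : η ^ 3 = δ := by
    apply RingOfIntegers.ext
    rw [← hη]; rfl
  exact mk0_eq_one_of_cube (η := η) (by rw [hη']; exact hI)

theorem exists_cubicData (cl : ClassGroup (𝓞 K)) (hcl : cl ^ 3 = 1) (hne : cl ≠ 1) :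
    ∃ a b c e : ℤ, Q.CubicData cl a b c e ∧ CubicBounds (152 * d) a b c e := by
  obtain ⟨I, δ, hδ, hIc, hI⟩ := exists_torsion_ideal cl hcl
  have hI0 : (I : Ideal (𝓞 K)) ≠ ⊥ := nonZeroDivisors.coe_ne_zero I
  have hδK : (δ : K) ≠ 0 := by simpa using hδ
  have hφ1 : 0 < |Q.φ δ| := by simpa using hδ
  have hφ2 : 0 < |Q.φ (Q.σ δ)| := by simpa using hδ
  obtain ⟨r₁, hr₁, hr₁'⟩ : ∃ r : ℝ, 0 < r ∧ r ^ 3 = |Q.φ δ| :=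
    ⟨_, Real.rpow_pos_of_pos hφ1 (1 / 3), by
      rw [← Real.rpow_natCast, ← Real.rpow_mul hφ1.le]; norm_num⟩
  obtain ⟨r₂, hr₂, hr₂'⟩ : ∃ r : ℝ, 0 < r ∧ r ^ 3 = |Q.φ (Q.σ δ)| :=
    ⟨_, Real.rpow_pos_of_pos hφ2 (1 / 3), by
      rw [← Real.rpow_natCast, ← Real.rpow_mul hφ2.le]; norm_num⟩
  have hrN : r₁ * r₂ = Ideal.absNorm (I : Ideal (𝓞 K)) := by
    have h1 : (r₁ * r₂) ^ 3 = (Ideal.absNorm (I : Ideal (𝓞 K)) : ℝ) ^ 3 := by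
      rw [mul_pow, hr₁', hr₂', ← Q.absNorm_real δ hδ, ← hI]; simp
    exact (pow_left_inj₀ (by positivity) (by positivity) (by norm_num)).1 h1
  obtain ⟨f₁, f₂, hf, m₁, m₂, hsp, hor, -, hle, hpr⟩ := Q.exists_reduced_basis' I hI0
    (w₁ := (r₁ ^ 2)⁻¹) (w₂ := (r₂ ^ 2)⁻¹) (by positivity) (by positivity)
  have hfK : (f₁ : K) ≠ 0 := by simpa using hf
  set P := Q.qf (r₁ ^ 2)⁻¹ (r₂ ^ 2)⁻¹ f₁ with hP
  set R := Q.qf (r₁ ^ 2)⁻¹ (r₂ ^ 2)⁻¹ f₂ with hR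
  have hPR : P * R ≤ 16 / 3 * d := by
    refine hpr.trans (le_of_eq ?_)
    rw [← hrN]; field_simp
  have hq : ∀ g : K, Q.qf (r₁ ^ 2)⁻¹ (r₂ ^ 2)⁻¹ g =
      (|Q.φ g| / r₁) ^ 2 + (|Q.φ (Q.σ g)| / r₂) ^ 2 := by
    intro g
    simp only [qf, div_pow, sq_abs]; ring
  have hP0 : 0 ≤ P := by rw [hP, hq]; positivity
  have bound : ∀ {v : ℤ} {g₁ g₂ g₃ : K}, |(v : ℝ)| * Real.sqrt d ≤
      |Q.φ g₁| * |Q.φ g₂| * |Q.φ g₃| / |Q.φ δ| +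
        |Q.φ (Q.σ g₁)| * |Q.φ (Q.σ g₂)| * |Q.φ (Q.σ g₃)| / |Q.φ (Q.σ δ)| →
      (v : ℝ) ^ 2 * d ≤ Q.qf (r₁ ^ 2)⁻¹ (r₂ ^ 2)⁻¹ g₁ * Q.qf (r₁ ^ 2)⁻¹ (r₂ ^ 2)⁻¹ g₂ *
        Q.qf (r₁ ^ 2)⁻¹ (r₂ ^ 2)⁻¹ g₃ := by
    intro v g₁ g₂ g₃ h
    have h1 : (v : ℝ) ^ 2 * d = (|(v : ℝ)| * Real.sqrt d) ^ 2 := by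
      rw [mul_pow, sq_abs, Real.sq_sqrt (by positivity)]
    rw [h1, hq, hq, hq]
    refine le_trans ?_ (cauchy_two _ _ _ _ _ _)
    refine pow_le_pow_left₀ (by positivity) (h.trans (le_of_eq ?_)) 2
    rw [← hr₁', ← hr₂']; field_simp
  obtain ⟨a, ha, ha'⟩ := Q.exists_coeff hδ hI m₁ m₁ m₁
  obtain ⟨b, hb, hb'⟩ := Q.exists_coeff hδ hI m₁ m₁ m₂
  obtain ⟨c, hc, hc'⟩ := Q.exists_coeff hδ hI m₁ m₂ m₂
  obtain ⟨e, he, he'⟩ := Q.exists_coeff hδ hI m₂ m₂ m₂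
  have hθ := Q.θ_ne
  have ha0 : a ≠ 0 := by
    rintro rfl
    apply hne
    rw [← hIc]
    refine Q.mk0_eq_one_of_fixed hδ hI hf ?_
    have hσδ := Q.σ_ne hδK
    rw [Int.cast_zero] at ha
    simp only [map_mul, map_inv₀, map_div₀, Q.σθ, map_pow] at ha ⊢
    field_simp at ha ⊢
    linear_combination ha
  refine ⟨a, b, c, e, ⟨I, f₁, f₂, (δ * Q.θ : K)⁻¹ * f₁ ^ 3, hIc, hf, ?_, m₁, m₂, hsp, hor, ?_, ?_,
    ?_, ?_⟩, ?_⟩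
  · exact mul_ne_zero (inv_ne_zero (mul_ne_zero hδK hθ)) (pow_ne_zero _ hfK)
  · rw [ha]; congr 2 <;> ring_nf
  · rw [hb]
    have : (δ * Q.θ : K)⁻¹ * f₁ ^ 3 * (f₂ / f₁) = (δ * Q.θ : K)⁻¹ * (f₁ * f₁ * f₂) := by
      field_simp
    rw [this]
  · rw [hc]
    have : (δ * Q.θ : K)⁻¹ * f₁ ^ 3 * (f₂ / f₁) ^ 2 = (δ * Q.θ : K)⁻¹ * (f₁ * f₂ * f₂) := by
      field_simp
    rw [this]
  · rw [he]
    have : (δ * Q.θ : K)⁻¹ * f₁ ^ 3 * (f₂ / f₁) ^ 3 = (δ * Q.θ : K)⁻¹ * (f₂ * f₂ * f₂) := by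
      field_simp
    rw [this]
  · exact CubicBounds.of_real (by have := Q.one_lt; omega) ha0 hP0 hle hPR (bound ha') (bound hb')
      (bound hc') (bound he')

end

end QuadField

section Recurrence

lemma recurrence_roots {a b c e A A' B B' τ τ' μ μ' : ℝ} (hA : A ≠ 0) (hA' : A' ≠ 0)
    (hτ : τ' < τ) (hμ : μ' < μ)
    (a1 : a = A + A') (b1 : b = A * τ + A' * τ') (c1 : c = A * τ ^ 2 + A' * τ' ^ 2)
    (e1 : e = A * τ ^ 3 + A' * τ' ^ 3)
    (a2 : a = B + B') (b2 : b = B * μ + B' * μ') (c2 : c = B * μ ^ 2 + B' * μ' ^ 2)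
    (e2 : e = B * μ ^ 3 + B' * μ' ^ 3) : τ = μ ∧ τ' = μ' := by
  have r1 : c = (τ + τ') * b - τ * τ' * a := by rw [a1, b1, c1]; ring
  have r2 : e = (τ + τ') * c - τ * τ' * b := by rw [b1, c1, e1]; ring
  have r3 : c = (μ + μ') * b - μ * μ' * a := by rw [a2, b2, c2]; ring
  have r4 : e = (μ + μ') * c - μ * μ' * b := by rw [b2, c2, e2]; ring
  have hdet : b ^ 2 - a * c ≠ 0 := by
    have : b ^ 2 - a * c = -(A * A' * (τ - τ') ^ 2) := by rw [a1, b1, c1]; ring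
    rw [this]
    have : τ - τ' ≠ 0 := by intro h; linarith
    exact neg_ne_zero.2 (mul_ne_zero (mul_ne_zero hA hA') (pow_ne_zero _ this))
  have ht : τ + τ' = μ + μ' := by
    have : ((τ + τ') - (μ + μ')) * (b ^ 2 - a * c) = 0 := by
      linear_combination -b * r1 + b * r3 + a * r2 - a * r4
    rcases mul_eq_zero.1 this with h | h
    · linarith
    · exact absurd h hdet
  have hn : τ * τ' = μ * μ' := by
    have : (τ * τ' - μ * μ') * (b ^ 2 - a * c) = 0 := by
      linear_combination -c * r1 + c * r3 + b * r2 - b * r4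
    rcases mul_eq_zero.1 this with h | h
    · linarith
    · exact absurd h hdet
  have h2 : (τ - τ') ^ 2 = (μ - μ') ^ 2 := by
    have e1 : (τ - τ') ^ 2 = (τ + τ') ^ 2 - 4 * (τ * τ') := by ring
    have e2 : (μ - μ') ^ 2 = (μ + μ') ^ 2 - 4 * (μ * μ') := by ring
    rw [e1, e2, ht, hn]
  have h3 : τ - τ' = μ - μ' :=
    (pow_left_inj₀ (by linarith) (by linarith) (by norm_num)).1 h2
  constructor <;> linarith

lemma squarefree_unique {d d' : ℕ} (hd : Squarefree d) (hd' : Squarefree d') (h0 : d ≠ 0)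
    {q q' : ℚ} (hq : q ≠ 0) (h : q ^ 2 * d = q' ^ 2 * d') : d = d' := by
  have h2 : IsSquare ((d * d' : ℕ) : ℚ) := ⟨q' * d' / q, by
    push_cast; field_simp; linear_combination (d' : ℚ) * h⟩
  rw [Rat.isSquare_natCast_iff] at h2
  obtain ⟨m, hm⟩ := h2
  have h3 : d ∣ m := by
    rw [← hd.dvd_pow_iff_dvd (n := 2) (by norm_num)]
    exact ⟨d', by rw [hm]; ring⟩
  obtain ⟨k, rfl⟩ := h3
  have h4 : d' = d * (k * k) := by
    apply Nat.eq_of_mul_eq_mul_left (Nat.pos_of_ne_zero h0)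
    rw [hm]; ring
  have h5 := hd' k ⟨d, by rw [h4]; ring⟩
  rw [Nat.isUnit_iff] at h5
  rw [h4, h5]; ring

end Recurrence

namespace QuadField

open NumberField
open scoped nonZeroDivisors

lemma sub_conj_eq {d : ℕ} {K : Type} [Field K] [NumberField K] (Q : QuadField d K) (x : K) :
    ∃ q : ℚ, Q.φ x - Q.φ (Q.σ x) = 2 * q * Real.sqrt d := by
  obtain ⟨a, b, rfl⟩ := Q.span x
  refine ⟨b, ?_⟩
  simp only [map_add, map_mul, Q.σθ, map_neg, Q.φθ, eq_ratCast, map_ratCast]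
  ring

lemma CubicData.unique_d {d d' : ℕ} {K K' : Type} [Field K] [NumberField K] [Field K']
    [NumberField K'] {Q : QuadField d K} {Q' : QuadField d' K'} {cl : ClassGroup (𝓞 K)}
    {cl' : ClassGroup (𝓞 K')} {a b c e : ℤ} (h : Q.CubicData cl a b c e)
    (h' : Q'.CubicData cl' a b c e) : d = d' := by
  obtain ⟨I, f₁, f₂, α, -, hf, hα, -, -, -, hor, ha, hb, hc, he⟩ := h.data
  obtain ⟨J, g₁, g₂, β, -, hg, hβ, -, -, -, hor', ha', hb', hc', he'⟩ := h'.data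
  have m1 := congrArg Q.φ ha
  have m2 := congrArg Q.φ hb
  have m3 := congrArg Q.φ hc
  have m4 := congrArg Q.φ he
  have m1' := congrArg Q'.φ ha'
  have m2' := congrArg Q'.φ hb'
  have m3' := congrArg Q'.φ hc'
  have m4' := congrArg Q'.φ he'
  simp only [map_add, map_mul, map_pow, map_intCast] at m1 m2 m3 m4 m1' m2' m3' m4'
  obtain ⟨e1, e2⟩ := recurrence_roots (by simpa using hα) (by simpa using Q.σ_ne hα) hor hor'
    m1 m2 m3 m4 m1' m2' m3' m4'
  obtain ⟨q, hq⟩ := Q.sub_conj_eq (f₂ / f₁)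
  obtain ⟨q', hq'⟩ := Q'.sub_conj_eq (g₂ / g₁)
  rw [e1, e2, hq'] at hq
  have hq0 : q ≠ 0 := by
    rintro rfl
    rw [← hq', Rat.cast_zero, mul_zero, zero_mul] at hq
    linarith
  have h2 : q ^ 2 * (d : ℚ) = q' ^ 2 * d' := by
    have := congrArg (· ^ 2) hq
    simp only [mul_pow, Real.sq_sqrt (Nat.cast_nonneg _)] at this
    have h3 : (q : ℝ) ^ 2 * d = q' ^ 2 * d' := by linarith
    exact_mod_cast h3
  exact squarefree_unique Q.sqf Q'.sqf (by have := Q.one_lt; omega) hq0 h2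

lemma CubicData.unique_class {d : ℕ} {K : Type} [Field K] [NumberField K] {Q : QuadField d K}
    {cl cl' : ClassGroup (𝓞 K)} {a b c e : ℤ} (h : Q.CubicData cl a b c e)
    (h' : Q.CubicData cl' a b c e) : cl = cl' := by
  obtain ⟨I, f₁, f₂, α, rfl, hf, hα, i1, i2, i3, hor, ha, hb, hc, he⟩ := h.data
  obtain ⟨J, g₁, g₂, β, rfl, hg, hβ, j1, j2, j3, hor', ha', hb', hc', he'⟩ := h'.data
  have m1 := congrArg Q.φ ha
  have m2 := congrArg Q.φ hb
  have m3 := congrArg Q.φ hc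
  have m4 := congrArg Q.φ he
  have m1' := congrArg Q.φ ha'
  have m2' := congrArg Q.φ hb'
  have m3' := congrArg Q.φ hc'
  have m4' := congrArg Q.φ he'
  simp only [map_add, map_mul, map_pow, map_intCast] at m1 m2 m3 m4 m1' m2' m3' m4'
  obtain ⟨e1, -⟩ := recurrence_roots (by simpa using hα) (by simpa using Q.σ_ne hα) hor hor'
    m1 m2 m3 m4 m1' m2' m3' m4'
  have e1' := Q.φ.injective e1
  have hf' : (f₁ : K) ≠ 0 := by simpa using hf
  have hg' : (g₁ : K) ≠ 0 := by simpa using hg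
  rw [div_eq_div_iff hf' hg'] at e1'
  have e3 : f₁ * g₂ = g₁ * f₂ := by
    apply RingOfIntegers.ext
    push_cast
    linear_combination -e1'
  exact ClassGroup.mk0_eq_mk0_iff.2 ⟨g₁, f₁, hg, hf, span_mul_eq_of_ratio i3 j3 i1 i2 j1 j2 e3⟩

end QuadField

section CubicCount

/-- Integer points in the box `|x|, |y| ≤ M` below the hyperbola `|x y| ≤ M`. -/
noncomputable def hyperbolaPts (M : ℕ) : Finset (ℤ × ℤ) :=
  ((Finset.Icc (-M : ℤ) M) ×ˢ (Finset.Icc (-M : ℤ) M)).filter (fun p => |p.1 * p.2| ≤ M)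

lemma card_hyperbolaPts_le (M : ℕ) :
    ((hyperbolaPts M).card : ℝ) ≤ 3 * M * (1 + 2 * (1 + Real.log M)) + 1 := by
  rcases Nat.eq_zero_or_pos M with rfl | hM
  · have : (hyperbolaPts 0).card ≤ 1 :=
      (Finset.card_filter_le _ _).trans (by simp)
    have h1 : ((hyperbolaPts 0).card : ℝ) ≤ 1 := by exact_mod_cast this
    simpa using h1
  have h1 : (hyperbolaPts M).card = ∑ x ∈ Finset.Icc (-M : ℤ) M,
      ((Finset.Icc (-M : ℤ) M).filter (fun y => |x * y| ≤ M)).card := by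
    rw [hyperbolaPts, Finset.card_filter, Finset.sum_product]
    simp only [Finset.card_filter]
  have h2 : ∀ x ∈ Finset.Icc (-M : ℤ) M,
      (((Finset.Icc (-M : ℤ) M).filter (fun y => |x * y| ≤ M)).card : ℝ)
        ≤ 3 * M * (1 / (max 1 x.natAbs : ℕ)) := by
    intro x hx
    rw [Finset.mem_Icc] at hx
    set n := max 1 x.natAbs with hn
    have hn1 : 1 ≤ n := le_max_left _ _
    have hnM : n ≤ M := by omega
    have hsub : (Finset.Icc (-M : ℤ) M).filter (fun y => |x * y| ≤ M) ⊆
        Finset.Icc (-((M / n : ℕ) : ℤ)) ((M / n : ℕ) : ℤ) := by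
      intro y hy
      rw [Finset.mem_filter, Finset.mem_Icc] at hy
      have : y.natAbs ≤ M / n := by
        rw [Nat.le_div_iff_mul_le (by omega)]
        rcases le_total 1 x.natAbs with h | h
        · have h3 := hy.2
          rw [hn, max_eq_right h, ← Int.natAbs_mul, mul_comm, ← Int.ofNat_le, Int.natCast_natAbs]
          exact h3
        · rw [hn, max_eq_left h]
          omega
      rw [Finset.mem_Icc]
      omega
    have hc := Finset.card_le_card hsub
    rw [Int.card_Icc] at hc
    have hc2 : ((Finset.Icc (-M : ℤ) M).filter (fun y => |x * y| ≤ M)).card ≤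
        2 * (M / n) + 1 := by omega
    have hc3 : ((((Finset.Icc (-M : ℤ) M).filter (fun y => |x * y| ≤ M)).card : ℕ) : ℝ) ≤
        2 * ((M / n : ℕ) : ℝ) + 1 := by exact_mod_cast hc2
    have h5 : ((M / n : ℕ) : ℝ) ≤ M / n := Nat.cast_div_le
    have h6 : (1 : ℝ) ≤ M / n := by
      rw [le_div_iff₀ (by positivity)]
      simpa using hnM
    have : (3 : ℝ) * M * (1 / n) = 3 * (M / n) := by ring
    rw [this]
    linarith
  have h3 : ∑ x ∈ Finset.Icc (-M : ℤ) M, (1 / (max 1 x.natAbs : ℕ) : ℝ)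
      ≤ 1 + 2 * (1 + Real.log M) := by
    have e : Finset.Icc (-M : ℤ) M ⊆ ({0} : Finset ℤ) ∪
        ((Finset.Icc 1 M).image (fun n : ℕ => (n : ℤ)) ∪
          (Finset.Icc 1 M).image (fun n : ℕ => -(n : ℤ))) := by
      intro x hx
      rw [Finset.mem_Icc] at hx
      simp only [Finset.mem_union, Finset.mem_singleton, Finset.mem_image, Finset.mem_Icc]
      rcases lt_trichotomy x 0 with h | h | h
      · exact Or.inr (Or.inr ⟨x.natAbs, by omega, by omega⟩)
      · exact Or.inl h
      · exact Or.inr (Or.inl ⟨x.natAbs, by omega, by omega⟩)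
    have hh : ∑ n ∈ Finset.Icc 1 M, (1 / (n : ℝ)) ≤ 1 + Real.log M := by
      have := harmonic_le_one_add_log M
      rw [harmonic_eq_sum_Icc] at this
      push_cast at this
      simpa [one_div] using this
    have hn0 : ∀ x : ℤ, (0 : ℝ) ≤ 1 / ((max 1 x.natAbs : ℕ) : ℝ) := fun x => by positivity
    have hun : ∀ s t : Finset ℤ, ∑ x ∈ s ∪ t, (1 / (max 1 x.natAbs : ℕ) : ℝ) ≤
        ∑ x ∈ s, (1 / (max 1 x.natAbs : ℕ) : ℝ) + ∑ x ∈ t, (1 / (max 1 x.natAbs : ℕ) : ℝ) := by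
      intro s t
      rw [← Finset.sum_union_inter]
      exact le_add_of_nonneg_right (Finset.sum_nonneg fun x _ => hn0 x)
    refine (Finset.sum_le_sum_of_subset_of_nonneg e fun x _ _ => hn0 x).trans ?_
    refine (hun _ _).trans ?_
    have h7 := hun ((Finset.Icc 1 M).image (fun n : ℕ => (n : ℤ)))
      ((Finset.Icc 1 M).image (fun n : ℕ => -(n : ℤ)))
    rw [Finset.sum_image (by intro a _ b _ h; simpa using h),
      Finset.sum_image (by intro a _ b _ h; simpa using h)] at h7
    have h8 : ∀ n ∈ Finset.Icc 1 M, (1 / ((max 1 n : ℕ) : ℝ)) = 1 / (n : ℝ) := by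
      intro n hn
      rw [Finset.mem_Icc] at hn
      rw [max_eq_right hn.1]
    simp only [Int.natAbs_neg, Int.natAbs_natCast] at h7
    rw [Finset.sum_congr rfl h8] at h7
    rw [Finset.sum_singleton]
    norm_num at h7 ⊢
    norm_num at hh
    linarith
  rw [h1]
  push_cast
  calc ∑ x ∈ Finset.Icc (-M : ℤ) M,
      (((Finset.Icc (-M : ℤ) M).filter (fun y => |x * y| ≤ M)).card : ℝ)
      ≤ ∑ x ∈ Finset.Icc (-M : ℤ) M, 3 * M * (1 / (max 1 x.natAbs : ℕ) : ℝ) :=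
        Finset.sum_le_sum h2
    _ = 3 * M * ∑ x ∈ Finset.Icc (-M : ℤ) M, (1 / (max 1 x.natAbs : ℕ) : ℝ) :=
        (Finset.mul_sum _ _ _).symm
    _ ≤ 3 * M * (1 + 2 * (1 + Real.log M)) := by gcongr
    _ ≤ _ := by linarith

lemma CubicBounds.mem_hyperbolaPts {D : ℕ} {a b c e : ℤ} (h : CubicBounds D a b c e) :
    (a, e) ∈ hyperbolaPts (Nat.sqrt D) ∧ (b, c) ∈ hyperbolaPts (Nat.sqrt D) := by
  set M := Nat.sqrt D
  have hM : ∀ x : ℤ, x ^ 2 ≤ D → |x| ≤ M := by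
    intro x hx
    rw [← Int.natCast_natAbs]
    have : x.natAbs ^ 2 ≤ D := by zify; rw [sq_abs]; exact hx
    exact_mod_cast Nat.le_sqrt'.2 this
  have h4 : ∀ x : ℤ, x ^ 4 ≤ D → |x| ≤ M := by
    intro x hx
    apply hM
    rcases eq_or_ne x 0 with rfl | h0
    · simp
    have : 1 ≤ x ^ 2 := by have := sq_pos_of_ne_zero h0; omega
    nlinarith
  have ha := h4 a h.h1
  have hb := h4 b h.h2
  have hae := hM _ h.h3
  have hbc := hM _ h.h4
  have ha1 : 1 ≤ |a| := Int.one_le_abs h.ha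
  have hc : |c| ≤ M := by
    apply hM
    rw [← sq_abs]
    have h5 := h.h5
    rcases eq_or_ne c 0 with rfl | h0
    · simp
    have hc1 : 1 ≤ |c| := Int.one_le_abs h0
    have : |c| ^ 3 ≤ |a| * |c| ^ 3 := le_mul_of_one_le_left (by positivity) ha1
    have : |c| ^ 2 ≤ |c| ^ 3 := pow_le_pow_right₀ hc1 (by norm_num)
    linarith
  have he : |e| ≤ M := by
    have : |e| ≤ |a * e| := by rw [abs_mul]; exact le_mul_of_one_le_left (abs_nonneg _) ha1
    linarith
  rw [abs_le] at ha hb hc he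
  simp only [hyperbolaPts, Finset.mem_filter, Finset.mem_product, Finset.mem_Icc]
  exact ⟨⟨⟨ha, he⟩, hae⟩, ⟨⟨hb, hc⟩, hbc⟩⟩

end CubicCount

section FirstMoment

open NumberField

noncomputable local instance (d : ℕ) : DecidableEq (ClassGroup (𝓞 (Kpos d))) :=
  Classical.decEq _

lemma hpos_eq_card (d : ℕ) :
    hpos 3 d = (Finset.univ.filter fun c : ClassGroup (𝓞 (Kpos d)) => c ^ 3 = 1).card := by
  rw [hpos, Nat.card_eq_fintype_card, Fintype.card_subtype]

lemma sum_hpos_le (s : Finset ℕ) (Y : ℕ) (hs : ∀ d ∈ s, Squarefree d ∧ 1 < d ∧ d ≤ Y) :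
    ∑ d ∈ s, hpos 3 d ≤ s.card + (hyperbolaPts (Nat.sqrt (152 * Y))).card ^ 2 := by
  have h1 : ∀ d ∈ s, hpos 3 d ≤ 1 + (Finset.univ.filter fun c : ClassGroup (𝓞 (Kpos d)) =>
      c ^ 3 = 1 ∧ c ≠ 1).card := by
    intro d _
    rw [hpos_eq_card, ← Finset.filter_filter, Finset.filter_ne']
    have := Finset.pred_card_le_card_erase (a := (1 : ClassGroup (𝓞 (Kpos d))))
      (s := Finset.univ.filter fun c : ClassGroup (𝓞 (Kpos d)) => c ^ 3 = 1)
    omega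
  refine (Finset.sum_le_sum h1).trans ?_
  rw [Finset.sum_add_distrib, Finset.sum_const, smul_eq_mul, mul_one, add_le_add_iff_left,
    ← Finset.card_sigma, sq, ← Finset.card_product]
  set S := s.sigma fun d => Finset.univ.filter fun c : ClassGroup (𝓞 (Kpos d)) =>
      c ^ 3 = 1 ∧ c ≠ 1
  have h2 : ∀ p : (Σ d : ℕ, ClassGroup (𝓞 (Kpos d))), p ∈ S → ∃ w : (ℤ × ℤ) × (ℤ × ℤ),
      ∃ hd : Squarefree p.1, ∃ h1 : 1 < p.1,
      (Kpos.quadField hd h1).CubicData p.2 w.1.1 w.2.1 w.2.2 w.1.2 ∧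
      CubicBounds (152 * Y) w.1.1 w.2.1 w.2.2 w.1.2 := by
    rintro ⟨d, c⟩ hp
    rw [Finset.mem_sigma, Finset.mem_filter] at hp
    obtain ⟨hd, -, hc, hc1⟩ := hp
    obtain ⟨h1, h2, h3⟩ := hs d hd
    obtain ⟨a, b, c', e, hdat, hb⟩ := (Kpos.quadField h1 h2).exists_cubicData c hc hc1
    refine ⟨((a, e), (b, c')), h1, h2, hdat, ?_⟩
    have h4 : ((152 * d : ℕ) : ℤ) ≤ ((152 * Y : ℕ) : ℤ) := by
      have h3' : d ≤ Y := h3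
      omega
    exact ⟨hb.ha, hb.h1.trans h4, hb.h2.trans h4, hb.h3.trans h4, hb.h4.trans h4, hb.h5.trans h4⟩
  choose! f hf using h2
  apply Finset.card_le_card_of_injOn f
  · intro p hp
    obtain ⟨_, _, _, hb⟩ := hf p hp
    simpa using hb.mem_hyperbolaPts
  · rintro ⟨d, c⟩ hp ⟨d', c'⟩ hp' he
    obtain ⟨h1, h2, h3, -⟩ := hf _ hp
    obtain ⟨h1', h2', h3', -⟩ := hf _ hp'
    rw [← he] at h3'
    have hdd : d = d' := h3.unique_d h3'
    subst hdd
    have := h3.unique_class h3'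
    simp only at this
    rw [this]

end FirstMoment

section PairCount

open Finset

/-- Cauchy–Schwarz for the fibres of a map on a product `E × P`. -/
lemma card_mul_sq_le {α κ : Type*} [DecidableEq α] [DecidableEq κ] (E : Finset α) (P : Finset ℕ)
    (S : Finset (ℕ × ℕ)) (F : Finset κ) (key : α → ℕ → κ)
    (hF : ∀ e ∈ E, ∀ p ∈ P, key e p ∈ F)
    (h1 : ∀ e ∈ E, ∀ e' ∈ E, ∀ p ∈ P, key e p = key e' p → e = e')
    (h2 : ∀ e ∈ E, ∀ e' ∈ E, ∀ p ∈ P, ∀ p' ∈ P, p ≠ p' → key e p = key e' p' → (p, p') ∈ S) :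
    E.card * P.card ^ 2 ≤ F.card * (P.card + S.card) := by
  set T := E ×ˢ P with hT
  set n : κ → ℕ := fun f => (T.filter fun t => key t.1 t.2 = f).card with hn
  have hsum : ∑ f ∈ F, n f = T.card :=
    (Finset.card_eq_sum_card_fiberwise (fun t ht => by
      rw [hT, mem_coe, mem_product] at ht
      exact hF _ ht.1 _ ht.2)).symm
  have hcs : T.card ^ 2 ≤ F.card * ∑ f ∈ F, n f ^ 2 := by
    rw [← hsum]
    exact sq_sum_le_card_mul_sum_sq
  set W := (T ×ˢ T).filter (fun q => key q.1.1 q.1.2 = key q.2.1 q.2.2) with hW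
  have hW1 : ∑ f ∈ F, n f ^ 2 = W.card := by
    rw [Finset.card_eq_sum_card_fiberwise (f := fun q => key q.1.1 q.1.2) (t := F)]
    · apply Finset.sum_congr rfl
      intro f _
      rw [sq, hn, ← Finset.card_product]
      congr 1
      ext ⟨t, t'⟩
      simp only [hW, mem_filter, mem_product]
      constructor
      · rintro ⟨⟨h1, h2⟩, h3, h4⟩; exact ⟨⟨⟨h1, h3⟩, by rw [h2, h4]⟩, h2⟩
      · rintro ⟨⟨⟨h1, h3⟩, h4⟩, h2⟩; exact ⟨⟨h1, h2⟩, h3, by rw [← h4, h2]⟩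
    · intro q hq
      simp only [hW, hT, mem_coe, mem_filter, mem_product] at hq
      exact hF _ hq.1.1.1 _ hq.1.1.2
  have hW2 : W.card ≤ (E ×ˢ (P.image (fun p => (p, p)) ∪ S)).card := by
    apply Finset.card_le_card_of_injOn (fun q => (q.1.1, (q.1.2, q.2.2)))
    · intro q hq
      simp only [hW, hT, mem_coe, mem_filter, mem_product] at hq
      obtain ⟨⟨⟨a1, a2⟩, a3, a4⟩, a5⟩ := hq
      simp only [mem_coe, mem_product, mem_union, mem_image]
      refine ⟨a1, ?_⟩
      rcases eq_or_ne q.1.2 q.2.2 with h | h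
      · exact Or.inl ⟨_, a2, by rw [← h]⟩
      · exact Or.inr (h2 _ a1 _ a3 _ a2 _ a4 h a5)
    · rintro ⟨⟨e, p⟩, e1, p1⟩ hq ⟨⟨e', p'⟩, e2, p2⟩ hq' h
      simp only [hW, hT, mem_coe, mem_filter, mem_product] at hq hq'
      simp only [Prod.mk.injEq] at h
      obtain ⟨rfl, rfl, rfl⟩ := h
      have := h1 e1 hq.1.2.1 e2 hq'.1.2.1 p1 hq.1.2.2 (by rw [← hq.2, ← hq'.2])
      rw [this]
  have hc : (E ×ˢ (P.image (fun p => (p, p)) ∪ S)).card ≤ E.card * (P.card + S.card) := by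
    rw [Finset.card_product]
    exact Nat.mul_le_mul_left _ ((Finset.card_union_le _ _).trans
      (Nat.add_le_add_right Finset.card_image_le _))
  rcases Nat.eq_zero_or_pos E.card with h0 | h0
  · rw [h0]; simp
  · apply Nat.le_of_mul_le_mul_left _ h0
    calc E.card * (E.card * P.card ^ 2) = T.card ^ 2 := by rw [hT, Finset.card_product]; ring
      _ ≤ F.card * (E.card * (P.card + S.card)) := by
          rw [hW1] at hcs
          exact hcs.trans (Nat.mul_le_mul_left _ (hW2.trans hc))
      _ = _ := by ring

end PairCount

section Forms

open Finset

/-- Binary quadratic forms `(a, b, c)` of discriminant `Δ` with `|b| ≤ L`. -/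
noncomputable def formSet (L : ℕ) (Δ : ℤ) : Finset (ℤ × ℤ × ℤ) :=
  (Icc (-L : ℤ) L).biUnion fun b =>
    (((b ^ 2 - Δ) / 4).natAbs.divisors ×ˢ ({1, -1} : Finset ℤ)).image fun q : ℕ × ℤ =>
      (q.2 * (q.1 : ℤ), b, (b ^ 2 - Δ) / 4 / (q.2 * (q.1 : ℤ)))

lemma mem_formSet {L : ℕ} {Δ a b c : ℤ} (hb : |b| ≤ L) (h : b ^ 2 - 4 * (a * c) = Δ)
    (ha : a ≠ 0) (hc : c ≠ 0) : (a, b, c) ∈ formSet L Δ := by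
  have e : (b ^ 2 - Δ) / 4 = a * c := by rw [← h]; omega
  rw [formSet, mem_biUnion]
  refine ⟨b, mem_Icc.2 (abs_le.1 hb), mem_image.2 ⟨(a.natAbs, a.sign), ?_, ?_⟩⟩
  · rw [mem_product, e, Nat.mem_divisors, Int.natAbs_mul]
    refine ⟨⟨dvd_mul_right _ _, mul_ne_zero (by simpa using ha) (by simpa using hc)⟩, ?_⟩
    rcases lt_or_gt_of_ne ha with h | h
    · simp [Int.sign_eq_neg_one_of_neg h]
    · simp [Int.sign_eq_one_of_pos h]
  · simp only [Int.sign_mul_natAbs, e, Int.mul_ediv_cancel_left _ ha]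

lemma card_formSet_le {ε : ℝ} (hε : 0 < ε) : ∃ C : ℝ, 0 < C ∧ ∀ (L : ℕ) (Δ : ℤ),
    ((formSet L Δ).card : ℝ) ≤ C * (L + 1) * ((L : ℝ) ^ 2 + |(Δ : ℝ)| + 1) ^ ε := by
  obtain ⟨C, hC, h⟩ := card_divisors_le_rpow hε
  refine ⟨4 * C, by positivity, fun L Δ => ?_⟩
  have h1 : (formSet L Δ).card ≤ ∑ b ∈ Icc (-L : ℤ) L, 2 * ((b ^ 2 - Δ) / 4).natAbs.divisors.card := by
    refine card_biUnion_le.trans (Finset.sum_le_sum fun b _ => ?_)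
    refine card_image_le.trans ?_
    rw [card_product, mul_comm]
    exact Nat.mul_le_mul_right _ (by simp)
  have h2 : ∀ b ∈ Icc (-L : ℤ) L, (2 * ((b ^ 2 - Δ) / 4).natAbs.divisors.card : ℝ) ≤
      2 * (C * ((L : ℝ) ^ 2 + |(Δ : ℝ)| + 1) ^ ε) := by
    intro b hb
    rw [mem_Icc] at hb
    gcongr
    rcases eq_or_ne ((b ^ 2 - Δ) / 4).natAbs 0 with h0 | h0
    · rw [h0]; simp; positivity
    · refine (h _ h0).trans ?_
      gcongr
      have h3 : (((b ^ 2 - Δ) / 4).natAbs : ℤ) ≤ L ^ 2 + |Δ| + 1 := by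
        have h4 : b ^ 2 ≤ (L : ℤ) ^ 2 := sq_le_sq' hb.1 hb.2
        have h5 : 0 ≤ b ^ 2 := sq_nonneg b
        have h6 : 0 ≤ |Δ| := abs_nonneg _
        have h7 := le_abs_self Δ
        have h8 := neg_abs_le Δ
        generalize b ^ 2 = y at *
        generalize (L : ℤ) ^ 2 = z at *
        generalize |Δ| = w at *
        omega
      have h9 : ((((b ^ 2 - Δ) / 4).natAbs : ℤ) : ℝ) ≤ ((L ^ 2 + |Δ| + 1 : ℤ) : ℝ) :=
        Int.cast_le.2 h3
      rw [Int.cast_natCast] at h9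
      exact h9.trans (le_of_eq (by push_cast; rfl))
  calc ((formSet L Δ).card : ℝ) ≤ ∑ b ∈ Icc (-L : ℤ) L,
        (2 * ((b ^ 2 - Δ) / 4).natAbs.divisors.card : ℝ) := by exact_mod_cast h1
    _ ≤ ∑ b ∈ Icc (-L : ℤ) L, 2 * (C * ((L : ℝ) ^ 2 + |(Δ : ℝ)| + 1) ^ ε) :=
        Finset.sum_le_sum h2
    _ = (2 * L + 1) * (2 * (C * ((L : ℝ) ^ 2 + |(Δ : ℝ)| + 1) ^ ε)) := by
        rw [Finset.sum_const, nsmul_eq_mul, Int.card_Icc]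
        congr 1
        have : ((L : ℤ) + 1 - -L).toNat = 2 * L + 1 := by omega
        rw [this]; push_cast; ring
    _ ≤ (2 * L + 2) * (2 * (C * ((L : ℝ) ^ 2 + |(Δ : ℝ)| + 1) ^ ε)) := by
        gcongr; norm_num
    _ = _ := by ring

end Forms

namespace QuadField

open NumberField
open scoped nonZeroDivisors

variable {d : ℕ} {K : Type} [Field K] [NumberField K] (Q : QuadField d K)

include Q in
/-- Prime ideals of degree one above primes modulo which `d` is a square. -/
lemma exists_ideal_of_sq {p : ℕ} (hp : p.Prime) (hp2 : ¬ p ∣ 2 * d) {ρ : ℤ}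
    (hρ : (p : ℤ) ∣ ρ ^ 2 - d) : ∃ P P' : Ideal (𝓞 K), Ideal.absNorm P = p ∧
      Ideal.absNorm P' = p ∧ P * P' = Ideal.span {(p : 𝓞 K)} := by
  have hp0 : (p : 𝓞 K) ≠ 0 := by exact_mod_cast hp.ne_zero
  have hnp : ¬ (p : 𝓞 K) ∣ Q.el ρ 1 := by
    rintro ⟨y, hy⟩
    obtain ⟨n, hn⟩ := Q.trace_int y
    have h1 := congrArg (fun z : 𝓞 K => (z : K)) hy
    have h2 := congrArg Q.σ h1
    simp only [coe_el, map_mul, map_add, map_intCast, map_natCast, Q.σθ, Int.cast_one, one_mul] at h1 h2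
    have h3 : ((2 * ρ : ℤ) : K) = ((p * n : ℤ) : K) := by
      push_cast; rw [← hn]
      linear_combination h1 + h2
    have h4 : 2 * ρ = p * n := by exact_mod_cast h3
    have h5 : (p : ℤ) ∣ 2 * ρ := ⟨n, h4⟩
    have hpp := Nat.prime_iff_prime_int.1 hp
    apply hp2
    have h6 : (p : ℤ) ∣ 2 * d := by
      rcases hpp.dvd_or_dvd h5 with h | h
      · exact h.mul_right _
      · have := (h.pow (two_ne_zero)).sub hρ
        refine Dvd.dvd.mul_left ?_ _
        convert this using 1; ring
    exact_mod_cast h6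
  have hprod : Q.el (-ρ) 1 * Q.el ρ 1 = ((d - ρ ^ 2 : ℤ) : 𝓞 K) := by
    apply RingOfIntegers.ext
    simp only [map_mul, coe_el, map_intCast]
    push_cast
    linear_combination Q.sq
  obtain ⟨j, hj⟩ : (p : ℤ) ∣ d - ρ ^ 2 := by
    rw [← neg_sub, dvd_neg]; exact hρ
  set P : Ideal (𝓞 K) := Ideal.span {(p : 𝓞 K), Q.el (-ρ) 1} with hP
  have hle : Ideal.span {(p : 𝓞 K)} ≤ P := Ideal.span_mono (by simp)
  have hdv : P ∣ Ideal.span {(p : 𝓞 K)} := Ideal.dvd_iff_le.2 hle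
  have hnorm : Ideal.absNorm (Ideal.span {(p : 𝓞 K)}) = p ^ 2 := by
    rw [Q.absNorm_span _ hp0, Q.nrm_eq (n := p ^ 2) (by
      push_cast; simp only [map_natCast]; ring)]
    rw [Int.natAbs_pow, Int.natAbs_natCast]
  obtain ⟨P', hPP⟩ := hdv
  have hmul : Ideal.absNorm P * Ideal.absNorm P' = p ^ 2 := by rw [← map_mul, ← hPP, hnorm]
  have hn1 : Ideal.absNorm P ≠ 1 := by
    rw [Ne, Ideal.absNorm_eq_one_iff]
    intro h
    have : (1 : 𝓞 K) ∈ P := by rw [h]; trivial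
    rw [hP, Ideal.mem_span_pair] at this
    obtain ⟨a, b, hab⟩ := this
    apply hnp
    refine ⟨a * Q.el ρ 1 + b * j, ?_⟩
    have hj' : ((d - ρ ^ 2 : ℤ) : 𝓞 K) = p * j := by rw [hj]; push_cast; ring
    linear_combination (-Q.el ρ 1) * hab + b * hprod + b * hj'
  have hn2 : Ideal.absNorm P' ≠ 1 := by
    rw [Ne, Ideal.absNorm_eq_one_iff]
    rintro rfl
    rw [Ideal.mul_top] at hPP
    have : Q.el (-ρ) 1 ∈ Ideal.span {(p : 𝓞 K)} := by
      rw [hPP]; exact Ideal.subset_span (by simp)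
    rw [Ideal.mem_span_singleton] at this
    obtain ⟨y, hy⟩ := this
    apply hnp
    refine ⟨- Q.conj y, ?_⟩
    apply RingOfIntegers.ext
    have h1 := congrArg (fun z : 𝓞 K => Q.σ (z : K)) hy
    simp only [coe_el, map_mul, map_add, map_intCast, map_natCast, Q.σθ, Int.cast_one, one_mul,
      map_neg, coe_conj, Int.cast_neg] at h1 ⊢
    linear_combination -h1
  have hPn : Ideal.absNorm P = p := by
    have : Ideal.absNorm P ∣ p ^ 2 := ⟨_, hmul.symm⟩
    rw [Nat.dvd_prime_pow hp] at this
    obtain ⟨i, hi, hi'⟩ := this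
    interval_cases i
    · exact absurd (by simpa using hi') hn1
    · simpa using hi'
    · rw [hi'] at hmul
      exact absurd (Nat.eq_of_mul_eq_mul_left (pow_pos hp.pos 2) (by rw [hmul, mul_one])) hn2
  refine ⟨P, P', hPn, ?_, hPP.symm⟩
  rw [hPn] at hmul
  exact Nat.eq_of_mul_eq_mul_left hp.pos (by rw [hmul, pow_two])

lemma sq_of_sq_eq {d : ℕ} (hd : Squarefree d) {N m a : ℤ} (hN : N ≠ 0)
    (h : N ^ 2 * m = a ^ 2 * d) : ∃ r : ℤ, m = r ^ 2 * d := by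
  have h2 : IsSquare ((m * d : ℤ) : ℚ) := ⟨a * d / N, by
    have hN' : (N : ℚ) ≠ 0 := by exact_mod_cast hN
    have h' : (N : ℚ) ^ 2 * m = a ^ 2 * d := by exact_mod_cast h
    push_cast; field_simp; linear_combination (d : ℚ) * h'⟩
  rw [Rat.isSquare_intCast_iff] at h2
  obtain ⟨k, hk⟩ := h2
  have h3 : (d : ℤ) ∣ k := by
    have : d ∣ k.natAbs ^ 2 := by
      rw [← Int.natCast_dvd_natCast]
      exact ⟨m, by push_cast; rw [sq_abs]; linear_combination -hk⟩
    rw [hd.dvd_pow_iff_dvd (n := 2) (by norm_num)] at this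
    exact Int.natCast_dvd.2 this
  obtain ⟨r, rfl⟩ := h3
  have hd0 : (d : ℤ) ≠ 0 := by exact_mod_cast hd.ne_zero
  exact ⟨r, mul_right_cancel₀ hd0 (by linear_combination hk)⟩

lemma int_of_mul_mem {N x : ℤ} {y : ℕ} (h : y ∣ x.natAbs) (hN : (y : ℤ) = N) : ∃ A : ℤ, x = A * N := by
  subst hN
  obtain ⟨A, hA⟩ := Int.natCast_dvd.2 h
  exact ⟨A, by rw [hA, mul_comm]⟩

/-- The integral binary quadratic form of a basis of an ideal. -/
lemma exists_form (J : Ideal (𝓞 K)) (hJ : J ≠ ⊥) {f₁ f₂ : 𝓞 K} (hf : f₁ ≠ 0)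
    (m₁ : f₁ ∈ J) (m₂ : f₂ ∈ J) (hor : Q.φ (Q.σ (f₂ / f₁)) < Q.φ (f₂ / f₁))
    (hal : (Q.φ (Q.alt f₁ f₂)) ^ 2 ≤ 4 * d * (Ideal.absNorm J : ℝ) ^ 2) :
    ∃ A B C : ℤ, A ≠ 0 ∧ C ≠ 0 ∧ (f₁ : K) * Q.σ f₁ = A * (Ideal.absNorm J : K) ∧
      (f₂ : K) * Q.σ f₂ = C * (Ideal.absNorm J : K) ∧
      (f₁ : K) * Q.σ f₂ + Q.σ f₁ * f₂ = B * (Ideal.absNorm J : K) ∧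
      (B ^ 2 - 4 * (A * C) = d ∨ B ^ 2 - 4 * (A * C) = 4 * d) := by
  set N := Ideal.absNorm J with hN
  have hN0 : (N : ℤ) ≠ 0 := by
    rw [Ne, Nat.cast_eq_zero, hN, Ideal.absNorm_eq_zero_iff]; exact hJ
  have hNK : (N : K) ≠ 0 := by exact_mod_cast hN0
  have hd0 : 0 < d := by have := Q.one_lt; omega
  have hfK : (f₁ : K) ≠ 0 := by simpa using hf
  have key : ∀ x ∈ J, ∃ A : ℤ, (x : K) * Q.σ x = A * (N : K) := by
    intro x hx
    rcases eq_or_ne x 0 with rfl | h0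
    · exact ⟨0, by simp⟩
    have : N ∣ (Q.nrm x).natAbs := by
      rw [← Q.absNorm_span x h0, hN]
      exact Ideal.absNorm_dvd_absNorm_of_le ((Ideal.span_singleton_le_iff_mem _).2 hx)
    obtain ⟨A, hA⟩ := int_of_mul_mem this rfl
    exact ⟨A, by rw [Q.nrm_spec, hA]; push_cast; rfl⟩
  obtain ⟨A, hA⟩ := key f₁ m₁
  obtain ⟨C, hC⟩ := key f₂ m₂
  obtain ⟨E, hE⟩ := key (f₁ + f₂) (J.add_mem m₁ m₂)
  simp only [map_add] at hE
  have hf₂ : (f₂ : K) ≠ 0 := by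
    rintro h; rw [h] at hor; simp at hor
  have hB : (f₁ : K) * Q.σ f₂ + Q.σ f₁ * f₂ = ((E - A - C : ℤ) : K) * (N : K) := by
    push_cast; linear_combination hE - hA - hC
  set B := E - A - C with hBdef
  obtain ⟨a, ha⟩ : ∃ a : ℤ, Q.alt f₁ f₂ = a * Q.θ := by
    refine ⟨Q.vco (f₁ * Q.conj f₂), ?_⟩
    rw [← Q.vco_spec]
    simp only [map_mul, coe_conj, alt, Q.σσ]
  have hsq : (N : ℤ) ^ 2 * (B ^ 2 - 4 * (A * C)) = a ^ 2 * d := by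
    have : (((N : ℤ) ^ 2 * (B ^ 2 - 4 * (A * C)) : ℤ) : K) = ((a ^ 2 * d : ℤ) : K) := by
      push_cast
      rw [← Q.sq]
      have : ((N : K) ^ 2 * (B ^ 2 - 4 * (A * C))) = (B * N) ^ 2 - 4 * (A * N) * (C * N) := by ring
      rw [this, ← hA, ← hB, ← hC, ← mul_pow, ← ha, alt]; ring
    exact_mod_cast this
  have ha0 : a ≠ 0 := by
    rintro rfl
    apply hor.ne
    congr 1
    rw [map_div₀, div_eq_div_iff (Q.σ_ne hfK) hfK]
    simp only [alt, Int.cast_zero, zero_mul] at ha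
    linear_combination ha
  obtain ⟨r, hr⟩ := sq_of_sq_eq Q.sqf hN0 hsq
  have hNr : ((N : ℤ) * r) ^ 2 = a ^ 2 := by
    have : ((d : ℕ) : ℤ) ≠ 0 := by exact_mod_cast hd0.ne'
    apply mul_right_cancel₀ this
    rw [← hsq, hr]; ring
  have hr0 : r ≠ 0 := by
    rintro rfl
    apply ha0
    have : a ^ 2 = 0 := by rw [← hNr]; ring
    simpa using this
  have hr4 : r ^ 2 ≤ 4 := by
    rw [ha, map_mul, Q.φθ, map_intCast, mul_pow, Real.sq_sqrt (by positivity)] at hal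
    have h1 : (a : ℝ) ^ 2 * d ≤ (4 * (N : ℝ) ^ 2) * d := by linarith
    have h2 := le_of_mul_le_mul_right h1 (by positivity)
    have h3 : a ^ 2 ≤ 4 * (N : ℤ) ^ 2 := by exact_mod_cast h2
    rw [← hNr] at h3
    have h4 : (N : ℤ) ^ 2 * r ^ 2 ≤ (N : ℤ) ^ 2 * 4 := by linarith
    exact le_of_mul_le_mul_left h4 (by positivity)
  refine ⟨A, B, C, ?_, ?_, hA, hC, hB, ?_⟩
  · rintro rfl
    rw [Int.cast_zero, zero_mul, mul_eq_zero] at hA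
    exact hA.elim hfK (Q.σ_ne hfK)
  · rintro rfl
    rw [Int.cast_zero, zero_mul, mul_eq_zero] at hC
    exact hC.elim hf₂ (Q.σ_ne hf₂)
  · rw [hr]
    have : r ≤ 2 := by nlinarith
    have : -2 ≤ r := by nlinarith
    interval_cases r <;> simp_all

/-- The data attached to a cube root ideal and a prime ideal: a reduced basis of their product,
its quadratic form, and the shape of the first basis vector. -/
structure ReducedItem (δ : 𝓞 K) (I P : Ideal (𝓞 K)) (A B C b : ℤ) : Prop where
  data : ∃ f₁ f₂ : 𝓞 K, f₁ ≠ 0 ∧ f₁ ∈ I * P ∧ f₂ ∈ I * P ∧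
    (∀ x ∈ I * P, ∃ a b : ℤ, x = a * f₁ + b * f₂) ∧ Q.φ (Q.σ (f₂ / f₁)) < Q.φ (f₂ / f₁) ∧ A ≠ 0 ∧
    (f₁ : K) * Q.σ f₁ = A * (Ideal.absNorm (I * P) : K) ∧
    (f₂ : K) * Q.σ f₂ = C * (Ideal.absNorm (I * P) : K) ∧
    (f₁ : K) * Q.σ f₂ + Q.σ f₁ * f₂ = B * (Ideal.absNorm (I * P) : K) ∧
    b = Int.log 2 ((|Q.φ f₁| ^ 3 / |Q.φ δ|) / (|Q.φ (Q.σ f₁)| ^ 3 / |Q.φ (Q.σ δ)|))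

/-- The set of possible values of the data of a `ReducedItem`. -/
noncomputable def itemSet (d : ℕ) : Finset ((ℤ × ℤ × ℤ) × ℤ) :=
  (formSet (Nat.sqrt (6 * d)) d ∪ formSet (Nat.sqrt (6 * d)) (4 * d)) ×ˢ
    Finset.Icc (-(Nat.clog 2 (152 * d ^ 3) : ℤ)) (Nat.clog 2 (152 * d ^ 3))

lemma int_log_mem {n : ℕ} {x : ℝ} (hx : 0 < x) (h1 : x ≤ n) (h2 : x⁻¹ ≤ n) :
    Int.log 2 x ∈ Finset.Icc (-(Nat.clog 2 n : ℤ)) (Nat.clog 2 n) := by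
  rw [Finset.mem_Icc]
  constructor
  · have h3 := Int.clog_mono_right (b := 2) (inv_pos.2 hx) h2
    rw [Int.clog_inv, Int.clog_natCast] at h3
    omega
  · have h3 := Int.log_mono_right (b := 2) hx h1
    rw [Int.log_natCast] at h3
    have := Nat.log_le_clog 2 n
    omega

lemma cube_ratio_le {d : ℕ} (hd0 : (1 : ℝ) ≤ d) {x y : ℝ} (hx : 0 < x) (hy : 0 < y)
    (h : (x ^ 2 + y ^ 2) ^ 2 ≤ 16 / 3 * d * (x ^ 2 * y ^ 2)) :
    x ^ 3 / y ^ 3 ≤ ((152 * d ^ 3 : ℕ) : ℝ) := by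
  have h1 : x ^ 2 ≤ 16 / 3 * d * y ^ 2 := by
    have : x ^ 2 * x ^ 2 ≤ x ^ 2 * (16 / 3 * d * y ^ 2) := by
      have : 0 ≤ x ^ 2 * y ^ 2 := by positivity
      have : 0 ≤ y ^ 2 * y ^ 2 := by positivity
      have : (x ^ 2 + y ^ 2) ^ 2 = x ^ 2 * x ^ 2 + 2 * (x ^ 2 * y ^ 2) + y ^ 2 * y ^ 2 := by ring
      have : x ^ 2 * (16 / 3 * d * y ^ 2) = 16 / 3 * d * (x ^ 2 * y ^ 2) := by ring
      linarith
    exact le_of_mul_le_mul_left this (by positivity)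
  have h2 : (x ^ 3) ^ 2 ≤ 152 * (d : ℝ) ^ 3 * (y ^ 3) ^ 2 := by
    calc (x ^ 3) ^ 2 = (x ^ 2) ^ 3 := by ring
      _ ≤ (16 / 3 * d * y ^ 2) ^ 3 := by gcongr
      _ = (16 / 3) ^ 3 * ((d : ℝ) ^ 3 * (y ^ 3) ^ 2) := by ring
      _ ≤ 152 * ((d : ℝ) ^ 3 * (y ^ 3) ^ 2) := by gcongr; norm_num
      _ = _ := by ring
  have h4 : (1 : ℝ) ≤ 152 * (d : ℝ) ^ 3 := by
    have : (1 : ℝ) ≤ (d : ℝ) ^ 3 := one_le_pow₀ hd0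
    linarith
  push_cast
  rw [div_le_iff₀ (by positivity)]
  refine (sq_le_sq₀ (by positivity) (by positivity)).1 (h2.trans ?_)
  rw [mul_pow]
  gcongr
  exact le_self_pow₀ h4 two_ne_zero

theorem exists_reducedItem {δ : 𝓞 K} (hδ : δ ≠ 0) {I P : Ideal (𝓞 K)} (hI : I ^ 3 = Ideal.span {δ})
    (hP : P ≠ ⊥) : ∃ A B C b : ℤ, Q.ReducedItem δ I P A B C b ∧ ((A, B, C), b) ∈ itemSet d := by
  have hI0 : I ≠ ⊥ := by
    rintro rfl
    apply hδ
    rw [← Ideal.span_singleton_eq_bot, ← hI]; exact zero_pow three_ne_zero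
  have hφ1 : 0 < |Q.φ δ| := by simpa using hδ
  have hφ2 : 0 < |Q.φ (Q.σ δ)| := by simpa using hδ
  obtain ⟨r₁, hr₁, hr₁'⟩ : ∃ r : ℝ, 0 < r ∧ r ^ 3 = |Q.φ δ| :=
    ⟨_, Real.rpow_pos_of_pos hφ1 (1 / 3), by
      rw [← Real.rpow_natCast, ← Real.rpow_mul hφ1.le]; norm_num⟩
  obtain ⟨r₂, hr₂, hr₂'⟩ : ∃ r : ℝ, 0 < r ∧ r ^ 3 = |Q.φ (Q.σ δ)| :=
    ⟨_, Real.rpow_pos_of_pos hφ2 (1 / 3), by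
      rw [← Real.rpow_natCast, ← Real.rpow_mul hφ2.le]; norm_num⟩
  have hrN : r₁ * r₂ = Ideal.absNorm I := by
    have h1 : (r₁ * r₂) ^ 3 = (Ideal.absNorm I : ℝ) ^ 3 := by
      rw [mul_pow, hr₁', hr₂', ← Q.absNorm_real δ hδ, ← hI]; simp
    exact (pow_left_inj₀ (by positivity) (by positivity) (by norm_num)).1 h1
  have hJ : I * P ≠ ⊥ := mul_ne_zero hI0 hP
  obtain ⟨f₁, f₂, hf, m₁, m₂, hsp, hor, hal, hle, hpr⟩ := Q.exists_reduced_basis' (I * P) hJ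
    (w₁ := (r₁ ^ 2)⁻¹) (w₂ := (r₂ ^ 2)⁻¹) (by positivity) (by positivity)
  obtain ⟨A, B, C, hA0, hC0, hA, hC, hB, hdisc⟩ := Q.exists_form (I * P) hJ hf m₁ m₂ hor hal
  set N : ℝ := ((Ideal.absNorm (I * P) : ℕ) : ℝ) with hN
  have hN0 : 0 < N := by
    rw [hN]; norm_cast
    rw [Nat.pos_iff_ne_zero, Ne, Ideal.absNorm_eq_zero_iff]; exact hJ
  have hd0 : (1 : ℝ) ≤ d := by exact_mod_cast Q.one_lt.le
  refine ⟨A, B, C, _, ⟨f₁, f₂, hf, m₁, m₂, hsp, hor, hA0, hA, hC, hB, rfl⟩, ?_⟩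
  have hA' : Q.φ f₁ * Q.φ (Q.σ f₁) = A * N := by
    rw [← map_mul, hA, map_mul, map_intCast, map_natCast]
  have hB' : Q.φ f₁ * Q.φ (Q.σ f₂) + Q.φ (Q.σ f₁) * Q.φ f₂ = B * N := by
    rw [← map_mul, ← map_mul, ← map_add, hB, map_mul, map_intCast, map_natCast]
  rw [itemSet, Finset.mem_product]
  constructor
  · have hBle : |B| ≤ (Nat.sqrt (6 * d) : ℕ) := by
      have h1 : (r₁ ^ 2)⁻¹ * (r₂ ^ 2)⁻¹ * ((B : ℝ) * N) ^ 2 ≤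
          (r₁ ^ 2)⁻¹ * (r₂ ^ 2)⁻¹ * (16 / 3 * d * N ^ 2) := by
        refine le_trans ?_ (hpr.trans (le_of_eq (by ring)))
        rw [← hB']
        simp only [qf]
        nlinarith [sq_nonneg ((r₁ ^ 2)⁻¹ * (Q.φ f₁ * Q.φ f₂) -
          (r₂ ^ 2)⁻¹ * (Q.φ (Q.σ f₁) * Q.φ (Q.σ f₂)))]
      have h2 := le_of_mul_le_mul_left h1 (by positivity)
      have h3 : (B : ℝ) ^ 2 ≤ 6 * d := by
        rw [mul_pow] at h2
        have := le_of_mul_le_mul_right h2 (by positivity)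
        linarith
      have h4 : B ^ 2 ≤ 6 * d := by exact_mod_cast h3
      have h5 : B.natAbs ≤ Nat.sqrt (6 * d) := by
        rw [Nat.le_sqrt']
        zify; rw [sq_abs]; exact h4
      rw [Int.abs_eq_natAbs]; exact_mod_cast h5
    rw [Finset.mem_union]
    rcases hdisc with h | h
    · exact Or.inl (mem_formSet hBle h hA0 hC0)
    · exact Or.inr (mem_formSet hBle h hA0 hC0)
  · set x₁ := |Q.φ f₁| / r₁ with hx₁
    set x₂ := |Q.φ (Q.σ f₁)| / r₂ with hx₂
    have hx₁0 : 0 < x₁ := by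
      have : 0 < |Q.φ f₁| := by simpa using hf
      positivity
    have hx₂0 : 0 < x₂ := by
      have : 0 < |Q.φ (Q.σ f₁)| := by simpa using hf
      positivity
    have hq : Q.qf (r₁ ^ 2)⁻¹ (r₂ ^ 2)⁻¹ f₁ = x₁ ^ 2 + x₂ ^ 2 := by
      simp only [qf, hx₁, hx₂, div_pow, sq_abs]; ring
    rw [hq] at hle hpr
    have hxN : (N / (r₁ * r₂)) ^ 2 ≤ x₁ ^ 2 * x₂ ^ 2 := by
      have h1 : x₁ ^ 2 * x₂ ^ 2 = (A * N / (r₁ * r₂)) ^ 2 := by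
        rw [← hA', hx₁, hx₂, div_pow, div_pow, sq_abs, sq_abs]; field_simp
      rw [h1, mul_div_assoc, mul_pow]
      have h2 : (1 : ℝ) ≤ (A : ℝ) ^ 2 := by
        have : 1 ≤ A ^ 2 := by have := pow_pos (abs_pos.2 hA0) 2; rw [sq_abs] at this; omega
        exact_mod_cast this
      have : 0 ≤ (N / (r₁ * r₂)) ^ 2 := by positivity
      nlinarith
    have hbd : (x₁ ^ 2 + x₂ ^ 2) ^ 2 ≤ 16 / 3 * d * (x₁ ^ 2 * x₂ ^ 2) := by
      calc (x₁ ^ 2 + x₂ ^ 2) ^ 2 = (x₁ ^ 2 + x₂ ^ 2) * (x₁ ^ 2 + x₂ ^ 2) := by ring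
        _ ≤ (x₁ ^ 2 + x₂ ^ 2) * _ := by gcongr
        _ ≤ _ := hpr
        _ = 16 / 3 * d * (N / (r₁ * r₂)) ^ 2 := by field_simp
        _ ≤ _ := by gcongr
    have hyx : (|Q.φ f₁| ^ 3 / |Q.φ δ|) / (|Q.φ (Q.σ f₁)| ^ 3 / |Q.φ (Q.σ δ)|) = x₁ ^ 3 / x₂ ^ 3 := by
      rw [hx₁, hx₂, div_pow, div_pow, hr₁', hr₂']
    rw [hyx]
    apply int_log_mem (by positivity) (cube_ratio_le hd0 hx₁0 hx₂0 hbd)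
    rw [inv_div]
    exact cube_ratio_le hd0 hx₂0 hx₁0 (by rw [add_comm, mul_comm (x₂ ^ 2)]; exact hbd)

end QuadField

/-- The Diophantine condition satisfied by two primes giving rise to the same form. -/
def PairCond (d Z p p' : ℕ) : Prop := ∃ D : ℤ, (D = d ∨ D = -3 * d) ∧ ∃ u v : ℤ, v ≠ 0 ∧
  (u ^ 2 - D * v ^ 2 = 4 * ((p : ℤ) * p') ^ 3 ∨ u ^ 2 - D * v ^ 2 = -(4 * ((p : ℤ) * p') ^ 3)) ∧
  u ^ 2 ≤ 8 * (Z : ℤ) ^ 6 ∧ d * v ^ 2 ≤ 8 * (Z : ℤ) ^ 6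

open Classical in
/-- The pairs of distinct primes satisfying `PairCond`. -/
noncomputable def pairSet (d Z : ℕ) (P : Finset ℕ) : Finset (ℕ × ℕ) :=
  (P ×ˢ P).filter fun q => q.1 ≠ q.2 ∧ PairCond d Z q.1 q.2

lemma root_eq_of_sym {x y x' y' : ℝ} (h1 : x + y = x' + y') (h2 : x * y = x' * y') (h : y < x)
    (h' : y' < x') : x = x' := by
  have : (x - x') * (x - y') = 0 := by linear_combination x * h1 - h2
  rcases mul_eq_zero.1 this with h3 | h3 <;> linarith

lemma size_of_ratio {a b y y' W : ℝ} (hy : 0 < y) (hy' : 0 < y') (hl : Int.log 2 y = Int.log 2 y')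
    (h : |a| * y = y' * |b|) (hW : |a| * |b| ≤ W) : (a + b) ^ 2 ≤ 8 * W ∧ (a - b) ^ 2 ≤ 8 * W := by
  have hyy : ∀ {s t : ℝ}, 0 < s → 0 < t → Int.log 2 s = Int.log 2 t → s ≤ 2 * t := by
    intro s t hs ht hst
    have b1 := Int.lt_zpow_succ_log_self (R := ℝ) (b := 2) (by norm_num) s
    have b2 := Int.zpow_log_le_self (R := ℝ) (b := 2) (by norm_num) ht
    rw [← hst] at b2
    rw [zpow_add_one₀ (by norm_num)] at b1
    push_cast at b1 b2
    linarith
  have h1 := hyy hy' hy hl.symm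
  have h2 := hyy hy hy' hl
  have ha := abs_nonneg a
  have hb := abs_nonneg b
  have k1 : |a| ≤ 2 * |b| := by
    have : |a| * y ≤ (2 * |b|) * y := by rw [h]; nlinarith
    exact le_of_mul_le_mul_right this hy
  have k2 : |b| ≤ 2 * |a| := by
    have : |b| * y' ≤ (2 * |a|) * y' := by rw [mul_comm, ← h]; nlinarith
    exact le_of_mul_le_mul_right this hy'
  have m1 : a ^ 2 ≤ 2 * W := by rw [← sq_abs]; nlinarith
  have m2 : b ^ 2 ≤ 2 * W := by rw [← sq_abs]; nlinarith
  constructor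
  · nlinarith [sq_nonneg (a - b)]
  · nlinarith [sq_nonneg (a + b)]

lemma four_mul_cube_ne_sq {p p' : ℕ} (hp : p.Prime) (hp' : p'.Prime) (hne : p ≠ p') (h2 : p ≠ 2)
    (u : ℤ) : u.natAbs ^ 2 ≠ 4 * (p * p') ^ 3 := by
  intro h
  have := congrArg (fun n => n.factorization p) h
  have h4 : (4 : ℕ) = 2 ^ 2 := rfl
  simp only [Nat.factorization_pow] at this
  rw [Nat.factorization_mul (by norm_num) (pow_ne_zero _ (mul_ne_zero hp.ne_zero hp'.ne_zero)),
    Nat.factorization_pow, Nat.factorization_mul hp.ne_zero hp'.ne_zero, h4, Nat.factorization_pow] at this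
  simp [hp.factorization, hp'.factorization, Nat.prime_two.factorization, hne, h2] at this
  omega

namespace QuadField

open NumberField
open scoped nonZeroDivisors

variable {d : ℕ} {K : Type} [Field K] [NumberField K] {Q : QuadField d K}

lemma ratio_eq {N N' : ℕ} {f₁ f₂ g₁ g₂ : 𝓞 K} {A B C : ℤ} (hA0 : A ≠ 0) (hf : f₁ ≠ 0) (hg : g₁ ≠ 0)
    (hN : N ≠ 0) (hN' : N' ≠ 0)
    (hor : Q.φ (Q.σ (f₂ / f₁)) < Q.φ (f₂ / f₁)) (hor' : Q.φ (Q.σ (g₂ / g₁)) < Q.φ (g₂ / g₁))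
    (hA : (f₁ : K) * Q.σ f₁ = A * (N : K)) (hC : (f₂ : K) * Q.σ f₂ = C * (N : K))
    (hB : (f₁ : K) * Q.σ f₂ + Q.σ f₁ * f₂ = B * (N : K))
    (hA' : (g₁ : K) * Q.σ g₁ = A * (N' : K)) (hC' : (g₂ : K) * Q.σ g₂ = C * (N' : K))
    (hB' : (g₁ : K) * Q.σ g₂ + Q.σ g₁ * g₂ = B * (N' : K)) : f₁ * g₂ = g₁ * f₂ := by
  have key : ∀ {M : ℕ} {x y : 𝓞 K}, M ≠ 0 → x ≠ 0 → (x : K) * Q.σ x = A * (M : K) →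
      (y : K) * Q.σ y = C * (M : K) → (x : K) * Q.σ y + Q.σ x * y = B * (M : K) →
      Q.φ (y / x) + Q.φ (Q.σ (y / x)) = B / A ∧ Q.φ (y / x) * Q.φ (Q.σ (y / x)) = C / A := by
    intro M x y hM hx h1 h2 h3
    have hx' : (x : K) ≠ 0 := by simpa using hx
    have hσ := Q.σ_ne hx'
    have hAK : (A : K) ≠ 0 := by exact_mod_cast hA0
    have hMK : (M : K) ≠ 0 := by exact_mod_cast hM
    rw [← map_add, ← map_mul]
    have e1 : (y / x : K) + Q.σ (y / x) = B / A := by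
      rw [map_div₀, div_add_div _ _ hx' hσ, h1, div_eq_div_iff (mul_ne_zero hAK hMK) hAK]
      linear_combination (A : K) * h3
    have e2 : (y / x : K) * Q.σ (y / x) = C / A := by
      rw [map_div₀, div_mul_div_comm, h1, h2]
      field_simp
    rw [e1, e2]; simp
  obtain ⟨s1, s2⟩ := key hN hf hA hC hB
  obtain ⟨t1, t2⟩ := key hN' hg hA' hC' hB'
  have h := Q.φ.injective (root_eq_of_sym (s1.trans t1.symm) (s2.trans t2.symm) hor hor')
  rw [div_eq_div_iff (by simpa using hf) (by simpa using hg)] at h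
  apply RingOfIntegers.ext
  push_cast
  linear_combination -h

lemma absNorm_ne_zero' {J : Ideal (𝓞 K)} (h : J ≠ ⊥) : Ideal.absNorm J ≠ 0 := by
  rwa [Ne, Ideal.absNorm_eq_zero_iff]

lemma ReducedItem.class_eq {δ δ' : 𝓞 K} {I I' : (Ideal (𝓞 K))⁰} {P : Ideal (𝓞 K)} (hP : P ≠ ⊥)
    {A B C b b' : ℤ} (h : Q.ReducedItem δ I P A B C b) (h' : Q.ReducedItem δ' I' P A B C b') :
    ClassGroup.mk0 I = ClassGroup.mk0 I' := by
  obtain ⟨f₁, f₂, hf, m₁, m₂, hsp, hor, hA0, hA, hC, hB, -⟩ := h.data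
  obtain ⟨g₁, g₂, hg, n₁, n₂, hsp', hor', -, hA', hC', hB', -⟩ := h'.data
  have hJ : (I : Ideal (𝓞 K)) * P ≠ 0 := mul_ne_zero (nonZeroDivisors.coe_ne_zero I) hP
  have hJ' : (I' : Ideal (𝓞 K)) * P ≠ 0 := mul_ne_zero (nonZeroDivisors.coe_ne_zero I') hP
  have hr := ratio_eq hA0 hf hg (absNorm_ne_zero' hJ) (absNorm_ne_zero' hJ') hor hor' hA hC hB hA' hC' hB'
  have hs := span_mul_eq_of_ratio (I := ⟨_, mem_nonZeroDivisors_of_ne_zero hJ⟩)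
    (J := ⟨_, mem_nonZeroDivisors_of_ne_zero hJ'⟩) hsp hsp' m₁ m₂ n₁ n₂ hr
  simp only [← mul_assoc] at hs
  have hs' := mul_right_cancel₀ hP hs
  exact ClassGroup.mk0_eq_mk0_iff.2 ⟨g₁, f₁, hg, hf, hs'⟩

lemma ReducedItem.pairCond {δ δ' : 𝓞 K} (hδ : δ ≠ 0) (hδ' : δ' ≠ 0) {I I' P P' T : Ideal (𝓞 K)}
    (hI : I ^ 3 = Ideal.span {δ}) (hI' : I' ^ 3 = Ideal.span {δ'})
    {p p' Z : ℕ} (hp : p.Prime) (hp' : p'.Prime) (hne : p ≠ p') (h2 : p ≠ 2)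
    (hpZ : p ≤ Z) (hpZ' : p' ≤ Z) (hPn : Ideal.absNorm P = p) (hTn : Ideal.absNorm T = p)
    (hPT : P * T = Ideal.span {(p : 𝓞 K)}) (hPn' : Ideal.absNorm P' = p')
    {A B C b : ℤ} (h : Q.ReducedItem δ I P A B C b) (h' : Q.ReducedItem δ' I' P' A B C b) :
    PairCond d Z p p' := by
  obtain ⟨f₁, f₂, hf, m₁, m₂, hsp, hor, hA0, hA, hC, hB, hb⟩ := h.data
  obtain ⟨g₁, g₂, hg, n₁, n₂, hsp', hor', -, hA', hC', hB', hb'⟩ := h'.data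
  have hne0 : ∀ {J : Ideal (𝓞 K)} {η : 𝓞 K}, η ≠ 0 → J ^ 3 = Ideal.span {η} → J ≠ ⊥ := by
    rintro J η hη hJ rfl
    apply hη
    rw [← Ideal.span_singleton_eq_bot, ← hJ]; exact zero_pow three_ne_zero
  have hP0 : P ≠ ⊥ := by rintro rfl; simp at hPn; exact hp.ne_zero hPn.symm
  have hP0' : P' ≠ ⊥ := by rintro rfl; simp at hPn'; exact hp'.ne_zero hPn'.symm
  have hJ : I * P ≠ 0 := mul_ne_zero (hne0 hδ hI) hP0
  have hJ' : I' * P' ≠ 0 := mul_ne_zero (hne0 hδ' hI') hP0'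
  have hr := ratio_eq hA0 hf hg (absNorm_ne_zero' hJ) (absNorm_ne_zero' hJ') hor hor' hA hC hB hA' hC' hB'
  have hs := span_mul_eq_of_ratio (I := ⟨_, mem_nonZeroDivisors_of_ne_zero hJ⟩)
    (J := ⟨_, mem_nonZeroDivisors_of_ne_zero hJ'⟩) hsp hsp' m₁ m₂ n₁ n₂ hr
  simp only at hs
  have hcube : Ideal.span {g₁ ^ 3 * δ * (p : 𝓞 K) ^ 3} = Ideal.span {f₁ ^ 3 * δ'} * (P' * T) ^ 3 := by
    rw [← Ideal.span_singleton_mul_span_singleton, ← Ideal.span_singleton_mul_span_singleton,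
      ← Ideal.span_singleton_mul_span_singleton, ← Ideal.span_singleton_pow, ← Ideal.span_singleton_pow,
      ← Ideal.span_singleton_pow, ← hI, ← hI', ← hPT]
    calc Ideal.span {g₁} ^ 3 * I ^ 3 * (P * T) ^ 3 = (Ideal.span {g₁} * (I * P)) ^ 3 * T ^ 3 := by ring
      _ = _ := by rw [hs]; ring
  have hfδ : f₁ ^ 3 * δ' ≠ 0 := mul_ne_zero (pow_ne_zero _ hf) hδ'
  obtain ⟨γ, hγ⟩ : f₁ ^ 3 * δ' ∣ g₁ ^ 3 * δ * (p : 𝓞 K) ^ 3 := by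
    rw [← Ideal.span_singleton_le_span_singleton, hcube]; exact Ideal.mul_le_left
  have hγs : Ideal.span {γ} = (P' * T) ^ 3 := by
    rw [hγ, ← Ideal.span_singleton_mul_span_singleton] at hcube
    exact mul_left_cancel₀ (by rw [Ne, Ideal.zero_eq_bot, Ideal.span_singleton_eq_bot]; exact hfδ) hcube
  have hγ0 : γ ≠ 0 := by
    rintro rfl
    rw [mul_zero] at hγ
    exact mul_ne_zero (mul_ne_zero (pow_ne_zero 3 hg) hδ)
      (pow_ne_zero 3 (by exact_mod_cast hp.ne_zero)) hγ
  have hγn : (Q.nrm γ).natAbs = (p * p') ^ 3 := by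
    rw [← Q.absNorm_span γ hγ0, hγs, map_pow, map_mul, hPn', hTn, mul_comm]
  obtain ⟨u, v, huv, hn⟩ := Q.exists_uv γ
  have hnorm : u ^ 2 - d * v ^ 2 = 4 * ((p : ℤ) * p') ^ 3 ∨
      u ^ 2 - d * v ^ 2 = -(4 * ((p : ℤ) * p') ^ 3) := by
    rw [hn]
    rcases Int.natAbs_eq (Q.nrm γ) with h | h <;> rw [h, hγn] <;> push_cast
    · exact Or.inl rfl
    · right; ring
  have hv : v ≠ 0 := by
    rintro rfl
    apply four_mul_cube_ne_sq hp hp' hne h2 u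
    have h0 : u ^ 2 - d * (0 : ℤ) ^ 2 = u ^ 2 := by ring
    rw [h0] at hnorm
    zify
    rw [sq_abs]
    rcases hnorm with h | h
    · exact h
    · exfalso
      have : 0 < 4 * ((p : ℤ) * p') ^ 3 := by
        have := hp.pos; have := hp'.pos; positivity
      have := sq_nonneg u
      linarith
  -- sizes of the conjugates
  have hpos : ∀ {x : 𝓞 K}, x ≠ 0 → 0 < |Q.φ x| ∧ 0 < |Q.φ (Q.σ x)| := by
    intro x hx; constructor <;> simpa using hx
  obtain ⟨f1, f2⟩ := hpos hf
  obtain ⟨g1, g2⟩ := hpos hg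
  obtain ⟨d1, d2⟩ := hpos hδ
  obtain ⟨e1, e2⟩ := hpos hδ'
  obtain ⟨c1, c2⟩ := hpos hγ0
  have hγK := congrArg (fun z : 𝓞 K => (z : K)) hγ
  simp only [map_mul, map_pow, map_natCast] at hγK
  have hg1 := congrArg (fun z => |Q.φ z|) hγK
  have hg2 := congrArg (fun z => |Q.φ (Q.σ z)|) hγK
  simp only [map_mul, map_pow, map_natCast, abs_mul, abs_pow, Nat.abs_cast] at hg1 hg2
  have hprod : |Q.φ γ| * |Q.φ (Q.σ γ)| = ((p : ℝ) * p') ^ 3 := by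
    rw [← Q.absNorm_real γ hγ0, Q.absNorm_span γ hγ0, hγn]; push_cast; rfl
  set y := (|Q.φ f₁| ^ 3 / |Q.φ δ|) / (|Q.φ (Q.σ f₁)| ^ 3 / |Q.φ (Q.σ δ)|) with hy
  set y' := (|Q.φ g₁| ^ 3 / |Q.φ δ'|) / (|Q.φ (Q.σ g₁)| ^ 3 / |Q.φ (Q.σ δ')|) with hy'
  have hy0 : 0 < y := by positivity
  have hy0' : 0 < y' := by positivity
  have hratio : |Q.φ γ| * y = y' * |Q.φ (Q.σ γ)| := by
    have hp3 : 0 < (p : ℝ) ^ 3 := by have := hp.pos; positivity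
    have a1 : |Q.φ γ| = |Q.φ g₁| ^ 3 * |Q.φ δ| * (p : ℝ) ^ 3 / (|Q.φ f₁| ^ 3 * |Q.φ δ'|) := by
      rw [eq_div_iff (by positivity), hg1]; ring
    have a2 : |Q.φ (Q.σ γ)| = |Q.φ (Q.σ g₁)| ^ 3 * |Q.φ (Q.σ δ)| * (p : ℝ) ^ 3 /
        (|Q.φ (Q.σ f₁)| ^ 3 * |Q.φ (Q.σ δ')|) := by
      rw [eq_div_iff (by positivity), hg2]; ring
    rw [a1, a2, hy, hy']
    field_simp
  have hpp : ((p : ℝ) * p') ^ 3 ≤ (Z : ℝ) ^ 6 := by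
    have b1 : (p : ℝ) ≤ Z := by exact_mod_cast hpZ
    have b2 : (p' : ℝ) ≤ Z := by exact_mod_cast hpZ'
    calc ((p : ℝ) * p') ^ 3 ≤ ((Z : ℝ) * Z) ^ 3 := by gcongr
      _ = _ := by ring
  rw [← hprod] at hpp
  obtain ⟨k1, k2⟩ := size_of_ratio hy0 hy0' (hb.symm.trans hb') hratio hpp
  have q1 := congrArg Q.φ huv
  have q2 := congrArg (fun z => Q.φ (Q.σ z)) huv
  simp only [map_mul, map_add, map_ofNat, map_intCast, Q.σθ, map_neg, Q.φθ] at q1 q2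
  refine ⟨d, Or.inl rfl, u, v, hv, hnorm, ?_, ?_⟩
  · have : (u : ℝ) ^ 2 ≤ 8 * (Z : ℝ) ^ 6 := by
      have : (u : ℝ) = Q.φ γ + Q.φ (Q.σ γ) := by linarith
      rw [this]; exact k1
    exact_mod_cast this
  · have : (d : ℝ) * (v : ℝ) ^ 2 ≤ 8 * (Z : ℝ) ^ 6 := by
      have h1 : (v : ℝ) * Real.sqrt d = Q.φ γ - Q.φ (Q.σ γ) := by linarith
      have h2 : (d : ℝ) * (v : ℝ) ^ 2 = (v * Real.sqrt d) ^ 2 := by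
        rw [mul_pow, Real.sq_sqrt (by positivity)]; ring
      rw [h2, h1]; exact k2
    exact_mod_cast this

variable (Q) in
include Q in
/-- The count of cube roots of unity in the class group by means of primes split in `K`. -/
theorem card_torsion_mul_sq_le_of_split {Z : ℕ} {P : Finset ℕ} (hP : ∀ p ∈ P, p.Prime ∧ ¬ p ∣ 2 * d ∧
    p ≤ Z ∧ ∃ ρ : ℤ, (p : ℤ) ∣ ρ ^ 2 - d) :
    Nat.card {c : ClassGroup (𝓞 K) // c ^ 3 = 1} * P.card ^ 2 ≤
      (itemSet d).card * (P.card + (pairSet d Z P).card) := by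
  classical
  have h0 : ∀ p, ∃ A T : Ideal (𝓞 K), p ∈ P → Ideal.absNorm A = p ∧
      Ideal.absNorm T = p ∧ A * T = Ideal.span {(p : 𝓞 K)} := by
    intro p
    by_cases hp : p ∈ P
    · obtain ⟨h1, h2, -, ρ, h3⟩ := hP p hp
      obtain ⟨A, T, h⟩ := Q.exists_ideal_of_sq h1 h2 h3
      exact ⟨A, T, fun _ => h⟩
    · exact ⟨⊥, ⊥, fun h => absurd h hp⟩
  choose 𝔭 T h𝔭 using h0
  choose I δ hδ hIc hI using fun c : {c : ClassGroup (𝓞 K) // c ^ 3 = 1} =>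
    exists_torsion_ideal c.1 c.2
  have hne : ∀ p ∈ P, 𝔭 p ≠ ⊥ := by
    intro p hp h
    have h1 := (h𝔭 p hp).1
    rw [h] at h1
    simp at h1
    exact (hP p hp).1.ne_zero h1.symm
  have h2 : ∀ (c : {c : ClassGroup (𝓞 K) // c ^ 3 = 1}) (p : ℕ), ∃ f : (ℤ × ℤ × ℤ) × ℤ, p ∈ P →
      Q.ReducedItem (δ c) (I c) (𝔭 p) f.1.1 f.1.2.1 f.1.2.2 f.2 ∧ f ∈ itemSet d := by
    intro c p
    by_cases hp : p ∈ P
    · obtain ⟨A, B, C, b, h1, h2⟩ := Q.exists_reducedItem (hδ c) (hI c) (hne p hp)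
      exact ⟨((A, B, C), b), fun _ => ⟨h1, h2⟩⟩
    · exact ⟨0, fun h => absurd h hp⟩
  choose key hkey using h2
  rw [Nat.card_eq_fintype_card, ← Finset.card_univ]
  refine card_mul_sq_le _ P _ _ key (fun c _ p hp => (hkey c p hp).2) ?_ ?_
  · intro c _ c' _ p hp h
    have r1 := (hkey c p hp).1
    have r2 := (hkey c' p hp).1
    rw [h] at r1
    have := r1.class_eq (hne p hp) r2
    rw [hIc, hIc] at this
    exact Subtype.ext this
  · intro c _ c' _ p hp p' hp' hpp h
    have r1 := (hkey c p hp).1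
    have r2 := (hkey c' p' hp').1
    rw [h] at r1
    obtain ⟨a1, a2, a3, -⟩ := hP p hp
    obtain ⟨b1, -, b3, -⟩ := hP p' hp'
    rw [pairSet, Finset.mem_filter, Finset.mem_product]
    refine ⟨⟨hp, hp'⟩, hpp, ?_⟩
    refine ReducedItem.pairCond (hδ c) (hδ c') (hI c) (hI c') a1 b1 hpp ?_ a3 b3 (h𝔭 p hp).1
      (h𝔭 p hp).2.1 (h𝔭 p hp).2.2 (h𝔭 p' hp').1 r1 r2
    rintro rfl
    exact a2 (dvd_mul_right _ _)

end QuadField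

section SqrtCyclotomic

/-- A field of characteristic zero containing the roots of unity of order `24 * d` contains a
square root of `d`. -/
lemma isSquare_natCast_of_isPrimitiveRoot {E : Type*} [Field E] [CharZero E] {m : ℕ} {ζ : E}
    (hm : m ≠ 0) (hζ : IsPrimitiveRoot ζ m) (h8 : 8 ∣ m) :
    ∀ d : ℕ, d ∣ m → IsSquare (d : E) := by
  obtain ⟨m', rfl⟩ := h8
  set η := ζ ^ m' with hη
  have hη8 : IsPrimitiveRoot η 8 := hζ.pow (by omega) (by ring)
  have h4 : η ^ 4 = -1 := by
    have h1 : (η ^ 4 - 1) * (η ^ 4 + 1) = 0 := by linear_combination hη8.pow_eq_one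
    rcases mul_eq_zero.1 h1 with h | h
    · exact absurd (sub_eq_zero.1 h) (hη8.pow_ne_one_of_pos_of_lt (by norm_num) (by norm_num))
    · exact eq_neg_of_add_eq_zero_left h
  have hneg : IsSquare (-1 : E) := ⟨η ^ 2, by rw [← h4]; ring⟩
  have hprime : ∀ p : ℕ, p.Prime → p ∣ 8 * m' → IsSquare (p : E) := by
    intro p hp hpm
    have := Fact.mk hp
    rcases eq_or_ne p 2 with rfl | h2
    · refine ⟨η - η ^ 3, ?_⟩
      push_cast
      linear_combination (2 - η ^ 2) * h4
    · have hξ : IsPrimitiveRoot (ζ ^ (8 * m' / p)) p :=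
        hζ.pow (Nat.pos_of_ne_zero hm) (Nat.div_mul_cancel hpm).symm
      have hψ := AddChar.zmodChar_primitive_of_primitive_root p hξ
      have hχ : (quadraticChar (ZMod p)) ≠ 1 :=
        quadraticChar_ne_one (by rwa [ZMod.ringChar_zmod_n])
      have hinj : Function.Injective (Int.castRingHom E) := Int.cast_injective
      have key := gaussSum_sq ((MulChar.ringHomComp_ne_one_iff hinj).2 hχ)
        ((quadraticChar_isQuadratic (ZMod p)).comp (Int.castRingHom E)) hψ
      rw [ZMod.card] at key
      obtain ⟨g, hg⟩ : ∃ g : E, g ^ 2 =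
          (quadraticChar (ZMod p)).ringHomComp (Int.castRingHom E) (-1) * p := ⟨_, key⟩
      have h1 : IsSquare ((quadraticChar (ZMod p)).ringHomComp (Int.castRingHom E) (-1)) := by
        rw [MulChar.ringHomComp_apply]
        rcases quadraticChar_dichotomy (F := ZMod p) (a := -1) (by simp) with h | h
        · rw [h]; simp
        · rw [h]; simpa using hneg
      obtain ⟨c, hc⟩ := h1
      have hc0 : c ≠ 0 := by
        rintro rfl
        have h0 := quadraticChar_dichotomy (F := ZMod p) (a := -1) (by simp)
        rw [MulChar.ringHomComp_apply] at hc
        rcases h0 with h | h <;> rw [h] at hc <;> simp at hc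
      refine ⟨g / c, ?_⟩
      rw [div_mul_div_comm, ← pow_two, hg, hc]
      field_simp
  intro d hd
  induction d using Nat.recOnMul with
  | zero => simp
  | one => simp
  | prime p hp => exact hprime p hp hd
  | mul a b ha hb =>
    push_cast
    exact (ha (dvd_of_mul_right_dvd hd)).mul (hb (dvd_of_mul_left_dvd hd))

end SqrtCyclotomic

section CubeDescent

namespace QuadField

variable {d : ℕ} {K : Type} [Field K] [NumberField K] (Q : QuadField d K)

/-- Rational coordinates with respect to a square root of `d` are unique. -/
lemma rat_coord_unique {E : Type*} [Field E] [CharZero E] (hd : Squarefree d) (h1 : 1 < d)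
    {θ' : E} (hθ : θ' ^ 2 = d) {a b : ℚ} (h : (a : E) + b * θ' = 0) : a = 0 ∧ b = 0 := by
  apply not_rat_sq hd h1
  have h2 : ((a ^ 2 : ℚ) : E) = ((d * b ^ 2 : ℚ) : E) := by
    push_cast
    linear_combination (a - b * θ') * h + (b : E) ^ 2 * hθ
  exact_mod_cast h2

/-- If `s + t√d` becomes a cube in a totally complex abelian number field, it is already a cube
in `ℚ(√d)`. -/
lemma exists_cube_of_abelian {E : Type*} [Field E] [NumberField E] [IsAbelianGalois ℚ E]
    [NumberField.IsTotallyComplex E] {θ' β : E} (hθ : θ' ^ 2 = d) {s t : ℤ}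
    (hβ : β ^ 3 = s + t * θ') : ∃ x : K, x ^ 3 = s + t * Q.θ := by
  have hd := Q.sqf
  have h1 := Q.one_lt
  by_cases hβ0 : β = 0
  · have h0 : ((s : ℚ) : E) + ((t : ℚ) : E) * θ' = 0 := by
      push_cast; rw [← hβ, hβ0]; ring
    obtain ⟨hs, ht⟩ := rat_coord_unique hd h1 hθ h0
    have hs' : s = 0 := by exact_mod_cast hs
    have ht' : t = 0 := by exact_mod_cast ht
    exact ⟨0, by simp [hs', ht']⟩
  obtain ⟨f⟩ : Nonempty (E →+* ℂ) := inferInstance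
  set τ : Gal(E/ℚ) := (NumberField.IsCMField.complexConj E).restrictScalars ℚ with hτ
  have hfτ : ∀ x, f (τ x) = (starRingEnd ℂ) (f x) := fun x ↦
    NumberField.IsCMField.complexEmbedding_complexConj E f x
  have hτθ : τ θ' = θ' := by
    apply f.injective
    rw [hfτ]
    have h2 : (f θ') ^ 2 = ((Real.sqrt d : ℝ) : ℂ) ^ 2 := by
      rw [← map_pow, hθ, map_natCast, ← Complex.ofReal_pow, Real.sq_sqrt (by positivity)]
      simp
    rcases sq_eq_sq_iff_eq_or_eq_neg.1 h2 with h | h <;> rw [h] <;> simp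
  have hη : ∀ η : E, η ^ 3 = 1 → η * τ η = 1 := by
    intro η h3
    apply f.injective
    rw [map_mul, hfτ, Complex.mul_conj, map_one, Complex.normSq_eq_norm_sq]
    have h4 : ‖f η‖ ^ 3 = 1 := by rw [← norm_pow, ← map_pow, h3]; simp
    have h5 : ‖f η‖ = 1 := (pow_eq_one_iff_of_nonneg (norm_nonneg _) (by norm_num)).1 h4
    rw [h5]; simp
  set n := β * τ β with hn
  have hn3 : n ^ 3 = (s + t * θ') ^ 2 := by
    have : (τ β) ^ 3 = s + t * θ' := by
      rw [← map_pow, hβ, map_add, map_mul, hτθ]; simp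
    rw [hn, mul_pow, hβ, this]; ring
  have hfix : n ∈ IntermediateField.adjoin ℚ {θ'} := by
    rw [← IsGalois.fixedField_fixingSubgroup (IntermediateField.adjoin ℚ {θ'}),
      IntermediateField.mem_fixedField_iff]
    intro σ hσ
    have hσθ : σ θ' = θ' := (IntermediateField.mem_fixingSubgroup_iff _ _).1 hσ θ'
      (IntermediateField.mem_adjoin_simple_self ℚ θ')
    have hσβ : (σ β) ^ 3 = β ^ 3 := by
      rw [← map_pow, hβ, map_add, map_mul, hσθ]; simp
    have h6 : σ β = (σ β / β) * β := by field_simp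
    have h7 : (σ β / β) * τ (σ β / β) = 1 := hη _ (by rw [div_pow, hσβ]; field_simp)
    have hcomm : σ (τ β) = τ (σ β) := by
      have := IsMulCommutative.is_comm.comm σ τ
      exact congrArg (fun g : Gal(E/ℚ) ↦ g β) this
    rw [hn, map_mul, hcomm]
    calc σ β * τ (σ β) = ((σ β / β) * β) * τ ((σ β / β) * β) := by rw [← h6]
      _ = ((σ β / β) * τ (σ β / β)) * (β * τ β) := by rw [map_mul]; ring
      _ = β * τ β := by rw [h7, one_mul]
  obtain ⟨a, b, hab⟩ : ∃ a b : ℚ, n = a + b * θ' := by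
    have h8 : n ∈ Algebra.adjoin ℚ {θ'} := by
      rwa [← IntermediateField.adjoin_toSubalgebra]
    refine Algebra.adjoin_induction (p := fun x _ ↦ ∃ a b : ℚ, x = a + b * θ')
      ?_ ?_ ?_ ?_ h8
    · rintro x rfl; exact ⟨0, 1, by simp⟩
    · intro r; exact ⟨r, 0, by simp⟩
    · rintro x y - - ⟨a, b, rfl⟩ ⟨a', b', rfl⟩
      exact ⟨a + a', b + b', by push_cast; ring⟩
    · rintro x y - - ⟨a, b, rfl⟩ ⟨a', b', rfl⟩
      exact ⟨a * a' + d * (b * b'), a * b' + a' * b, by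
        push_cast; linear_combination (b * b' : E) * hθ⟩
  have hcoord : (((a ^ 3 + 3 * a * b ^ 2 * d - (s ^ 2 + d * t ^ 2) : ℚ)) : E) +
      ((3 * a ^ 2 * b + b ^ 3 * d - 2 * s * t : ℚ) : E) * θ' = 0 := by
    rw [hab] at hn3
    push_cast
    linear_combination hn3 - (3 * a * b ^ 2 + b ^ 3 * θ' - t ^ 2 : E) * hθ
  obtain ⟨hc1, hc2⟩ := rat_coord_unique hd h1 hθ hcoord
  have hc1' : ((a ^ 3 + 3 * a * b ^ 2 * d - (s ^ 2 + d * t ^ 2) : ℚ) : K) = 0 := by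
    rw [hc1]; simp
  have hc2' : ((3 * a ^ 2 * b + b ^ 3 * d - 2 * s * t : ℚ) : K) = 0 := by
    rw [hc2]; simp
  push_cast at hc1' hc2'
  have hK : ((a : K) + b * Q.θ) ^ 3 = (s + t * Q.θ) ^ 2 := by
    linear_combination hc1' + Q.θ * hc2' + (3 * a * b ^ 2 + b ^ 3 * Q.θ - t ^ 2 : K) * Q.sq
  by_cases h0 : (s : K) + t * Q.θ = 0
  · exact ⟨0, by rw [h0]; simp⟩
  have h9 : ((a : K) + b * Q.θ) ≠ 0 := by
    intro h
    rw [h] at hK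
    exact h0 (pow_eq_zero_iff (two_ne_zero) |>.1 (by rw [← hK]; ring))
  refine ⟨(s + t * Q.θ) / (a + b * Q.θ), ?_⟩
  rw [div_pow, hK]
  field_simp

end QuadField

end CubeDescent

section SplitPrimes

open NumberField

variable {L : Type*} [Field L] [NumberField L]

/-- If a set of algebraic integers generates `L` over `ℚ`, the order it generates has an
exponent. -/
lemma exists_mul_mem_adjoin_int {S : Set (𝓞 L)}
    (hS : Algebra.adjoin ℚ ((↑) '' S : Set L) = ⊤) :
    ∃ N : ℕ, N ≠ 0 ∧ ∀ x : 𝓞 L, (N : 𝓞 L) * x ∈ Algebra.adjoin ℤ S := by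
  have key : ∀ x : L, ∃ n : ℕ, n ≠ 0 ∧ ∃ y ∈ Algebra.adjoin ℤ S, (n : L) * x = (y : 𝓞 L) := by
    intro x
    have hx : x ∈ Algebra.adjoin ℚ ((↑) '' S : Set L) := by rw [hS]; trivial
    refine Algebra.adjoin_induction
      (p := fun x _ ↦ ∃ n : ℕ, n ≠ 0 ∧ ∃ y ∈ Algebra.adjoin ℤ S, (n : L) * x = (y : 𝓞 L))
      ?_ ?_ ?_ ?_ hx
    · rintro _ ⟨y, hy, rfl⟩
      exact ⟨1, one_ne_zero, y, Algebra.subset_adjoin hy, by simp⟩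
    · intro r
      refine ⟨r.den, r.den_nz, (r.num : 𝓞 L), ?_, ?_⟩
      · exact Subalgebra.intCast_mem _ _
      · have := Rat.den_mul_eq_num r
        have h2 : ((r.den * r : ℚ) : L) = ((r.num : ℚ) : L) := by rw [this]
        push_cast at h2
        simpa using h2
    · rintro x y - - ⟨n, hn, u, hu, hx⟩ ⟨m, hm, v, hv, hy⟩
      refine ⟨n * m, mul_ne_zero hn hm, (m : 𝓞 L) * u + (n : 𝓞 L) * v, ?_, ?_⟩
      · exact add_mem (mul_mem (natCast_mem _ _) hu) (mul_mem (natCast_mem _ _) hv)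
      · push_cast
        linear_combination (m : L) * hx + (n : L) * hy
    · rintro x y - - ⟨n, hn, u, hu, hx⟩ ⟨m, hm, v, hv, hy⟩
      refine ⟨n * m, mul_ne_zero hn hm, u * v, mul_mem hu hv, ?_⟩
      push_cast
      linear_combination (m * y : L) * hx + (u : L) * hy
  choose n hn y hy hxy using key
  classical
  obtain ⟨G, hG⟩ := (Module.finite_def (R := ℤ) (M := 𝓞 L)).1 inferInstance
  refine ⟨∏ g ∈ G, n g, Finset.prod_ne_zero_iff.2 fun g _ ↦ hn _, fun x ↦ ?_⟩
  have hx : x ∈ Submodule.span ℤ (G : Set (𝓞 L)) := by rw [hG]; trivial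
  refine Submodule.span_induction
    (p := fun x _ ↦ ((∏ g ∈ G, n g : ℕ) : 𝓞 L) * x ∈ Algebra.adjoin ℤ S) ?_ ?_ ?_ ?_ hx
  · intro g hg
    rw [← Finset.prod_erase_mul G (fun g : 𝓞 L ↦ n (g : L)) hg]
    have : ((n (g : L) : 𝓞 L)) * g = y (g : L) := by
      apply RingOfIntegers.ext
      push_cast
      exact hxy _
    push_cast
    rw [mul_assoc, this]
    exact mul_mem (by rw [← Nat.cast_prod]; exact natCast_mem _ _) (hy _)
  · simp
  · intro a b _ _ ha hb
    rw [mul_add]; exact add_mem ha hb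
  · intro a b _ hb
    rw [mul_smul_comm]
    exact Subalgebra.smul_mem _ hb a

omit [NumberField L] in
/-- Frobenius acts trivially modulo `q` as soon as it does on generators of an order of index
prime to `q`. -/
lemma dvd_pow_sub_self {S : Set (𝓞 L)} {N : ℕ}
    (hN : ∀ x : 𝓞 L, (N : 𝓞 L) * x ∈ Algebra.adjoin ℤ S) {q : ℕ} (hq : q.Prime)
    (hqN : ¬ q ∣ N) (hS : ∀ x ∈ S, (q : 𝓞 L) ∣ x ^ q - x) (x : 𝓞 L) :
    (q : 𝓞 L) ∣ x ^ q - x := by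
  have hcast : ∀ n : ℤ, (q : 𝓞 L) ∣ (n : 𝓞 L) ^ q - n := by
    intro n
    have h : (q : ℤ) ∣ n ^ q - n := by
      have := Fact.mk hq
      rw [← ZMod.intCast_zmod_eq_zero_iff_dvd]
      push_cast
      rw [ZMod.pow_card, sub_self]
    have := map_dvd (Int.castRingHom (𝓞 L)) h
    simpa using this
  have hadj : ∀ y ∈ Algebra.adjoin ℤ S, (q : 𝓞 L) ∣ y ^ q - y := by
    intro y hy
    refine Algebra.adjoin_induction (p := fun y _ ↦ (q : 𝓞 L) ∣ y ^ q - y) hS ?_ ?_ ?_ hy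
    · intro n; simpa using hcast n
    · intro a b _ _ ha hb
      obtain ⟨r, hr⟩ := exists_add_pow_prime_eq hq a b
      have : (a + b) ^ q - (a + b) = (a ^ q - a) + (b ^ q - b) + q * (a * b * r) := by
        rw [hr]; ring
      rw [this]
      exact dvd_add (dvd_add ha hb) (dvd_mul_right _ _)
    · intro a b _ _ ha hb
      have : (a * b) ^ q - a * b = (a ^ q - a) * b ^ q + a * (b ^ q - b) := by ring
      rw [this]
      exact dvd_add (ha.mul_right _) (hb.mul_left _)
  have h1 := hadj _ (hN x)
  have h2 : (q : 𝓞 L) ∣ N * (x ^ q - x) := by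
    have : (N : 𝓞 L) * (x ^ q - x) = ((N * x) ^ q - N * x) - ((N : ℤ) ^ q - (N : ℤ) : 𝓞 L) * x ^ q := by
      push_cast; ring
    rw [this]
    refine dvd_sub h1 (Dvd.dvd.mul_right ?_ _)
    have := hcast N
    simpa using this
  have hc : IsCoprime (q : 𝓞 L) (N : 𝓞 L) := by
    have : IsCoprime (q : ℤ) (N : ℤ) :=
      Nat.isCoprime_iff_coprime.2 ((Nat.Prime.coprime_iff_not_dvd hq).2 hqN)
    simpa using this.map (Int.castRingHom (𝓞 L))
  exact hc.dvd_of_dvd_mul_left h2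

/-- If Frobenius acts trivially modulo `q`, then `q` splits completely. -/
lemma exists_split_ideals {q : ℕ} (hq : q.Prime) (h : ∀ x : 𝓞 L, (q : 𝓞 L) ∣ x ^ q - x) :
    ∃ F : Finset (Ideal (𝓞 L)), F.card = Module.finrank ℚ L ∧
      ∀ P ∈ F, P.IsPrime ∧ Ideal.absNorm P = q := by
  classical
  set I : Ideal (𝓞 L) := Ideal.span {(q : 𝓞 L)} with hI
  have hq0 : (q : 𝓞 L) ≠ 0 := by exact_mod_cast hq.ne_zero
  have hI0 : I ≠ ⊥ := by
    rw [hI, Ne, Ideal.span_singleton_eq_bot]; exact hq0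
  have hmem : ∀ x : 𝓞 L, x ^ q - x ∈ I := fun x ↦ Ideal.mem_span_singleton.2 (h x)
  have hnorm : Ideal.absNorm I = q ^ Module.finrank ℚ L := by
    rw [hI, Ideal.absNorm_span_natCast]
    congr 1
    exact RingOfIntegers.rank L
  set s := UniqueFactorizationMonoid.normalizedFactors I with hs
  have hP : ∀ P ∈ s, P.IsPrime ∧ Ideal.absNorm P = q := by
    intro P hPs
    have hprime : Prime P := UniqueFactorizationMonoid.prime_of_normalized_factor P hPs
    have hdvd : P ∣ I := UniqueFactorizationMonoid.dvd_of_mem_normalizedFactors hPs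
    have hPp : P.IsPrime := Ideal.isPrime_of_prime hprime
    refine ⟨hPp, ?_⟩
    have hmax : P.IsMaximal := hPp.isMaximal hprime.ne_zero
    have hle : I ≤ P := Ideal.le_of_dvd hdvd
    have hfin : Finite (𝓞 L ⧸ P) := by
      apply Ideal.finiteQuotientOfFreeOfNeBot P hprime.ne_zero
    let := Ideal.Quotient.field P
    have := Fintype.ofFinite (𝓞 L ⧸ P)
    have hcard : Ideal.absNorm P = Fintype.card (𝓞 L ⧸ P) := by
      rw [Ideal.absNorm_apply, Submodule.cardQuot_apply, Nat.card_eq_fintype_card]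
    have hle2 : Ideal.absNorm P ≤ q := by
      rw [hcard]
      set f : Polynomial (𝓞 L ⧸ P) := Polynomial.X ^ q - Polynomial.X with hf
      have hf0 : f ≠ 0 := FiniteField.X_pow_card_sub_X_ne_zero _ hq.one_lt
      have hdeg : f.natDegree = q := FiniteField.X_pow_card_sub_X_natDegree_eq _ hq.one_lt
      calc Fintype.card (𝓞 L ⧸ P) = (Finset.univ : Finset (𝓞 L ⧸ P)).card := rfl
        _ ≤ f.roots.toFinset.card := by
          apply Finset.card_le_card
          intro x _
          obtain ⟨x, rfl⟩ := Ideal.Quotient.mk_surjective x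
          rw [Multiset.mem_toFinset, Polynomial.mem_roots hf0]
          simp only [hf, Polynomial.IsRoot, Polynomial.eval_sub, Polynomial.eval_pow,
            Polynomial.eval_X]
          rw [← map_pow, ← map_sub, Ideal.Quotient.eq_zero_iff_mem]
          exact hle (hmem x)
        _ ≤ f.roots.card := Multiset.toFinset_card_le _
        _ ≤ f.natDegree := Polynomial.card_roots' f
        _ = q := hdeg
    have hdvd2 : Ideal.absNorm P ∣ q ^ Module.finrank ℚ L := by
      rw [← hnorm]; exact map_dvd _ hdvd
    obtain ⟨k, -, hk⟩ := (Nat.dvd_prime_pow hq).1 hdvd2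
    have hk0 : k ≠ 0 := by
      rintro rfl
      rw [pow_zero, Ideal.absNorm_eq_one_iff] at hk
      exact hPp.ne_top hk
    refine le_antisymm hle2 ?_
    rw [hk]
    exact Nat.le_self_pow hk0 q
  have hnodup : s.Nodup := by
    have hsq : Squarefree I := by
      intro J hJ
      have hIJ : I ≤ J * J := Ideal.le_of_dvd hJ
      have hJ0 : J ≠ 0 := by
        rintro rfl
        rw [zero_mul] at hJ
        exact hI0 (zero_dvd_iff.1 hJ)
      have hle : J ≤ J * J := by
        intro x hx
        have h1 : x ^ q ∈ J * J := by
          rw [← Nat.sub_add_cancel hq.two_le, pow_add, pow_two x]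
          exact Ideal.mul_mem_left _ _ (Ideal.mul_mem_mul hx hx)
        have h2 := (J * J).sub_mem h1 (hIJ (hmem x))
        simpa using h2
      have heq : J * J = J * 1 := by
        rw [mul_one]; exact le_antisymm Ideal.mul_le_left hle
      rw [mul_left_cancel₀ hJ0 heq]
      exact isUnit_one
    exact (UniqueFactorizationMonoid.squarefree_iff_nodup_normalizedFactors hI0).1 hsq
  have hprod : (s.map Ideal.absNorm).prod = q ^ s.card := by
    rw [Multiset.map_congr rfl (fun P hPs ↦ (hP P hPs).2), Multiset.map_const',
      Multiset.prod_replicate]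
  have hcards : s.card = Module.finrank ℚ L := by
    apply Nat.pow_right_injective hq.two_le
    show q ^ s.card = q ^ Module.finrank ℚ L
    rw [← hprod, ← hnorm, ← map_multiset_prod, Ideal.prod_normalizedFactors_eq_self hI0]
  refine ⟨s.toFinset, ?_, fun P hPs ↦ hP P (Multiset.mem_toFinset.1 hPs)⟩
  rw [Multiset.toFinset_card_of_nodup hnodup, hcards]

end SplitPrimes

section SplitPrimeSum

open NumberField

lemma inv_rpow_sum_le (K : ℕ) (J : ℕ) :
    ∑ j ∈ Finset.range J, (2 : ℝ) ^ (-((2 : ℝ)⁻¹ ^ K) * j) ≤ 4 * 2 ^ K := by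
  set u : ℝ := (2 : ℝ)⁻¹ ^ K with hu
  have hu0 : 0 < u := by positivity
  have hu1 : u ≤ 1 := pow_le_one₀ (by norm_num) (by norm_num)
  set r : ℝ := (2 : ℝ) ^ (-u) with hr
  have hr0 : 0 < r := by positivity
  have hr1 : r ≤ 1 - u / 2 := by
    have h1 : (1 + (-1/2 : ℝ)) ^ u ≤ 1 + u * (-1/2) :=
      rpow_one_add_le_one_add_mul_self (by norm_num) hu0.le hu1
    have h2 : r = (1 + (-1/2 : ℝ)) ^ u := by
      rw [hr, Real.rpow_neg (by norm_num), ← Real.inv_rpow (by norm_num)]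
      norm_num
    rw [h2]; linarith
  have h3 : ∀ j ∈ Finset.range J, (2 : ℝ) ^ (-u * j) = r ^ j := by
    intro j _
    rw [Real.rpow_mul (by norm_num), Real.rpow_natCast]
  rw [Finset.sum_congr rfl h3]
  have h4 : (∑ j ∈ Finset.range J, r ^ j) * (1 - r) ≤ 1 := by
    have := geom_sum_mul_neg r J
    rw [this]
    have : 0 ≤ r ^ J := by positivity
    linarith
  have h5 : (∑ j ∈ Finset.range J, r ^ j) * (u / 2) ≤ 1 := by
    refine le_trans (mul_le_mul_of_nonneg_left (by linarith) ?_) h4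
    positivity
  have h6 : u * 2 ^ K = 1 := by rw [hu, ← mul_pow]; norm_num
  have h7 : 0 ≤ ∑ j ∈ Finset.range J, r ^ j := by positivity
  have h8 : ∑ j ∈ Finset.range J, r ^ j ≤ 2 * 2 ^ K := by
    calc ∑ j ∈ Finset.range J, r ^ j
        = ((∑ j ∈ Finset.range J, r ^ j) * (u / 2)) * (2 * 2 ^ K) := by
          linear_combination -(∑ j ∈ Finset.range J, r ^ j) * h6
      _ ≤ 1 * (2 * 2 ^ K) := mul_le_mul_of_nonneg_right h5 (by positivity)
      _ = _ := one_mul _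
  have : (0 : ℝ) < 2 ^ K := by positivity
  linarith

/-- Dirichlet series of a set with linear counting function, near `1`. -/
lemma sum_rpow_le_of_card_le {α : Type*} (W : Finset α) (f : α → ℕ) (hf : ∀ w ∈ W, f w ≠ 0)
    {C : ℝ} (hC : 0 ≤ C)
    (h : ∀ x : ℕ, 1 ≤ x → ((W.filter (fun w ↦ f w ≤ x)).card : ℝ) ≤ C * x) (K : ℕ) :
    ∑ w ∈ W, (f w : ℝ) ^ (-(1 + (2 : ℝ)⁻¹ ^ K)) ≤ 8 * C * 2 ^ K := by
  classical
  set u : ℝ := (2 : ℝ)⁻¹ ^ K with hu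
  have hu0 : 0 < u := by positivity
  set J := (W.sup fun w ↦ Nat.log 2 (f w)) + 1 with hJ
  have hmaps : ∀ w ∈ W, Nat.log 2 (f w) ∈ Finset.range J := by
    intro w hw
    rw [Finset.mem_range, hJ, Nat.lt_succ_iff]
    exact Finset.le_sup (f := fun w ↦ Nat.log 2 (f w)) hw
  rw [← Finset.sum_fiberwise_of_maps_to hmaps]
  calc ∑ j ∈ Finset.range J, ∑ w ∈ W.filter (fun w ↦ Nat.log 2 (f w) = j),
        (f w : ℝ) ^ (-(1 + u))
      ≤ ∑ j ∈ Finset.range J, (2 * C) * (2 : ℝ) ^ (-u * j) := by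
        apply Finset.sum_le_sum
        intro j _
        have h1 : ∀ w ∈ W.filter (fun w ↦ Nat.log 2 (f w) = j),
            (f w : ℝ) ^ (-(1 + u)) ≤ ((2 : ℝ) ^ j) ^ (-(1 + u)) := by
          intro w hw
          rw [Finset.mem_filter] at hw
          have h2 : 2 ^ j ≤ f w := by
            rw [← hw.2]; exact Nat.pow_log_le_self 2 (hf w hw.1)
          apply Real.rpow_le_rpow_of_nonpos (by positivity) (by exact_mod_cast h2)
          linarith
        have h3 : ((W.filter (fun w ↦ Nat.log 2 (f w) = j)).card : ℝ) ≤ C * 2 ^ (j + 1) := by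
          refine le_trans ?_ (le_trans (h (2 ^ (j + 1)) Nat.one_le_two_pow) (by push_cast; rfl))
          norm_cast
          apply Finset.card_le_card
          intro w hw
          rw [Finset.mem_filter] at hw ⊢
          refine ⟨hw.1, ?_⟩
          rw [← hw.2]
          exact (Nat.lt_pow_succ_log_self one_lt_two _).le
        calc _ ≤ ∑ w ∈ W.filter (fun w ↦ Nat.log 2 (f w) = j), ((2 : ℝ) ^ j) ^ (-(1 + u)) :=
              Finset.sum_le_sum h1
          _ = (W.filter (fun w ↦ Nat.log 2 (f w) = j)).card * ((2 : ℝ) ^ j) ^ (-(1 + u)) := by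
              rw [Finset.sum_const, nsmul_eq_mul]
          _ ≤ (C * 2 ^ (j + 1)) * ((2 : ℝ) ^ j) ^ (-(1 + u)) :=
              mul_le_mul_of_nonneg_right h3 (by positivity)
          _ = (2 * C) * (2 : ℝ) ^ (-u * j) := by
              rw [← Real.rpow_natCast 2 j, ← Real.rpow_mul (by norm_num),
                show (j : ℝ) * (-(1 + u)) = -(j : ℝ) + -u * j by ring,
                Real.rpow_add (by norm_num), Real.rpow_neg (by norm_num), Real.rpow_natCast,
                pow_succ]
              field_simp
    _ = (2 * C) * ∑ j ∈ Finset.range J, (2 : ℝ) ^ (-u * j) := by rw [Finset.mul_sum]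
    _ ≤ (2 * C) * (4 * 2 ^ K) :=
        mul_le_mul_of_nonneg_left (inv_rpow_sum_le K J) (by positivity)
    _ = _ := by ring

variable (L : Type*) [Field L] [NumberField L]

/-- The number of ideals of bounded norm is at most linear. -/
lemma exists_card_ideals_le : ∃ C : ℝ, 1 ≤ C ∧ ∀ (W : Finset (Ideal (𝓞 L))) (x : ℕ), 1 ≤ x →
    ((W.filter (fun I ↦ Ideal.absNorm I ≤ x)).card : ℝ) ≤ C * x := by
  classical
  have ht := ((Ideal.tendsto_norm_le_div_atTop L).comp tendsto_natCast_atTop_atTop).bddAbove_range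
  obtain ⟨C, hC⟩ := ht
  refine ⟨max C 1, le_max_right _ _, fun W x hx ↦ ?_⟩
  have h1 : ((Nat.card {I : Ideal (𝓞 L) // (Ideal.absNorm I : ℝ) ≤ (x : ℝ)} : ℕ) : ℝ) / x ≤ C :=
    hC ⟨x, rfl⟩
  have hx0 : (0 : ℝ) < x := by exact_mod_cast hx
  rw [div_le_iff₀ hx0] at h1
  refine le_trans ?_ (le_trans h1 (mul_le_mul_of_nonneg_right (le_max_left _ _) hx0.le))
  norm_cast
  have hfin : Finite {I : Ideal (𝓞 L) // (Ideal.absNorm I : ℝ) ≤ (x : ℝ)} := by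
    simp only [Nat.cast_le]
    exact Ideal.finite_setOfPred_absNorm_le x
  have := Fintype.ofFinite {I : Ideal (𝓞 L) // (Ideal.absNorm I : ℝ) ≤ (x : ℝ)}
  have : Nat.card {I : Ideal (𝓞 L) // (Ideal.absNorm I : ℝ) ≤ (x : ℝ)} =
    Nat.card {I : Ideal (𝓞 L) // (Ideal.absNorm I) ≤ x} := by simp only [Nat.cast_le]
  rw [← Nat.card_eq_finsetCard]
  simp only [Nat.cast_le] at *
  exact Nat.card_le_card_of_injective
    (fun I : {I // I ∈ W.filter (fun I ↦ Ideal.absNorm I ≤ x)} ↦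
      (⟨I.1, (Finset.mem_filter.1 I.2).2⟩ : {I : Ideal (𝓞 L) // (Ideal.absNorm I) ≤ x}))
    (fun a b hab ↦ by
      apply Subtype.ext
      simpa using hab)

/-- Completely split primes have density at most the inverse of the degree. -/
lemma exists_split_sum_le : ∃ C : ℝ, ∀ T : Finset ℕ,
    (∀ q ∈ T, q.Prime ∧ ∃ F : Finset (Ideal (𝓞 L)), F.card = Module.finrank ℚ L ∧
      ∀ P ∈ F, P.IsPrime ∧ Ideal.absNorm P = q) →
    ∀ K : ℕ, Module.finrank ℚ L * ∑ q ∈ T, (q : ℝ) ^ (-(1 + (2 : ℝ)⁻¹ ^ K)) ≤ K + C := by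
  classical
  obtain ⟨C, hC1, hC⟩ := exists_card_ideals_le L
  refine ⟨Real.logb 2 (8 * C), fun T hT K ↦ ?_⟩
  set s : ℝ := -(1 + (2 : ℝ)⁻¹ ^ K) with hs
  have hs0 : s ≤ 0 := by
    have : (0 : ℝ) < (2 : ℝ)⁻¹ ^ K := by positivity
    rw [hs]; linarith
  set F : ℕ → Finset (Ideal (𝓞 L)) := fun q ↦ if h : q ∈ T then (hT q h).2.choose else ∅ with hF
  have hFq : ∀ q ∈ T, (F q).card = Module.finrank ℚ L ∧
      ∀ P ∈ F q, P.IsPrime ∧ Ideal.absNorm P = q := by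
    intro q hq
    simp only [hF, dif_pos hq]
    exact (hT q hq).2.choose_spec
  set W := T.biUnion F with hW
  have hWp : ∀ P ∈ W, Prime P := by
    intro P hP
    obtain ⟨q, hq, hPq⟩ := Finset.mem_biUnion.1 hP
    obtain ⟨h1, h2⟩ := (hFq q hq).2 P hPq
    refine Ideal.prime_of_isPrime ?_ h1
    rintro rfl
    rw [Ideal.absNorm_bot] at h2
    exact (hT q hq).1.ne_zero h2.symm
  have hsum : ∑ P ∈ W, (Ideal.absNorm P : ℝ) ^ s =
      Module.finrank ℚ L * ∑ q ∈ T, (q : ℝ) ^ s := by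
    rw [hW, Finset.sum_biUnion, Finset.mul_sum]
    · refine Finset.sum_congr rfl fun q hq ↦ ?_
      rw [Finset.sum_congr rfl (fun P hP ↦ by rw [((hFq q hq).2 P hP).2]), Finset.sum_const,
        (hFq q hq).1, nsmul_eq_mul]
    · intro q hq q' hq' hne
      rw [Function.onFun, Finset.disjoint_left]
      intro P hP hP'
      exact hne (((hFq q hq).2 P hP).2.symm.trans ((hFq q' hq').2 P hP').2)
  have hinj : Set.InjOn (fun U : Finset (Ideal (𝓞 L)) ↦ ∏ P ∈ U, P) W.powerset := by
    have hsub : ∀ U V : Finset (Ideal (𝓞 L)), U ⊆ W → V ⊆ W →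
        ∏ P ∈ U, P = ∏ P ∈ V, P → U ⊆ V := by
      intro U V hU hV h P hP
      have hPp := hWp P (hU hP)
      have hd : P ∣ ∏ P ∈ V, P := h ▸ Finset.dvd_prod_of_mem _ hP
      obtain ⟨P', hP', hdvd⟩ := (Prime.dvd_finsetProd_iff hPp _).1 hd
      have := associated_iff_eq.1 (hPp.associated_of_dvd (hWp P' (hV hP')) hdvd)
      rwa [this]
    intro U hU V hV h
    simp only [Finset.coe_powerset, Set.mem_preimage, Set.mem_powerset_iff,
      Finset.coe_subset] at hU hV
    exact Finset.Subset.antisymm (hsub U V hU hV h) (hsub V U hV hU h.symm)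
  have hprod : ∏ P ∈ W, (1 + (Ideal.absNorm P : ℝ) ^ s) ≤ 8 * C * 2 ^ K := by
    rw [Finset.prod_one_add]
    have h1 : ∀ U ∈ W.powerset, ∏ P ∈ U, (Ideal.absNorm P : ℝ) ^ s =
        (Ideal.absNorm (∏ P ∈ U, P) : ℝ) ^ s := by
      intro U _
      rw [Real.finsetProd_rpow _ _ (fun _ _ ↦ by positivity), map_prod]
      push_cast
      rfl
    rw [Finset.sum_congr rfl h1,
      ← Finset.sum_image (f := fun I : Ideal (𝓞 L) ↦ (Ideal.absNorm I : ℝ) ^ s) hinj]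
    refine sum_rpow_le_of_card_le _ _ ?_ (by linarith) (fun x hx ↦ hC _ x hx) K
    intro I hI
    obtain ⟨U, hU, rfl⟩ := Finset.mem_image.1 hI
    rw [Ne, Ideal.absNorm_eq_zero_iff]
    exact Finset.prod_ne_zero_iff.2 fun P hP ↦ (hWp P (Finset.mem_powerset.1 hU hP)).ne_zero
  have hlow : (2 : ℝ) ^ (∑ P ∈ W, (Ideal.absNorm P : ℝ) ^ s) ≤
      ∏ P ∈ W, (1 + (Ideal.absNorm P : ℝ) ^ s) := by
    rw [Real.rpow_sum_of_pos (by norm_num)]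
    refine Finset.prod_le_prod (fun _ _ ↦ by positivity) fun P hP ↦ ?_
    have h1 : (1 : ℝ) ≤ Ideal.absNorm P := by
      have : Ideal.absNorm P ≠ 0 := by
        rw [Ne, Ideal.absNorm_eq_zero_iff]
        exact (hWp P hP).ne_zero
      exact_mod_cast Nat.one_le_iff_ne_zero.2 this
    have := rpow_one_add_le_one_add_mul_self (s := 1) (by norm_num)
      (p := (Ideal.absNorm P : ℝ) ^ s) (by positivity) (Real.rpow_le_one_of_one_le_of_nonpos h1 hs0)
    norm_num at this
    exact this
  rw [hsum] at hlow
  have h2 := Real.logb_le_logb_of_le one_lt_two (by positivity) (hlow.trans hprod)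
  rw [Real.logb_rpow (by norm_num) (by norm_num), Real.logb_mul (by positivity) (by positivity),
    Real.logb_pow, Real.logb_self_eq_one one_lt_two] at h2
  linarith

end SplitPrimeSum

section PrimesOneMod

open ArithmeticFunction ArithmeticFunction.vonMangoldt

/-- The primes above `N` congruent to `1` modulo `m`. -/
def IsLargeOneMod (m N q : ℕ) : Prop := q.Prime ∧ N < q ∧ (q : ZMod m) = 1

open Classical in
lemma exists_finset_log_sum_ge (m N : ℕ) [NeZero m] : ∃ C : ℝ, 0 ≤ C ∧ ∀ x : ℝ, 1 < x → x ≤ 2 →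
    ∃ T₀ : Finset ℕ, ∀ T, T₀ ⊆ T → (m.totient : ℝ)⁻¹ / (x - 1) - C ≤
      ∑ q ∈ T.filter (IsLargeOneMod m N), Real.log q / (q : ℝ) ^ x := by
  obtain ⟨C₀, hC₀⟩ := LSeries_residueClass_lower_bound (q := m) (a := 1) isUnit_one
  have hnp := summable_residueClass_non_primes_div (1 : ZMod m)
  set D := ∑' n : ℕ, (if n.Prime then 0 else residueClass (1 : ZMod m) n) / n with hD
  set E := ∑ n ∈ Finset.range (N + 1), vonMangoldt n with hE
  have hnp0 : ∀ n : ℕ, 0 ≤ (if n.Prime then 0 else residueClass (1 : ZMod m) n) / n := by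
    intro n
    have := residueClass_nonneg (1 : ZMod m) n
    split_ifs <;> positivity
  have hpt : ∀ x : ℝ, 1 < x → ∀ n : ℕ, residueClass (1 : ZMod m) n / (n : ℝ) ^ x ≤
      (if IsLargeOneMod m N n then Real.log n / (n : ℝ) ^ x else 0) +
      (if n.Prime then 0 else residueClass (1 : ZMod m) n) / n +
      (if n ∈ Finset.range (N + 1) then vonMangoldt n else 0) := by
    intro x hx n
    have h0 := residueClass_nonneg (1 : ZMod m) n
    have h1 : 0 ≤ (if IsLargeOneMod m N n then Real.log n / (n : ℝ) ^ x else 0) := by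
      have : 0 ≤ Real.log n := Real.log_natCast_nonneg n
      split_ifs <;> positivity
    have h2 := hnp0 n
    have h3 : 0 ≤ (if n ∈ Finset.range (N + 1) then vonMangoldt n else 0) := by
      split_ifs
      · exact vonMangoldt_nonneg
      · exact le_rfl
    rcases Nat.eq_zero_or_pos n with rfl | hn
    · have : residueClass (1 : ZMod m) 0 = 0 := residueClass_apply_zero _
      rw [this, zero_div]; positivity
    have hn1 : (1 : ℝ) ≤ n := by exact_mod_cast hn
    have hnx : (n : ℝ) ≤ (n : ℝ) ^ x := by
      conv_lhs => rw [← Real.rpow_one n]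
      exact Real.rpow_le_rpow_of_exponent_le hn1 hx.le
    by_cases hp : n.Prime
    · by_cases hm : (n : ZMod m) = 1
      · by_cases hN : N < n
        · rw [if_pos (show IsLargeOneMod m N n from ⟨hp, hN, hm⟩)]
          have : residueClass (1 : ZMod m) n ≤ Real.log n :=
            (residueClass_le _ n).trans vonMangoldt_le_log
          have : residueClass (1 : ZMod m) n / (n : ℝ) ^ x ≤ Real.log n / (n : ℝ) ^ x := by gcongr
          linarith
        · rw [if_pos (Finset.mem_range.2 (by omega : n < N + 1))]
          have : residueClass (1 : ZMod m) n / (n : ℝ) ^ x ≤ vonMangoldt n :=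
            (div_le_self h0 (hn1.trans hnx)).trans (residueClass_le _ n)
          linarith
      · have : residueClass (1 : ZMod m) n = 0 := by
          simp [residueClass, Set.indicator, hm]
        rw [this, zero_div]; positivity
    · rw [if_neg hp] at h2 ⊢
      have : residueClass (1 : ZMod m) n / (n : ℝ) ^ x ≤ residueClass (1 : ZMod m) n / n := by
        gcongr
      linarith
  have hE0 : 0 ≤ E := Finset.sum_nonneg fun _ _ ↦ vonMangoldt_nonneg
  have hD0 : 0 ≤ D := tsum_nonneg hnp0
  refine ⟨|C₀| + 1 + D + E, by positivity, fun x hx1 hx2 ↦ ?_⟩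
  have hsum : Summable fun n : ℕ ↦ residueClass (1 : ZMod m) n / (n : ℝ) ^ x :=
    LSeries.summable_real_of_abscissaOfAbsConv_lt <|
        (abscissaOfAbsConv_residueClass_le_one _).trans_lt <| mod_cast hx1
  have hlow := hC₀ (x := x) ⟨hx1, hx2⟩
  have hev := hsum.hasSum.eventually (lt_mem_nhds (sub_one_lt _))
  obtain ⟨T₀, hT₀⟩ := Filter.eventually_atTop.1 hev
  refine ⟨T₀, fun T hT ↦ ?_⟩
  have h1 := hT₀ T hT
  have h2 := Finset.sum_le_sum (s := T) fun n _ ↦ hpt x hx1 n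
  rw [Finset.sum_add_distrib, Finset.sum_add_distrib, ← Finset.sum_filter, ← Finset.sum_filter]
    at h2
  have h3 := hnp.sum_le_tsum T fun n _ ↦ hnp0 n
  have h4 : ∑ n ∈ T.filter (· ∈ Finset.range (N + 1)), vonMangoldt n ≤ E := by
    apply Finset.sum_le_sum_of_subset_of_nonneg
    · intro n hn
      exact (Finset.mem_filter.1 hn).2
    · intro n _ _
      exact vonMangoldt_nonneg
  have h5 := le_abs_self C₀
  simp only [← hD] at h3
  linarith

open Classical in
/-- The primes congruent to `1` modulo `m` have at least (half) the expected density. -/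
lemma exists_finset_rpow_sum_ge (m N : ℕ) [NeZero m] : ∃ C : ℝ, ∀ K : ℕ,
    ∃ T : Finset ℕ, (∀ q ∈ T, IsLargeOneMod m N q) ∧
      K * ((m.totient : ℝ)⁻¹ / 2) - C ≤ ∑ q ∈ T, (q : ℝ) ^ (-(1 + (2 : ℝ)⁻¹ ^ K)) := by
  obtain ⟨C, hC0, hC⟩ := exists_finset_log_sum_ge m N
  have hx : ∀ k : ℕ, (1 : ℝ) < 1 + (2 : ℝ)⁻¹ ^ k ∧ (1 + (2 : ℝ)⁻¹ ^ k) ≤ 2 := by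
    intro k
    have h1 : (0 : ℝ) < (2 : ℝ)⁻¹ ^ k := by positivity
    have h2 : (2 : ℝ)⁻¹ ^ k ≤ 1 := pow_le_one₀ (by norm_num) (by norm_num)
    constructor <;> linarith
  choose T₀ hT₀ using fun k : ℕ ↦ hC _ (hx k).1 (hx k).2
  refine ⟨C, fun K ↦ ?_⟩
  set G := ((Finset.range K).biUnion T₀).filter (IsLargeOneMod m N) with hG
  have hGp : ∀ q ∈ G, IsLargeOneMod m N q := fun q hq ↦ (Finset.mem_filter.1 hq).2
  refine ⟨G, hGp, ?_⟩
  have hstep : ∀ k < K, (m.totient : ℝ)⁻¹ / 2 - C * (2 : ℝ)⁻¹ ^ (k + 1) ≤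
      ∑ q ∈ G, (q : ℝ) ^ (-(1 + (2 : ℝ)⁻¹ ^ (k + 1))) - ∑ q ∈ G, (q : ℝ) ^ (-(1 + (2 : ℝ)⁻¹ ^ k)) := by
    intro k hk
    have h1 := hT₀ k _ (Finset.subset_biUnion_of_mem T₀ (Finset.mem_range.2 hk))
    rw [← hG] at h1
    rw [← Finset.sum_sub_distrib]
    have h2 : ∀ q ∈ G, (2 : ℝ)⁻¹ ^ (k + 1) * (Real.log q / (q : ℝ) ^ (1 + (2 : ℝ)⁻¹ ^ k)) ≤
        (q : ℝ) ^ (-(1 + (2 : ℝ)⁻¹ ^ (k + 1))) - (q : ℝ) ^ (-(1 + (2 : ℝ)⁻¹ ^ k)) := by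
      intro q hq
      have hq0 : (0 : ℝ) < q := by exact_mod_cast (hGp q hq).1.pos
      set u : ℝ := (2 : ℝ)⁻¹ ^ (k + 1) with hu
      have hu2 : (2 : ℝ)⁻¹ ^ k = 2 * u := by rw [hu, pow_succ]; ring
      rw [hu2, show -(1 + u) = -(1 + 2 * u) + u by ring, Real.rpow_add hq0 (-(1 + 2 * u)) u,
        Real.rpow_neg hq0.le (1 + 2 * u)]
      have h3 : u * Real.log q + 1 ≤ (q : ℝ) ^ u := by
        rw [Real.rpow_def_of_pos hq0, mul_comm u]
        exact Real.add_one_le_exp _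
      have h4 : (0 : ℝ) < ((q : ℝ) ^ (1 + 2 * u))⁻¹ := by positivity
      rw [div_eq_mul_inv]
      nlinarith [mul_le_mul_of_nonneg_left h3 h4.le]
    refine le_trans ?_ (Finset.sum_le_sum h2)
    rw [← Finset.mul_sum]
    have h5 : (0 : ℝ) < (2 : ℝ)⁻¹ ^ (k + 1) := by positivity
    refine le_trans (le_of_eq ?_) (mul_le_mul_of_nonneg_left h1 h5.le)
    rw [pow_succ]
    field_simp
    ring
  have htel := Finset.sum_range_sub (fun k ↦ ∑ q ∈ G, (q : ℝ) ^ (-(1 + (2 : ℝ)⁻¹ ^ k))) K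
  have hsum := Finset.sum_le_sum (s := Finset.range K) fun k hk ↦ hstep k (Finset.mem_range.1 hk)
  rw [htel, Finset.sum_sub_distrib, Finset.sum_const, Finset.card_range, nsmul_eq_mul,
    ← Finset.mul_sum] at hsum
  have hgeom : ∑ k ∈ Finset.range K, (2 : ℝ)⁻¹ ^ (k + 1) ≤ 1 := by
    have : ∀ K : ℕ, ∑ k ∈ Finset.range K, (2 : ℝ)⁻¹ ^ (k + 1) = 1 - (2 : ℝ)⁻¹ ^ K := by
      intro K
      induction K with
      | zero => simp
      | succ n ih => rw [Finset.sum_range_succ, ih, pow_succ]; ring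
    rw [this]
    have : (0 : ℝ) < (2 : ℝ)⁻¹ ^ K := by positivity
    linarith
  have h0 : 0 ≤ ∑ q ∈ G, (q : ℝ) ^ (-(1 + (2 : ℝ)⁻¹ ^ 0)) := by positivity
  have := mul_le_mul_of_nonneg_left hgeom hC0
  linarith

end PrimesOneMod

section NonCube

open NumberField

/-- In an extension where `θ ^ 2 = d`, the residues of `s + tθ` modulo a prime splitting in
`ℚ(√d)` are governed by those of `s ± tρ`. -/
lemma dvd_pow_sub_one_of_sq {R : Type*} [CommRing R] {q : ℕ} (hq : q.Prime) {d : ℕ}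
    {θ : R} (hθ : θ ^ 2 = d) {ρ s t : ℤ} (hρ : (q : ℤ) ∣ ρ ^ 2 - d) (h2 : ¬ (q : ℤ) ∣ 2 * ρ)
    {k : ℕ} (h3 : (q : ℤ) ∣ (s + t * ρ) ^ k - 1) (h4 : (q : ℤ) ∣ (s - t * ρ) ^ k - 1) :
    (q : R) ∣ (s + t * θ) ^ k - 1 := by
  obtain ⟨a, ha⟩ := map_dvd (Int.castRingHom R) hρ
  obtain ⟨b, hb⟩ := map_dvd (Int.castRingHom R) h3
  obtain ⟨c, hc⟩ := map_dvd (Int.castRingHom R) h4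
  simp only [map_sub, map_pow, map_add, map_mul, map_one, eq_intCast, Int.cast_natCast] at ha hb hc
  obtain ⟨u, hu⟩ := sub_dvd_pow_sub_pow (s + t * θ : R) (s + t * ρ) k
  obtain ⟨v, hv⟩ := sub_dvd_pow_sub_pow (s + t * θ : R) (s - t * ρ) k
  have h5 : (q : R) ∣ (2 * ρ : ℤ) * ((s + t * θ) ^ k - 1) := by
    refine ⟨-a * t * u + a * t * v + (θ + ρ) * b - (θ - ρ) * c, ?_⟩
    push_cast
    linear_combination (θ + ρ) * hu - (θ - ρ) * hv + (θ + ρ) * hb - (θ - ρ) * hc +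
      (t * u - t * v) * hθ - (t * u - t * v) * ha
  have hc : IsCoprime (q : R) ((2 * ρ : ℤ) : R) := by
    have : IsCoprime (q : ℤ) (2 * ρ) :=
      (Prime.coprime_iff_not_dvd (Nat.prime_iff_prime_int.1 hq)).2 h2
    simpa using this.map (Int.castRingHom R)
  exact hc.dvd_of_dvd_mul_left h5

lemma Int.dvd_pow_sub_one_of_cube {q : ℕ} (hq : q.Prime) {k : ℕ} (hk : 3 * k = q - 1) {a y : ℤ}
    (ha : ¬ (q : ℤ) ∣ a) (hy : (q : ℤ) ∣ y ^ 3 - a) : (q : ℤ) ∣ a ^ k - 1 := by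
  have := Fact.mk hq
  rw [← ZMod.intCast_zmod_eq_zero_iff_dvd] at hy ha ⊢
  push_cast at hy ha ⊢
  rw [sub_eq_zero] at hy ⊢
  rw [← hy, ← pow_mul, hk]
  apply ZMod.pow_card_sub_one_eq_one
  intro h0
  rw [h0] at hy
  exact ha (by rw [← hy]; ring)

lemma exists_sq_of_modEq_one {d q : ℕ} (hq : q.Prime) (hq2 : q ≠ 2)
    (h : q % (4 * d) = 1 % (4 * d)) : ∃ ρ : ℤ, (q : ℤ) ∣ ρ ^ 2 - d := by
  have := Fact.mk hq
  have h1 : jacobiSym d q = 1 := by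
    rw [jacobiSym.mod_right' d (hq.odd_of_ne_two hq2), h,
      ← jacobiSym.mod_right' d odd_one, jacobiSym.one_right]
  rw [← jacobiSym.legendreSym.to_jacobiSym] at h1
  have h2 : ((d : ℤ) : ZMod q) ≠ 0 := by
    intro h0
    rw [(legendreSym.eq_zero_iff q d).2 h0] at h1
    exact zero_ne_one h1
  obtain ⟨c, hc⟩ := (legendreSym.eq_one_iff q h2).1 h1
  obtain ⟨ρ, rfl⟩ := ZMod.intCast_surjective c
  refine ⟨ρ, ?_⟩
  rw [← ZMod.intCast_zmod_eq_zero_iff_dvd]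
  push_cast at hc ⊢
  rw [hc]; ring

section Kummer

variable {E : Type} [Field E] [NumberField E]

/-- Adjoining a cube root of a non-cube to a number field. -/
lemma exists_kummer_extension {δ : E} (h : ∀ b : E, b ^ 3 ≠ δ) :
    ∃ (L : Type) (_ : Field L) (_ : NumberField L) (_ : Algebra E L) (γ : L),
      γ ^ 3 = algebraMap E L δ ∧ Module.finrank ℚ L = Module.finrank ℚ E * 3 ∧
      ∀ A : Subalgebra ℚ L, γ ∈ A → (∀ e : E, algebraMap E L e ∈ A) → A = ⊤ := by
  have hirr : Irreducible (Polynomial.X ^ 3 - Polynomial.C δ) :=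
    X_pow_sub_C_irreducible_of_prime Nat.prime_three h
  have := Fact.mk hirr
  have hfin : FiniteDimensional E (AdjoinRoot (Polynomial.X ^ 3 - Polynomial.C δ)) :=
    (AdjoinRoot.powerBasis hirr.ne_zero).finite
  have : CharZero (AdjoinRoot (Polynomial.X ^ 3 - Polynomial.C δ)) :=
    charZero_of_injective_algebraMap
      (algebraMap E (AdjoinRoot (Polynomial.X ^ 3 - Polynomial.C δ))).injective
  have : FiniteDimensional ℚ (AdjoinRoot (Polynomial.X ^ 3 - Polynomial.C δ)) :=
    FiniteDimensional.trans ℚ E _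
  refine ⟨AdjoinRoot (Polynomial.X ^ 3 - Polynomial.C δ), inferInstance, ⟨⟩, inferInstance,
    AdjoinRoot.root _, ?_, ?_, ?_⟩
  · have := AdjoinRoot.eval₂_root (Polynomial.X ^ 3 - Polynomial.C δ)
    rw [Polynomial.eval₂_sub, Polynomial.eval₂_pow, Polynomial.eval₂_X, Polynomial.eval₂_C,
      sub_eq_zero] at this
    exact this
  · rw [← Module.finrank_mul_finrank ℚ E,
      (AdjoinRoot.powerBasis hirr.ne_zero).finrank, AdjoinRoot.powerBasis_dim hirr.ne_zero,
      Polynomial.natDegree_X_pow_sub_C]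
  · intro A hγ hE
    rw [eq_top_iff]
    intro x _
    obtain ⟨p, rfl⟩ := AdjoinRoot.mk_surjective x
    rw [← AdjoinRoot.aeval_eq, Polynomial.aeval_eq_sum_range]
    refine sum_mem fun i _ ↦ ?_
    rw [Algebra.smul_def]
    exact mul_mem (hE _) (pow_mem hγ _)

end Kummer

namespace QuadField

variable {d : ℕ} {K : Type} [Field K] [NumberField K] (Q : QuadField d K)

lemma exists_kummer_data_of_cyclotomic {m : ℕ} [NeZero m] (E : Type) [Field E] [NumberField E]
    [IsCyclotomicExtension {m} ℚ E] (hm0 : m ≠ 0) (h8 : 8 ∣ m) (hdm : d ∣ m) (h2 : 2 < m)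
    {s t : ℤ} (h : ¬ ∃ x : K, x ^ 3 = s + t * Q.θ) :
    ∃ (L : Type) (_ : Field L) (_ : NumberField L) (ζ' θ' γ' : 𝓞 L), ζ' ^ m = 1 ∧
      θ' ^ 2 = d ∧ γ' ^ 3 = s + t * θ' ∧
      Algebra.adjoin ℚ ((↑) '' ({ζ', θ', γ'} : Set (𝓞 L)) : Set L) = ⊤ ∧
      Module.finrank ℚ L = m.totient * 3 := by
  have hζ := IsCyclotomicExtension.zeta_spec m ℚ E
  set ζ := IsCyclotomicExtension.zeta m ℚ E
  have : IsAbelianGalois ℚ E := IsCyclotomicExtension.isAbelianGalois {m} ℚ E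
  have : IsTotallyComplex E := IsCyclotomicExtension.Rat.isTotallyComplex E (n := m) h2
  obtain ⟨θE, hθE⟩ := isSquare_natCast_of_isPrimitiveRoot hm0 hζ h8 d hdm
  have hθE2 : θE ^ 2 = d := by rw [pow_two]; exact hθE.symm
  obtain ⟨L, _, _, _, γ, hγ, hrank, htop⟩ := exists_kummer_extension (δ := s + t * θE)
    (fun b hb ↦ h (Q.exists_cube_of_abelian hθE2 hb))
  have hθL2 : (algebraMap E L θE) ^ 2 = d := by rw [← map_pow, hθE2, map_natCast]
  have hγ3 : γ ^ 3 = s + t * algebraMap E L θE := by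
    rw [hγ]; simp only [map_add, map_mul, map_intCast]
  have hζL : (algebraMap E L ζ) ^ m = 1 := by rw [← map_pow, hζ.pow_eq_one, map_one]
  have hθint : IsIntegral ℤ (algebraMap E L θE) := by
    apply IsIntegral.of_pow (n := 2) (by norm_num)
    rw [hθL2]; exact isIntegral_natCast _
  have hγint : IsIntegral ℤ γ := by
    apply IsIntegral.of_pow (n := 3) (by norm_num)
    rw [hγ3]
    exact (isIntegral_intCast _).add ((isIntegral_intCast _).mul hθint)
  have hζint : IsIntegral ℤ (algebraMap E L ζ) := by
    apply IsIntegral.of_pow (n := m) (Nat.pos_of_ne_zero hm0)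
    rw [hζL]; exact isIntegral_one
  obtain ⟨ζ', hζ'⟩ : ∃ z : 𝓞 L, algebraMap (𝓞 L) L z = algebraMap E L ζ := ⟨⟨_, hζint⟩, rfl⟩
  obtain ⟨θ', hθ'⟩ : ∃ z : 𝓞 L, algebraMap (𝓞 L) L z = algebraMap E L θE := ⟨⟨_, hθint⟩, rfl⟩
  obtain ⟨γ', hγ'⟩ : ∃ z : 𝓞 L, algebraMap (𝓞 L) L z = γ := ⟨⟨_, hγint⟩, rfl⟩
  have hinj := FaithfulSMul.algebraMap_injective (𝓞 L) L
  refine ⟨L, inferInstance, inferInstance, ζ', θ', γ',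
    hinj ?_, hinj ?_, hinj ?_, ?_, ?_⟩
  · rw [map_pow, hζ', hζL, map_one]
  · rw [map_pow, hθ', hθL2, map_natCast]
  · rw [map_pow, hγ', hγ3]; simp only [map_add, map_mul, map_intCast, hθ']
  · apply htop
    · exact Algebra.subset_adjoin ⟨γ', by simp, hγ'⟩
    · intro e
      have he : e ∈ Algebra.adjoin ℚ ({ζ} : Set E) := by
        rw [IsCyclotomicExtension.adjoin_primitive_root_eq_top hζ]; trivial
      have hle : Algebra.adjoin ℚ ({ζ} : Set E) ≤ Subalgebra.comap (IsScalarTower.toAlgHom ℚ E L)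
          (Algebra.adjoin ℚ ((↑) '' ({ζ', θ', γ'} : Set (𝓞 L)) : Set L)) := by
        apply Algebra.adjoin_le
        rintro _ rfl
        exact Algebra.subset_adjoin ⟨ζ', by simp, hζ'⟩
      exact hle he
  · rw [hrank, IsCyclotomicExtension.finrank (n := m) E
      (Polynomial.cyclotomic.irreducible_rat (Nat.pos_of_ne_zero hm0))]

lemma exists_kummer_data {s t : ℤ} (h : ¬ ∃ x : K, x ^ 3 = s + t * Q.θ) :
    ∃ (L : Type) (_ : Field L) (_ : NumberField L) (ζ' θ' γ' : 𝓞 L), ζ' ^ (24 * d) = 1 ∧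
      θ' ^ 2 = d ∧ γ' ^ 3 = s + t * θ' ∧
      Algebra.adjoin ℚ ((↑) '' ({ζ', θ', γ'} : Set (𝓞 L)) : Set L) = ⊤ ∧
      Module.finrank ℚ L = (24 * d).totient * 3 := by
  have hd1 := Q.one_lt
  have hm0 : 24 * d ≠ 0 := by omega
  have : NeZero (24 * d) := ⟨hm0⟩
  have : IsCyclotomicExtension {24 * d} ℚ (CyclotomicField (24 * d) ℚ) := by
    convert! (inferInstance : @IsCyclotomicExtension {24 * d} ℚ (CyclotomicField (24 * d) ℚ) _ _
      (CyclotomicField.algebra (24 * d) ℚ))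
  exact Q.exists_kummer_data_of_cyclotomic (CyclotomicField (24 * d) ℚ) hm0 ⟨3 * d, by ring⟩
    ⟨24, by ring⟩ (by omega) h

/-- An element of `ℤ[√d]` which is not a cube in `ℚ(√d)` fails to be a cube modulo arbitrarily
large primes. -/
lemma exists_prime_noncube {s t : ℤ} (h : ¬ ∃ x : K, x ^ 3 = s + t * Q.θ) (N : ℕ) :
    ∃ q : ℕ, q.Prime ∧ N < q ∧ q % 3 = 1 ∧ ∃ ρ : ℤ, (q : ℤ) ∣ ρ ^ 2 - d ∧
      ¬ ∃ y : ℤ, (q : ℤ) ∣ y ^ 3 - (s + t * ρ) := by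
  classical
  by_contra! hcon
  have hd1 := Q.one_lt
  set m := 24 * d with hm
  have hm0 : m ≠ 0 := by omega
  have : NeZero m := ⟨hm0⟩
  obtain ⟨L, _, _, ζ', θ', γ', hζ', hθ', hγ', hadj, hrank⟩ := Q.exists_kummer_data h
  rw [← hm] at hζ' hrank
  obtain ⟨N₁, hN₁, hN₁'⟩ := exists_mul_mem_adjoin_int hadj
  have hnz : s ^ 2 - d * t ^ 2 ≠ 0 := by
    intro h0
    have h1 : ((s : ℚ)) ^ 2 = d * (t : ℚ) ^ 2 := by
      have : s ^ 2 = d * t ^ 2 := by linarith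
      exact_mod_cast this
    obtain ⟨hs, ht⟩ := not_rat_sq Q.sqf Q.one_lt _ _ h1
    have hs' : s = 0 := by exact_mod_cast hs
    have ht' : t = 0 := by exact_mod_cast ht
    exact h ⟨0, by simp [hs', ht']⟩
  set N' := N + N₁ + (s ^ 2 - d * t ^ 2).natAbs + 2 * d + 2 with hN'
  have hsplit : ∀ q, IsLargeOneMod m N' q → q.Prime ∧ ∃ F : Finset (Ideal (𝓞 L)),
      F.card = Module.finrank ℚ L ∧ ∀ P ∈ F, P.IsPrime ∧ Ideal.absNorm P = q := by
    rintro q ⟨hq, hqN, hqm⟩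
    have := Fact.mk hq
    refine ⟨hq, exists_split_ideals hq ?_⟩
    have hmd : m ∣ q - 1 := by
      rw [← ZMod.natCast_eq_zero_iff, Nat.cast_sub hq.one_lt.le, hqm]; simp
    obtain ⟨j, hj⟩ := hmd
    have hq1 : q = m * j + 1 := by have := hq.one_lt; omega
    obtain ⟨ρ, hρ⟩ := exists_sq_of_modEq_one (d := d) hq (by omega) (by
      rw [hq1, hm, show 24 * d * j + 1 = 1 + (4 * d) * (6 * j) by ring, Nat.add_mul_mod_self_left])
    have hsmall : ∀ n : ℕ, n ≠ 0 → n < q → ¬ q ∣ n := fun n hn hnq hdvd ↦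
      absurd (Nat.le_of_dvd (Nat.pos_of_ne_zero hn) hdvd) (by omega)
    have hqd : ¬ (q : ℤ) ∣ d := by
      intro hdvd
      exact hsmall d (by omega) (by omega) (by exact_mod_cast hdvd)
    have hqρ : ¬ (q : ℤ) ∣ ρ := by
      intro hdvd
      apply hqd
      have := dvd_sub (hdvd.pow two_ne_zero : (q : ℤ) ∣ ρ ^ 2) hρ
      simpa using this
    have hqp : Prime (q : ℤ) := Nat.prime_iff_prime_int.1 hq
    have hq2ρ : ¬ (q : ℤ) ∣ 2 * ρ := by
      intro hdvd
      rcases hqp.dvd_or_dvd hdvd with h2 | h2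
      · exact hsmall 2 (by omega) (by omega) (by exact_mod_cast h2)
      · exact hqρ h2
    have hqn : ¬ (q : ℤ) ∣ (s + t * ρ) * (s - t * ρ) := by
      intro hdvd
      have h2 : (q : ℤ) ∣ s ^ 2 - d * t ^ 2 := by
        have h3 := dvd_add hdvd (hρ.mul_left (t ^ 2))
        rwa [show (s + t * ρ) * (s - t * ρ) + t ^ 2 * (ρ ^ 2 - d) = s ^ 2 - d * t ^ 2 by ring]
          at h3
      exact hsmall _ (Int.natAbs_ne_zero.2 hnz) (by omega) (Int.natCast_dvd.1 h2)
    have hk : 3 * (8 * d * j) = q - 1 := by rw [hj, hm]; ring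
    obtain ⟨y, hy⟩ := hcon q hq (by omega) (by
      rw [hq1, hm, show 24 * d * j + 1 = 1 + 3 * (8 * d * j) by ring, Nat.add_mul_mod_self_left])
      ρ hρ
    obtain ⟨y', hy'⟩ := hcon q hq (by omega) (by
      rw [hq1, hm, show 24 * d * j + 1 = 1 + 3 * (8 * d * j) by ring, Nat.add_mul_mod_self_left])
      (-ρ) (by rwa [neg_sq])
    have hy'' : (q : ℤ) ∣ y' ^ 3 - (s - t * ρ) := by
      rwa [show s + t * -ρ = s - t * ρ by ring] at hy'
    have hcube := dvd_pow_sub_one_of_sq hq hθ' hρ hq2ρ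
      (Int.dvd_pow_sub_one_of_cube hq hk (fun hh ↦ hqn (hh.mul_right _)) hy)
      (Int.dvd_pow_sub_one_of_cube hq hk (fun hh ↦ hqn (hh.mul_left _)) hy'')
    refine dvd_pow_sub_self hN₁' hq (hsmall N₁ hN₁ (by omega)) ?_
    intro x hx
    rcases hx with hx | hx | hx <;> rw [hx]
    · rw [hq1, pow_succ, pow_mul, hζ', one_pow, one_mul, sub_self]
      exact dvd_zero _
    · have h5 : (q : ℤ) ∣ d ^ (12 * d * j) - 1 := by
        have h6 : (q : ℤ) ∣ ρ ^ (q - 1) - 1 := by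
          rw [← ZMod.intCast_zmod_eq_zero_iff_dvd] at hqρ ⊢
          push_cast
          rw [ZMod.pow_card_sub_one_eq_one hqρ, sub_self]
        rw [show q - 1 = 2 * (12 * d * j) by rw [hj, hm]; ring, pow_mul] at h6
        have h7 := hρ.trans (sub_dvd_pow_sub_pow (ρ ^ 2) (d : ℤ) (12 * d * j))
        have := dvd_sub h6 h7
        rwa [show (ρ ^ 2) ^ (12 * d * j) - 1 - ((ρ ^ 2) ^ (12 * d * j) - (d : ℤ) ^ (12 * d * j)) =
          (d : ℤ) ^ (12 * d * j) - 1 by ring] at this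
      have h8 : (q : 𝓞 L) ∣ (d : 𝓞 L) ^ (12 * d * j) - 1 := by
        simpa using map_dvd (Int.castRingHom (𝓞 L)) h5
      have h9 : θ' ^ q - θ' = ((d : 𝓞 L) ^ (12 * d * j) - 1) * θ' := by
        rw [hq1, hm, show 24 * d * j + 1 = 2 * (12 * d * j) + 1 by ring, pow_succ, pow_mul, hθ']
        ring
      rw [h9]
      exact h8.mul_right _
    · have h9 : γ' ^ q - γ' = ((s + t * θ') ^ (8 * d * j) - 1) * γ' := by
        rw [hq1, hm, show 24 * d * j + 1 = 3 * (8 * d * j) + 1 by ring, pow_succ, pow_mul, hγ']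
        ring
      rw [h9]
      exact hcube.mul_right _
  obtain ⟨C₁, hC₁⟩ := exists_split_sum_le L
  obtain ⟨C₂, hC₂⟩ := exists_finset_rpow_sum_ge m N'
  have hφ : (0 : ℝ) < m.totient := by exact_mod_cast Nat.totient_pos.2 (Nat.pos_of_ne_zero hm0)
  obtain ⟨k, hk⟩ := exists_nat_gt (2 * (C₁ + m.totient * 3 * C₂))
  obtain ⟨T, hT, hlow⟩ := hC₂ k
  have hup := hC₁ T (fun q hq ↦ hsplit q (hT q hq)) k
  rw [hrank] at hup
  push_cast at hup
  have h1 := mul_le_mul_of_nonneg_left hlow (by positivity : (0 : ℝ) ≤ m.totient * 3)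
  have h2 : (m.totient * 3 : ℝ) * (k * ((m.totient : ℝ)⁻¹ / 2) - C₂) =
    3 / 2 * k - m.totient * 3 * C₂ := by field_simp
  linarith

end QuadField

end NonCube

section Represented

open NumberField nonZeroDivisors

namespace QuadField

variable {d : ℕ} {K : Type} [Field K] [NumberField K] (Q : QuadField d K)

/-- Every three-torsion ideal class contains an ideal coprime to a given integer. -/
lemma exists_coprime_torsion_ideal (c : ClassGroup (𝓞 K)) (hc : c ^ 3 = 1) {N : ℕ} (hN : N ≠ 0) :
    ∃ (J : (Ideal (𝓞 K))⁰) (δ : 𝓞 K), δ ≠ 0 ∧ ClassGroup.mk0 J = c ∧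
      (J : Ideal (𝓞 K)) ^ 3 = Ideal.span {δ} ∧
      IsCoprime (J : Ideal (𝓞 K)) (Ideal.span {(N : 𝓞 K)}) := by
  have hN0 : Ideal.span {(N : 𝓞 K)} ≠ ⊥ := by
    rw [Ne, Ideal.span_singleton_eq_bot]; exact_mod_cast hN
  by_cases htop : Ideal.span {(N : 𝓞 K)} = ⊤
  · obtain ⟨J, δ, h1, h2, h3⟩ := exists_torsion_ideal c hc
    exact ⟨J, δ, h1, h2, h3, Ideal.isCoprime_iff_sup_eq.2 (by rw [htop, sup_top_eq])⟩
  obtain ⟨A, hA⟩ := ClassGroup.mk0_surjective c⁻¹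
  have hA0 : (A : Ideal (𝓞 K)) ≠ 0 := nonZeroDivisors.coe_ne_zero A
  have hle : (A : Ideal (𝓞 K)) * Ideal.span {(N : 𝓞 K)} ≤ A :=
    Ideal.dvd_iff_le.1 (dvd_mul_right _ _)
  have hne : (A : Ideal (𝓞 K)) * Ideal.span {(N : 𝓞 K)} ≠ 0 := mul_ne_zero hA0 hN0
  obtain ⟨a, ha⟩ := IsDedekindDomain.exists_sup_span_eq hle hne
  have haA : Ideal.span {a} ≤ (A : Ideal (𝓞 K)) := by
    rw [← ha]; exact le_sup_right
  obtain ⟨B, hB⟩ := Ideal.dvd_iff_le.2 haA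
  have hcop : B ⊔ Ideal.span {(N : 𝓞 K)} = ⊤ := by
    apply mul_left_cancel₀ hA0
    rw [hB, ← Ideal.mul_sup, sup_comm] at ha
    rw [ha, ← Ideal.one_eq_top, mul_one]
  have hB0 : B ≠ 0 := by
    rintro rfl
    rw [Ideal.zero_eq_bot, bot_sup_eq] at hcop
    exact htop hcop
  set B' : (Ideal (𝓞 K))⁰ := ⟨B, mem_nonZeroDivisors_of_ne_zero hB0⟩ with hB'
  have hBc : ClassGroup.mk0 B' = c := by
    have h1 : ClassGroup.mk0 (A * B') = 1 := by
      exact (ClassGroup.mk0_eq_one_iff (A * B').2).2 ⟨a, hB.symm⟩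
    rw [map_mul, hA] at h1
    exact (inv_mul_eq_one.1 h1).symm
  obtain ⟨δ, hδ, h⟩ := exists_generator_cube (I := B') (by rw [hBc, hc])
  exact ⟨B', δ, hδ, hBc, h, Ideal.isCoprime_iff_sup_eq.2 hcop⟩

include Q in
lemma natCast_dvd_of_dvd_uv {q : ℕ} (h2 : IsCoprime (q : ℤ) 2) {x : 𝓞 K} {u v : ℤ}
    (hx : 2 * (x : K) = u + v * Q.θ) (hu : (q : ℤ) ∣ u) (hv : (q : ℤ) ∣ v) : (q : 𝓞 K) ∣ x := by
  obtain ⟨a, rfl⟩ := hu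
  obtain ⟨b, rfl⟩ := hv
  have h1 : (q : 𝓞 K) ∣ ((2 : ℤ) : 𝓞 K) * x := by
    rw [show ((2 : ℤ) : 𝓞 K) * x = x + x by push_cast; ring]
    refine ⟨Q.el a b, RingOfIntegers.ext ?_⟩
    push_cast [coe_el] at hx ⊢
    linear_combination hx
  have h3 : IsCoprime (q : 𝓞 K) ((2 : ℤ) : 𝓞 K) := by simpa using h2.map (Int.castRingHom (𝓞 K))
  exact h3.dvd_of_dvd_mul_left h1

include Q in
/-- Odd primes not dividing `d` are unramified. -/
lemma natCast_dvd_of_dvd_cube {q : ℕ} (hq : q.Prime) (hq2 : ¬ q ∣ 2 * d) {x : 𝓞 K}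
    (hx : (q : 𝓞 K) ∣ x ^ 3) : (q : 𝓞 K) ∣ x := by
  have hqp : Prime (q : ℤ) := Nat.prime_iff_prime_int.1 hq
  have h2 : IsCoprime (q : ℤ) 2 := by
    rw [Prime.coprime_iff_not_dvd hqp]
    intro h
    exact hq2 ((by exact_mod_cast h : q ∣ 2).mul_right _)
  obtain ⟨u, v, huv, hnorm⟩ := Q.exists_uv x
  have hnq : (q : ℤ) ∣ Q.nrm x := by
    obtain ⟨y, hy⟩ := hx
    have h1 : Q.nrm x ^ 3 = q ^ 2 * Q.nrm y := by
      rw [← nrm_pow, hy, nrm_mul]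
      congr 1
      apply nrm_eq
      push_cast
      rw [map_natCast]; ring
    exact hqp.dvd_of_dvd_pow (n := 3) ⟨q * Q.nrm y, by rw [h1]; ring⟩
  have hxx : x ^ 2 = u * x - Q.nrm x := by
    apply RingOfIntegers.ext
    push_cast
    have h4 : (4 : K) * (x : K) ^ 2 = 4 * (u * x - Q.nrm x) := by
      have h5 : (u : K) ^ 2 - d * v ^ 2 = 4 * Q.nrm x := by exact_mod_cast congrArg (Int.cast (R := K)) hnorm
      linear_combination (2 * (x : K) + v * Q.θ - u) * huv - h5 + (v : K) ^ 2 * Q.sq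
    exact mul_left_cancel₀ (by norm_num) h4
  obtain ⟨k, hk⟩ := hnq
  have hk' : ((Q.nrm x : ℤ) : 𝓞 K) = q * k := by rw [hk]; push_cast; rfl
  have hux : (q : 𝓞 K) ∣ ((u ^ 2 : ℤ) : 𝓞 K) * x := by
    have : ((u ^ 2 : ℤ) : 𝓞 K) * x = x ^ 3 + q * (k * x + u * k) := by
      push_cast
      linear_combination (-x - u) * hxx + (x + u) * hk'
    rw [this]
    exact dvd_add hx (dvd_mul_right _ _)
  by_cases hqu : (q : ℤ) ∣ u
  · refine Q.natCast_dvd_of_dvd_uv h2 huv hqu ?_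
    have h6 : (q : ℤ) ∣ d * v ^ 2 := by
      have h7 : (d : ℤ) * v ^ 2 = u * u - 4 * (q * k) := by rw [← hk]; linear_combination -hnorm
      rw [h7]
      exact dvd_sub (hqu.mul_right _) ((dvd_mul_right _ _).mul_left _)
    rcases hqp.dvd_or_dvd h6 with h | h
    · exact absurd ((by exact_mod_cast h : q ∣ d).mul_left 2) hq2
    · exact hqp.dvd_of_dvd_pow h
  · have h8 : IsCoprime (q : ℤ) (u ^ 2) :=
      ((Prime.coprime_iff_not_dvd hqp).2 hqu).pow_right
    have h9 : IsCoprime (q : 𝓞 K) ((u ^ 2 : ℤ) : 𝓞 K) := by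
      simpa using h8.map (Int.castRingHom (𝓞 K))
    exact h9.dvd_of_dvd_mul_left hux

include Q in
lemma natCast_isUnit_iff {q : ℕ} (h : IsUnit (q : 𝓞 K)) : q = 1 := by
  obtain ⟨y, hy⟩ := h.exists_right_inv
  have h1 : Q.nrm ((q : 𝓞 K) * y) = 1 := by rw [hy]; apply nrm_eq; simp
  rw [nrm_mul, Q.nrm_eq (x := (q : 𝓞 K)) (n := (q : ℤ) * q) (by push_cast; simp)] at h1
  have h2 : IsUnit (q : ℤ) := IsUnit.of_mul_eq_one ((q : ℤ) * Q.nrm y) (by rw [← h1]; ring)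
  simpa [Int.isUnit_iff] using h2

include Q in
lemma span_le_of_dvd_cube {q : ℕ} (hq : q.Prime) (hq2 : ¬ q ∣ 2 * d) {J : Ideal (𝓞 K)}
    (h : J ^ 3 ≤ Ideal.span {(q : 𝓞 K)}) : J ≤ Ideal.span {(q : 𝓞 K)} := by
  intro x hx
  rw [Ideal.mem_span_singleton]
  exact Q.natCast_dvd_of_dvd_cube hq hq2
    (Ideal.mem_span_singleton.1 (h (Ideal.pow_mem_pow hx 3)))

lemma el_inj {s t u v : ℤ} (h : Q.el s t = Q.el u v) : s = u ∧ t = v := by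
  have h1 := congrArg (fun x : 𝓞 K => (x : K)) h
  simp only [coe_el] at h1
  have h2 : algebraMap ℚ K ((s - u : ℤ) : ℚ) + algebraMap ℚ K ((t - v : ℤ) : ℚ) * Q.θ = 0 := by
    simp only [map_intCast]; push_cast; linear_combination h1
  obtain ⟨h3, h4⟩ := Q.rat_pair_zero h2
  have h3' : s - u = 0 := by exact_mod_cast h3
  have h4' : t - v = 0 := by exact_mod_cast h4
  omega

/-- If `el s t` generates the cube of an ideal coprime to `18 d`, it is a rational cube times a
primitive element. -/
lemma exists_primitive (N : ℕ) : ∀ (J : Ideal (𝓞 K)) (s t : ℤ), s.natAbs + t.natAbs = N →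
    Q.el s t ≠ 0 → J ^ 3 = Ideal.span {Q.el s t} →
    IsCoprime J (Ideal.span {((18 * d : ℕ) : 𝓞 K)}) → 9 ∣ t →
    ∃ s' t' n k : ℤ, k ≠ 0 ∧ s = k ^ 3 * s' ∧ t = k ^ 3 * t' ∧ s' ^ 2 - d * t' ^ 2 = n ^ 3 ∧
      IsCoprime s' t' ∧ 9 ∣ t' := by
  induction N using Nat.strong_induction_on with
  | _ N ih =>
  intro J s t hN h0 hJ hco h9
  by_cases hst : IsCoprime s t
  · have h1 := Q.natAbs_nrm_cube h0 hJ
    rw [nrm_el] at h1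
    rcases Int.natAbs_eq (s ^ 2 - d * t ^ 2) with h | h
    · exact ⟨s, t, Ideal.absNorm J, 1, one_ne_zero, by ring, by ring, by rw [h, h1]; push_cast; ring,
        hst, h9⟩
    · exact ⟨s, t, -Ideal.absNorm J, 1, one_ne_zero, by ring, by ring,
        by rw [h, h1]; push_cast; ring, hst, h9⟩
  rw [Int.isCoprime_iff_gcd_eq_one] at hst
  obtain ⟨q, hq, hqg⟩ := Nat.exists_prime_and_dvd hst
  obtain ⟨a, ha⟩ : (q : ℤ) ∣ s := (Int.natCast_dvd_natCast.2 hqg).trans (Int.gcd_dvd_left _ _)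
  obtain ⟨b, hb⟩ : (q : ℤ) ∣ t := (Int.natCast_dvd_natCast.2 hqg).trans (Int.gcd_dvd_right _ _)
  have hδ : Q.el s t = (q : 𝓞 K) * Q.el a b := by
    apply RingOfIntegers.ext
    push_cast [coe_el, ha, hb]
    ring
  have hJq : J ^ 3 ≤ Ideal.span {(q : 𝓞 K)} := by
    rw [hJ, Ideal.span_singleton_le_span_singleton, hδ]
    exact dvd_mul_right _ _
  have hq18 : ¬ q ∣ 18 * d := by
    intro hdv
    have h1 : Ideal.span {((18 * d : ℕ) : 𝓞 K)} ≤ Ideal.span {(q : 𝓞 K)} := by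
      rw [Ideal.span_singleton_le_span_singleton]
      exact Nat.cast_dvd_cast hdv
    have h2 : J ^ 3 ⊔ Ideal.span {((18 * d : ℕ) : 𝓞 K)} = ⊤ :=
      Ideal.isCoprime_iff_sup_eq.1 hco.pow_left
    have h3 : Ideal.span {(q : 𝓞 K)} = ⊤ := top_le_iff.1 (h2 ▸ sup_le hJq h1)
    rw [Ideal.span_singleton_eq_top] at h3
    exact hq.one_lt.ne' (Q.natCast_isUnit_iff h3)
  have hq2 : ¬ q ∣ 2 * d := fun h => hq18 (h.trans ⟨9, by ring⟩)
  have hqI : Prime (q : ℤ) := Nat.prime_iff_prime_int.1 hq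
  have hc2 : IsCoprime ((q : ℤ) ^ 3) 2 := by
    apply IsCoprime.pow_left
    rw [Prime.coprime_iff_not_dvd hqI]
    exact fun h => hq18 ((by exact_mod_cast h : q ∣ 2).trans ⟨9 * d, by ring⟩)
  have hc9 : IsCoprime (9 : ℤ) ((q : ℤ) ^ 3) := by
    apply IsCoprime.pow_right
    rw [show (9 : ℤ) = 3 ^ 2 by norm_num]
    apply IsCoprime.pow_left
    rw [isCoprime_comm, Prime.coprime_iff_not_dvd hqI]
    exact fun h => hq18 ((by exact_mod_cast h : q ∣ 3).trans ⟨6 * d, by ring⟩)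
  obtain ⟨J₁, hJ₁⟩ := Ideal.dvd_iff_le.2 (Q.span_le_of_dvd_cube hq hq2 hJq)
  have hq0 : (q : 𝓞 K) ≠ 0 := by exact_mod_cast hq.ne_zero
  have hmem : Q.el s t ∈ Ideal.span {(q : 𝓞 K) ^ 3} := by
    have : J ^ 3 ≤ Ideal.span {(q : 𝓞 K) ^ 3} := by
      rw [hJ₁, mul_pow, Ideal.span_singleton_pow]
      exact Ideal.dvd_iff_le.1 (dvd_mul_right _ _)
    exact this (hJ ▸ Ideal.mem_span_singleton_self _)
  obtain ⟨δ₁, hδ₁⟩ := Ideal.mem_span_singleton.1 hmem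
  have hJ₁3 : J₁ ^ 3 = Ideal.span {δ₁} := by
    have h1 : Ideal.span {(q : 𝓞 K) ^ 3} ≠ 0 := by
      rw [Ideal.zero_eq_bot, Ne, Ideal.span_singleton_eq_bot]
      exact pow_ne_zero 3 hq0
    apply mul_left_cancel₀ h1
    rw [Ideal.span_singleton_mul_span_singleton, ← hδ₁, ← hJ, hJ₁, mul_pow,
      Ideal.span_singleton_pow]
  obtain ⟨u, v, huv, -⟩ := Q.exists_uv δ₁
  have h2el : Q.el (2 * s) (2 * t) = Q.el (q ^ 3 * u) (q ^ 3 * v) := by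
    apply RingOfIntegers.ext
    have h1 := congrArg (fun x : 𝓞 K => (x : K)) hδ₁
    push_cast [coe_el] at h1 ⊢
    linear_combination 2 * h1 + (q : K) ^ 3 * huv
  obtain ⟨hs2, ht2⟩ := Q.el_inj h2el
  obtain ⟨s₁, hs₁⟩ : 2 ∣ u := hc2.symm.dvd_of_dvd_mul_left ⟨s, hs2.symm⟩
  obtain ⟨t₁, ht₁⟩ : 2 ∣ v := hc2.symm.dvd_of_dvd_mul_left ⟨t, ht2.symm⟩
  have hs : s = q ^ 3 * s₁ := by
    rw [hs₁] at hs2; linarith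
  have ht : t = q ^ 3 * t₁ := by
    rw [ht₁] at ht2; linarith
  have hδel : δ₁ = Q.el s₁ t₁ := by
    apply RingOfIntegers.ext
    have : (2 : K) * δ₁ = 2 * (Q.el s₁ t₁ : 𝓞 K) := by
      rw [huv, hs₁, ht₁]; push_cast [coe_el]; ring
    exact mul_left_cancel₀ two_ne_zero this
  subst hδel
  have h01 : Q.el s₁ t₁ ≠ 0 := by
    intro h; rw [h, mul_zero] at hδ₁; exact h0 hδ₁
  have hlt : s₁.natAbs + t₁.natAbs < N := by
    have hq8 : 2 ≤ q ^ 3 := hq.two_le.trans (Nat.le_self_pow (by norm_num) q)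
    have h1 : s.natAbs = q ^ 3 * s₁.natAbs := by rw [hs, Int.natAbs_mul]; simp [Int.natAbs_pow]
    have h2 : t.natAbs = q ^ 3 * t₁.natAbs := by rw [ht, Int.natAbs_mul]; simp [Int.natAbs_pow]
    have h3 : s₁.natAbs + t₁.natAbs ≠ 0 := by
      intro h4
      have h5 : s₁ = 0 := by omega
      have h6 : t₁ = 0 := by omega
      apply h01
      rw [h5, h6]
      apply RingOfIntegers.ext
      simp [coe_el]
    rw [← hN, h1, h2]
    nlinarith [Nat.pos_of_ne_zero h3]
  have hco₁ : IsCoprime J₁ (Ideal.span {((18 * d : ℕ) : 𝓞 K)}) := by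
    rw [hJ₁] at hco
    exact hco.of_mul_left_right
  obtain ⟨s', t', n, k, hk, h1, h2, h3, h4, h5⟩ := ih _ hlt J₁ s₁ t₁ rfl h01 hJ₁3 hco₁
    (hc9.dvd_of_dvd_mul_left (ht ▸ h9))
  exact ⟨s', t', n, q * k, mul_ne_zero (by exact_mod_cast hq.ne_zero) hk,
    by rw [hs, h1]; ring, by rw [ht, h2]; ring, h3, h4, h5⟩

end QuadField

end Represented

section Represented

open NumberField nonZeroDivisors

lemma eq_of_mul_sq_eq_one {G : Type*} [CommGroup G] {x y w : G} (hy : y ^ 3 = 1) (hw : w ^ 3 = 1)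
    (h : x * w * (y * w) ^ 2 = 1) : x = y := by
  have h1 : x * w * (y * w) ^ 2 * y = x * w ^ 3 * y ^ 3 := by
    simp only [pow_succ, pow_zero, one_mul]; ac_rfl
  rw [h, hy, hw, one_mul, mul_one, mul_one] at h1
  exact h1.symm

namespace QuadField

variable {d : ℕ} {K : Type} [Field K] [NumberField K] (Q : QuadField d K)

lemma exists_pow_sub_one {δ : 𝓞 K} {N : ℕ} (hN : N ≠ 0) (h : IsCoprime δ (N : 𝓞 K)) :
    ∃ j : ℕ, (N : 𝓞 K) ∣ δ ^ (j + 1) - 1 := by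
  have hN0 : Ideal.span {(N : 𝓞 K)} ≠ ⊥ := by
    rw [Ne, Ideal.span_singleton_eq_bot]; exact_mod_cast hN
  have : Finite (𝓞 K ⧸ Ideal.span {(N : 𝓞 K)}) := Ideal.finiteQuotientOfFreeOfNeBot _ hN0
  obtain ⟨a, b, hab, he⟩ := Finite.exists_ne_map_eq_of_infinite
    (fun n : ℕ => Ideal.Quotient.mk (Ideal.span {(N : 𝓞 K)}) (δ ^ n))
  wlog hlt : a < b generalizing a b
  · exact this b a hab.symm he.symm (by omega)
  obtain ⟨j, rfl⟩ : ∃ j, b = a + (j + 1) := ⟨b - a - 1, by omega⟩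
  refine ⟨j, ?_⟩
  have h1 : (N : 𝓞 K) ∣ δ ^ (a + (j + 1)) - δ ^ a := by
    rw [← Ideal.mem_span_singleton, ← Ideal.Quotient.eq]
    exact he.symm
  have h2 : IsCoprime (N : 𝓞 K) (δ ^ a) := h.symm.pow_right
  refine h2.dvd_of_dvd_mul_left ?_
  convert h1 using 1
  ring

lemma exists_el_of_dvd {β : 𝓞 K} (h : ((18 : ℕ) : 𝓞 K) ∣ β - 1) :
    ∃ a b : ℤ, β = Q.el (1 + 9 * a) (9 * b) := by
  obtain ⟨y, hy⟩ := h
  obtain ⟨u, v, huv, -⟩ := Q.exists_uv y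
  refine ⟨u, v, RingOfIntegers.ext ?_⟩
  obtain ⟨N, hN⟩ : ∃ N : ℕ, N = 9 := ⟨9, rfl⟩
  have h1 : β = 1 + (N : 𝓞 K) * (y + y) := by
    rw [hN]; push_cast at hy ⊢; linear_combination hy
  have hNK : (N : K) = 9 := by rw [hN]; norm_num
  rw [h1]
  push_cast [coe_el]
  rw [hNK]
  linear_combination 9 * huv

lemma dvd_sub_of_uv {δ δ' : 𝓞 K} {u v u' v' : ℤ} (h : 2 * (δ : K) = u + v * Q.θ)
    (h' : 2 * (δ' : K) = u' + v' * Q.θ) (hu : 36 ∣ u - u') (hv : 36 ∣ v - v') :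
    ((18 : ℕ) : 𝓞 K) ∣ δ - δ' := by
  obtain ⟨a, ha⟩ := hu
  obtain ⟨b, hb⟩ := hv
  refine ⟨Q.el a b, RingOfIntegers.ext ?_⟩
  have ha' : (u : K) - u' = 36 * a := by exact_mod_cast congrArg (Int.cast (R := K)) ha
  have hb' : (v : K) - v' = 36 * b := by exact_mod_cast congrArg (Int.cast (R := K)) hb
  have : (2 : K) * ((δ : K) - δ') = 2 * (18 * (a + b * Q.θ)) := by
    linear_combination h - h' + ha' + Q.θ * hb'
  push_cast [coe_el]
  exact mul_left_cancel₀ two_ne_zero this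

lemma isCoprime_of_isCoprime_ringOfIntegers {a b : ℤ}
    (h : IsCoprime (a : 𝓞 K) (b : 𝓞 K)) : IsCoprime a b := by
  refine isCoprime_of_dvd _ _ ?_ ?_
  · rintro ⟨rfl, rfl⟩
    obtain ⟨a, b, h⟩ := h
    simp at h
  · intro q hq _ h1 h2
    have hu : IsUnit (algebraMap ℤ (𝓞 K) q) :=
      h.isUnit_of_dvd' (map_dvd (algebraMap ℤ (𝓞 K)) h1) (map_dvd (algebraMap ℤ (𝓞 K)) h2)
    have hn := hu.map (Algebra.norm ℤ)
    rw [Algebra.norm_algebraMap, isUnit_pow_iff Module.finrank_pos.ne'] at hn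
    exact hq hn

lemma isCoprime_of_el {s t n : ℤ} {L : ℕ} (h : s ^ 2 - d * t ^ 2 = n ^ 3)
    (hco : IsCoprime (Q.el s t) (L : 𝓞 K)) : IsCoprime n (L : ℤ) := by
  have h1 : RingOfIntegers.mapRingHom (Q.σ : K →+* K) (Q.el s t) = Q.el s (-t) := by
    apply RingOfIntegers.ext
    change Q.σ (Q.el s t : K) = _
    rw [coe_el, coe_el, map_add, map_mul, map_intCast, map_intCast, Q.σθ]
    push_cast
    ring
  have h2 := hco.map (RingOfIntegers.mapRingHom (Q.σ : K →+* K))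
  rw [h1, map_natCast] at h2
  have h3 : Q.el s t * Q.el s (-t) = (n : 𝓞 K) ^ 3 := by
    apply RingOfIntegers.ext
    have : ((s : K) ^ 2 - d * t ^ 2) = n ^ 3 := by exact_mod_cast congrArg (Int.cast (R := K)) h
    have hn : ((n : 𝓞 K) : K) = n := map_intCast (algebraMap (𝓞 K) K) n
    push_cast [coe_el]
    refine Eq.trans ?_ (congrArg (fun x : K => x ^ 3) hn.symm)
    linear_combination this - t ^ 2 * Q.sq
  have h4 := hco.mul_left h2
  rw [h3] at h4
  apply isCoprime_of_isCoprime_ringOfIntegers (K := K)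
  exact_mod_cast h4.of_isCoprime_of_dvd_left (dvd_pow_self _ three_ne_zero)

/-- A family of primitive elements `s + t θ`, all congruent to `1` up to cubes and independent
modulo cubes, representing a positive proportion of the three-torsion classes. -/
theorem exists_represented_family {L : ℕ} (hL : L ≠ 0) :
    ∃ (ι : Type) (_ : Fintype ι) (s t n : ι → ℤ),
      Nat.card {c : ClassGroup (𝓞 K) // c ^ 3 = 1} ≤ 1296 * Fintype.card ι ∧
      (∀ i, s i ^ 2 - d * t i ^ 2 = n i ^ 3 ∧ IsCoprime (s i) (t i) ∧ 9 ∣ t i) ∧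
      (∀ i, IsCoprime (n i) (L : ℤ)) ∧
      ∀ i j, i ≠ j → ¬ ∃ x : K, x ^ 3 = (s i + t i * Q.θ) * (s j + t j * Q.θ) ^ 2 := by
  classical
  have hd0 : 18 * d * L ≠ 0 := mul_ne_zero (by have := Q.one_lt; omega) hL
  set T := {c : ClassGroup (𝓞 K) // c ^ 3 = 1}
  have := Fintype.ofFinite T
  choose J δ hδ0 hJc hJ hco using fun c : T => exists_coprime_torsion_ideal c.1 c.2 hd0
  choose u v huv _ using fun c : T => Q.exists_uv (δ c)
  set key : T → ZMod 36 × ZMod 36 := fun c => (u c, v c)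
  obtain ⟨z, -, hz⟩ := Finset.exists_max_image Finset.univ
    (fun z => (Finset.univ.filter (fun c => key c = z)).card) ⟨(0, 0), Finset.mem_univ _⟩
  set B := Finset.univ.filter (fun c => key c = z) with hB
  have hcard : Nat.card T ≤ 1296 * B.card := by
    rw [Nat.card_eq_fintype_card, ← Finset.card_univ]
    refine (Finset.card_le_mul_card_image_of_maps_to (f := key) (t := Finset.univ)
      (fun _ _ => Finset.mem_univ _) B.card (fun z _ => hz z (Finset.mem_univ _))).trans ?_
    rw [Finset.card_univ, Fintype.card_prod, ZMod.card, mul_comm]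
  have hBne : B.Nonempty := by
    rw [← Finset.card_pos]
    have : 0 < Nat.card T := by
      have : Nonempty T := ⟨⟨1, one_pow 3⟩⟩
      exact Nat.card_pos
    omega
  obtain ⟨c₀, hc₀⟩ := hBne
  have hcoδ : ∀ c, IsCoprime (δ c) ((18 * d * L : ℕ) : 𝓞 K) := by
    intro c
    have h1 : IsCoprime ((J c : Ideal (𝓞 K)) ^ 3) (Ideal.span {((18 * d * L : ℕ) : 𝓞 K)}) :=
      (hco c).pow_left
    rwa [hJ c, Ideal.isCoprime_span_singleton_iff] at h1
  have hco18 : ∀ c, IsCoprime (δ c) ((18 : ℕ) : 𝓞 K) := by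
    intro c
    have h1 := hcoδ c
    rw [Nat.cast_mul, Nat.cast_mul] at h1
    exact h1.of_mul_right_left.of_mul_right_left
  obtain ⟨j, hj⟩ := exists_pow_sub_one (by norm_num) (hco18 c₀)
  have hβ : ∀ c : B, ∃ a b : ℤ, δ c.1 * δ c₀ ^ j = Q.el (1 + 9 * a) (9 * b) := by
    intro c
    apply Q.exists_el_of_dvd
    have hk : key c.1 = key c₀ :=
      (Finset.mem_filter.1 c.2).2.trans (Finset.mem_filter.1 hc₀).2.symm
    have hu : (36 : ℤ) ∣ u c.1 - u c₀ :=
      (ZMod.intCast_eq_intCast_iff_dvd_sub _ _ 36).1 (congrArg Prod.fst hk).symm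
    have hv : (36 : ℤ) ∣ v c.1 - v c₀ :=
      (ZMod.intCast_eq_intCast_iff_dvd_sub _ _ 36).1 (congrArg Prod.snd hk).symm
    have h1 := Q.dvd_sub_of_uv (huv c.1) (huv c₀) hu hv
    have h2 : δ c.1 * δ c₀ ^ j - 1 = (δ c.1 - δ c₀) * δ c₀ ^ j + (δ c₀ ^ (j + 1) - 1) := by ring
    rw [h2]
    exact dvd_add (h1.mul_right _) hj
  choose a b hab using hβ
  set I : B → (Ideal (𝓞 K))⁰ := fun c => J c.1 * J c₀ ^ j with hI
  have hI3 : ∀ c : B, (I c : Ideal (𝓞 K)) ^ 3 = Ideal.span {δ c.1 * δ c₀ ^ j} := by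
    intro c
    have : (I c : Ideal (𝓞 K)) = (J c.1 : Ideal (𝓞 K)) * (J c₀ : Ideal (𝓞 K)) ^ j := by
      simp only [hI, Submonoid.coe_mul, SubmonoidClass.coe_pow]
    rw [this, mul_pow, ← pow_mul, mul_comm j, pow_mul, hJ, hJ, Ideal.span_singleton_pow,
      Ideal.span_singleton_mul_span_singleton]
  have hIco : ∀ c : B, IsCoprime (I c : Ideal (𝓞 K)) (Ideal.span {((18 * d : ℕ) : 𝓞 K)}) := by
    intro c
    simp only [hI, Submonoid.coe_mul, SubmonoidClass.coe_pow]
    have h1 : ∀ c, IsCoprime (J c : Ideal (𝓞 K)) (Ideal.span {((18 * d : ℕ) : 𝓞 K)}) := by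
      intro c
      refine (hco c).of_isCoprime_of_dvd_right (Ideal.dvd_iff_le.2 ?_)
      rw [Ideal.span_singleton_le_span_singleton]
      exact Nat.cast_dvd_cast (dvd_mul_right (18 * d) L)
    exact (h1 _).mul_left (h1 _).pow_left
  have hne : ∀ c : B, δ c.1 * δ c₀ ^ j ≠ 0 := fun c => mul_ne_zero (hδ0 _) (pow_ne_zero _ (hδ0 _))
  choose s t n k hk hs ht hst hcop h9 using fun c : B =>
    Q.exists_primitive _ (I c) (1 + 9 * a c) (9 * b c) rfl (hab c ▸ hne c) (hab c ▸ hI3 c)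
      (hIco c) (dvd_mul_right _ _)
  have hL' : ∀ c, IsCoprime (n c) (L : ℤ) := by
    intro c
    have h1 : IsCoprime (δ c.1 * δ c₀ ^ j) ((18 * d * L : ℕ) : 𝓞 K) :=
      (hcoδ _).mul_left (hcoδ _).pow_left
    rw [hab, Nat.cast_mul] at h1
    refine Q.isCoprime_of_el (hst c) (h1.of_mul_right_right.of_isCoprime_of_dvd_left
      ⟨(k c : 𝓞 K) ^ 3, RingOfIntegers.ext ?_⟩)
    have hkc : ((k c : 𝓞 K) : K) = k c := map_intCast (algebraMap (𝓞 K) K) (k c)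
    rw [coe_el, hs c, ht c]
    push_cast [coe_el]
    refine Eq.trans ?_ (congrArg (fun x : K => (s c + t c * Q.θ) * x ^ 3) hkc.symm)
    ring
  refine ⟨_, inferInstance, s ∘ B.equivFin.symm, t ∘ B.equivFin.symm, n ∘ B.equivFin.symm,
    by simpa using hcard, fun i => ⟨hst _, hcop _, h9 _⟩, fun i => hL' _, ?_⟩
  suffices h : ∀ c c' : B, (∃ x : K, x ^ 3 = (s c + t c * Q.θ) * (s c' + t c' * Q.θ) ^ 2) →
      c = c' by
    intro i i' hii' hx
    exact hii' (B.equivFin.symm.injective (h _ _ hx))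
  rintro c c' ⟨x, hx⟩
  have hval : ∀ c : B, ((δ c.1 * δ c₀ ^ j : 𝓞 K) : K) = (k c : K) ^ 3 * (s c + t c * Q.θ) := by
    intro c
    rw [hab c, coe_el, hs c, ht c]; push_cast; ring
  have hcoe : ∀ A B : 𝓞 K, ((A * B ^ 2 : 𝓞 K) : K) = (A : K) * (B : K) ^ 2 := fun A B => by
    push_cast; rfl
  have hx3 : ((k c : K) * k c' ^ 2 * x) ^ 3 =
      ((δ c.1 * δ c₀ ^ j * (δ c'.1 * δ c₀ ^ j) ^ 2 : 𝓞 K) : K) := by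
    rw [hcoe, hval, hval, mul_pow, hx]; ring
  set η : 𝓞 K := ⟨(k c : K) * k c' ^ 2 * x, IsIntegral.of_pow (n := 3) (by norm_num)
    (by rw [hx3]; exact RingOfIntegers.isIntegral_coe _)⟩ with hη
  have hη3 : η ^ 3 = δ c.1 * δ c₀ ^ j * (δ c'.1 * δ c₀ ^ j) ^ 2 := by
    apply RingOfIntegers.ext
    rw [← hx3]; push_cast; rfl
  have h1 : ClassGroup.mk0 (I c * I c' ^ 2) = 1 := by
    apply mk0_eq_one_of_cube (η := η)
    rw [hη3]
    have : ((I c * I c' ^ 2 : (Ideal (𝓞 K))⁰) : Ideal (𝓞 K)) = I c * (I c' : Ideal (𝓞 K)) ^ 2 := by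
      simp only [Submonoid.coe_mul, SubmonoidClass.coe_pow]
    rw [this, mul_pow, ← pow_mul, mul_comm 2 3, pow_mul, hI3, hI3, Ideal.span_singleton_pow,
      Ideal.span_singleton_mul_span_singleton]
  simp only [hI, map_mul, map_pow, hJc] at h1
  exact Subtype.ext (Subtype.ext (eq_of_mul_sq_eq_one c'.1.2
    (by rw [← pow_mul, mul_comm, pow_mul, c₀.2, one_pow]) h1))

end QuadField

end Represented

section SymValues

open QuadraticAlgebra

lemma Int.exists_cube_of_pow {q : ℕ} (hq : q.Prime) {k : ℕ} (hk : q = 3 * k + 1) {x : ℤ}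
    (hx : (q : ℤ) ∣ x ^ k - 1) (hx0 : ¬ (q : ℤ) ∣ x) : ∃ y : ℤ, (q : ℤ) ∣ y ^ 3 - x := by
  have : Fact q.Prime := ⟨hq⟩
  obtain ⟨g, hg⟩ := IsCyclic.exists_generator (α := (ZMod q)ˣ)
  have hx0' : (x : ZMod q) ≠ 0 := by rwa [Ne, ZMod.intCast_zmod_eq_zero_iff_dvd]
  have hord : orderOf g = 3 * k := by
    rw [orderOf_eq_card_of_forall_mem_zpowers hg, Nat.card_eq_fintype_card, ZMod.card_units, hk]
    simp
  have hkpos : 0 < k := by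
    have := hq.two_le
    omega
  obtain ⟨j, hj⟩ := (mem_powers_iff_mem_zpowers.2 (hg (Units.mk0 _ hx0')) : _ ∈ Submonoid.powers g)
  have hj' : g ^ (j * k) = 1 := by
    rw [pow_mul]
    change (fun n => g ^ n) j ^ k = 1
    rw [hj]
    ext
    have h := (ZMod.intCast_zmod_eq_zero_iff_dvd _ q).2 hx
    push_cast at h ⊢
    rw [Units.val_mk0]
    exact sub_eq_zero.1 h
  have h3 : 3 ∣ j := by
    have h4 := orderOf_dvd_of_pow_eq_one hj'
    rw [hord] at h4
    exact Nat.dvd_of_mul_dvd_mul_right hkpos h4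
  obtain ⟨l, rfl⟩ := h3
  obtain ⟨y, hy⟩ := ZMod.intCast_surjective ((g ^ l : (ZMod q)ˣ) : ZMod q)
  refine ⟨y, (ZMod.intCast_zmod_eq_zero_iff_dvd _ q).1 ?_⟩
  push_cast
  rw [hy, sub_eq_zero]
  have h5 := congrArg (fun u : (ZMod q)ˣ => (u : ZMod q)) hj
  simp only [Units.val_mk0] at h5
  rw [← h5]
  push_cast
  ring

lemma Int.exists_sq_eq_neg_three {q : ℕ} (hq : q.Prime) (h1 : q % 3 = 1) :
    ∃ w : ℤ, (q : ℤ) ∣ w ^ 2 + 3 := by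
  have : Fact q.Prime := ⟨hq⟩
  have : Fact (Nat.Prime 3) := ⟨Nat.prime_three⟩
  have hc : 3 ∣ Fintype.card (ZMod q)ˣ := by
    rw [ZMod.card_units]
    exact (Nat.modEq_iff_dvd' hq.one_le).1 (by simp [Nat.ModEq, h1])
  obtain ⟨y, hy⟩ := exists_prime_orderOf_dvd_card 3 hc
  have hy3 : (y : ZMod q) ^ 3 = 1 := by
    have := pow_orderOf_eq_one y
    rw [hy] at this
    simpa using congrArg (fun u : (ZMod q)ˣ => (u : ZMod q)) this
  have hy1 : (y : ZMod q) ≠ 1 := by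
    intro h
    have : y = 1 := by ext; simpa using h
    rw [this, orderOf_one] at hy
    omega
  have hy2 : (y : ZMod q) ^ 2 + y + 1 = 0 := by
    have h : ((y : ZMod q) - 1) * ((y : ZMod q) ^ 2 + y + 1) = 0 := by linear_combination hy3
    exact (mul_eq_zero.1 h).resolve_left (sub_ne_zero.2 hy1)
  obtain ⟨z, hz⟩ := ZMod.intCast_surjective (y : ZMod q)
  refine ⟨2 * z + 1, (ZMod.intCast_zmod_eq_zero_iff_dvd _ q).1 ?_⟩
  push_cast
  rw [hz]
  linear_combination 4 * hy2

/-- The symbol at a split prime is a power of the corresponding residue. -/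
lemma symT_lin {q : ℕ} [Fact q.Prime] (h3 : q ≠ 3) {s t n r ρ : ℤ}
    (hr : ((r : ℤ) : Fbar q) = ρ * eisRed q Eis.th)
    (hn : (q : ℤ) ∣ (s + t * ρ) * (s - t * ρ) - n ^ 3) (hqn : ¬ (q : ℤ) ∣ n) :
    symT q ((s : Eis) * Eis.th + ((t * r : ℤ) : Eis)) =
      ((s + t * ρ : ℤ) : Fbar q) ^ ((q ^ 2 - 1) / 3) := by
  have hab : (((s + t * ρ) * (s - t * ρ) : ℤ) : Fbar q) = (n : Fbar q) ^ 3 := by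
    have := (int_eq_zero_iff (q := q) _).2 hn
    push_cast at this ⊢
    linear_combination this
  set θ := eisRed q Eis.th with hθ
  have hθ2 : θ ^ 2 = -3 := by
    rw [hθ, ← map_pow, Eis.th_sq, map_neg, map_ofNat]
  have hθ0 : θ ≠ 0 := by
    intro h
    rw [h] at hθ2
    exact three_ne h3 (by linear_combination hθ2)
  have hn0 : ((n : ℤ) : Fbar q) ≠ 0 := by rwa [Ne, int_eq_zero_iff]
  have hz : eisRed q (-Eis.th * (n : Eis)) = -θ * n := by
    rw [map_mul, map_neg, map_intCast]
  have hone : (-θ * (n : Fbar q)) ^ (q ^ 2 - 1) = 1 := by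
    rw [← hz]
    apply red_pow_sub_one h3
    rw [hz]
    exact mul_ne_zero (neg_ne_zero.2 hθ0) hn0
  have hdiv : 3 * ((q ^ 2 - 1) / 3) = q ^ 2 - 1 := by
    apply Nat.mul_div_cancel'
    have h := (Nat.coprime_primes (Fact.out : q.Prime) Nat.prime_three).2 h3
    have h' : q % 3 = 1 ∨ q % 3 = 2 := by
      have : ¬ 3 ∣ q := fun h4 =>
        h3 ((Nat.prime_dvd_prime_iff_eq Nat.prime_three Fact.out).1 h4).symm
      omega
    apply (Nat.modEq_iff_dvd' (Nat.one_le_pow _ _ (Fact.out : q.Prime).pos)).1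
    rcases h' with h' | h' <;> simp [Nat.ModEq, Nat.pow_mod, h']
  unfold symT
  have hA : eisRed q (((s : Eis) * Eis.th + ((t * r : ℤ) : Eis)) ^ 2 *
      star ((s : Eis) * Eis.th + ((t * r : ℤ) : Eis))) =
      (-θ * n) ^ 3 * ((s + t * ρ : ℤ) : Fbar q) := by
    rw [star_add, StarMul.star_mul, Eis.star_th, Eis.star_int, Eis.star_int]
    simp only [map_mul, map_pow, map_add, map_neg, map_intCast, ← hθ]
    push_cast at hab ⊢
    rw [hr]
    linear_combination (-θ ^ 3 * (s + t * ρ)) * hab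
  rw [hA, mul_pow, ← pow_mul, hdiv, hone, one_mul]

/-- If the symbols of two elements agree at a split prime, then their residues agree modulo
cubes. -/
lemma exists_cube_of_symP_eq {q : ℕ} [Fact q.Prime] (h1 : q % 3 = 1) {a b : ℤ}
    (ha : ¬ (q : ℤ) ∣ a) (hb : ¬ (q : ℤ) ∣ b)
    (h : ((a : ℤ) : Fbar q) ^ ((q ^ 2 - 1) / 3) = ((b : ℤ) : Fbar q) ^ ((q ^ 2 - 1) / 3)) :
    ∃ y : ℤ, (q : ℤ) ∣ y ^ 3 - a * b ^ 2 := by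
  have hqI : Prime (q : ℤ) := Nat.prime_iff_prime_int.1 Fact.out
  have h3 : q ≠ 3 := by rintro rfl; simp at h1
  obtain ⟨k, hk⟩ : ∃ k, q = 3 * k + 1 := ⟨q / 3, by omega⟩
  have hE : (q ^ 2 - 1) / 3 = k * (3 * k + 2) := by
    have : q ^ 2 - 1 = 3 * (k * (3 * k + 2)) := by
      rw [hk]
      have : (3 * k + 1) ^ 2 = 3 * (k * (3 * k + 2)) + 1 := by ring
      omega
    rw [this]; simp
  have hx0 : ¬ (q : ℤ) ∣ a * b ^ 2 := by
    intro hd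
    rcases hqI.dvd_or_dvd hd with h | h
    · exact ha h
    · exact hb (hqI.dvd_of_dvd_pow h)
  have hunit : ∀ x : ℤ, ¬ (q : ℤ) ∣ x → ((x : ℤ) : Fbar q) ^ (3 * k) = 1 := by
    intro x hx
    have h4 := Int.ModEq.pow_card_sub_one_eq_one (Fact.out : q.Prime) (n := x)
      (((Prime.coprime_iff_not_dvd hqI).2 hx).symm)
    have h5 : (q : ℤ) ∣ x ^ (q - 1) - 1 := h4.symm.dvd
    rw [← int_eq_zero_iff, show q - 1 = 3 * k by omega] at h5
    push_cast at h5
    exact sub_eq_zero.1 h5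
  refine Int.exists_cube_of_pow Fact.out hk ?_ hx0
  rw [← int_eq_zero_iff]
  push_cast
  rw [sub_eq_zero]
  set x : Fbar q := (a : Fbar q) * (b : Fbar q) ^ 2 with hx
  have hx3 : (x ^ k) ^ 3 = 1 := by
    have := hunit (a * b ^ 2) hx0
    push_cast at this
    rw [← pow_mul, mul_comm k 3]; exact this
  have hxE : (x ^ k) ^ (3 * k + 2) = 1 := by
    rw [← pow_mul, ← hE, hx, mul_pow, h, ← pow_mul, mul_comm 2, pow_mul, ← pow_succ', ← pow_mul,
      hE, show k * (3 * k + 2) * (2 + 1) = 3 * k * (3 * k + 2) by ring, pow_mul, hunit b hb,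
      one_pow]
  have hx2 : (x ^ k) ^ 2 = 1 := by
    rwa [pow_add, pow_mul, hx3, one_pow, one_mul] at hxE
  rwa [pow_succ, hx2, one_mul] at hx3

end SymValues

section SymValues

open QuadraticAlgebra

variable {ι : Type} {d : ℕ} {s t n : ι → ℤ}

/-- The simultaneous cubic symbols of a family at a modulus `m` with a root `r` of `-3 d`. -/
noncomputable def symVec (s t : ι → ℤ) (m r : ℤ) (i : ι) : Eis :=
  symM m ((s i : ℤ) * Eis.th + ((t i * r : ℤ) : Eis))

/-- The value `e` of `symVec` is attained at moduli coprime to any given integer. -/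
def IsSymVec (d : ℕ) (s t : ι → ℤ) (e : ι → Eis) : Prop :=
  ∀ N : ℤ, N ≠ 0 → ∃ m r : ℤ, 0 < m ∧ IsCoprime m N ∧ m ∣ r ^ 2 + 3 * d ∧ symVec s t m r = e

lemma symVec_congr {m r r' : ℤ} (h : m ∣ r - r') : symVec s t m r = symVec s t m r' := by
  obtain ⟨k, hk⟩ := h
  funext i
  refine symM_congr ((t i * k : ℤ) : Eis) ?_
  rw [show r = r' + m * k by linear_combination hk]
  push_cast
  ring

lemma symVec_cube (m r : ℤ) (i : ι) : symVec s t m r i ^ 3 = 1 := symM_cube _ _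

lemma symVec_mul {m m' r : ℤ} (hm : m ≠ 0) (hm' : m' ≠ 0) :
    symVec s t (m * m') r = symVec s t m r * symVec s t m' r := by
  funext i
  exact symM_mul_left hm hm' _

lemma Int.exists_crt {m m' : ℤ} (h : IsCoprime m m') (r r' : ℤ) :
    ∃ x, m ∣ x - r ∧ m' ∣ x - r' := by
  obtain ⟨a, b, hab⟩ := h
  exact ⟨r + (r' - r) * a * m, ⟨(r' - r) * a, by ring⟩,
    ⟨(r - r') * b, by linear_combination (r' - r) * hab⟩⟩

lemma Int.dvd_sq_add_of_dvd_sub {m x r D : ℤ} (h : m ∣ x - r) (hr : m ∣ r ^ 2 + D) :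
    m ∣ x ^ 2 + D := by
  have : x ^ 2 + D = (x - r) * (x + r) + (r ^ 2 + D) := by ring
  rw [this]
  exact dvd_add (h.mul_right _) hr

lemma IsSymVec.one : IsSymVec d s t 1 := fun _ _ =>
  ⟨1, 0, one_pos, isCoprime_one_left, one_dvd _, funext fun _ => symM_one_left _⟩

lemma IsSymVec.mul {e e' : ι → Eis} (h : IsSymVec d s t e) (h' : IsSymVec d s t e') :
    IsSymVec d s t (e * e') := by
  intro N hN
  obtain ⟨m, r, hm, hmN, hmr, rfl⟩ := h N hN
  obtain ⟨m', r', hm', hmN', hmr', rfl⟩ := h' (N * m) (mul_ne_zero hN hm.ne')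
  have hmm : IsCoprime m m' := hmN'.symm.of_mul_left_right
  obtain ⟨x, hx, hx'⟩ := Int.exists_crt hmm r r'
  refine ⟨m * m', x, mul_pos hm hm', hmN.mul_left hmN'.of_mul_right_left,
    hmm.mul_dvd (Int.dvd_sq_add_of_dvd_sub hx hmr) (Int.dvd_sq_add_of_dvd_sub hx' hmr'), ?_⟩
  rw [symVec_mul hm.ne' hm'.ne', symVec_congr hx, symVec_congr hx']

/-- The submonoid of values attained by `symVec`. -/
def symSubmonoid (d : ℕ) (s t : ι → ℤ) : Submonoid (ι → Eis) where
  carrier := {e | IsSymVec d s t e}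
  one_mem' := IsSymVec.one
  mul_mem' := IsSymVec.mul

lemma finite_cube_roots [Finite ι] : {e : ι → Eis | ∀ i, e i ^ 3 = 1}.Finite := by
  refine Set.Finite.pi' (t := fun _ => {x : Eis | x ^ 3 = 1}) fun _ => ?_
  refine Set.Finite.subset (Set.toFinite {1, Eis.w, Eis.w ^ 2}) ?_
  intro x hx
  simpa using Eis.cube_one hx

lemma IsSymVec.cube {e : ι → Eis} (h : IsSymVec d s t e) (i : ι) : e i ^ 3 = 1 := by
  obtain ⟨m, r, -, -, -, rfl⟩ := h 1 one_ne_zero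
  exact symVec_cube _ _ _

lemma Int.isCoprime_of_lt_prime {q : ℕ} (hq : q.Prime) {N : ℤ} (hN : N ≠ 0) (h : N.natAbs < q) :
    IsCoprime (q : ℤ) N := by
  rw [Prime.coprime_iff_not_dvd (Nat.prime_iff_prime_int.1 hq)]
  intro hd
  have := Nat.le_of_dvd (Int.natAbs_pos.2 hN) (Int.natCast_dvd.1 hd)
  omega

/-- At a split prime separating two members of the family, the symbols differ. -/
lemma exists_symVec_ne {q : ℕ} (hq : q.Prime) (h1 : q % 3 = 1) {ρ : ℤ} (hρ : (q : ℤ) ∣ ρ ^ 2 - d)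
    {i j : ι} (hi : s i ^ 2 - d * t i ^ 2 = n i ^ 3) (hj : s j ^ 2 - d * t j ^ 2 = n j ^ 3)
    (hni : ¬ (q : ℤ) ∣ n i) (hnj : ¬ (q : ℤ) ∣ n j)
    (hnc : ¬ ∃ y : ℤ, (q : ℤ) ∣ y ^ 3 - (s i + t i * ρ) * (s j + t j * ρ) ^ 2) :
    ∃ r : ℤ, (q : ℤ) ∣ r ^ 2 + 3 * d ∧ symVec s t q r i ≠ symVec s t q r j := by
  have : Fact q.Prime := ⟨hq⟩
  have hqI : Prime (q : ℤ) := Nat.prime_iff_prime_int.1 hq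
  have h3 : q ≠ 3 := by rintro rfl; simp at h1
  obtain ⟨w, hw⟩ : ∃ w : ℤ, ((w : ℤ) : Fbar q) = eisRed q Eis.th := by
    obtain ⟨w, hw⟩ := Int.exists_sq_eq_neg_three hq h1
    rw [← int_eq_zero_iff] at hw
    have h2 : eisRed q Eis.th ^ 2 = -3 := by rw [← map_pow, Eis.th_sq, map_neg, map_ofNat]
    have h4 : ((w : Fbar q) - eisRed q Eis.th) * ((w : Fbar q) + eisRed q Eis.th) = 0 := by
      push_cast at hw
      linear_combination hw - h2
    rcases mul_eq_zero.1 h4 with h | h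
    · exact ⟨w, sub_eq_zero.1 h⟩
    · exact ⟨-w, by push_cast; linear_combination -h⟩
  have hw3 : (q : ℤ) ∣ w ^ 2 + 3 := by
    rw [← int_eq_zero_iff]
    push_cast
    rw [hw, ← map_pow, Eis.th_sq, map_neg, map_ofNat]
    ring
  have hr : (q : ℤ) ∣ (ρ * w) ^ 2 + 3 * d := by
    have : (ρ * w) ^ 2 + 3 * d = ρ ^ 2 * (w ^ 2 + 3) - 3 * (ρ ^ 2 - d) := by ring
    rw [this]
    exact dvd_sub (hw3.mul_left _) (hρ.mul_left _)
  have key : ∀ k, s k ^ 2 - d * t k ^ 2 = n k ^ 3 → ¬ (q : ℤ) ∣ n k →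
      ¬ (q : ℤ) ∣ s k + t k * ρ ∧ eisRed q (symVec s t q (ρ * w) k) =
        ((s k + t k * ρ : ℤ) : Fbar q) ^ ((q ^ 2 - 1) / 3) := by
    intro k hk hnk
    have hab : (q : ℤ) ∣ (s k + t k * ρ) * (s k - t k * ρ) - n k ^ 3 := by
      have : (s k + t k * ρ) * (s k - t k * ρ) - n k ^ 3 = -(t k ^ 2) * (ρ ^ 2 - d) := by
        rw [← hk]; ring
      rw [this]
      exact hρ.mul_left _
    have hnorm : ¬ (q : ℤ) ∣ norm ((s k : Eis) * Eis.th + ((t k * (ρ * w) : ℤ) : Eis)) := by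
      rw [Eis.norm_lin]
      intro hd
      have : (3 * s k ^ 2 + (t k * (ρ * w)) ^ 2) =
          t k ^ 2 * ((ρ * w) ^ 2 + 3 * d) + 3 * n k ^ 3 := by rw [← hk]; ring
      rw [this] at hd
      have h5 := (dvd_add_right (hr.mul_left _)).1 hd
      rcases hqI.dvd_or_dvd h5 with h | h
      · exact h3 ((Nat.prime_dvd_prime_iff_eq hq Nat.prime_three).1 (by exact_mod_cast h))
      · exact hnk (hqI.dvd_of_dvd_pow h)
    constructor
    · intro hd
      exact hnk (hqI.dvd_of_dvd_pow ((dvd_sub_right (hd.mul_right _)).1 hab))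
    · rw [← symT_lin (r := ρ * w) h3 (by push_cast; rw [hw]) hab hnk, ← red_symP h3 hnorm]
      congr 1
      have hl : (q : ℤ).natAbs.primeFactorsList = [q] := by
        rw [Int.natAbs_natCast, Nat.primeFactorsList_prime hq]
      simp only [symVec, symM, hl, List.map_cons, List.map_nil, List.prod_singleton, symQ, hq,
        dif_pos]
  refine ⟨ρ * w, hr, fun he => hnc ?_⟩
  obtain ⟨hai, hsi⟩ := key i hi hni
  obtain ⟨haj, hsj⟩ := key j hj hnj
  exact exists_cube_of_symP_eq h1 hai haj (by rw [← hsi, ← hsj, he])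

/-- Distinct members of an independent family are separated by attained values. -/
lemma exists_isSymVec_ne [Finite ι] {i j : ι} (hni : n i ≠ 0) (hnj : n j ≠ 0)
    (hi : s i ^ 2 - d * t i ^ 2 = n i ^ 3) (hj : s j ^ 2 - d * t j ^ 2 = n j ^ 3)
    (hnc : ∀ N : ℕ, ∃ q, q.Prime ∧ N < q ∧ q % 3 = 1 ∧ ∃ ρ : ℤ, (q : ℤ) ∣ ρ ^ 2 - d ∧
      ¬ ∃ y : ℤ, (q : ℤ) ∣ y ^ 3 - (s i + t i * ρ) * (s j + t j * ρ) ^ 2) :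
    ∃ e, IsSymVec d s t e ∧ e i ≠ e j := by
  by_contra! hcon
  have hbad : ∀ e : ι → Eis, ∃ N : ℤ, N ≠ 0 ∧ (e i ≠ e j → ∀ m r : ℤ, 0 < m → IsCoprime m N →
      m ∣ r ^ 2 + 3 * d → symVec s t m r ≠ e) := by
    intro e
    by_cases he : IsSymVec d s t e
    · exact ⟨1, one_ne_zero, fun h => absurd (hcon e he) h⟩
    · simp only [IsSymVec] at he
      push Not at he
      obtain ⟨N, hN, h⟩ := he
      exact ⟨N, hN, fun _ => h⟩
  choose N hN0 hN using hbad
  set S := (finite_cube_roots (ι := ι)).toFinset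
  have hM0 : (∏ e ∈ S, N e) * (n i * n j) ≠ 0 :=
    mul_ne_zero (Finset.prod_ne_zero_iff.2 fun e _ => hN0 e) (mul_ne_zero hni hnj)
  obtain ⟨q, hq, hlt, h1, ρ, hρ, hy⟩ := hnc ((∏ e ∈ S, N e) * (n i * n j)).natAbs
  have hco := Int.isCoprime_of_lt_prime hq hM0 hlt
  have hqI : Prime (q : ℤ) := Nat.prime_iff_prime_int.1 hq
  have hcon' : IsCoprime (q : ℤ) (n i * n j) := hco.of_mul_right_right
  obtain ⟨r, hr, hne⟩ := exists_symVec_ne hq h1 hρ hi hj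
    ((Prime.coprime_iff_not_dvd hqI).1 hcon'.of_mul_right_left)
    ((Prime.coprime_iff_not_dvd hqI).1 hcon'.of_mul_right_right) hy
  have hmem : symVec s t q r ∈ S := by
    simp only [S, Set.Finite.mem_toFinset, Set.mem_ofPred_eq]
    exact fun k => symVec_cube _ _ _
  refine hN _ hne q r (by exact_mod_cast hq.pos) ?_ hr rfl
  exact hco.of_mul_right_left.of_prod_right _ hmem

/-- An independent family has at most as many members as there are attained values. -/
theorem exists_finset_isSymVec [Fintype ι]
    (hsep : ∀ i j, i ≠ j → ∃ e, IsSymVec d s t e ∧ e i ≠ e j) :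
    ∃ E : Finset (ι → Eis), Fintype.card ι ≤ E.card ∧ ∀ e ∈ E, IsSymVec d s t e := by
  classical
  have hfin : (symSubmonoid d s t : Set (ι → Eis)).Finite :=
    finite_cube_roots.subset fun e he i => IsSymVec.cube he i
  have : Fintype (symSubmonoid d s t) := hfin.fintype
  refine ⟨hfin.toFinset, ?_, fun e he => hfin.mem_toFinset.1 he⟩
  let F : ι → (symSubmonoid d s t →* Eis) := fun i =>
    (Pi.evalMonoidHom (fun _ => Eis) i).comp (symSubmonoid d s t).subtype
  have hF : Function.Injective F := by
    intro i j hij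
    by_contra hne
    obtain ⟨e, he, hne'⟩ := hsep i j hne
    exact hne' (DFunLike.congr_fun hij ⟨e, he⟩)
  have hli := (linearIndependent_monoidHom (symSubmonoid d s t) Eis).comp F hF
  have h1 := hli.fintype_card_le_finrank
  rw [Module.finrank_fintype_fun_eq_card] at h1
  rw [← Set.ncard_eq_toFinset_card _ hfin, ← Nat.card_coe_set_eq]
  exact h1.trans_eq Nat.card_eq_fintype_card.symm

/-- Attained values can be realized simultaneously by pairwise coprime moduli. -/
lemma exists_moduli (E : Finset (ι → Eis)) (hE : ∀ e ∈ E, IsSymVec d s t e) {N : ℤ} (hN : N ≠ 0) :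
    ∃ m r : (ι → Eis) → ℤ, (∀ e ∈ E, 0 < m e ∧ IsCoprime (m e) N ∧ m e ∣ r e ^ 2 + 3 * d ∧
      symVec s t (m e) (r e) = e) ∧ ∀ e ∈ E, ∀ e' ∈ E, e ≠ e' → IsCoprime (m e) (m e') := by
  classical
  induction E using Finset.induction_on with
  | empty => exact ⟨0, 0, by simp, by simp⟩
  | insert a E ha ih =>
    obtain ⟨m, r, h1, h2⟩ := ih fun e he => hE e (Finset.mem_insert_of_mem he)
    obtain ⟨m', r', hm', hco, hr', hv⟩ := hE a (Finset.mem_insert_self _ _) (N * ∏ e ∈ E, m e)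
      (mul_ne_zero hN (Finset.prod_ne_zero_iff.2 fun e he => (h1 e he).1.ne'))
    have hne : ∀ e ∈ E, e ≠ a := fun e he h => ha (h ▸ he)
    have hcoe : ∀ e ∈ E, IsCoprime m' (m e) := fun e he =>
      hco.of_mul_right_right.of_prod_right _ he
    refine ⟨Function.update m a m', Function.update r a r', ?_, ?_⟩
    · intro e he
      rcases Finset.mem_insert.1 he with rfl | he
      · simpa using ⟨hm', hco.of_mul_right_left, hr', hv⟩
      · simpa [Function.update_of_ne (hne e he)] using h1 e he
    · intro e he e' he' hee
      rcases Finset.mem_insert.1 he with rfl | hE₁ <;> rcases Finset.mem_insert.1 he' with rfl | hE₂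
      · exact absurd rfl hee
      · simpa [Function.update_of_ne (hne e' hE₂)] using hcoe e' hE₂
      · simpa [Function.update_of_ne (hne e hE₁)] using (hcoe e hE₁).symm
      · simpa [Function.update_of_ne (hne e hE₁), Function.update_of_ne (hne e' hE₂)] using
          h2 e hE₁ e' hE₂ hee

end SymValues

section ImaginaryForms

/-- `f` is the triple of coefficients of a form equivalent to `M x² + 2 R x y + C y²`, where
`M C = R² + D`. -/
def IsEquivForm (D M R : ℤ) (f : ℤ × ℤ × ℤ) : Prop := ∃ C x y u v : ℤ, M * C = R ^ 2 + D ∧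
  x * v - y * u = 1 ∧ f.1 = M * x ^ 2 + 2 * R * x * y + C * y ^ 2 ∧
  f.2.1 = 2 * (M * x * u + R * (x * v + y * u) + C * y * v) ∧
  f.2.2 = M * u ^ 2 + 2 * R * u * v + C * v ^ 2

lemma exists_isEquivForm {d : ℕ} {M R : ℤ} (hd : 0 < d) (hM : 0 < M) (h : M ∣ R ^ 2 + 243 * d) :
    ∃ f ∈ formSet (Nat.sqrt (324 * d)) (-972 * d), IsEquivForm (243 * d) M R f := by
  obtain ⟨C, hC⟩ := h
  have hdR : (0 : ℝ) < d := by exact_mod_cast hd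
  have hCR : (R : ℝ) ^ 2 + 243 * d = M * C := by exact_mod_cast hC
  have hΔ : 4 * (M : ℝ) * C - (2 * R) ^ 2 = 972 * d := by linear_combination -4 * hCR
  obtain ⟨p, q, r, s, hdet, h1, h2, h3⟩ := exists_reduced_form (A := M) (B := 2 * R) (C := C)
    (by exact_mod_cast hM) (by rw [hΔ]; positivity)
  rw [hΔ] at h3
  set a : ℤ := M * p ^ 2 + 2 * R * p * q + C * q ^ 2 with ha
  set b : ℤ := 2 * (M * p * r + R * (p * s + q * r) + C * q * s) with hb
  set c : ℤ := M * r ^ 2 + 2 * R * r * s + C * s ^ 2 with hc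
  have eb : (b : ℝ) = 2 * M * p * r + 2 * R * (p * s + q * r) + 2 * C * q * s := by
    rw [hb]; push_cast; ring
  have ea : (a : ℝ) = M * p ^ 2 + 2 * R * p * q + C * q ^ 2 := by rw [ha]; push_cast; ring
  have ec : (c : ℝ) = M * r ^ 2 + 2 * R * r * s + C * s ^ 2 := by rw [hc]; push_cast; ring
  rw [← eb, ← ea] at h1
  rw [← eb, ← ec] at h2
  rw [← ea, ← ec] at h3
  have hdisc : b ^ 2 - 4 * (a * c) = -972 * d := by
    have : b ^ 2 - 4 * (a * c) = 4 * (R ^ 2 - M * C) * (p * s - q * r) ^ 2 := by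
      rw [ha, hb, hc]; ring
    rw [this, hdet, ← hC]; ring
  have hac : a * c ≠ 0 := by
    intro h0
    rw [h0] at hdisc
    have : (0 : ℤ) < d := by exact_mod_cast hd
    nlinarith [sq_nonneg b]
  have hbb : (b : ℝ) ^ 2 ≤ 324 * d := by
    rw [← sq_abs]
    have := mul_le_mul h1 h2 (abs_nonneg _) ((abs_nonneg _).trans h1)
    nlinarith
  have hbI : b.natAbs ^ 2 ≤ 324 * d := by
    zify
    rw [sq_abs]
    exact_mod_cast hbb
  refine ⟨(a, b, c), mem_formSet ?_ hdisc (left_ne_zero_of_mul hac) (right_ne_zero_of_mul hac),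
    C, p, q, r, s, hC.symm, hdet, rfl, rfl, rfl⟩
  rw [Int.abs_eq_natAbs]
  exact_mod_cast Nat.le_sqrt'.2 hbI

/-- Two lattices with a common reduced form are related by an element of norm `M M'`. -/
lemma IsEquivForm.exists_norm {D M R M' R' : ℤ} {f : ℤ × ℤ × ℤ} (h : IsEquivForm D M R f)
    (h' : IsEquivForm D M' R' f) :
    ∃ X z : ℤ, X ^ 2 + D * z ^ 2 = M * M' ∧ M ∣ X - R * z ∧ M' ∣ X + R' * z := by
  obtain ⟨C, x, y, u, v, hC, hdet, ha, hb, hc⟩ := h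
  obtain ⟨C', x', y', u', v', hC', hdet', ha', hb', hc'⟩ := h'
  rw [ha] at ha'
  rw [hb] at hb'
  rw [hc] at hc'
  obtain ⟨x1, hx1⟩ : ∃ x1, x1 = x * v' - u * y' := ⟨_, rfl⟩
  obtain ⟨z, hz⟩ : ∃ z, z = y * v' - v * y' := ⟨_, rfl⟩
  obtain ⟨U, hU⟩ : ∃ U, U = u * x' - x * u' := ⟨_, rfl⟩
  obtain ⟨V, hV⟩ : ∃ V, V = v * x' - y * u' := ⟨_, rfl⟩
  have h1 : M' = M * x1 ^ 2 + 2 * R * x1 * z + C * z ^ 2 := by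
    have e : M * x1 ^ 2 + 2 * R * x1 * z + C * z ^ 2 =
        M' * (x' * v' - y' * u') ^ 2 := by
      rw [hx1, hz]
      linear_combination v' ^ 2 * ha' - v' * y' * hb' + y' ^ 2 * hc'
    rw [e, hdet']; ring
  have h2 : R' = M * x1 * U + R * (x1 * V + z * U) + C * z * V := by
    have e : 2 * (M * x1 * U + R * (x1 * V + z * U) + C * z * V) =
        2 * R' * (x' * v' - y' * u') ^ 2 := by
      rw [hx1, hz, hU, hV]
      linear_combination -2 * u' * v' * ha' + (v' * x' + u' * y') * hb' - 2 * x' * y' * hc'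
    rw [hdet'] at e
    linarith
  have h3 : x1 * V - z * U = 1 := by
    have : x1 * V - z * U = (x * v - y * u) * (x' * v' - y' * u') := by
      rw [hx1, hz, hU, hV]; ring
    rw [this, hdet, hdet', one_mul]
  refine ⟨M * x1 + R * z, z, ?_, ⟨x1, by ring⟩, ⟨V, ?_⟩⟩
  · rw [h1]; linear_combination -z ^ 2 * hC
  · rw [h2, h1]; linear_combination (-(M * x1 + R * z)) * h3

end ImaginaryForms

section SymCompare

open QuadraticAlgebra

variable {ι : Type} {d : ℕ} {s t n : ι → ℤ}

lemma isCoprime_norm_of_root {m r s t n : ℤ} (h3 : IsCoprime m 3) (hn : IsCoprime m n)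
    (hr : m ∣ r ^ 2 + 3 * d) (hst : s ^ 2 - d * t ^ 2 = n ^ 3) :
    IsCoprime m (norm ((s : Eis) * Eis.th + ((t * r : ℤ) : Eis))) := by
  obtain ⟨k, hk⟩ := hr
  have e : norm ((s : Eis) * Eis.th + ((t * r : ℤ) : Eis)) = 3 * n ^ 3 + m * (t ^ 2 * k) := by
    rw [Eis.norm_lin]
    linear_combination t ^ 2 * hk + 3 * hst
  rw [e]
  exact (h3.mul_right hn.pow_right).add_mul_left_right _

lemma norm_intCast_eis (c : ℤ) : norm (c : Eis) = c ^ 2 := by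
  rw [show (c : Eis) = ((0 : ℤ) : Eis) * Eis.th + (c : Eis) by simp, Eis.norm_lin]; ring

lemma symM_lin_mul {m r s t n c : ℤ} (h3 : IsCoprime m 3) (hn : IsCoprime m n)
    (hr : m ∣ r ^ 2 + 3 * d) (hst : s ^ 2 - d * t ^ 2 = n ^ 3) (hc : IsCoprime m c) :
    symM m ((c : Eis) * ((s : Eis) * Eis.th + ((t * r : ℤ) : Eis))) =
      symM m ((s : Eis) * Eis.th + ((t * r : ℤ) : Eis)) := by
  rw [symM_mul h3 (by rw [norm_intCast_eis]; exact hc.pow_right)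
    (isCoprime_norm_of_root h3 hn hr hst), symM_int h3 hc, one_mul]

lemma dvd_of_norm_eq {M M' r X z q : ℤ} (hM : M ≠ 0) (hr : M ∣ r ^ 2 + 3 * d)
    (h : X ^ 2 + 243 * d * z ^ 2 = M * M') (hX : M ∣ X - 9 * r * z) (hqz : q ∣ z) (hqM : q ∣ M) :
    q ∣ M' := by
  obtain ⟨C, hC⟩ := hr
  obtain ⟨x, hx⟩ := hX
  have e : M' = z * (81 * C * z + 18 * r * x) + M * x ^ 2 := by
    apply mul_left_cancel₀ hM
    rw [← h]
    linear_combination (X + 9 * r * z + M * x) * hx + 81 * z ^ 2 * hC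
  rw [e]
  exact dvd_add (hqz.mul_right _) (hqM.mul_right _)

/-- A relation between coprime moduli forces equality of the symbols. -/
theorem symVec_eq_of_norm (hst : ∀ i, s i ^ 2 - d * t i ^ 2 = n i ^ 3 ∧ IsCoprime (s i) (t i) ∧
    9 ∣ t i) {M M' r r' X z : ℤ} (hM : M ≠ 0) (hM' : M' ≠ 0) (hco : IsCoprime M M')
    (h3 : IsCoprime M 3) (h3' : IsCoprime M' 3)
    (hn : ∀ i, IsCoprime M (n i)) (hn' : ∀ i, IsCoprime M' (n i)) (hr : M ∣ r ^ 2 + 3 * d)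
    (hr' : M' ∣ r' ^ 2 + 3 * d) (h : X ^ 2 + 243 * d * z ^ 2 = M * M') (hX : M ∣ X - 9 * r * z)
    (hX' : M' ∣ X + 9 * r' * z) : symVec s t M r = symVec s t M' r' := by
  have hr2 : M' ∣ (-r') ^ 2 + 3 * d := by rwa [neg_sq]
  have hX2 : M' ∣ X - 9 * (-r') * z := by
    rw [show X - 9 * (-r') * z = X + 9 * r' * z by ring]; exact hX'
  have h2 : X ^ 2 + 243 * d * z ^ 2 = M' * M := by rw [h, mul_comm]
  have hXz : IsCoprime X z := by
    refine isCoprime_of_prime_dvd ?_ ?_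
    · rintro ⟨rfl, rfl⟩
      exact mul_ne_zero hM hM' (by rw [← h]; ring)
    · intro q hq hqX hqz
      have hqm : q ∣ M * M' := by
        rw [← h]
        exact dvd_add (dvd_pow hqX two_ne_zero) ((dvd_pow hqz two_ne_zero).mul_left _)
      rcases hq.dvd_or_dvd hqm with h5 | h5
      · exact hq.not_isUnit (hco.isUnit_of_dvd' h5 (dvd_of_norm_eq hM hr h hX hqz h5))
      · exact hq.not_isUnit (hco.isUnit_of_dvd' (dvd_of_norm_eq hM' hr2 h2 hX2 hqz h5) h5)
  have hz : ∀ {m ρ : ℤ}, m ≠ 0 → m ∣ X - 9 * ρ * z → IsCoprime m z := by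
    intro m ρ hm0 hm
    refine isCoprime_of_prime hm0 fun q hq hqm hqz => ?_
    refine hq.not_isUnit (hXz.isUnit_of_dvd' ?_ hqz)
    exact (dvd_sub_left (hqz.mul_left _)).1 (hqm.trans hm)
  have hX3 : IsCoprime X 3 := by
    have e : IsCoprime (X ^ 2 + 3 * (81 * d * z ^ 2)) 3 := by
      rw [show X ^ 2 + 3 * (81 * d * z ^ 2) = M * M' by rw [← h]; ring]
      exact h3.mul_left h3'
    exact ((IsCoprime.add_mul_left_left_iff).1 e).of_isCoprime_of_dvd_left
      (dvd_pow_self _ two_ne_zero)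
  have c9 : ∀ {m : ℤ}, IsCoprime m 3 → IsCoprime m z → IsCoprime m (9 * z) := by
    intro m hm hmz
    rw [show (9 : ℤ) = 3 ^ 2 by norm_num]
    exact hm.pow_right.mul_right hmz
  have hMz := c9 h3 (hz hM hX)
  have hMz' := c9 h3' (hz hM' hX2)
  funext i
  obtain ⟨hi, hsti, ht9⟩ := hst i
  have key := symM_eq_one_of_represented hi hsti ((by norm_num : (3 : ℤ) ∣ 9).trans ht9)
    (c9 hX3 hXz) (dvd_mul_right 9 z) (show M * M' = X ^ 2 + 3 * d * (9 * z) ^ 2 by rw [← h]; ring)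
    ((hn i).mul_left (hn' i)) (h3.mul_left h3')
  rw [symM_mul_left hM hM'] at key
  have k1 : symM M ((s i * (9 * z) : ℤ) * Eis.th + (t i * X : ℤ)) = symVec s t M r i := by
    obtain ⟨x, hx⟩ := hX
    rw [symVec, ← symM_lin_mul h3 (hn i) hr hi hMz]
    refine symM_congr ((t i * x : ℤ) : Eis) ?_
    have : X = 9 * r * z + M * x := by linear_combination hx
    rw [this]
    push_cast
    ring
  have k2 : symM M' ((s i * (9 * z) : ℤ) * Eis.th + (t i * X : ℤ)) =
      star (symVec s t M' r' i) := by
    obtain ⟨x, hx⟩ := hX'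
    have hnorm := isCoprime_norm_of_root h3' (hn' i) hr' hi
    set A : Eis := (s i : Eis) * Eis.th + ((t i * r' : ℤ) : Eis) with hA
    have e1 : symM M' (((-(9 * z) : ℤ) : Eis) * star A) = star (symM M' A) := by
      rw [symM_mul h3' (by rw [norm_intCast_eis]; exact hMz'.neg_right.pow_right)
        (by rw [Eis.norm_star']; exact hnorm), symM_int h3' hMz'.neg_right, one_mul,
        symM_star h3' hnorm]
    rw [symVec, ← hA, ← e1]
    refine symM_congr ((t i * x : ℤ) : Eis) ?_
    have : X = -(9 * r' * z) + M' * x := by linear_combination hx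
    rw [this, hA, star_add, star_mul, Eis.star_th, Eis.star_int, Eis.star_int]
    push_cast
    ring
  rw [k1, k2, Eis.star_of_cube (symVec_cube _ _ _)] at key
  calc symVec s t M r i = symVec s t M r i * symVec s t M' r' i ^ 3 := by
        rw [symVec_cube, mul_one]
    _ = symVec s t M r i * symVec s t M' r' i ^ 2 * symVec s t M' r' i := by ring
    _ = symVec s t M' r' i := by rw [key, one_mul]

end SymCompare

section TypeI

open QuadraticAlgebra

lemma Int.exists_root_cube {p : ℕ} (hp : p.Prime) {D ρ : ℤ} (h2 : p ≠ 2) (hD : ¬ (p : ℤ) ∣ D)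
    (h : (p : ℤ) ∣ ρ ^ 2 + D) : ∃ r : ℤ, (p : ℤ) ^ 3 ∣ r ^ 2 + D := by
  have hpI : Prime (p : ℤ) := Nat.prime_iff_prime_int.1 hp
  have lift : ∀ {k : ℕ} {ρ : ℤ}, k ≠ 0 → (p : ℤ) ^ k ∣ ρ ^ 2 + D →
      ∃ r : ℤ, (p : ℤ) ^ (2 * k) ∣ r ^ 2 + D := by
    intro k ρ hk h
    have h0 : ¬ (p : ℤ) ∣ 2 * ρ := by
      intro hd
      rcases hpI.dvd_or_dvd hd with h3 | h3
      · exact h2 ((Nat.prime_dvd_prime_iff_eq hp Nat.prime_two).1 (by exact_mod_cast h3))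
      · exact hD ((dvd_add_right (dvd_pow h3 two_ne_zero)).1 ((dvd_pow_self _ hk).trans h))
    obtain ⟨a, b, hab⟩ : IsCoprime ((p : ℤ) ^ k) (2 * ρ) :=
      ((Prime.coprime_iff_not_dvd hpI).2 h0).pow_left
    obtain ⟨c, hc⟩ := h
    refine ⟨ρ - (p : ℤ) ^ k * c * b, c * a + c ^ 2 * b ^ 2, ?_⟩
    rw [pow_mul']
    linear_combination hc + (p : ℤ) ^ k * c * (-hab)
  obtain ⟨r, hr⟩ := lift one_ne_zero (by simpa using h)
  obtain ⟨r', hr'⟩ := lift (k := 2) two_ne_zero hr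
  exact ⟨r', (pow_dvd_pow _ (by norm_num)).trans hr'⟩

/-- A common factor of `X` and `z` can be removed from a relation. -/
lemma exists_div_of_dvd {M M' g r r' X z D : ℤ} (hg : g ≠ 0)
    (h : X ^ 2 + D * z ^ 2 = (M * g) * (M' * g)) (hX : M ∣ X - 9 * r * z)
    (hX' : M' ∣ X + 9 * r' * z) (hM : IsCoprime M g) (hM' : IsCoprime M' g) (hgX : g ∣ X)
    (hgz : g ∣ z) : ∃ X₁ z₁ : ℤ, X₁ ^ 2 + D * z₁ ^ 2 = M * M' ∧ M ∣ X₁ - 9 * r * z₁ ∧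
      M' ∣ X₁ + 9 * r' * z₁ := by
  obtain ⟨X₁, rfl⟩ := hgX
  obtain ⟨z₁, rfl⟩ := hgz
  refine ⟨X₁, z₁, ?_, hM.dvd_of_dvd_mul_left ?_, hM'.dvd_of_dvd_mul_left ?_⟩
  · apply mul_left_cancel₀ (pow_ne_zero 2 hg)
    linear_combination h
  · rw [show g * (X₁ - 9 * r * z₁) = g * X₁ - 9 * r * (g * z₁) by ring]
    exact hX
  · rw [show g * (X₁ + 9 * r' * z₁) = g * X₁ + 9 * r' * (g * z₁) by ring]
    exact hX'

lemma dvd_of_dvd_two_roots {g r r' X z d : ℤ} (h6 : IsCoprime g 6) (hd : IsCoprime g d)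
    (hr : g ∣ r ^ 2 + 3 * d) (hrr : g ∣ r - r') (hX : g ∣ X - 9 * r * z)
    (hX' : g ∣ X + 9 * r' * z) : g ∣ X ∧ g ∣ z := by
  have h3 : IsCoprime g 3 := h6.of_isCoprime_of_dvd_right ⟨2, by norm_num⟩
  have h2 : IsCoprime g 2 := h6.of_isCoprime_of_dvd_right ⟨3, by norm_num⟩
  have hgr : IsCoprime g r := by
    obtain ⟨k, hk⟩ := hr
    have : IsCoprime g (r ^ 2) := by
      rw [show r ^ 2 = -(3 * d) + g * k by linear_combination hk]
      exact (h3.mul_right hd).neg_right.add_mul_left_right _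
    exact this.of_isCoprime_of_dvd_right (dvd_pow_self _ two_ne_zero)
  have hz : g ∣ z := by
    have h18 : IsCoprime g (2 * (3 * (3 * r))) :=
      h2.mul_right (h3.mul_right (h3.mul_right hgr))
    refine h18.dvd_of_dvd_mul_left ?_
    have := dvd_add (dvd_sub hX' hX) (hrr.mul_left (9 * z))
    convert this using 1
    ring
  exact ⟨(dvd_sub_left (hz.mul_left _)).1 hX, hz⟩

variable {ι : Type} [Fintype ι] {d Z : ℕ} {s t n : ι → ℤ}

theorem card_mul_sq_le_of_isSymVec (hd : 0 < d) {P : Finset ℕ}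
    (hP : ∀ p ∈ P, p.Prime ∧ ¬ p ∣ 6 * d ∧ p ≤ Z ∧ ∃ ρ : ℤ, (p : ℤ) ∣ ρ ^ 2 + 3 * d)
    (hst : ∀ i, s i ^ 2 - d * t i ^ 2 = n i ^ 3 ∧ IsCoprime (s i) (t i) ∧ 9 ∣ t i)
    (hn0 : ∀ i, n i ≠ 0) (hnP : ∀ i, ∀ p ∈ P, IsCoprime (n i) (p : ℤ))
    (E : Finset (ι → Eis)) (hE : ∀ e ∈ E, IsSymVec d s t e) :
    E.card * P.card ^ 2 ≤ (formSet (Nat.sqrt (324 * d)) (-972 * d)).card *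
      (P.card + (pairSet d Z P).card) := by
  classical
  have hd0 : (d : ℤ) ≠ 0 := by exact_mod_cast hd.ne'
  have hpr : ∀ p ∈ P, Prime (p : ℤ) := fun p hp => Nat.prime_iff_prime_int.1 (hP p hp).1
  have hpn : ∀ p ∈ P, ∀ {a b : ℤ}, a * b = 6 * d → ¬ (p : ℤ) ∣ a := by
    intro p hp a b hab hd
    refine (hP p hp).2.1 ?_
    have : (p : ℤ) ∣ 6 * d := hab ▸ hd.mul_right b
    exact_mod_cast this
  obtain ⟨m, r₀, hm, hmm⟩ := exists_moduli E hE (N := 6 * d * ((∏ i, n i) * ∏ p ∈ P, (p : ℤ)))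
    (mul_ne_zero (mul_ne_zero (by norm_num) hd0) (mul_ne_zero
      (Finset.prod_ne_zero_iff.2 fun i _ => hn0 i)
      (Finset.prod_ne_zero_iff.2 fun p hp => (hpr p hp).ne_zero)))
  have hm6 : ∀ e ∈ E, IsCoprime (m e) 6 := fun e he =>
    (hm e he).2.1.of_mul_right_left.of_mul_right_left
  have hmd : ∀ e ∈ E, IsCoprime (m e) d := fun e he =>
    (hm e he).2.1.of_mul_right_left.of_mul_right_right
  have hmn : ∀ e ∈ E, ∀ i, IsCoprime (m e) (n i) := fun e he i =>
    (hm e he).2.1.of_mul_right_right.of_mul_right_left.of_prod_right _ (Finset.mem_univ i)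
  have hmp : ∀ e ∈ E, ∀ p ∈ P, IsCoprime (m e) p := fun e he p hp =>
    (hm e he).2.1.of_mul_right_right.of_mul_right_right.of_prod_right _ hp
  have hp6 : ∀ p ∈ P, IsCoprime (p : ℤ) 6 := fun p hp =>
    (Prime.coprime_iff_not_dvd (hpr p hp)).2 (hpn p hp rfl)
  have hpd : ∀ p ∈ P, IsCoprime (p : ℤ) d := fun p hp =>
    (Prime.coprime_iff_not_dvd (hpr p hp)).2 (hpn p hp (mul_comm _ _))
  have h1 : ∀ p, ∃ ρ : ℤ, p ∈ P → (p : ℤ) ^ 3 ∣ ρ ^ 2 + 3 * d := by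
    intro p
    by_cases hp : p ∈ P
    · obtain ⟨a1, a2, -, ρ, a3⟩ := hP p hp
      obtain ⟨r, hr⟩ := Int.exists_root_cube a1
        (by rintro rfl; exact a2 (dvd_mul_of_dvd_left (by norm_num) _))
        (hpn p hp (b := 2) (by ring)) a3
      exact ⟨r, fun _ => hr⟩
    · exact ⟨0, fun h => absurd h hp⟩
  choose ρ hρ using h1
  have h2 : ∀ (e : ι → Eis) (p : ℕ), ∃ (r : ℤ) (f : ℤ × ℤ × ℤ), e ∈ E → p ∈ P →
      m e ∣ r - r₀ e ∧ (p : ℤ) ^ 3 ∣ r - ρ p ∧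
      f ∈ formSet (Nat.sqrt (324 * d)) (-972 * d) ∧
      IsEquivForm (243 * d) (m e * (p : ℤ) ^ 3) (9 * r) f := by
    intro e p
    by_cases he : e ∈ E ∧ p ∈ P
    · obtain ⟨r, hr1, hr2⟩ := Int.exists_crt ((hmp e he.1 p he.2).pow_right (n := 3)) (r₀ e) (ρ p)
      have hp0 : (0 : ℤ) < p := by exact_mod_cast (hP p he.2).1.pos
      obtain ⟨f, hf, hf'⟩ := exists_isEquivForm (R := 9 * r) hd
        (mul_pos (hm e he.1).1 (pow_pos hp0 3)) (by
          have := ((hmp e he.1 p he.2).pow_right (n := 3)).mul_dvd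
            (Int.dvd_sq_add_of_dvd_sub hr1 (hm e he.1).2.2.1)
            (Int.dvd_sq_add_of_dvd_sub hr2 (hρ p he.2))
          rw [show (9 * r) ^ 2 + 243 * (d : ℤ) = 81 * (r ^ 2 + 3 * d) by ring]
          exact this.mul_left _)
      exact ⟨r, f, fun _ _ => ⟨hr1, hr2, hf, hf'⟩⟩
    · exact ⟨0, 0, fun h h' => absurd ⟨h, h'⟩ he⟩
  choose r key hkey using h2
  have hrm : ∀ e ∈ E, ∀ p ∈ P, m e ∣ r e p ^ 2 + 3 * d := fun e he p hp =>
    Int.dvd_sq_add_of_dvd_sub (hkey e p he hp).1 (hm e he).2.2.1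
  have hrp : ∀ e ∈ E, ∀ p ∈ P, (p : ℤ) ^ 3 ∣ r e p ^ 2 + 3 * d := fun e he p hp =>
    Int.dvd_sq_add_of_dvd_sub (hkey e p he hp).2.1 (hρ p hp)
  have hval : ∀ e ∈ E, ∀ p ∈ P, symVec s t (m e) (r e p) = e := fun e he p hp =>
    (symVec_congr (hkey e p he hp).1).trans (hm e he).2.2.2
  have h63 : ∀ {x : ℤ}, IsCoprime x 6 → IsCoprime x 3 := fun h =>
    h.of_isCoprime_of_dvd_right ⟨2, by norm_num⟩
  have hp3 : ∀ p ∈ P, (p : ℤ) ^ 3 ≠ 0 := fun p hp => pow_ne_zero 3 (hpr p hp).ne_zero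
  refine card_mul_sq_le E P _ _ key (fun e he p hp => (hkey e p he hp).2.2.1) ?_ ?_
  · intro e he e' he' p hp hk
    by_contra hne
    have f1 := (hkey e p he hp).2.2.2
    have f2 := (hkey e' p he' hp).2.2.2
    rw [← hk] at f2
    obtain ⟨X, z, hN, hX, hX'⟩ := f1.exists_norm f2
    have hg := dvd_of_dvd_two_roots (hp6 p hp).pow_left (hpd p hp).pow_left (hrp e he p hp)
      (by rw [show r e p - r e' p = (r e p - ρ p) - (r e' p - ρ p) by ring]
          exact dvd_sub (hkey e p he hp).2.1 (hkey e' p he' hp).2.1)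
      ((dvd_mul_left _ _).trans hX) ((dvd_mul_left _ _).trans hX')
    obtain ⟨X₁, z₁, hN1, hX1, hX1'⟩ := exists_div_of_dvd (hp3 p hp) hN
      ((dvd_mul_right _ _).trans hX) ((dvd_mul_right _ _).trans hX')
      (hmp e he p hp).pow_right (hmp e' he' p hp).pow_right hg.1 hg.2
    have := symVec_eq_of_norm hst (hm e he).1.ne' (hm e' he').1.ne' (hmm e he e' he' hne)
      (h63 (hm6 e he)) (h63 (hm6 e' he')) (hmn e he) (hmn e' he') (hrm e he p hp)
      (hrm e' he' p hp) hN1 hX1 hX1'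
    rw [hval e he p hp, hval e' he' p hp] at this
    exact hne this
  · intro e he e' he' p hp p' hp' hpp hk
    have f1 := (hkey e p he hp).2.2.2
    have f2 := (hkey e' p' he' hp').2.2.2
    rw [← hk] at f2
    obtain ⟨X, z, hN, hX, hX'⟩ := f1.exists_norm f2
    have hcop : IsCoprime (p : ℤ) p' :=
      (Nat.isCoprime_iff_coprime).2 ((Nat.coprime_primes (hP p hp).1 (hP p' hp').1).2 hpp)
    by_cases hee : e = e'
    · subst hee
      have hg := dvd_of_dvd_two_roots (hm6 e he) (hmd e he) (hrm e he p hp)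
        (by rw [show r e p - r e p' = (r e p - r₀ e) - (r e p' - r₀ e) by ring]
            exact dvd_sub (hkey e p he hp).1 (hkey e p' he' hp').1)
        ((dvd_mul_right _ _).trans hX) ((dvd_mul_right _ _).trans hX')
      obtain ⟨X₁, z₁, hN1, -, -⟩ := exists_div_of_dvd (M := (p : ℤ) ^ 3) (M' := (p' : ℤ) ^ 3)
        (hm e he).1.ne' (by rw [hN]; ring) ((dvd_mul_left _ _).trans hX)
        ((dvd_mul_left _ _).trans hX') (hmp e he p hp).symm.pow_left
        (hmp e he p' hp').symm.pow_left hg.1 hg.2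
      rw [pairSet, Finset.mem_filter, Finset.mem_product]
      refine ⟨⟨hp, hp'⟩, hpp, -3 * d, Or.inr rfl, 2 * X₁, 18 * z₁, ?_, Or.inl ?_, ?_, ?_⟩
      · intro h0
        have hz0 : z₁ = 0 := by omega
        rw [hz0] at hN1
        refine four_mul_cube_ne_sq (hP p hp).1 (hP p' hp').1 hpp ?_ (2 * X₁) ?_
        · rintro rfl
          exact (hP 2 hp).2.1 (dvd_mul_of_dvd_left (by norm_num) _)
        · zify
          rw [sq_abs]
          linear_combination 4 * hN1
      · linear_combination 4 * hN1
      all_goals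
        have b1 : (p : ℤ) ≤ Z := by exact_mod_cast (hP p hp).2.2.1
        have b2 : (p' : ℤ) ≤ Z := by exact_mod_cast (hP p' hp').2.2.1
        have b3 : (p : ℤ) ^ 3 * (p' : ℤ) ^ 3 ≤ (Z : ℤ) ^ 6 := by
          rw [show (Z : ℤ) ^ 6 = Z ^ 3 * Z ^ 3 by ring]
          gcongr
        have b4 : 0 ≤ (d : ℤ) * z₁ ^ 2 := by positivity
        have b5 : 0 ≤ (Z : ℤ) ^ 6 := by positivity
        nlinarith [sq_nonneg X₁]
    · exfalso
      have hco : IsCoprime (m e * (p : ℤ) ^ 3) (m e' * (p' : ℤ) ^ 3) :=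
        ((hmm e he e' he' hee).mul_right (hmp e he p' hp').pow_right).mul_left
          (((hmp e' he' p hp).symm.pow_left).mul_right hcop.pow)
      have hdv : ∀ e ∈ E, ∀ p ∈ P, m e * (p : ℤ) ^ 3 ∣ r e p ^ 2 + 3 * d := fun e he p hp =>
        (hmp e he p hp).pow_right.mul_dvd (hrm e he p hp) (hrp e he p hp)
      have hval' : ∀ e ∈ E, ∀ p ∈ P, symVec s t (m e * (p : ℤ) ^ 3) (r e p) = e := by
        intro e he p hp
        rw [symVec_mul (hm e he).1.ne' (hp3 p hp), hval e he p hp]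
        have : symVec s t ((p : ℤ) ^ 3) (r e p) = 1 := by
          funext i
          rw [symVec, symM_pow_left (hpr p hp).ne_zero, symM_cube, Pi.one_apply]
        rw [this, mul_one]
      have := symVec_eq_of_norm hst (mul_ne_zero (hm e he).1.ne' (hp3 p hp))
        (mul_ne_zero (hm e' he').1.ne' (hp3 p' hp')) hco
        ((h63 (hm6 e he)).mul_left (h63 (hp6 p hp)).pow_left)
        ((h63 (hm6 e' he')).mul_left (h63 (hp6 p' hp')).pow_left)
        (fun i => (hmn e he i).mul_left (hnP i p hp).symm.pow_left)
        (fun i => (hmn e' he' i).mul_left (hnP i p' hp').symm.pow_left)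
        (hdv e he p hp) (hdv e' he' p' hp') hN hX hX'
      rw [hval' e he p hp, hval' e' he' p' hp'] at this
      exact hee this

end TypeI

namespace QuadField

open NumberField

variable {d Z : ℕ} {K : Type} [Field K] [NumberField K] {Q : QuadField d K}

variable (Q) in
lemma exists_separating_prime {s t s' t' : ℤ}
    (h : ¬ ∃ x : K, x ^ 3 = (s + t * Q.θ) * (s' + t' * Q.θ) ^ 2) (N : ℕ) :
    ∃ q : ℕ, q.Prime ∧ N < q ∧ q % 3 = 1 ∧ ∃ ρ : ℤ, (q : ℤ) ∣ ρ ^ 2 - d ∧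
      ¬ ∃ y : ℤ, (q : ℤ) ∣ y ^ 3 - (s + t * ρ) * (s' + t' * ρ) ^ 2 := by
  have e : (s + t * Q.θ) * (s' + t' * Q.θ) ^ 2 =
      ((s * (s' ^ 2 + d * t' ^ 2) + 2 * d * t * s' * t' : ℤ) : K) +
        ((t * (s' ^ 2 + d * t' ^ 2) + 2 * s * s' * t' : ℤ) : K) * Q.θ := by
    push_cast
    linear_combination (s * t' ^ 2 + 2 * t * s' * t' + t * t' ^ 2 * Q.θ) * Q.sq
  rw [e] at h
  obtain ⟨q, hq, hN, h1, ρ, hρ, hy⟩ := Q.exists_prime_noncube h N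
  refine ⟨q, hq, hN, h1, ρ, hρ, fun ⟨y, hd⟩ => hy ⟨y, ?_⟩⟩
  have := dvd_add hd (hρ.mul_left (s * t' ^ 2 + 2 * t * s' * t' + t * t' ^ 2 * ρ))
  refine (congrArg (fun a : ℤ => (q : ℤ) ∣ a) ?_).mp this
  ring

variable (Q) in
include Q in
lemma ne_zero_of_represented {s t n : ℤ} (h : s ^ 2 - d * t ^ 2 = n ^ 3) (hc : IsCoprime s t) :
    n ≠ 0 := by
  rintro rfl
  have h1 : (s : ℚ) ^ 2 = d * (t : ℚ) ^ 2 := by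
    have : s ^ 2 = d * t ^ 2 := by linear_combination h
    exact_mod_cast this
  obtain ⟨a, b⟩ := not_rat_sq Q.sqf Q.one_lt _ _ h1
  rw [Int.cast_eq_zero] at a b
  subst a b
  obtain ⟨x, y, hxy⟩ := hc
  simp at hxy

variable (Q) in
include Q in
theorem card_torsion_mul_sq_le_of_root {P : Finset ℕ}
    (hP : ∀ p ∈ P, p.Prime ∧ ¬ p ∣ 6 * d ∧ p ≤ Z ∧ ∃ ρ : ℤ, (p : ℤ) ∣ ρ ^ 2 + 3 * d) :
    Nat.card {c : ClassGroup (𝓞 K) // c ^ 3 = 1} * P.card ^ 2 ≤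
      1296 * ((formSet (Nat.sqrt (324 * d)) (-972 * d)).card *
        (P.card + (pairSet d Z P).card)) := by
  obtain ⟨ι, _, s, t, n, hcard, hst, hnL, hind⟩ := Q.exists_represented_family
    (L := ∏ p ∈ P, p) (Finset.prod_ne_zero_iff.2 fun p hp => (hP p hp).1.ne_zero)
  have hn0 : ∀ i, n i ≠ 0 := fun i => Q.ne_zero_of_represented (hst i).1 (hst i).2.1
  obtain ⟨E, hE, hE'⟩ := exists_finset_isSymVec (d := d) (s := s) (t := t) fun i j hij =>
    exists_isSymVec_ne (hn0 i) (hn0 j) (hst i).1 (hst j).1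
      (Q.exists_separating_prime (hind i j hij))
  have := card_mul_sq_le_of_isSymVec (by have := Q.one_lt; omega) hP hst hn0
    (fun i p hp => by
      have h1 := hnL i
      rw [Nat.cast_prod] at h1
      exact h1.of_prod_right _ hp) E hE'
  calc _ ≤ (1296 * E.card) * P.card ^ 2 := by
        gcongr
        exact hcard.trans (Nat.mul_le_mul_left _ hE)
    _ = 1296 * (E.card * P.card ^ 2) := by ring
    _ ≤ _ := Nat.mul_le_mul_left _ this

end QuadField

section PairMoment

open Finset

lemma sq_card_le_card_mul_card_fiber {α β : Type*} [DecidableEq α] [DecidableEq β] (U : Finset α)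
    (B : Finset β) (f : α → β) (hf : ∀ x ∈ U, f x ∈ B) :
    U.card ^ 2 ≤ B.card * ((U ×ˢ U).filter fun q => f q.1 = f q.2).card := by
  have hsum : ∑ b ∈ B, (U.filter fun x => f x = b).card = U.card :=
    (Finset.card_eq_sum_card_fiberwise fun x hx => hf x hx).symm
  have hW : ∑ b ∈ B, (U.filter fun x => f x = b).card ^ 2 =
      ((U ×ˢ U).filter fun q => f q.1 = f q.2).card := by
    rw [Finset.card_eq_sum_card_fiberwise (f := fun q => f q.1) (t := B)]
    · apply Finset.sum_congr rfl
      intro b _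
      rw [sq, ← Finset.card_product]
      congr 1
      ext ⟨x, y⟩
      simp only [mem_filter, mem_product]
      constructor
      · rintro ⟨⟨h1, h2⟩, h3, h4⟩; exact ⟨⟨⟨h1, h3⟩, by rw [h2, h4]⟩, h2⟩
      · rintro ⟨⟨⟨h1, h3⟩, h4⟩, h2⟩; exact ⟨⟨h1, h2⟩, h3, by rw [← h4, h2]⟩
    · intro q hq
      simp only [mem_coe, mem_filter, mem_product] at hq
      exact hf _ hq.1.1
  rw [← hW]
  conv_lhs => rw [← hsum]
  exact sq_sum_le_card_mul_sum_sq

/-- A finite set containing all `(d, v)` for which some `e * d * v ^ 2 + A` and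
`e * d * v ^ 2 + A'` are both squares. -/
noncomputable def repSet (A A' : ℤ) : Finset (ℕ × ℕ) :=
  (A - A').natAbs.divisors.biUnion fun w =>
    (((w + (A - A') / w) / 2) ^ 2 - A).natAbs.divisors ×ˢ
      (((w + (A - A') / w) / 2) ^ 2 - A).natAbs.divisors

lemma mem_repSet {A A' e : ℤ} (hA : A ≠ A') (he : e ≠ 0) {d v u u' : ℕ} (hd : d ≠ 0) (hv : v ≠ 0)
    (h : (u : ℤ) ^ 2 - e * d * v ^ 2 = A) (h' : (u' : ℤ) ^ 2 - e * d * v ^ 2 = A') :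
    (d, v) ∈ repSet A A' := by
  have h1 : A - A' = ((u + u' : ℕ) : ℤ) * (u - u') := by
    rw [← h, ← h']; push_cast; ring
  have hw : ((u + u' : ℕ) : ℤ) ≠ 0 := by
    intro h0
    rw [h0, zero_mul] at h1
    exact hA (by linarith)
  rw [repSet, mem_biUnion]
  refine ⟨u + u', ?_, ?_⟩
  · rw [Nat.mem_divisors]
    refine ⟨?_, ?_⟩
    · rw [← Int.natCast_dvd]
      exact ⟨_, h1⟩
    · rw [Int.natAbs_ne_zero, sub_ne_zero]
      exact hA
  · have h2 : (A - A') / ((u + u' : ℕ) : ℤ) = u - u' := by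
      rw [h1, Int.mul_ediv_cancel_left _ hw]
    have h3 : (((u + u' : ℕ) : ℤ) + ((u : ℤ) - u')) / 2 = u := by
      push_cast; omega
    have h4 : (u : ℤ) ^ 2 - A = e * d * v ^ 2 := by rw [← h]; ring
    rw [h2, h3, h4, mem_product, Nat.mem_divisors, Nat.mem_divisors, ← Int.natCast_dvd,
      ← Int.natCast_dvd, Int.natAbs_ne_zero]
    have h5 : e * d * (v : ℤ) ^ 2 ≠ 0 := by positivity
    exact ⟨⟨⟨e * v ^ 2, by ring⟩, h5⟩, ⟨⟨e * d * v, by ring⟩, h5⟩⟩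

lemma card_repSet_le {A A' : ℤ} {L t : ℕ} (hA : |A| ≤ L) (hA' : |A'| ≤ L)
    (ht : ∀ m ≤ 5 * L ^ 2, m.divisors.card ≤ t) : (repSet A A').card ≤ t ^ 3 := by
  have hn : |A - A'| ≤ 2 * L := (abs_sub _ _).trans (by linarith)
  have hn' : (A - A').natAbs ≤ 2 * L := by
    have := Int.abs_eq_natAbs (A - A')
    omega
  have hL : L ≤ L ^ 2 := by nlinarith [Nat.zero_le L, sq_nonneg ((L : ℤ) - 1)]
  refine (card_biUnion_le_card_mul _ _ (t ^ 2) fun w hw => ?_).trans ?_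
  · rw [card_product, ← sq]
    refine Nat.pow_le_pow_left (ht _ ?_) 2
    rw [Nat.mem_divisors] at hw
    have hw' := (Nat.le_of_dvd (Nat.pos_of_ne_zero hw.2) hw.1).trans hn'
    have h1 : |(A - A') / (w : ℤ)| ≤ 2 * L := (Int.abs_ediv_le_abs _ _).trans hn
    have h2 : |(w + (A - A') / (w : ℤ)) / 2| ≤ 2 * L := by
      rw [abs_le] at h1 ⊢
      omega
    have h3 : ((w + (A - A') / (w : ℤ)) / 2) ^ 2 ≤ (2 * L : ℤ) ^ 2 := by
      rw [← sq_abs]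
      exact pow_le_pow_left₀ (abs_nonneg _) h2 2
    have h4 : 0 ≤ ((w + (A - A') / (w : ℤ)) / 2) ^ 2 := sq_nonneg _
    have h5 : (2 * L : ℤ) ^ 2 = 4 * ((L ^ 2 : ℕ) : ℤ) := by push_cast; ring
    rw [h5] at h3
    rw [abs_le] at hA
    generalize ((w + (A - A') / (w : ℤ)) / 2) ^ 2 = y at *
    omega
  · calc _ ≤ t * t ^ 2 := Nat.mul_le_mul_right _ (ht _ (by nlinarith))
      _ = _ := by ring

end PairMoment

section PairMoment

open Finset

open Classical in
/-- Solutions of `u ^ 2 - e * d * v ^ 2 = 4 * s * (p * p') ^ 3`, recorded as `((e, s), d, v), p, p'`. -/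
noncomputable def pairSol (T P : Finset ℕ) (V : ℕ) : Finset (((ℤ × ℤ) × ℕ × ℕ) × ℕ × ℕ) :=
  (((({1, -3} : Finset ℤ) ×ˢ ({1, -1} : Finset ℤ)) ×ˢ (T ×ˢ Icc 1 V)) ×ˢ (P ×ˢ P)).filter fun x =>
    x.2.1 ≠ x.2.2 ∧ ∃ u : ℕ, (u : ℤ) ^ 2 - x.1.1.1 * x.1.2.1 * (x.1.2.2 : ℤ) ^ 2 =
      x.1.1.2 * (4 * ((x.2.1 : ℤ) * x.2.2) ^ 3)

lemma mem_pairSol {T P : Finset ℕ} {V : ℕ} {e s : ℤ} {d v p p' : ℕ} :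
    (((e, s), d, v), p, p') ∈ pairSol T P V ↔ (((e = 1 ∨ e = -3) ∧ (s = 1 ∨ s = -1)) ∧
      d ∈ T ∧ 1 ≤ v ∧ v ≤ V) ∧ (p ∈ P ∧ p' ∈ P) ∧ p ≠ p' ∧
      ∃ u : ℕ, (u : ℤ) ^ 2 - e * d * (v : ℤ) ^ 2 = s * (4 * ((p : ℤ) * p') ^ 3) := by
  simp only [pairSol, mem_filter, mem_product, mem_insert, mem_singleton, mem_Icc, ne_eq, and_assoc]

lemma sum_card_pairSet_le {T P : Finset ℕ} {Y Z V : ℕ} (hY : ∀ d ∈ T, Y ≤ d)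
    (hV : 8 * Z ^ 6 < Y * (V + 1) ^ 2) :
    ∑ d ∈ T, (pairSet d Z P).card ≤ (pairSol T P V).card := by
  classical
  rw [← Finset.card_sigma]
  refine (Finset.card_le_card (t := (pairSol T P V).image
    fun x => (⟨x.1.2.1, x.2⟩ : Σ _ : ℕ, ℕ × ℕ)) ?_).trans card_image_le
  rintro ⟨d, p, p'⟩ hx
  rw [mem_sigma, pairSet, mem_filter, mem_product] at hx
  obtain ⟨hd, ⟨hp, hp'⟩, hne, D, hD, u, v, hv, huv, -, hvZ⟩ := hx
  have hv1 : v.natAbs ≤ V := by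
    by_contra! hc
    have h1 : (V + 1) ^ 2 ≤ v.natAbs ^ 2 := Nat.pow_le_pow_left hc 2
    have h2 : d * v.natAbs ^ 2 ≤ 8 * Z ^ 6 := by
      have : (d : ℤ) * (v.natAbs : ℤ) ^ 2 ≤ 8 * (Z : ℤ) ^ 6 := by rwa [Int.natAbs_sq]
      exact_mod_cast this
    have h3 := Nat.mul_le_mul (hY d hd) h1
    omega
  have hv0 : 1 ≤ v.natAbs := Int.natAbs_pos.2 hv
  rw [mem_image]
  obtain ⟨e, he, rfl⟩ : ∃ e : ℤ, (e = 1 ∨ e = -3) ∧ D = e * d := by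
    rcases hD with h | h
    · exact ⟨1, Or.inl rfl, by rw [h, one_mul]⟩
    · exact ⟨-3, Or.inr rfl, h⟩
  obtain ⟨s, hs, h⟩ : ∃ s : ℤ, (s = 1 ∨ s = -1) ∧
      u ^ 2 - e * d * v ^ 2 = s * (4 * ((p : ℤ) * p') ^ 3) := by
    rcases huv with h | h
    · exact ⟨1, Or.inl rfl, by rw [h, one_mul]⟩
    · exact ⟨-1, Or.inr rfl, by rw [h, neg_one_mul]⟩
  refine ⟨(((e, s), d, v.natAbs), p, p'), mem_pairSol.2 ⟨⟨⟨he, hs⟩, hd, hv0, hv1⟩, ⟨hp, hp'⟩, hne,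
    u.natAbs, ?_⟩, rfl⟩
  rwa [Int.natAbs_sq, Int.natAbs_sq]

lemma sq_card_pairSol_le {T P : Finset ℕ} {Z V t : ℕ} (hT : 0 ∉ T)
    (hP : ∀ p ∈ P, p.Prime ∧ p ≤ Z) (ht : ∀ m ≤ 5 * (4 * Z ^ 6) ^ 2, m.divisors.card ≤ t) :
    (pairSol T P V).card ^ 2 ≤
      4 * T.card * V * (2 * (pairSol T P V).card + 4 * t ^ 3 * P.card ^ 4) := by
  classical
  set U := pairSol T P V with hU
  set B := ((({1, -3} : Finset ℤ) ×ˢ ({1, -1} : Finset ℤ)) ×ˢ (T ×ˢ Icc 1 V)) with hB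
  have hBc : B.card = 4 * T.card * V := by
    rw [hB, card_product, card_product, card_product, Nat.card_Icc]
    simp [mul_assoc]
  have h1 := sq_card_le_card_mul_card_fiber U B (fun x => x.1) fun x hx => by
    rw [hU, pairSol, mem_filter, mem_product] at hx
    exact hx.1.1
  rw [hBc] at h1
  refine h1.trans (Nat.mul_le_mul_left _ ?_)
  set W := (U ×ˢ U).filter fun q => q.1.1 = q.2.1 with hW
  rw [← Finset.card_filter_add_card_filter_not
    (fun q => q.1.2.1 * q.1.2.2 = q.2.2.1 * q.2.2.2) (s := W)]
  refine Nat.add_le_add ?_ ?_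
  · have : (U ×ˢ (univ : Finset Bool)).card = 2 * U.card := by
      rw [card_product, mul_comm]; simp
    rw [← this]
    refine card_le_card_of_injOn (fun q => (q.1, decide (q.1.2.1 = q.2.2.1))) ?_ ?_
    · intro q hq
      simp only [hW, coe_filter, mem_filter, mem_product, Set.mem_ofPred_eq] at hq
      simp [hq.1.1.1, em]
    · rintro ⟨⟨⟨⟨e, s⟩, d, v⟩, p, p'⟩, ⟨⟨⟨e₁, s₁⟩, d₁, v₁⟩, q, q'⟩⟩ hq
        ⟨⟨⟨⟨e₂, s₂⟩, d₂, v₂⟩, p₂, p₂'⟩, ⟨⟨⟨e₃, s₃⟩, d₃, v₃⟩, q₂, q₂'⟩⟩ hq2 h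
      simp only [Prod.mk.injEq, decide_eq_decide] at h
      obtain ⟨⟨⟨⟨rfl, rfl⟩, rfl, rfl⟩, rfl, rfl⟩, h⟩ := h
      simp only [hW, hU, coe_filter, mem_filter, mem_product, Set.mem_ofPred_eq, mem_pairSol,
        Prod.mk.injEq] at hq hq2
      obtain ⟨⟨⟨a, b⟩, ⟨rfl, rfl⟩, rfl, rfl⟩, hpq⟩ := hq
      obtain ⟨⟨⟨-, b2⟩, ⟨rfl, rfl⟩, rfl, rfl⟩, hpq2⟩ := hq2
      have P1 := (hP p a.2.1.1).1
      have P2 := (hP p' a.2.1.2).1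
      have key : ∀ {q q' : ℕ}, q.Prime → p * p' = q * q' → (p = q ∧ q' = p') ∨ (p ≠ q ∧ q = p' ∧ q' = p) := by
        intro q q' hq h
        have hd : q ∣ p * p' := ⟨_, h⟩
        by_cases hne : p = q
        · subst hne
          exact Or.inl ⟨rfl, (Nat.eq_of_mul_eq_mul_left P1.pos h).symm⟩
        · rcases hq.dvd_mul.1 hd with h2 | h2
          · exact absurd ((Nat.prime_dvd_prime_iff_eq hq P1).1 h2).symm hne
          · have e := (Nat.prime_dvd_prime_iff_eq hq P2).1 h2
            subst e
            refine Or.inr ⟨hne, rfl, ?_⟩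
            rw [mul_comm] at h
            exact (Nat.eq_of_mul_eq_mul_left hq.pos h).symm
      rcases key (hP q b.2.1.1).1 hpq with ⟨x1, x2⟩ | ⟨x1, x2, x3⟩ <;>
      rcases key (hP q₂ b2.2.1.1).1 hpq2 with ⟨y1, y2⟩ | ⟨y1, y2, y3⟩
      · rw [← x1, ← y1, x2, y2]
      · exact absurd (h.1 x1) y1
      · exact absurd (h.2 y1) x1
      · rw [x2, x3, y2, y3]
  · have : ((P ×ˢ P) ×ˢ (P ×ˢ P)).card = P.card ^ 4 := by
      simp only [card_product]; ring
    rw [← this]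
    refine card_le_mul_card_image_of_maps_to (f := fun q => (q.1.2, q.2.2)) ?_ _ ?_
    · intro q hq
      simp only [hW, hU, pairSol, mem_filter, mem_product] at hq
      simp only [mem_product]
      exact ⟨hq.1.1.1.1.2, hq.1.1.2.1.2⟩
    · rintro ⟨⟨p, p'⟩, q, q'⟩ hpq
      simp only [mem_product] at hpq
      have hL : ∀ {s : ℤ} {p p' : ℕ}, (s = 1 ∨ s = -1) → p ≤ Z → p' ≤ Z →
          |s * (4 * ((p : ℤ) * p') ^ 3)| ≤ ((4 * Z ^ 6 : ℕ) : ℤ) := by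
        intro s p p' hs hp hp'
        have hs1 : |s| = 1 := by rcases hs with rfl | rfl <;> simp
        rw [abs_mul, hs1, one_mul, abs_of_nonneg (by positivity)]
        have : (p * p') ^ 3 ≤ (Z * Z) ^ 3 := Nat.pow_le_pow_left (Nat.mul_le_mul hp hp') 3
        have h2 : 4 * (p * p') ^ 3 ≤ 4 * Z ^ 6 := by
          calc _ ≤ 4 * (Z * Z) ^ 3 := by omega
            _ = _ := by ring
        exact_mod_cast h2
      calc _ ≤ ((({1, -3} : Finset ℤ) ×ˢ ({1, -1} : Finset ℤ)).biUnion fun c =>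
            if |c.2| = 1 then ((repSet (c.2 * (4 * ((p : ℤ) * p') ^ 3)) (c.2 * (4 * ((q : ℤ) * q') ^ 3))).image
              (Prod.mk c)) else ∅).card := by
            refine card_le_card_of_injOn (fun x => x.1.1) ?_ ?_
            · rintro ⟨⟨⟨⟨e, s⟩, d, v⟩, a, a'⟩, ⟨⟨⟨e₁, s₁⟩, d₁, v₁⟩, b, b'⟩⟩ hx
              simp only [hW, hU, coe_filter, mem_filter, mem_product, Set.mem_ofPred_eq, mem_pairSol,
                Prod.mk.injEq] at hx
              obtain ⟨⟨⟨⟨x, y⟩, ⟨rfl, rfl⟩, rfl, rfl⟩, hne⟩, ⟨rfl, rfl⟩, rfl, rfl⟩ := hx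
              obtain ⟨⟨⟨he, hs⟩, hd, hv1, -⟩, -, -, u, hu⟩ := x
              obtain ⟨-, -, -, u', hu'⟩ := y
              have hs1 : |s| = 1 := by rcases hs with rfl | rfl <;> simp
              rw [mem_coe, mem_biUnion]
              refine ⟨(e, s), by simpa using ⟨he, hs⟩, ?_⟩
              rw [if_pos hs1]
              refine mem_image_of_mem _ (mem_repSet (e := e) ?_ ?_ ?_ ?_ hu hu')
              · intro h
                have hs0 : s ≠ 0 := by rcases hs with rfl | rfl <;> simp
                have h2 := mul_left_cancel₀ four_ne_zero (mul_left_cancel₀ hs0 h)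
                have h3 : (a * a') ^ 3 = (b * b') ^ 3 := by exact_mod_cast h2
                exact hne (Nat.pow_left_injective three_ne_zero h3)
              · rcases he with rfl | rfl <;> simp
              · rintro rfl; exact hT hd
              · omega
            · rintro ⟨x, y⟩ hx ⟨x', y'⟩ hx' h
              simp only [hW, coe_filter, mem_filter, mem_product, Set.mem_ofPred_eq,
                Prod.mk.injEq] at hx hx' h
              obtain ⟨⟨⟨-, h1⟩, -⟩, h2, h3⟩ := hx
              obtain ⟨⟨⟨-, h1'⟩, -⟩, h2', h3'⟩ := hx'
              rw [Prod.mk.injEq]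
              refine ⟨Prod.ext h (h2.trans h2'.symm), Prod.ext ?_ (h3.trans h3'.symm)⟩
              rw [← h1, ← h1', h]
        _ ≤ (({1, -3} : Finset ℤ) ×ˢ ({1, -1} : Finset ℤ)).card * t ^ 3 := by
            refine card_biUnion_le_card_mul _ _ _ fun c _ => ?_
            split_ifs with hc
            · refine card_image_le.trans (card_repSet_le (hL ?_ ?_ ?_) (hL ?_ ?_ ?_) ht)
              · exact (abs_eq zero_le_one).1 hc
              · exact (hP p hpq.1.1).2
              · exact (hP p' hpq.1.2).2
              · exact (abs_eq zero_le_one).1 hc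
              · exact (hP q hpq.2.1).2
              · exact (hP q' hpq.2.2).2
            · simp
        _ = _ := by rw [card_product]; simp

end PairMoment

section TypeBound

open NumberField

lemma exists_sq_or_neg_three_mul {p : ℕ} (hp : p.Prime) (h2 : p % 3 = 2) {d : ℕ} (hd : ¬ p ∣ 6 * d) :
    (∃ ρ : ℤ, (p : ℤ) ∣ ρ ^ 2 - d) ∨ ∃ ρ : ℤ, (p : ℤ) ∣ ρ ^ 2 + 3 * d := by
  have := Fact.mk hp
  have key : ∀ a : ℤ, IsSquare (a : ZMod p) → ∃ ρ : ℤ, (p : ℤ) ∣ ρ ^ 2 - a := by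
    rintro a ⟨x, hx⟩
    obtain ⟨ρ, rfl⟩ := ZMod.intCast_surjective x
    refine ⟨ρ, ?_⟩
    rw [← ZMod.intCast_zmod_eq_zero_iff_dvd]
    push_cast
    rw [hx, sq, sub_self]
  by_cases h1 : IsSquare ((d : ℤ) : ZMod p)
  · exact Or.inl (key _ h1)
  by_cases h3 : IsSquare ((-3 * d : ℤ) : ZMod p)
  · obtain ⟨ρ, h⟩ := key _ h3
    exact Or.inr ⟨ρ, by rwa [show ρ ^ 2 + 3 * (d : ℤ) = ρ ^ 2 - -3 * d by ring]⟩
  exfalso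
  have hd0 : ((d : ℤ) : ZMod p) ≠ 0 := by
    rw [Ne, ZMod.intCast_zmod_eq_zero_iff_dvd]
    exact fun h => hd (Dvd.dvd.mul_left (by exact_mod_cast h) 6)
  have hp2 : p ≠ 2 := by rintro rfl; exact hd (Dvd.dvd.mul_right (by norm_num) d)
  have hp3 : p ≠ 3 := by rintro rfl; exact hd (Dvd.dvd.mul_right (by norm_num) d)
  have h30 : ((-3 : ℤ) : ZMod p) ≠ 0 := by
    rw [Ne, ZMod.intCast_zmod_eq_zero_iff_dvd, dvd_neg]
    intro h
    have : p ∣ 3 := by exact_mod_cast h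
    exact hp3 ((Nat.prime_dvd_prime_iff_eq hp Nat.prime_three).1 this)
  have hsq : IsSquare ((-3 : ℤ) : ZMod p) := by
    have q1 := (quadraticChar_neg_one_iff_not_isSquare (a := ((d : ℤ) : ZMod p))).2 h1
    have q2 := (quadraticChar_neg_one_iff_not_isSquare (a := ((-3 * d : ℤ) : ZMod p))).2 h3
    rw [Int.cast_mul, map_mul, q1] at q2
    refine (quadraticChar_one_iff_isSquare h30).1 ?_
    linarith
  obtain ⟨y, hy⟩ := hsq
  have h20 : (2 : ZMod p) ≠ 0 := by
    have := (Ring.two_ne_zero : ringChar (ZMod p) ≠ 2 → _)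
    rw [ZMod.ringChar_zmod_n] at this
    exact this hp2
  have hy' : y * y = -3 := by rw [← hy]; push_cast; ring
  set w : ZMod p := (y - 1) / 2 with hw
  have hw2 : w ^ 2 + w + 1 = 0 := by
    rw [hw]
    field_simp
    linear_combination hy'
  have hw3 : w ^ 3 = 1 := by linear_combination (w - 1) * hw2
  have hw0 : w ≠ 0 := by rintro h; rw [h] at hw3; simp at hw3
  have hfer := ZMod.pow_card_sub_one_eq_one hw0
  obtain ⟨k, hk⟩ : ∃ k, p - 1 = 3 * k + 1 := ⟨(p - 2) / 3, by have := hp.two_le; omega⟩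
  rw [hk, pow_succ, pow_mul, hw3, one_pow, one_mul] at hfer
  rw [hfer] at hw2
  apply h30
  push_cast
  linear_combination -hw2

lemma pairSet_mono {d Z : ℕ} {P P' : Finset ℕ} (h : P ⊆ P') : pairSet d Z P ⊆ pairSet d Z P' := by
  classical
  exact Finset.filter_subset_filter _ (Finset.product_subset_product h h)

theorem hpos_mul_sq_le {d Z : ℕ} (hd : Squarefree d) (h1 : 1 < d) {P : Finset ℕ}
    (hP : ∀ p ∈ P, p.Prime ∧ p % 3 = 2 ∧ ¬ p ∣ 6 * d ∧ p ≤ Z) :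
    hpos 3 d * P.card ^ 2 ≤ 4 * (((QuadField.itemSet d).card +
      1296 * (formSet (Nat.sqrt (324 * d)) (-972 * d)).card) * (P.card + (pairSet d Z P).card)) := by
  classical
  set P₁ := P.filter fun p : ℕ => ∃ ρ : ℤ, (p : ℤ) ∣ ρ ^ 2 - d with hP1
  set P₂ := P.filter fun p : ℕ => ∃ ρ : ℤ, (p : ℤ) ∣ ρ ^ 2 + 3 * d with hP2
  have hU : P.card ≤ P₁.card + P₂.card := by
    refine (Finset.card_le_card ?_).trans (Finset.card_union_le _ _)
    intro p hp
    obtain ⟨a, b, c, -⟩ := hP p hp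
    rw [Finset.mem_union, hP1, hP2, Finset.mem_filter, Finset.mem_filter]
    exact (exists_sq_or_neg_three_mul a b c).imp (fun h => ⟨hp, h⟩) fun h => ⟨hp, h⟩
  have hmono : ∀ {P' : Finset ℕ}, P' ⊆ P →
      P'.card + (pairSet d Z P').card ≤ P.card + (pairSet d Z P).card := fun h =>
    Nat.add_le_add (Finset.card_le_card h) (Finset.card_le_card (pairSet_mono h))
  have t1 := (Kpos.quadField hd h1).card_torsion_mul_sq_le_of_split (Z := Z) (P := P₁) fun p hp => by
    rw [hP1, Finset.mem_filter] at hp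
    obtain ⟨a, b, c, e⟩ := hP p hp.1
    refine ⟨a, fun h => c ?_, e, hp.2⟩
    rw [show 6 * d = 3 * (2 * d) by ring]
    exact h.mul_left 3
  have t2 := (Kpos.quadField hd h1).card_torsion_mul_sq_le_of_root (Z := Z) (P := P₂) fun p hp => by
    rw [hP2, Finset.mem_filter] at hp
    obtain ⟨a, b, c, e⟩ := hP p hp.1
    exact ⟨a, c, e, hp.2⟩
  have m1 := hmono (P' := P₁) (Finset.filter_subset _ _)
  have m2 := hmono (P' := P₂) (Finset.filter_subset _ _)
  change hpos 3 d * _ ≤ _ at t1 t2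
  set S := P.card + (pairSet d Z P).card
  have u1 := t1.trans (Nat.mul_le_mul_left _ m1)
  have u2 := t2.trans (Nat.mul_le_mul_left _ (Nat.mul_le_mul_left _ m2))
  have hsq : P.card ^ 2 ≤ 4 * max (P₁.card ^ 2) (P₂.card ^ 2) := by
    rcases le_total P₁.card P₂.card with h | h
    · calc _ ≤ (2 * P₂.card) ^ 2 := Nat.pow_le_pow_left (by omega) 2
        _ = 4 * P₂.card ^ 2 := by ring
        _ ≤ _ := Nat.mul_le_mul_left _ (le_max_right _ _)
    · calc _ ≤ (2 * P₁.card) ^ 2 := Nat.pow_le_pow_left (by omega) 2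
        _ = 4 * P₁.card ^ 2 := by ring
        _ ≤ _ := Nat.mul_le_mul_left _ (le_max_left _ _)
  calc _ ≤ hpos 3 d * (4 * max (P₁.card ^ 2) (P₂.card ^ 2)) := Nat.mul_le_mul_left _ hsq
    _ = 4 * max (hpos 3 d * P₁.card ^ 2) (hpos 3 d * P₂.card ^ 2) := by
        rw [Nat.mul_max_mul_left]; ring
    _ ≤ _ := by
        refine Nat.mul_le_mul_left _ (max_le (u1.trans ?_) (u2.trans ?_))
        · exact Nat.mul_le_mul_right _ (Nat.le_add_right _ _)
        · rw [← mul_assoc]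
          exact Nat.mul_le_mul_right _ (Nat.le_add_left _ _)

end TypeBound

section Eventual

open Filter Real

lemma eventually_le_rpow (C : ℝ) {ε : ℝ} (hε : 0 < ε) : ∀ᶠ Y : ℕ in atTop, C ≤ (Y : ℝ) ^ ε :=
  ((tendsto_rpow_atTop hε).comp tendsto_natCast_atTop_atTop).eventually_ge_atTop C

lemma eventually_log_le_rpow {ε : ℝ} (hε : 0 < ε) : ∀ᶠ Y : ℕ in atTop, log Y ≤ (Y : ℝ) ^ ε := by
  have := ((isLittleO_log_rpow_atTop hε).bound one_pos).natCast_atTop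
  filter_upwards [this] with Y h
  rw [one_mul, norm_eq_abs, norm_of_nonneg (by positivity)] at h
  exact (le_abs_self _).trans h

lemma natCast_clog_le {n : ℕ} (hn : 1 ≤ n) : (Nat.clog 2 n : ℝ) ≤ 2 * log n + 1 := by
  have hn' : (1 : ℝ) ≤ n := by exact_mod_cast hn
  rw [← Real.natCeil_logb_natCast]
  have h0 : 0 ≤ logb (2 : ℕ) n := logb_nonneg (by norm_num) hn'
  refine (Nat.ceil_lt_add_one h0).le.trans ?_
  have h2 : 0.6931 < log 2 := by have := log_two_gt_d9; linarith
  have h3 : 0 ≤ log n := log_nonneg hn'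
  have : logb (2 : ℕ) n ≤ 2 * log n := by
    rw [logb, Nat.cast_ofNat, div_le_iff₀ (by linarith)]
    nlinarith
  linarith

lemma eventually_card_formSet_le {ε : ℝ} (hε : 0 < ε) : ∀ᶠ Y : ℕ in atTop, ∀ (d a : ℕ) (Δ : ℤ),
    d ≤ 2 * Y → a ≤ 324 → |Δ| ≤ 972 * d →
      ((formSet (Nat.sqrt (a * d)) Δ).card : ℝ) ≤ (Y : ℝ) ^ (1 / 2 + ε) := by
  set η := ε / 3 with hη
  have hη0 : 0 < η := by positivity
  obtain ⟨C, hC, h⟩ := card_formSet_le hη0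
  filter_upwards [eventually_le_rpow (27 * C) hη0, eventually_ge_atTop 3000] with Y hY1 hY3 d a Δ hd ha hΔ
  have hY3' : (3000 : ℝ) ≤ Y := by exact_mod_cast hY3
  have hY0 : (0 : ℝ) < Y := by linarith
  have hd' : (d : ℝ) ≤ 2 * Y := by exact_mod_cast hd
  have ha' : (a : ℝ) ≤ 324 := by exact_mod_cast ha
  have had : (a : ℝ) * d ≤ 648 * Y := by
    calc (a : ℝ) * d ≤ 324 * (2 * Y) := by gcongr
      _ = _ := by ring
  have hL : ((Nat.sqrt (a * d) : ℕ) : ℝ) ^ 2 ≤ a * d := by exact_mod_cast Nat.sqrt_le' (a * d)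
  have hL1 : ((Nat.sqrt (a * d) : ℕ) : ℝ) + 1 ≤ 27 * √Y := by
    have h1 : ((Nat.sqrt (a * d) : ℕ) : ℝ) ≤ 26 * √Y := by
      refine abs_le_of_sq_le_sq' ?_ (by positivity) |>.2
      rw [mul_pow, sq_sqrt hY0.le]
      linarith
    have h2 : 1 ≤ √(Y : ℝ) := by rw [one_le_sqrt]; linarith
    linarith
  have hΔ' : |(Δ : ℝ)| ≤ 972 * d := by exact_mod_cast hΔ
  have hs : ((Nat.sqrt (a * d) : ℕ) : ℝ) ^ 2 + |(Δ : ℝ)| + 1 ≤ (Y : ℝ) ^ 2 := by nlinarith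
  calc _ ≤ C * ((Nat.sqrt (a * d) : ℕ) + 1) * (((Nat.sqrt (a * d) : ℕ) : ℝ) ^ 2 + |(Δ : ℝ)| + 1) ^ η := h _ _
    _ ≤ C * (27 * √Y) * ((Y : ℝ) ^ 2) ^ η := by gcongr
    _ = (27 * C) * (Y : ℝ) ^ (1 / 2 + 2 * η) := by
        have : ((Y : ℝ) ^ 2) ^ η = (Y : ℝ) ^ (2 * η) := by
          rw [← rpow_natCast, ← rpow_mul hY0.le, Nat.cast_ofNat]
        rw [this, rpow_add hY0, sqrt_eq_rpow]
        ring
    _ ≤ (Y : ℝ) ^ η * (Y : ℝ) ^ (1 / 2 + 2 * η) := by gcongr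
    _ = _ := by rw [← rpow_add hY0]; congr 1; rw [hη]; ring

lemma eventually_card_items_le {ε : ℝ} (hε : 0 < ε) : ∀ᶠ Y : ℕ in atTop, ∀ d : ℕ, 1 ≤ d →
    d ≤ 2 * Y → ((4 * ((QuadField.itemSet d).card +
      1296 * (formSet (Nat.sqrt (324 * d)) (-972 * d)).card) : ℕ) : ℝ) ≤ (Y : ℝ) ^ (1 / 2 + ε) := by
  set η := ε / 3 with hη
  have hη0 : 0 < η := by positivity
  filter_upwards [eventually_card_formSet_le hη0, eventually_le_rpow 12000 hη0,
    eventually_log_le_rpow hη0, eventually_ge_atTop 3000] with Y hF hC hl hY3 d hd1 hd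
  have hY3' : (3000 : ℝ) ≤ Y := by exact_mod_cast hY3
  have hY0 : (0 : ℝ) < Y := by linarith
  have hd' : (d : ℝ) ≤ 2 * Y := by exact_mod_cast hd
  have hd1' : (1 : ℝ) ≤ d := by exact_mod_cast hd1
  have f1 := hF d 6 d hd (by norm_num) (by rw [abs_of_nonneg (by positivity)]; omega)
  have f2 := hF d 6 (4 * d) hd (by norm_num) (by rw [abs_of_nonneg (by positivity)]; omega)
  have f3 := hF d 324 (-972 * d) hd (by norm_num)
    (by rw [neg_mul, abs_neg, abs_of_nonneg (by positivity)])
  set F := (Y : ℝ) ^ (1 / 2 + η)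
  set l := (Y : ℝ) ^ η
  have hF0 : 0 ≤ F := by positivity
  have hc : (Nat.clog 2 (152 * d ^ 3) : ℝ) ≤ 9 * l := by
    refine (natCast_clog_le (by nlinarith [Nat.one_le_pow 3 d hd1])).trans ?_
    have h1 : log ((152 * d ^ 3 : ℕ) : ℝ) ≤ log ((Y : ℝ) ^ 4) := by
      apply log_le_log
      · positivity
      · push_cast
        calc 152 * (d : ℝ) ^ 3 ≤ 152 * (2 * (Y : ℝ)) ^ 3 := by gcongr
          _ = 1216 * (Y : ℝ) ^ 3 := by ring
          _ ≤ Y * (Y : ℝ) ^ 3 := by gcongr; linarith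
          _ = _ := by ring
    rw [log_pow] at h1
    push_cast at h1 ⊢
    linarith
  have hI : ((QuadField.itemSet d).card : ℝ) ≤ (2 * F) * (19 * l) := by
    rw [QuadField.itemSet, Finset.card_product, Nat.cast_mul]
    gcongr
    · refine (Nat.cast_le.2 (Finset.card_union_le _ _)).trans ?_
      push_cast
      linarith
    · rw [Int.card_Icc]
      have : ((Nat.clog 2 (152 * d ^ 3) : ℤ) + 1 - -(Nat.clog 2 (152 * d ^ 3))).toNat =
        2 * Nat.clog 2 (152 * d ^ 3) + 1 := by omega
      rw [this]
      push_cast at hc ⊢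
      linarith
  push_cast
  calc _ ≤ 4 * ((2 * F) * (19 * l) + 1296 * F) := by gcongr
    _ ≤ l * (F * l) := by nlinarith [mul_nonneg hF0 (sub_nonneg.2 hC)]
    _ = (Y : ℝ) ^ (1 / 2 + ε) := by
        rw [← rpow_add hY0, ← rpow_add hY0]; congr 1; rw [hη]; ring

end Eventual

section PointwiseBound

open Filter Real

/-- The primes `p ≡ 2 mod 3` up to `Z` not dividing `6 * d`. -/
def goodPrimes (d Z : ℕ) : Finset ℕ := (primes32 Z).filter fun p => ¬ p ∣ 6 * d

lemma of_mem_goodPrimes {d Z p : ℕ} (h : p ∈ goodPrimes d Z) :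
    p.Prime ∧ p % 3 = 2 ∧ ¬ p ∣ 6 * d ∧ p ≤ Z := by
  rw [goodPrimes, primes32, Finset.mem_filter, Finset.mem_filter, Finset.mem_Icc] at h
  exact ⟨h.1.2.1, h.1.2.2, h.2, h.1.1.2⟩

lemma eventually_le_card_goodPrimes {ε : ℝ} (hε : 0 < ε) : ∀ᶠ Y : ℕ in atTop, ∀ d Z : ℕ, 1 ≤ d →
    d ≤ 2 * Y → (Y : ℝ) ^ ε ≤ Z → Z ≤ Y → (Z : ℝ) ≤ (goodPrimes d Z).card * (Y : ℝ) ^ ε := by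
  set η := ε / 8 with hη
  have hη0 : 0 < η := by positivity
  obtain ⟨C₁, hC₁, h₁⟩ := card_divisors_le_rpow hη0
  obtain ⟨C₂, hC₂, h₂⟩ := card_primes32_ge hη0
  filter_upwards [eventually_le_rpow (max C₁ (max C₂ (12 ^ η))) hη0, eventually_le_rpow 2 hη0,
    eventually_ge_atTop 1] with Y hC h2 hY1 d Z hd1 hd hZ hZY
  rw [max_le_iff, max_le_iff] at hC
  have hY0 : (0 : ℝ) < Y := by exact_mod_cast hY1
  have e8 : (Y : ℝ) ^ ε = ((Y : ℝ) ^ η) ^ 8 := by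
    rw [← rpow_natCast, ← rpow_mul hY0.le]; congr 1; rw [hη]; push_cast; ring
  rw [e8] at hZ ⊢
  have hd' : (d : ℝ) ≤ 2 * Y := by exact_mod_cast hd
  have hdiv : (((6 * d).divisors.card : ℕ) : ℝ) ≤ ((Y : ℝ) ^ η) ^ 3 := by
    refine (h₁ (6 * d) (by omega)).trans ?_
    calc C₁ * ((6 * d : ℕ) : ℝ) ^ η ≤ C₁ * (12 * Y) ^ η := by
          gcongr; push_cast; linarith
      _ = C₁ * 12 ^ η * (Y : ℝ) ^ η := by rw [mul_rpow (by norm_num) hY0.le]; ring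
      _ ≤ (Y : ℝ) ^ η * (Y : ℝ) ^ η * (Y : ℝ) ^ η :=
          mul_le_mul_of_nonneg_right (mul_le_mul hC.1 hC.2.2 (by positivity) (by positivity))
            (by positivity)
      _ = _ := by ring
  have hZY' : (Z : ℝ) ^ η ≤ (Y : ℝ) ^ η := by gcongr
  have hC2 := hC.2.1
  set y := (Y : ℝ) ^ η with hy
  have hy8 : 2 ^ 8 ≤ y ^ 8 := pow_le_pow_left₀ (by norm_num) h2 8
  have hZ2 : 2 ≤ Z := by
    have : (2 : ℝ) ≤ Z := by linarith
    exact_mod_cast this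
  have hZ0 : (0 : ℝ) < Z := by positivity
  have h3 : (Z : ℝ) ≤ y ^ 2 * (primes32 Z).card := by
    calc (Z : ℝ) = (Z : ℝ) ^ η * (Z : ℝ) ^ (1 - η) := by
          rw [← rpow_add hZ0, add_sub_cancel, rpow_one]
      _ ≤ y * (C₂ * (primes32 Z).card) := by
          gcongr
          exact h₂ Z hZ2
      _ ≤ y * (y * (primes32 Z).card) := by gcongr
      _ = _ := by ring
  have h4 : ((primes32 Z).card : ℝ) ≤ (goodPrimes d Z).card + y ^ 3 := by
    refine le_trans ?_ (add_le_add_right hdiv _)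
    rw [← Finset.card_filter_add_card_filter_not (fun p => ¬ p ∣ 6 * d) (s := primes32 Z)]
    push_cast
    refine add_le_add le_rfl (Nat.cast_le.2 (Finset.card_le_card ?_))
    intro p hp
    rw [Finset.mem_filter, not_not] at hp
    rw [Nat.mem_divisors]
    exact ⟨hp.2, by omega⟩
  set G : ℝ := ((goodPrimes d Z).card : ℝ)
  have hG : 0 ≤ G := Nat.cast_nonneg _
  have h5 : (Z : ℝ) ≤ y ^ 2 * G + y ^ 5 :=
    h3.trans ((mul_le_mul_of_nonneg_left h4 (sq_nonneg y)).trans_eq (by ring))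
  have h6 : 2 * y ^ 5 ≤ y ^ 8 := by
    have : 2 ≤ y ^ 3 := by linarith [pow_le_pow_left₀ (by norm_num) h2 3]
    nlinarith [pow_nonneg (by linarith : 0 ≤ y) 5]
  have h7 : 2 * y ^ 2 ≤ y ^ 8 := by
    have : 2 ≤ y ^ 6 := by linarith [pow_le_pow_left₀ (by norm_num) h2 6]
    nlinarith [pow_nonneg (by linarith : 0 ≤ y) 2]
  linarith [mul_nonneg hG (sub_nonneg.2 h7)]

lemma eventually_hpos_mul_le {ε : ℝ} (hε : 0 < ε) : ∀ᶠ Y : ℕ in atTop, ∀ d Z : ℕ, Squarefree d →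
    1 < d → d ≤ 2 * Y → (hpos 3 d : ℝ) * (goodPrimes d Z).card ^ 2 ≤
      (Y : ℝ) ^ (1 / 2 + ε) * ((goodPrimes d Z).card + (pairSet d Z (goodPrimes d Z)).card) := by
  filter_upwards [eventually_card_items_le hε] with Y h d Z hd hd1 hdY
  have h1 := hpos_mul_sq_le hd hd1 fun p hp => of_mem_goodPrimes (d := d) (Z := Z) hp
  rw [← mul_assoc] at h1
  have h2 : ((hpos 3 d * (goodPrimes d Z).card ^ 2 : ℕ) : ℝ) ≤ _ := Nat.cast_le.2 h1
  rw [Nat.cast_mul, Nat.cast_mul _ (_ + _), Nat.cast_pow, Nat.cast_add (goodPrimes d Z).card] at h2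
  refine h2.trans ?_
  gcongr
  exact h d hd1.le hdY

/-- The pointwise bound `h₃(d) ≪ d ^ (1 / 3 + ε)`. -/
theorem eventually_hpos_le {ε : ℝ} (hε : 0 < ε) : ∀ᶠ Y : ℕ in atTop, ∀ d : ℕ, Squarefree d → 1 < d →
    Y ≤ d → d ≤ 2 * Y → (hpos 3 d : ℝ) ≤ (Y : ℝ) ^ (1 / 3 + ε) := by
  wlog hε1 : ε ≤ 1 / 8 generalizing ε
  · filter_upwards [this (ε := 1 / 8) (by norm_num) le_rfl, eventually_ge_atTop 1]
      with Y h hY d h1 h2 h3 h4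
    refine (h d h1 h2 h3 h4).trans (rpow_le_rpow_of_exponent_le (by exact_mod_cast hY) ?_)
    linarith
  set η := ε / 3 with hη
  have hη0 : 0 < η := by positivity
  filter_upwards [eventually_hpos_mul_le hη0, eventually_le_card_goodPrimes hη0,
    eventually_le_rpow 4 hη0, eventually_ge_atTop 2] with Y h1 h2 h3 hY2 d hd hd1 hYd hdY
  have hY0 : (0 : ℝ) < Y := by positivity
  have hY1 : (1 : ℝ) ≤ Y := by exact_mod_cast (by omega : 1 ≤ Y)
  set R := (Y : ℝ) ^ (1 / 6 : ℝ) with hR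
  have hR6 : R ^ 6 = Y := by
    rw [hR, ← rpow_natCast, ← rpow_mul hY0.le]; norm_num
  have hR4 : 4 * (Y : ℝ) ^ η ≤ R := by
    calc 4 * (Y : ℝ) ^ η ≤ (Y : ℝ) ^ η * (Y : ℝ) ^ η := by gcongr
      _ = (Y : ℝ) ^ (η + η) := by rw [rpow_add hY0]
      _ ≤ _ := rpow_le_rpow_of_exponent_le hY1 (by rw [hη]; linarith)
  have hηR : 1 ≤ (Y : ℝ) ^ η := by linarith
  set Z := ⌊R / 2⌋₊ with hZ
  have hR0 : 0 ≤ R / 2 := by positivity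
  have hZle : (Z : ℝ) ≤ R / 2 := Nat.floor_le hR0
  have hZge : R / 4 ≤ Z := by
    have := Nat.lt_floor_add_one (R / 2)
    linarith
  have hZ6 : 8 * Z ^ 6 < Y := by
    have : (8 : ℝ) * (Z : ℝ) ^ 6 < Y := by
      calc (8 : ℝ) * (Z : ℝ) ^ 6 ≤ 8 * (R / 2) ^ 6 := by gcongr
        _ = R ^ 6 / 8 := by ring
        _ < Y := by rw [hR6]; linarith
    exact_mod_cast this
  have hZY : Z ≤ Y := by
    rcases Nat.eq_zero_or_pos Z with h | h
    · omega
    · have := Nat.le_self_pow (n := 6) (by norm_num) Z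
      omega
  have g := h2 d Z hd1.le hdY (by linarith) hZY
  have hS : pairSet d Z (goodPrimes d Z) = ∅ := by
    classical
    rw [Finset.eq_empty_iff_forall_notMem]
    rintro ⟨p, p'⟩ hp
    rw [pairSet, Finset.mem_filter] at hp
    obtain ⟨-, -, D, -, u, v, hv, -, -, h⟩ := hp
    have hv2 : 1 ≤ v ^ 2 := by
      have : 0 < v ^ 2 := by positivity
      omega
    have : (d : ℤ) ≤ 8 * Z ^ 6 := by nlinarith
    have : d ≤ 8 * Z ^ 6 := by exact_mod_cast this
    omega
  have k := h1 d Z hd hd1 hdY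
  rw [hS, Finset.card_empty, Nat.cast_zero, add_zero] at k
  set G : ℝ := ((goodPrimes d Z).card : ℝ)
  have hZ0 : (0 : ℝ) < Z := by linarith
  have hG : 0 < G := by
    by_contra! hc
    nlinarith
  have k1 : (hpos 3 d : ℝ) * G ≤ (Y : ℝ) ^ (1 / 2 + η) := by
    refine le_of_mul_le_mul_right ?_ hG
    calc _ = _ := by ring
      _ ≤ _ := k
  have k2 : R ≤ 4 * (G * (Y : ℝ) ^ η) := by linarith
  have k3 : (hpos 3 d : ℝ) * R ≤ (Y : ℝ) ^ (1 / 2 + 3 * η) := by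
    calc (hpos 3 d : ℝ) * R ≤ hpos 3 d * (4 * (G * (Y : ℝ) ^ η)) := by gcongr
      _ = (hpos 3 d * G) * (Y : ℝ) ^ η * 4 := by ring
      _ ≤ (Y : ℝ) ^ (1 / 2 + η) * (Y : ℝ) ^ η * (Y : ℝ) ^ η := by gcongr
      _ = _ := by rw [← rpow_add hY0, ← rpow_add hY0]; congr 1; ring
  have k4 : (Y : ℝ) ^ (1 / 2 + 3 * η) = (Y : ℝ) ^ (1 / 3 + ε) * R := by
    rw [hR, ← rpow_add hY0]; congr 1; rw [hη]; ring
  rw [k4] at k3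
  exact le_of_mul_le_mul_right k3 (by positivity)

end PointwiseBound

section LargeValues

open Filter Real

lemma mul_pow_five_le_of_moment {x y H Z n W V : ℝ} (hx : 0 < x) (hy : 2 ≤ y) (hH : 0 < H)
    (hZ0 : 0 < Z) (hn : 0 < n) (hV0 : 0 ≤ V) (hH2 : x * y ^ 20 ≤ H ^ 2) (hZ : Z * H ≤ 2 * x * y ^ 3)
    (hV : V * x ≤ 3 * Z ^ 3) (hW : n * (H * Z ^ 2) ≤ W * (x * y ^ 4))
    (hWW : W ^ 2 ≤ 4 * n * V * (2 * W + 4 * y ^ 3 * Z ^ 4)) : n * H ^ 5 ≤ 768 * x ^ 4 * y ^ 20 := by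
  have hy0 : 0 < y := by linarith
  have hW0 : 0 < W := by
    by_contra! hc
    have h1 : 0 < n * (H * Z ^ 2) := by positivity
    have h2 : W * (x * y ^ 4) ≤ 0 := mul_nonpos_of_nonpos_of_nonneg hc (by positivity)
    linarith
  rcases le_total (4 * y ^ 3 * Z ^ 4) (2 * W) with h | h
  · exfalso
    have h1 : W ≤ 16 * (n * V) := by
      refine le_of_mul_le_mul_right ?_ hW0
      calc W * W = W ^ 2 := by ring
        _ ≤ 4 * n * V * (2 * W + 4 * y ^ 3 * Z ^ 4) := hWW
        _ ≤ 4 * n * V * (2 * W + 2 * W) := by gcongr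
        _ = _ := by ring
    have h2 : H ≤ 48 * y ^ 4 * Z := by
      refine le_of_mul_le_mul_left ?_ (by positivity : 0 < n * Z ^ 2)
      calc n * Z ^ 2 * H = n * (H * Z ^ 2) := by ring
        _ ≤ W * (x * y ^ 4) := hW
        _ ≤ 16 * (n * V) * (x * y ^ 4) := by gcongr
        _ = 16 * n * y ^ 4 * (V * x) := by ring
        _ ≤ 16 * n * y ^ 4 * (3 * Z ^ 3) := by gcongr
        _ = _ := by ring
    have h3 : H ^ 2 ≤ 96 * x * y ^ 7 := by
      calc H ^ 2 = H * H := by ring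
        _ ≤ 48 * y ^ 4 * Z * H := by gcongr
        _ = 48 * y ^ 4 * (Z * H) := by ring
        _ ≤ 48 * y ^ 4 * (2 * x * y ^ 3) := by gcongr
        _ = _ := by ring
    have h4 : (2 : ℝ) ^ 13 ≤ y ^ 13 := pow_le_pow_left₀ (by norm_num) hy 13
    have h5 : x * y ^ 7 * y ^ 13 ≤ x * y ^ 7 * 96 := by
      calc _ = x * y ^ 20 := by ring
        _ ≤ _ := hH2.trans h3
        _ = _ := by ring
    have h6 := le_of_mul_le_mul_left h5 (by positivity)
    linarith
  · have h1 : n * (n * H ^ 2) ≤ n * (96 * Z ^ 3 * x * y ^ 11) := by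
      refine le_of_mul_le_mul_left ?_ (by positivity : 0 < Z ^ 4)
      calc Z ^ 4 * (n * (n * H ^ 2)) = (n * (H * Z ^ 2)) ^ 2 := by ring
        _ ≤ (W * (x * y ^ 4)) ^ 2 := by gcongr
        _ = W ^ 2 * (x ^ 2 * y ^ 8) := by ring
        _ ≤ (4 * n * V * (2 * W + 4 * y ^ 3 * Z ^ 4)) * (x ^ 2 * y ^ 8) := by gcongr
        _ ≤ (4 * n * V * (4 * y ^ 3 * Z ^ 4 + 4 * y ^ 3 * Z ^ 4)) * (x ^ 2 * y ^ 8) := by gcongr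
        _ = 32 * n * y ^ 11 * Z ^ 4 * x * (V * x) := by ring
        _ ≤ 32 * n * y ^ 11 * Z ^ 4 * x * (3 * Z ^ 3) := by gcongr
        _ = _ := by ring
    have h2 := le_of_mul_le_mul_left h1 hn
    calc n * H ^ 5 = n * H ^ 2 * H ^ 3 := by ring
      _ ≤ 96 * Z ^ 3 * x * y ^ 11 * H ^ 3 := by gcongr
      _ = 96 * x * y ^ 11 * (Z * H) ^ 3 := by ring
      _ ≤ 96 * x * y ^ 11 * (2 * x * y ^ 3) ^ 3 := by gcongr
      _ = _ := by ring

lemma le_of_hpos_bound {x y H Z M S h : ℝ} (hx : 0 < x) (hy : 2 ≤ y) (hH : 0 < H) (hZ0 : 0 < Z)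
    (hS : 0 ≤ S) (hHh : H ≤ h) (hZ : x * y ^ 3 ≤ Z * H) (hM : Z ≤ M * y)
    (h1 : h * M ^ 2 ≤ x * y * (M + S)) : H * Z ^ 2 ≤ S * (x * y ^ 4) := by
  have hy0 : 0 < y := by linarith
  have hM0 : 0 < M := by
    by_contra! hc
    have : M * y ≤ 0 := mul_nonpos_of_nonpos_of_nonneg hc hy0.le
    linarith
  have h2 : 2 * (x * y) ≤ H * M := by
    refine le_of_mul_le_mul_right ?_ hy0
    calc 2 * (x * y) * y = 2 * (x * y ^ 2) := by ring
      _ ≤ y * (x * y ^ 2) := by gcongr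
      _ = x * y ^ 3 := by ring
      _ ≤ Z * H := hZ
      _ ≤ M * y * H := by gcongr
      _ = _ := by ring
  have h3 : H * M ^ 2 ≤ 2 * (x * y * S) := by
    have h4 : H * M ^ 2 ≤ x * y * M + x * y * S := by
      calc _ ≤ h * M ^ 2 := by gcongr
        _ ≤ _ := h1
        _ = _ := by ring
    have h5 := mul_le_mul_of_nonneg_right h2 hM0.le
    nlinarith
  calc H * Z ^ 2 ≤ H * (M * y) ^ 2 := by gcongr
    _ = H * M ^ 2 * y ^ 2 := by ring
    _ ≤ 2 * (x * y * S) * y ^ 2 := by gcongr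
    _ = 2 * (x * y ^ 3 * S) := by ring
    _ ≤ y * (x * y ^ 3 * S) := by gcongr
    _ = _ := by ring

lemma eventually_card_divisors_le {ε : ℝ} (hε : 0 < ε) : ∀ᶠ Y : ℕ in atTop, ∀ Z m : ℕ, Z ≤ Y →
    m ≤ 5 * (4 * Z ^ 6) ^ 2 → m.divisors.card ≤ ⌊(Y : ℝ) ^ ε⌋₊ := by
  set η := ε / 14 with hη
  have hη0 : 0 < η := by positivity
  obtain ⟨C, hC, h⟩ := card_divisors_le_rpow hη0
  filter_upwards [eventually_le_rpow C hη0, eventually_ge_atTop 80] with Y h1 h2 Z m hZ hm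
  have hY0 : (0 : ℝ) < Y := by positivity
  apply Nat.le_floor
  rcases eq_or_ne m 0 with rfl | hm0
  · simp; positivity
  have hm' : m ≤ Y ^ 13 := by
    calc m ≤ 5 * (4 * Z ^ 6) ^ 2 := hm
      _ = 80 * Z ^ 12 := by ring
      _ ≤ Y * Y ^ 12 := by gcongr
      _ = _ := by ring
  calc (m.divisors.card : ℝ) ≤ C * (m : ℝ) ^ η := h m hm0
    _ ≤ (Y : ℝ) ^ η * ((Y : ℝ) ^ 13) ^ η := by
        gcongr
        exact_mod_cast hm'
    _ = (Y : ℝ) ^ ε := by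
        rw [← rpow_natCast, ← rpow_mul hY0.le, ← rpow_add hY0]; congr 1; rw [hη]; push_cast; ring

/-- There are few `d` for which `h₃(d)` is large. -/
theorem eventually_card_large_le : ∀ᶠ Y : ℕ in atTop, ∀ (H : ℝ) (T : Finset ℕ),
    (Y : ℝ) ^ (251 / 1000 : ℝ) ≤ H → (∀ d ∈ T, Squarefree d ∧ 1 < d ∧ Y ≤ d ∧ d ≤ 2 * Y ∧
      H ≤ hpos 3 d) → (T.card : ℝ) * H ^ 5 ≤ (Y : ℝ) ^ (2001 / 1000 : ℝ) := by
  have hη0 : (0 : ℝ) < 1 / 30000 := by norm_num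
  filter_upwards [eventually_hpos_mul_le hη0, eventually_le_card_goodPrimes hη0,
    eventually_hpos_le hη0, eventually_card_divisors_le hη0, eventually_le_rpow 2 hη0,
    eventually_ge_atTop 2] with Y h1 h2 h3 h4 hy hY2 H T hH hT
  have hY0 : (0 : ℝ) < Y := by positivity
  have hY1 : (1 : ℝ) ≤ Y := by exact_mod_cast (by omega : 1 ≤ Y)
  rcases T.eq_empty_or_nonempty with rfl | ⟨d₀, hd₀⟩
  · simp; positivity
  have hH0 : 0 < H := lt_of_lt_of_le (by positivity) hH
  have hHle : H ≤ (Y : ℝ) ^ (1 / 3 + 1 / 30000 : ℝ) := by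
    obtain ⟨a, b, c, e, f⟩ := hT d₀ hd₀
    exact f.trans (h3 d₀ a b c e)
  have hexp : ∀ (a : ℝ) (n : ℕ), ((Y : ℝ) ^ a) ^ n = (Y : ℝ) ^ (a * n) := fun a n => by
    rw [← rpow_natCast, ← rpow_mul hY0.le]
  set y := (Y : ℝ) ^ (1 / 30000 : ℝ) with hyd
  set x := (Y : ℝ) ^ (1 / 2 : ℝ) with hxd
  have hx0 : 0 < x := by positivity
  have hy0 : 0 < y := by positivity
  have hx2 : x ^ 2 = Y := by rw [hxd, hexp]; norm_num
  have hxy : (Y : ℝ) ^ (1 / 2 + 1 / 30000 : ℝ) = x * y := by rw [rpow_add hY0]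
  have hH2 : x * y ^ 20 ≤ H ^ 2 := by
    calc x * y ^ 20 = (Y : ℝ) ^ (1 / 2 + 1 / 30000 * (20 : ℕ) : ℝ) := by
          rw [hyd, hexp, ← rpow_add hY0]
      _ ≤ (Y : ℝ) ^ (251 / 1000 * (2 : ℕ) : ℝ) := rpow_le_rpow_of_exponent_le hY1 (by norm_num)
      _ = ((Y : ℝ) ^ (251 / 1000 : ℝ)) ^ 2 := by rw [hexp]
      _ ≤ H ^ 2 := by gcongr
  set R := x * y ^ 3 / H with hR
  have hRy : y ≤ R := by
    rw [hR, le_div_iff₀ hH0]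
    calc y * H ≤ y * (Y : ℝ) ^ (1 / 3 + 1 / 30000 : ℝ) := by gcongr
      _ = (Y : ℝ) ^ (1 / 30000 + (1 / 3 + 1 / 30000) : ℝ) := by rw [rpow_add hY0 (1 / 30000)]
      _ ≤ (Y : ℝ) ^ (1 / 2 : ℝ) := rpow_le_rpow_of_exponent_le hY1 (by norm_num)
      _ ≤ x * y ^ 3 := le_mul_of_one_le_right hx0.le (one_le_pow₀ (by linarith))
  have hR0 : 0 < R := by linarith
  set Z := ⌈R⌉₊ with hZd
  have hZR : R ≤ Z := Nat.le_ceil R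
  have hZR2 : (Z : ℝ) ≤ 2 * R := by
    have := Nat.ceil_lt_add_one hR0.le
    linarith
  have hZ0 : (0 : ℝ) < Z := by linarith
  have hRH : R * H = x * y ^ 3 := div_mul_cancel₀ _ hH0.ne'
  have hZH : x * y ^ 3 ≤ Z * H := by rw [← hRH]; gcongr
  have hZH2 : Z * H ≤ 2 * x * y ^ 3 := by
    calc Z * H ≤ 2 * R * H := by gcongr
      _ = _ := by rw [mul_assoc, hRH]; ring
  have hZY : Z ≤ Y := by
    have hH1 : 1 ≤ H := le_trans (one_le_rpow hY1 (by norm_num)) hH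
    have : (Z : ℝ) ≤ Y := by
      calc (Z : ℝ) ≤ Z * H := le_mul_of_one_le_right hZ0.le hH1
        _ ≤ 2 * x * y ^ 3 := hZH2
        _ ≤ y * x * y ^ 3 := by gcongr
        _ = x * y ^ 4 := by ring
        _ = (Y : ℝ) ^ (1 / 2 + 1 / 30000 * (4 : ℕ) : ℝ) := by rw [hyd, hexp, ← rpow_add hY0]
        _ ≤ (Y : ℝ) ^ (1 : ℝ) := rpow_le_rpow_of_exponent_le hY1 (by norm_num)
        _ = Y := rpow_one _
    exact_mod_cast this
  set V := ⌊3 * (Z : ℝ) ^ 3 / x⌋₊ with hVd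
  have hV : (V : ℝ) * x ≤ 3 * (Z : ℝ) ^ 3 := by
    rw [← le_div_iff₀ hx0]
    exact Nat.floor_le (by positivity)
  have hV' : 8 * Z ^ 6 < Y * (V + 1) ^ 2 := by
    have h5 : 3 * (Z : ℝ) ^ 3 < (V + 1) * x := by
      rw [← div_lt_iff₀ hx0]
      exact Nat.lt_floor_add_one _
    have : 8 * (Z : ℝ) ^ 6 < Y * ((V : ℝ) + 1) ^ 2 := by
      calc 8 * (Z : ℝ) ^ 6 ≤ 9 * (Z : ℝ) ^ 6 := by gcongr; norm_num
        _ = (3 * (Z : ℝ) ^ 3) ^ 2 := by ring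
        _ < ((V + 1) * x) ^ 2 := by gcongr
        _ = _ := by rw [mul_pow, hx2]; ring
    exact_mod_cast this
  have hPc : ((primes32 Z).card : ℝ) ≤ Z := by
    have : (primes32 Z).card ≤ Z := by
      rw [primes32]
      exact (Finset.card_filter_le _ _).trans (by simp)
    exact_mod_cast this
  set t := ⌊y⌋₊
  have ht : (t : ℝ) ≤ y := Nat.floor_le hy0.le
  have m1 := sum_card_pairSet_le (T := T) (P := primes32 Z) (fun d hd => (hT d hd).2.2.1) hV'
  have m2 := sq_card_pairSol_le (T := T) (V := V) (P := primes32 Z) (Z := Z) (t := t)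
    (fun h0 => by have := (hT 0 h0).2.1; omega)
    (fun p hp => by
      rw [primes32, Finset.mem_filter, Finset.mem_Icc] at hp
      exact ⟨hp.2.1, hp.1.2⟩) (fun m hm => h4 Z m hZY hm)
  set W := (pairSol T (primes32 Z) V).card
  have hW : (T.card : ℝ) * (H * (Z : ℝ) ^ 2) ≤ W * (x * y ^ 4) := by
    calc (T.card : ℝ) * (H * (Z : ℝ) ^ 2) = ∑ d ∈ T, H * (Z : ℝ) ^ 2 := by
          rw [Finset.sum_const, nsmul_eq_mul]
      _ ≤ ∑ d ∈ T, ((pairSet d Z (primes32 Z)).card : ℝ) * (x * y ^ 4) := by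
          refine Finset.sum_le_sum fun d hd => ?_
          obtain ⟨a, b, c, e, f⟩ := hT d hd
          have k1 := h1 d Z a b e
          rw [hxy] at k1
          refine (le_of_hpos_bound hx0 hy hH0 hZ0 (Nat.cast_nonneg _) f hZH
            (h2 d Z b.le e (hRy.trans hZR) hZY) k1).trans ?_
          gcongr
          exact pairSet_mono (Finset.filter_subset _ _)
      _ = ((∑ d ∈ T, (pairSet d Z (primes32 Z)).card : ℕ) : ℝ) * (x * y ^ 4) := by
          rw [← Finset.sum_mul]; push_cast; rfl
      _ ≤ _ := by gcongr
  have hWW : (W : ℝ) ^ 2 ≤ 4 * T.card * V * (2 * W + 4 * y ^ 3 * (Z : ℝ) ^ 4) := by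
    calc (W : ℝ) ^ 2 ≤ 4 * T.card * V * (2 * W + 4 * (t : ℝ) ^ 3 * ((primes32 Z).card : ℝ) ^ 4) := by
          exact_mod_cast m2
      _ ≤ _ := by gcongr
  have hn : (0 : ℝ) < T.card := by exact_mod_cast Finset.card_pos.2 ⟨d₀, hd₀⟩
  calc (T.card : ℝ) * H ^ 5 ≤ 768 * x ^ 4 * y ^ 20 :=
        mul_pow_five_le_of_moment hx0 hy hH0 hZ0 hn (Nat.cast_nonneg _) hH2 hZH2 hV hW hWW
    _ ≤ 2 ^ 10 * x ^ 4 * y ^ 20 := by gcongr; norm_num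
    _ ≤ y ^ 10 * x ^ 4 * y ^ 20 := by gcongr
    _ = (x ^ 2) ^ 2 * y ^ 30 := by ring
    _ = (Y : ℝ) ^ (2001 / 1000 : ℝ) := by
        rw [hx2, hyd, hexp, ← rpow_natCast, ← rpow_add hY0]; norm_num

end LargeValues

section Moments

open Filter Real

/-- The squarefree integers `d > 1` with `Y ≤ d < 2 * Y`. -/
def dyadicSqfree (Y : ℕ) : Finset ℕ :=
  (Finset.Ico Y (2 * Y)).filter fun d => Squarefree d ∧ 1 < d

lemma mem_dyadicSqfree {Y d : ℕ} :
    d ∈ dyadicSqfree Y ↔ (Y ≤ d ∧ d < 2 * Y) ∧ Squarefree d ∧ 1 < d := by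
  simp [dyadicSqfree]

lemma one_le_hpos (d : ℕ) : (1 : ℝ) ≤ hpos 3 d := by
  have : Nonempty {c : ClassGroup (NumberField.RingOfIntegers (Kpos d)) // c ^ 3 = 1} :=
    ⟨⟨1, one_pow 3⟩⟩
  have h : 0 < hpos 3 d := Nat.card_pos
  exact_mod_cast h

lemma eventually_first_moment_le {ε : ℝ} (hε : 0 < ε) :
    ∀ᶠ Y : ℕ in atTop, ∑ d ∈ dyadicSqfree Y, (hpos 3 d : ℝ) ≤ (Y : ℝ) ^ (1 + ε) := by
  filter_upwards [eventually_le_rpow (1 + 304 * 40 ^ 2) (half_pos hε),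
    eventually_log_le_rpow (ε := ε / 4) (by positivity), eventually_ge_atTop 304] with Y h1 h2 hY
  have hY1 : (304 : ℝ) ≤ Y := by exact_mod_cast hY
  have hY0 : (0 : ℝ) < Y := by linarith
  have h := sum_hpos_le (dyadicSqfree Y) (2 * Y) fun d hd => by
    have := mem_dyadicSqfree.1 hd
    exact ⟨this.2.1, this.2.2, this.1.2.le⟩
  have hc : (dyadicSqfree Y).card ≤ Y := by
    rw [dyadicSqfree]
    exact (Finset.card_filter_le _ _).trans (by simp; omega)
  set M := Nat.sqrt (152 * (2 * Y)) with hM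
  have hM2 : (M : ℝ) ^ 2 ≤ 304 * Y := by
    have : M ^ 2 ≤ 152 * (2 * Y) := Nat.sqrt_le' _
    have h' : (M : ℝ) ^ 2 ≤ 152 * (2 * Y) := by exact_mod_cast this
    linarith
  have hM1 : 1 ≤ M := Nat.sqrt_pos.2 (by omega)
  have hM1' : (1 : ℝ) ≤ M := by exact_mod_cast hM1
  have hMY : (M : ℝ) ≤ Y ^ 1 := by
    rw [pow_one]
    have : (M : ℝ) ^ 2 ≤ (Y : ℝ) ^ 2 := by nlinarith
    exact le_of_sq_le_sq this hY0.le
  set L := (Y : ℝ) ^ (ε / 4) with hL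
  have hL1 : 1 ≤ L := one_le_rpow (by linarith) (by positivity)
  have hlog : Real.log M ≤ L := by
    refine (Real.log_le_log (by linarith) hMY).trans ?_
    simpa using h2
  have hcard := card_hyperbolaPts_le M
  have hcard2 : ((hyperbolaPts M).card : ℝ) ≤ M * (40 * L) := by
    refine hcard.trans ?_
    have a1 : 3 * (M : ℝ) * (1 + 2 * (1 + Real.log M)) ≤ 3 * M * (5 * L) := by
      gcongr
      linarith
    have a2 : 1 ≤ (M : ℝ) * L := one_le_mul_of_one_le_of_one_le hM1' hL1
    linarith
  have hL2 : L ^ 2 = (Y : ℝ) ^ (ε / 2) := by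
    rw [hL, ← rpow_natCast, ← rpow_mul hY0.le]
    congr 1
    push_cast
    ring
  have hL3 : 1 ≤ L ^ 2 := one_le_pow₀ hL1
  have hR : (∑ d ∈ dyadicSqfree Y, (hpos 3 d : ℝ)) ≤
      (dyadicSqfree Y).card + ((hyperbolaPts M).card : ℝ) ^ 2 := by exact_mod_cast h
  have hc' : ((dyadicSqfree Y).card : ℝ) ≤ Y := by exact_mod_cast hc
  calc ∑ d ∈ dyadicSqfree Y, (hpos 3 d : ℝ)
      ≤ Y + (M * (40 * L)) ^ 2 := hR.trans (by gcongr)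
    _ = Y + (M : ℝ) ^ 2 * (40 ^ 2 * L ^ 2) := by ring
    _ ≤ Y * L ^ 2 + (304 * Y) * (40 ^ 2 * L ^ 2) := by
        gcongr
        exact le_mul_of_one_le_right hY0.le hL3
    _ = Y * ((1 + 304 * 40 ^ 2) * L ^ 2) := by ring
    _ ≤ Y * ((Y : ℝ) ^ (ε / 2) * (Y : ℝ) ^ (ε / 2)) := by
        rw [hL2]
        gcongr
    _ = (Y : ℝ) ^ (1 + ε) := by
        rw [← rpow_add hY0, add_halves, rpow_add hY0, rpow_one]

/-- If `f` takes values in `[0, A]` or in one of the intervals `[a j, b j]`, then its fourth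
moment is controlled by its first moment and the number of large values. -/
lemma sum_pow_four_le {T : Finset ℕ} {f : ℕ → ℝ} {n : ℕ} {A : ℝ} {a b : ℕ → ℝ} (hA : 0 ≤ A)
    (hf : ∀ d ∈ T, 0 ≤ f d)
    (hT : ∀ d ∈ T, f d ≤ A ∨ ∃ j < n, a j ≤ f d ∧ f d ≤ b j) :
    ∑ d ∈ T, f d ^ 4 ≤ A ^ 3 * ∑ d ∈ T, f d +
      ∑ j ∈ Finset.range n, ((T.filter fun d => a j ≤ f d).card : ℝ) * b j ^ 4 := by
  have h1 : ∀ d ∈ T, f d ^ 4 ≤ A ^ 3 * f d +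
      ∑ j ∈ Finset.range n, if a j ≤ f d then b j ^ 4 else 0 := by
    intro d hd
    have h0 := hf d hd
    have hs : ∀ j ∈ Finset.range n, 0 ≤ (if a j ≤ f d then b j ^ 4 else 0) := fun j _ => by
      split_ifs <;> positivity
    rcases hT d hd with h | ⟨j, hj, hj'⟩
    · refine le_add_of_le_of_nonneg ?_ (Finset.sum_nonneg hs)
      rw [pow_succ]
      gcongr
    · refine le_add_of_nonneg_of_le (by positivity) ?_
      refine le_trans ?_ (Finset.single_le_sum hs (Finset.mem_range.2 hj))
      rw [if_pos hj'.1]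
      exact pow_le_pow_left₀ h0 hj'.2 4
  refine (Finset.sum_le_sum h1).trans_eq ?_
  rw [Finset.sum_add_distrib, Finset.mul_sum, Finset.sum_comm]
  congr 1
  refine Finset.sum_congr rfl fun j _ => ?_
  rw [← Finset.sum_filter, Finset.sum_const, nsmul_eq_mul]

lemma exists_rpow_step {y x δ : ℝ} {s : ℝ} (n : ℕ) (h0 : y ^ s ≤ x) (hn : x ≤ y ^ (s + n * δ)) :
    y ^ s = x ∨ ∃ j < n, y ^ (s + j * δ) ≤ x ∧ x ≤ y ^ (s + (j + 1) * δ) := by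
  induction n with
  | zero =>
    left
    rw [Nat.cast_zero, zero_mul, add_zero] at hn
    exact le_antisymm h0 hn
  | succ n ih =>
    rcases le_total x (y ^ (s + n * δ)) with h | h
    · rcases ih h with h | ⟨j, hj, h⟩
      · exact .inl h
      · exact .inr ⟨j, hj.trans n.lt_succ_self, h⟩
    · exact .inr ⟨n, n.lt_succ_self, h, by exact_mod_cast hn⟩

lemma eventually_fourth_moment_le :
    ∀ᶠ Y : ℕ in atTop, ∑ d ∈ dyadicSqfree Y, (hpos 3 d : ℝ) ^ 4 ≤ (Y : ℝ) ^ (11 / 6 : ℝ) := by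
  filter_upwards [eventually_first_moment_le (ε := 1 / 1000) (by norm_num),
    eventually_hpos_le (ε := 1 / 1000) (by norm_num), eventually_card_large_le,
    eventually_le_rpow 6 (ε := 1 / 100) (by norm_num), eventually_ge_atTop 1]
    with Y h1 hB hC h6 hY
  have hY1 : (1 : ℝ) ≤ Y := by exact_mod_cast hY
  have hY0 : (0 : ℝ) < Y := by linarith
  have key := sum_pow_four_le (T := dyadicSqfree Y) (f := fun d => (hpos 3 d : ℝ)) (n := 5)
    (A := (Y : ℝ) ^ (251 / 1000 : ℝ)) (a := fun j => (Y : ℝ) ^ (251 / 1000 + j * (1 / 60) : ℝ))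
    (b := fun j => (Y : ℝ) ^ (251 / 1000 + (j + 1) * (1 / 60) : ℝ)) (by positivity)
    (fun d _ => by positivity) fun d hd => by
      obtain ⟨⟨h1, h2⟩, h3, h4⟩ := mem_dyadicSqfree.1 hd
      rcases le_total (hpos 3 d : ℝ) ((Y : ℝ) ^ (251 / 1000 : ℝ)) with h | h
      · exact .inl h
      · rcases exists_rpow_step (δ := 1 / 60) 5 h ((hB d h3 h4 h1 h2.le).trans_eq (by norm_num))
          with h | h
        · exact .inl h.ge
        · exact .inr h
  have hterm : ∀ j ∈ Finset.range 5, (((dyadicSqfree Y).filter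
      fun d => (Y : ℝ) ^ (251 / 1000 + j * (1 / 60) : ℝ) ≤ hpos 3 d).card : ℝ) *
      ((Y : ℝ) ^ (251 / 1000 + (j + 1) * (1 / 60) : ℝ)) ^ 4 ≤ (Y : ℝ) ^ (1817 / 1000 : ℝ) := by
    intro j _
    have hj : (0 : ℝ) ≤ j := j.cast_nonneg
    have hc := hC ((Y : ℝ) ^ (251 / 1000 + j * (1 / 60) : ℝ)) ((dyadicSqfree Y).filter
      fun d => (Y : ℝ) ^ (251 / 1000 + j * (1 / 60) : ℝ) ≤ hpos 3 d)
      (rpow_le_rpow_of_exponent_le hY1 (by linarith)) fun d hd => by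
        obtain ⟨hd, hH⟩ := Finset.mem_filter.1 hd
        obtain ⟨⟨h1, h2⟩, h3, h4⟩ := mem_dyadicSqfree.1 hd
        exact ⟨h3, h4, h1, h2.le, hH⟩
    have e : ((Y : ℝ) ^ (251 / 1000 + (j + 1) * (1 / 60) : ℝ)) ^ 4 =
        ((Y : ℝ) ^ (251 / 1000 + j * (1 / 60) : ℝ)) ^ 5 *
          (Y : ℝ) ^ (-(251 / 1000 + j * (1 / 60)) + 4 / 60 : ℝ) := by
      rw [← rpow_natCast, ← rpow_natCast, ← rpow_mul hY0.le, ← rpow_mul hY0.le, ← rpow_add hY0]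
      congr 1
      push_cast
      ring
    rw [e, ← mul_assoc]
    refine (mul_le_mul_of_nonneg_right hc (by positivity)).trans ?_
    rw [← rpow_add hY0]
    exact rpow_le_rpow_of_exponent_le hY1 (by linarith)
  have hA : ((Y : ℝ) ^ (251 / 1000 : ℝ)) ^ 3 * ∑ d ∈ dyadicSqfree Y, (hpos 3 d : ℝ) ≤
      (Y : ℝ) ^ (1817 / 1000 : ℝ) := by
    refine (mul_le_mul_of_nonneg_left h1 (by positivity)).trans ?_
    rw [← rpow_natCast, ← rpow_mul hY0.le, ← rpow_add hY0]
    exact rpow_le_rpow_of_exponent_le hY1 (by norm_num)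
  calc ∑ d ∈ dyadicSqfree Y, (hpos 3 d : ℝ) ^ 4
      ≤ (Y : ℝ) ^ (1817 / 1000 : ℝ) + ∑ j ∈ Finset.range 5, (Y : ℝ) ^ (1817 / 1000 : ℝ) :=
        key.trans (add_le_add hA (Finset.sum_le_sum hterm))
    _ = 6 * (Y : ℝ) ^ (1817 / 1000 : ℝ) := by
        rw [Finset.sum_const, Finset.card_range, nsmul_eq_mul]
        push_cast
        ring
    _ ≤ (Y : ℝ) ^ (1 / 100 : ℝ) * (Y : ℝ) ^ (1817 / 1000 : ℝ) := by gcongr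
    _ ≤ (Y : ℝ) ^ (11 / 6 : ℝ) := by
        rw [← rpow_add hY0]
        exact rpow_le_rpow_of_exponent_le hY1 (by norm_num)

/-- Interpolation of the `k`-th power between the first and the fourth one. -/
lemma rpow_le_interpolate {h t k : ℝ} (hh : 0 < h) (ht : 0 < t) (hk1 : 1 ≤ k) (hk4 : k ≤ 4) :
    h ^ k ≤ t ^ (k - 1) * h + t ^ (k - 4) * h ^ 4 := by
  rcases le_total h t with hle | hle
  · refine le_add_of_le_of_nonneg ?_ (by positivity)
    calc h ^ k = h ^ (k - 1) * h := by rw [← rpow_add_one hh.ne', sub_add_cancel]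
      _ ≤ _ := by gcongr
  · refine le_add_of_nonneg_of_le (by positivity) ?_
    calc h ^ k = h ^ (k - 4) * h ^ 4 := by
          rw [← rpow_natCast, ← rpow_add hh]
          norm_num
      _ ≤ _ := mul_le_mul_of_nonneg_right
          (rpow_le_rpow_of_nonpos ht hle (by linarith)) (by positivity)

lemma eventually_moment_le_of_le_four {k ε : ℝ} (hε : 0 < ε) (hk1 : 1 ≤ k) (hk4 : k ≤ 4) :
    ∀ᶠ Y : ℕ in atTop,
      ∑ d ∈ dyadicSqfree Y, (hpos 3 d : ℝ) ^ k ≤ (Y : ℝ) ^ ((5 * k + 13) / 18 + ε) := by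
  filter_upwards [eventually_first_moment_le (half_pos hε), eventually_fourth_moment_le,
    eventually_le_rpow 2 (half_pos hε), eventually_ge_atTop 1] with Y h1 h4 h2 hY
  have hY1 : (1 : ℝ) ≤ Y := by exact_mod_cast hY
  have hY0 : (0 : ℝ) < Y := by linarith
  set t := (Y : ℝ) ^ (5 / 18 : ℝ) with ht
  have ht0 : 0 < t := by positivity
  have a1 : t ^ (k - 1) * (Y : ℝ) ^ (1 + ε / 2) ≤ (Y : ℝ) ^ ((5 * k + 13) / 18 + ε / 2) := by
    rw [ht, ← rpow_mul hY0.le, ← rpow_add hY0]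
    exact rpow_le_rpow_of_exponent_le hY1 (by linarith)
  have a2 : t ^ (k - 4) * (Y : ℝ) ^ (11 / 6 : ℝ) ≤ (Y : ℝ) ^ ((5 * k + 13) / 18 + ε / 2) := by
    rw [ht, ← rpow_mul hY0.le, ← rpow_add hY0]
    exact rpow_le_rpow_of_exponent_le hY1 (by linarith)
  calc ∑ d ∈ dyadicSqfree Y, (hpos 3 d : ℝ) ^ k
      ≤ ∑ d ∈ dyadicSqfree Y,
          (t ^ (k - 1) * (hpos 3 d : ℝ) + t ^ (k - 4) * (hpos 3 d : ℝ) ^ 4) :=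
        Finset.sum_le_sum fun d _ =>
          rpow_le_interpolate (zero_lt_one.trans_le (one_le_hpos d)) ht0 hk1 hk4
    _ = t ^ (k - 1) * ∑ d ∈ dyadicSqfree Y, (hpos 3 d : ℝ) +
          t ^ (k - 4) * ∑ d ∈ dyadicSqfree Y, (hpos 3 d : ℝ) ^ 4 := by
        rw [Finset.sum_add_distrib, Finset.mul_sum, Finset.mul_sum]
    _ ≤ t ^ (k - 1) * (Y : ℝ) ^ (1 + ε / 2) + t ^ (k - 4) * (Y : ℝ) ^ (11 / 6 : ℝ) := by
        gcongr
    _ ≤ 2 * (Y : ℝ) ^ ((5 * k + 13) / 18 + ε / 2) := by linarith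
    _ ≤ (Y : ℝ) ^ (ε / 2) * (Y : ℝ) ^ ((5 * k + 13) / 18 + ε / 2) := by gcongr
    _ = (Y : ℝ) ^ ((5 * k + 13) / 18 + ε) := by
        rw [← rpow_add hY0]
        congr 1
        ring

lemma eventually_moment_le_of_four_le {k ε : ℝ} (hε : 0 < ε) (hk4 : 4 ≤ k) :
    ∀ᶠ Y : ℕ in atTop,
      ∑ d ∈ dyadicSqfree Y, (hpos 3 d : ℝ) ^ k ≤ (Y : ℝ) ^ ((2 * k + 3) / 6 + ε) := by
  have hk : 0 < k - 3 := by linarith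
  filter_upwards [eventually_fourth_moment_le, eventually_hpos_le (ε := ε / (k - 3))
    (by positivity), eventually_ge_atTop 1] with Y h4 hB hY
  have hY1 : (1 : ℝ) ≤ Y := by exact_mod_cast hY
  have hY0 : (0 : ℝ) < Y := by linarith
  have he : ε / (k - 3) * (k - 4) ≤ ε := by
    rw [div_mul_eq_mul_div, div_le_iff₀ hk]
    gcongr
    norm_num
  set t := (Y : ℝ) ^ (1 / 3 + ε / (k - 3)) with ht
  have ht0 : 0 < t := by positivity
  calc ∑ d ∈ dyadicSqfree Y, (hpos 3 d : ℝ) ^ k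
      ≤ ∑ d ∈ dyadicSqfree Y, t ^ (k - 4) * (hpos 3 d : ℝ) ^ 4 := by
        refine Finset.sum_le_sum fun d hd => ?_
        obtain ⟨⟨h1, h2⟩, h3, h4⟩ := mem_dyadicSqfree.1 hd
        have h0 : (0 : ℝ) < hpos 3 d := zero_lt_one.trans_le (one_le_hpos d)
        have hle := hB d h3 h4 h1 h2.le
        calc (hpos 3 d : ℝ) ^ k = (hpos 3 d : ℝ) ^ (k - 4) * (hpos 3 d : ℝ) ^ 4 := by
              rw [← rpow_natCast, ← rpow_add h0]
              norm_num
          _ ≤ _ := by gcongr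
    _ ≤ t ^ (k - 4) * (Y : ℝ) ^ (11 / 6 : ℝ) := by
        rw [← Finset.mul_sum]
        gcongr
    _ ≤ (Y : ℝ) ^ ((2 * k + 3) / 6 + ε) := by
        rw [ht, ← rpow_mul hY0.le, ← rpow_add hY0]
        exact rpow_le_rpow_of_exponent_le hY1 (by linarith)

/-- Summation of dyadic bounds. -/
lemma exists_sum_le_of_dyadic {f : ℕ → ℝ} {e : ℝ} (hf : ∀ d, 0 ≤ f d) (he : 1 ≤ e)
    (h : ∀ᶠ Y : ℕ in atTop, ∑ d ∈ dyadicSqfree Y, f d ≤ (Y : ℝ) ^ e) :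
    ∃ C : ℝ, 0 < C ∧ ∀ X : ℝ, 2 ≤ X →
      ∑ d ∈ (Finset.range (⌈X⌉₊ + 1)).filter (fun d : ℕ => Squarefree d ∧ 1 < d ∧ (d : ℝ) < X),
        f d ≤ C * X ^ e := by
  obtain ⟨N, hN⟩ := eventually_atTop.1 h
  have hD : ∀ Y : ℕ, ∑ d ∈ dyadicSqfree Y, f d ≤
      (∑ d ∈ Finset.range (2 * N), f d) + (Y : ℝ) ^ e := by
    intro Y
    rcases le_total N Y with hY | hY
    · exact le_add_of_nonneg_of_le (Finset.sum_nonneg fun d _ => hf d) (hN Y hY)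
    · refine le_add_of_le_of_nonneg (Finset.sum_le_sum_of_subset_of_nonneg (fun d hd => ?_)
        fun d _ _ => hf d) (by positivity)
      have := mem_dyadicSqfree.1 hd
      exact Finset.mem_range.2 (by omega)
  set S := ∑ d ∈ Finset.range (2 * N), f d with hS
  have hS0 : 0 ≤ S := Finset.sum_nonneg fun d _ => hf d
  have hF : ∀ j : ℕ, ∑ d ∈ (Finset.range (2 ^ j)).filter (fun d => Squarefree d ∧ 1 < d), f d ≤
      (S + 1) * ((2 : ℝ) ^ j) ^ e := by
    intro j
    induction j with
    | zero =>
      rw [Finset.sum_eq_zero fun d hd => ?_]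
      · positivity
      · simp only [Finset.mem_filter, Finset.mem_range] at hd
        omega
    | succ j ih =>
      have h1 : ((Finset.range (2 ^ (j + 1))).filter fun d => Squarefree d ∧ 1 < d) ⊆
          ((Finset.range (2 ^ j)).filter fun d => Squarefree d ∧ 1 < d) ∪
            dyadicSqfree (2 ^ j) := by
        intro d hd
        simp only [Finset.mem_union, Finset.mem_filter, Finset.mem_range,
          mem_dyadicSqfree] at hd ⊢
        rw [pow_succ] at hd
        rcases lt_or_ge d (2 ^ j) with h | h
        · exact .inl ⟨h, hd.2⟩
        · exact .inr ⟨⟨h, by omega⟩, hd.2⟩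
      have h2 := Finset.sum_le_sum_of_subset_of_nonneg h1 fun d _ _ => hf d
      have h3 := Finset.sum_union_inter (f := f)
        (s₁ := (Finset.range (2 ^ j)).filter fun d => Squarefree d ∧ 1 < d)
        (s₂ := dyadicSqfree (2 ^ j))
      have h4 : 0 ≤ ∑ d ∈ ((Finset.range (2 ^ j)).filter fun d => Squarefree d ∧ 1 < d) ∩
          dyadicSqfree (2 ^ j), f d := Finset.sum_nonneg fun d _ => hf d
      have h5 := hD (2 ^ j)
      push_cast at h5
      set P := ((2 : ℝ) ^ j) ^ e with hP
      have hP1 : 1 ≤ P := one_le_rpow (one_le_pow₀ one_le_two) (by linarith)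
      have h6 : 2 * P ≤ ((2 : ℝ) ^ (j + 1)) ^ e := by
        rw [pow_succ, mul_rpow (by positivity) (by positivity), mul_comm]
        gcongr
        simpa using rpow_le_rpow_of_exponent_le one_le_two he
      calc _ ≤ (S + 1) * P + (S + P) := by linarith
        _ ≤ (S + 1) * (2 * P) := by nlinarith
        _ ≤ _ := by gcongr
  refine ⟨(S + 1) * 2 ^ e, by positivity, fun X hX => ?_⟩
  have hX0 : 0 < X := by linarith
  obtain ⟨j, hj1, hj2⟩ := exists_nat_pow_near (one_le_two.trans hX) one_lt_two
  have hsub : ((Finset.range (⌈X⌉₊ + 1)).filter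
      fun d : ℕ => Squarefree d ∧ 1 < d ∧ (d : ℝ) < X) ⊆
      (Finset.range (2 ^ (j + 1))).filter fun d => Squarefree d ∧ 1 < d := by
    intro d hd
    simp only [Finset.mem_filter, Finset.mem_range] at hd ⊢
    refine ⟨?_, hd.2.1, hd.2.2.1⟩
    exact_mod_cast hd.2.2.2.trans hj2
  refine (Finset.sum_le_sum_of_subset_of_nonneg hsub fun d _ _ => hf d).trans
    ((hF (j + 1)).trans ?_)
  rw [mul_assoc, ← mul_rpow zero_le_two hX0.le]
  gcongr
  rw [pow_succ]
  linarith

end Moments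

/-- For every real `k` and every `ε > 0` there is `C = C(k, ε)` such that for
all `X ≥ 2`: if `1 ≤ k ≤ 4` then `∑_{1 < d < X, d squarefree} h_3(d)^k ≤
C · X^((5k+13)/18 + ε)`, and if `k ≥ 4` then this sum is at most
`C · X^((2k+3)/6 + ε)`. -/
theorem kth_moment_h3_real_bound (k : ℝ) (ε : ℝ) (hε : 0 < ε) :
    ∃ C : ℝ, 0 < C ∧ ∀ X : ℝ, 2 ≤ X →
      ((1 ≤ k ∧ k ≤ 4) →
        ∑ d ∈ (Finset.range (⌈X⌉₊ + 1)).filter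
            (fun d : ℕ => Squarefree d ∧ 1 < d ∧ (d : ℝ) < X),
          (hpos 3 d : ℝ) ^ k
        ≤ C * X ^ ((5 * k + 13) / 18 + ε)) ∧
      (4 ≤ k →
        ∑ d ∈ (Finset.range (⌈X⌉₊ + 1)).filter
            (fun d : ℕ => Squarefree d ∧ 1 < d ∧ (d : ℝ) < X),
          (hpos 3 d : ℝ) ^ k
        ≤ C * X ^ ((2 * k + 3) / 6 + ε)) := by
  have hf : ∀ d, 0 ≤ (hpos 3 d : ℝ) ^ k := fun d => by positivity
  rcases lt_or_ge k 1 with hk1 | hk1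
  · exact ⟨1, one_pos, fun X _ => ⟨fun h => absurd h.1 hk1.not_ge, fun h => by linarith⟩⟩
  rcases le_total k 4 with hk4 | hk4
  · obtain ⟨C, hC, h⟩ := exists_sum_le_of_dyadic hf (by linarith)
      (eventually_moment_le_of_le_four hε hk1 hk4)
    refine ⟨C, hC, fun X hX => ⟨fun _ => h X hX, fun h4 => ?_⟩⟩
    obtain rfl := le_antisymm hk4 h4
    convert h X hX using 4
    norm_num
  · obtain ⟨C, hC, h⟩ := exists_sum_le_of_dyadic hf (by linarith)
      (eventually_moment_le_of_four_le hε hk4)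
    refine ⟨C, hC, fun X hX => ⟨fun h4 => ?_, fun _ => h X hX⟩⟩
    obtain rfl := le_antisymm h4.2 hk4
    convert h X hX using 4
    norm_num
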